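/- Fix nonnegative integers r_1 and r_2 (not both zero). There exists a real number 𝒟 > 0, depending only on (r_1, r_2), such that for every number field K with exactly r_1 real embeddings and r_2 pairs of complex conjugate embeddings and with absolute discriminant D_K > 𝒟, the naïve Mertens-type conjecture over K is false, i.e., it is NOT the case that −1 ≤ M_K^- ≤ M_K^+ ≤ 1. -/

import Mathlib

noncomputable section

open NumberField Filter Topology MeasureTheory Complex

open scoped Classical

/-- The Möbius function on integral ideals of a number field `K`. -/
def moebiusK (K : Type) [Field K] [NumberField K] (I : Ideal (𝓞 K)) : ℤ :=
  if Squarefree I then (-1) ^ (UniqueFactorizationMonoid.factors I).card else 0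

/-- The Mertens function of a number field `K`: the sum of `μ_K(𝔞)` over nonzero integral
ideals `𝔞` of norm at most `x`, where ideals of norm exactly `x` count with weight `1/2`. -/
def mertensK (K : Type) [Field K] [NumberField K] (x : ℝ) : ℝ :=
  ∑' I : Ideal (𝓞 K),
    if I ≠ ⊥ ∧ (Ideal.absNorm I : ℝ) < x then (moebiusK K I : ℝ)
    else if I ≠ ⊥ ∧ (Ideal.absNorm I : ℝ) = x then (moebiusK K I : ℝ) / 2
    else 0

/-- `M_K^- = liminf_{x → ∞} M_K(x) / x^{1/2}`, as an extended real number. -/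
def MKminus (K : Type) [Field K] [NumberField K] : EReal :=
  Filter.liminf (fun x : ℝ => ((mertensK K x / Real.sqrt x : ℝ) : EReal)) Filter.atTop

/-- `M_K^+ = limsup_{x → ∞} M_K(x) / x^{1/2}`, as an extended real number. -/
def MKplus (K : Type) [Field K] [NumberField K] : EReal :=
  Filter.limsup (fun x : ℝ => ((mertensK K x / Real.sqrt x : ℝ) : EReal)) Filter.atTop

/-- The naïve Mertens-type conjecture over `K`: `-1 ≤ M_K^- ≤ M_K^+ ≤ 1`. -/
def NaiveMertensConj (K : Type) [Field K] [NumberField K] : Prop :=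
  -1 ≤ MKminus K ∧ MKminus K ≤ MKplus K ∧ MKplus K ≤ 1

/-- A predicate identifying the Dedekind zeta function of `K`: a function analytic away
from `s = 1` agreeing with the Dirichlet series `∑ N(𝔞)^{-s}` on `Re s > 1`. -/
def IsDedekindZeta (K : Type) [Field K] [NumberField K] (Z : ℂ → ℂ) : Prop :=
  (∀ s : ℂ, s ≠ 1 → DifferentiableAt ℂ Z s) ∧
  ∀ s : ℂ, 1 < s.re →
    Z s = ∑' I : {I : Ideal (𝓞 K) // I ≠ ⊥}, (Ideal.absNorm I.1 : ℂ) ^ (-s)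

/-- The Riemann hypothesis for a zeta function `Z`: all nontrivial zeros lie on `Re s = 1/2`. -/
def ZetaRH (Z : ℂ → ℂ) : Prop :=
  ∀ ρ : ℂ, Z ρ = 0 → 0 < ρ.re → ρ.re < 1 → ρ.re = 1 / 2

section
/-- The integral of `f` along the vertical line `Re z = c`, with respect to `Im z`. -/
def lineIntegral (f : ℂ → ℂ) (c : ℝ) : ℂ := ∫ t : ℝ, f (c + t * I)

lemma integrable_inv_one_add_sq_mul (C : ℝ) : Integrable (fun t : ℝ => C / (1 + t ^ 2)) := by
  simpa [div_eq_mul_inv] using integrable_inv_one_add_sq.const_mul C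

lemma integrable_vertical {f : ℂ → ℂ} {c C : ℝ}
    (hf : ∀ t : ℝ, ContinuousAt f (c + t * I))
    (hC : ∀ t : ℝ, ‖f (c + t * I)‖ ≤ C / (1 + t ^ 2)) :
    Integrable (fun t : ℝ => f (c + t * I)) := by
  refine (integrable_inv_one_add_sq_mul C).mono' ?_ (ae_of_all _ hC)
  refine Continuous.aestronglyMeasurable (continuous_iff_continuousAt.2 fun t => ?_)
  exact ContinuousAt.comp (f := fun t : ℝ => (c + t * I : ℂ)) (hf t) (by fun_prop)

lemma norm_lineIntegral_le {f : ℂ → ℂ} {c C : ℝ}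
    (hC : ∀ t : ℝ, ‖f (c + t * I)‖ ≤ C / (1 + t ^ 2)) :
    ‖lineIntegral f c‖ ≤ C * Real.pi := by
  refine (norm_integral_le_of_norm_le (integrable_inv_one_add_sq_mul C) (ae_of_all _ hC)).trans ?_
  simp [div_eq_mul_inv, integral_const_mul]

lemma tendsto_horizontal_zero {f : ℂ → ℂ} {a b C : ℝ} (hab : a ≤ b) (ε : ℝ)
    (hε : ε ^ 2 = 1)
    (hbd : ∀ z : ℂ, a ≤ z.re → z.re ≤ b → ‖f z‖ ≤ C / (1 + z.im ^ 2)) :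
    Tendsto (fun T : ℝ => ∫ x in a..b, f (x + (ε * T : ℝ) * I)) atTop (𝓝 0) := by
  have h1 : Tendsto (fun T : ℝ => C / (1 + T ^ 2) * |b - a|) atTop (𝓝 0) := by
    have : Tendsto (fun T : ℝ => C / (1 + T ^ 2)) atTop (𝓝 0) :=
      tendsto_const_nhds.div_atTop (tendsto_atTop_add_const_left _ _
          (tendsto_pow_atTop two_ne_zero))
    simpa using this.mul_const _
  refine squeeze_zero_norm (fun T => ?_) h1
  refine intervalIntegral.norm_integral_le_of_norm_le_const fun x hx => ?_
  rw [Set.uIoc_of_le hab] at hx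
  have := hbd (x + (ε * T : ℝ) * I) (by simpa using hx.1.le) (by simpa using hx.2)
  simpa [mul_pow, hε] using this

/-- Shifting a line of integration across a strip where the integrand is holomorphic. -/
lemma lineIntegral_shift {f : ℂ → ℂ} {a b C : ℝ} (hab : a ≤ b)
    (hf : ∀ z : ℂ, a ≤ z.re → z.re ≤ b → DifferentiableAt ℂ f z)
    (hbd : ∀ z : ℂ, a ≤ z.re → z.re ≤ b → ‖f z‖ ≤ C / (1 + z.im ^ 2)) :
    lineIntegral f a = lineIntegral f b := by
  have hC : 0 ≤ C := by
    have := (norm_nonneg _).trans (hbd (a : ℂ) (by simp) (by simpa))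
    simpa using this
  have key : ∀ T : ℝ, (∫ x in a..b, f (x + ((-1) * T : ℝ) * I))
      - (∫ x in a..b, f (x + (1 * T : ℝ) * I))
      + I * (∫ y in (-T)..T, f (b + y * I)) - I * (∫ y in (-T)..T, f (a + y * I)) = 0 := by
    intro T
    have := Complex.integral_boundary_rect_eq_zero_of_differentiableOn f
      (a + (-T : ℝ) * I) (b + (T : ℝ) * I) (fun z hz => (hf z ?_ ?_).differentiableWithinAt)
    · simpa using this
    · have := hz.1; simp [Set.uIcc_of_le hab] at this; exact this.1
    · have := hz.1; simp [Set.uIcc_of_le hab] at this; exact this.2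
  have ha := intervalIntegral_tendsto_integral (integrable_vertical (c := a) (C := C)
    (fun t => (hf _ (by simp) (by simpa)).continuousAt)
    (fun t => by simpa using hbd (a + t * I) (by simp) (by simpa))) tendsto_neg_atTop_atBot
        tendsto_id
  have hb := intervalIntegral_tendsto_integral (integrable_vertical (c := b) (C := C)
    (fun t => (hf _ (by simpa) (by simp)).continuousAt)
    (fun t => by simpa using hbd (b + t * I) (by simpa) (by simp))) tendsto_neg_atTop_atBot
        tendsto_id
  have h1 := tendsto_horizontal_zero hab (-1) (by norm_num) hbd
  have h2 := tendsto_horizontal_zero hab 1 (by norm_num) hbd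
  have := ((h1.sub h2).add (hb.const_mul I)).sub (ha.const_mul I)
  have h0 := tendsto_nhds_unique this
    ((tendsto_const_nhds (x := (0 : ℂ))).congr fun T => (by simpa using (key T).symm))
  have h3 : I * (lineIntegral f b - lineIntegral f a) = 0 := by
    rw [← h0]; simp [lineIntegral]; ring
  have := (mul_eq_zero.1 h3).resolve_left I_ne_zero
  exact (sub_eq_zero.1 this).symm

/-- Polynomial growth is absorbed by a Gaussian. -/
lemma exists_poly_mul_gauss_le (m : ℕ) {δ : ℝ} (hδ : 0 < δ) :
    ∃ C : ℝ, 0 < C ∧ ∀ t : ℝ, (1 + |t|) ^ m * Real.exp (-δ * t ^ 2) ≤ C / (1 + t ^ 2) := by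
  have hlim : Tendsto (fun t : ℝ => (1 + t) ^ (m + 2) * Real.exp (-δ * t)) atTop (𝓝 0) := by
    have h := Real.tendsto_pow_mul_exp_neg_atTop_nhds_zero (m + 2)
    have h2 : Tendsto (fun t : ℝ => δ * (1 + t)) atTop atTop :=
      (tendsto_atTop_add_const_left _ _ tendsto_id).const_mul_atTop hδ
    have h3 := (h.comp h2).const_mul (Real.exp δ / δ ^ (m + 2))
    rw [mul_zero] at h3
    refine h3.congr fun t => ?_
    simp only [Function.comp]
    rw [mul_pow, show -(δ * (1 + t)) = -δ + -δ * t by ring, Real.exp_add, Real.exp_neg]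
    field_simp
  have hc : ContinuousOn (fun t : ℝ => (1 + t) ^ (m + 2) * Real.exp (-δ * t)) (Set.Ici 0) := by
    fun_prop
  obtain ⟨T, hT⟩ := (eventually_atTop.1 (hlim.eventually (gt_mem_nhds zero_lt_one)))
  obtain ⟨B, hB⟩ := (isCompact_Icc (a := (0:ℝ)) (b := max T 0)).exists_bound_of_continuousOn
    (hc.mono Set.Icc_subset_Ici_self)
  have hbd : ∀ t : ℝ, 0 ≤ t → (1 + t) ^ (m + 2) * Real.exp (-δ * t) ≤ max B 1 := by
    intro t ht
    by_cases h : t ≤ max T 0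
    · exact ((le_abs_self _).trans (hB t ⟨ht, h⟩)).trans (le_max_left _ _)
    · exact (hT t ((le_max_left _ _).trans (not_le.1 h).le)).le.trans (le_max_right _ _)
  refine ⟨max B 1 * Real.exp δ, by positivity, fun t => ?_⟩
  rw [le_div_iff₀ (by positivity)]
  have h1 : Real.exp (-δ * t ^ 2) ≤ Real.exp δ * Real.exp (-δ * |t|) := by
    rw [← Real.exp_add]; gcongr
    have := sq_abs t
    nlinarith [abs_nonneg t, sq_nonneg (|t| - 1)]
  have h2 : 1 + t ^ 2 ≤ (1 + |t|) ^ 2 := by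
    have := sq_abs t
    nlinarith [abs_nonneg t]
  calc (1 + |t|) ^ m * Real.exp (-δ * t ^ 2) * (1 + t ^ 2)
      ≤ (1 + |t|) ^ m * (Real.exp δ * Real.exp (-δ * |t|)) * (1 + |t|) ^ 2 := by gcongr
    _ = ((1 + |t|) ^ (m + 2) * Real.exp (-δ * |t|)) * Real.exp δ := by ring
    _ ≤ max B 1 * Real.exp δ := by gcongr; exact hbd _ (abs_nonneg t)
end

section
lemma norm_cexp_sq (z : ℂ) : ‖cexp (z ^ 2)‖ = Real.exp (z.re ^ 2 - z.im ^ 2) := by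
  rw [Complex.norm_exp]; congr 1; simp [pow_two]

lemma lineIntegral_gauss_div {c : ℝ} (hc : 0 < c) :
    lineIntegral (fun z => cexp (z ^ 2) / z ^ 1) c = Real.pi := by
  have h1 : ∀ t : ℝ, cexp ((c + t * I) ^ 2) / (c + t * I) ^ 1
      = ∫ x in Set.Ioi (0:ℝ), cexp ((c + t * I) ^ 2) * cexp (-(c + t * I) * x) := by
    intro t
    rw [integral_const_mul, integral_exp_mul_complex_Ioi (by simpa using hc)]
    simp only [ofReal_zero, mul_zero, Complex.exp_zero, pow_one, neg_div_neg_eq, mul_one_div]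
  have hint : Integrable (Function.uncurry fun (t x : ℝ) =>
      cexp ((c + t * I) ^ 2) * cexp (-(c + t * I) * x))
      (volume.prod (volume.restrict (Set.Ioi (0:ℝ)))) := by
    have hg : Integrable (fun t : ℝ => Real.exp (c ^ 2) * Real.exp (-1 * t ^ 2)) :=
      (integrable_exp_neg_mul_sq one_pos).const_mul _
    have he : Integrable (fun x : ℝ => Real.exp (-c * x)) (volume.restrict (Set.Ioi (0:ℝ))) :=
      exp_neg_integrableOn_Ioi 0 hc
    refine (hg.mul_prod he).mono' (Continuous.aestronglyMeasurable (by fun_prop))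
      (ae_of_all _ fun p => le_of_eq ?_)
    simp only [Function.uncurry, norm_mul, norm_cexp_sq]
    rw [Complex.norm_exp, ← Real.exp_add, ← Real.exp_add, ← Real.exp_add]
    congr 1; simp; ring
  unfold lineIntegral
  simp_rw [h1]
  rw [integral_integral_swap hint]
  have h2 : ∀ x : ℝ, ∫ t : ℝ, cexp ((c + t * I) ^ 2) * cexp (-(c + t * I) * x)
      = ((Real.sqrt Real.pi * Real.exp (-(1/4) * x ^ 2) : ℝ) : ℂ) := by
    intro x
    have h3 := integral_cexp_quadratic (b := -1) (by simp) (2 * c * I - I * x) (c ^ 2 - c * x)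
    have h4 : (fun t : ℝ => cexp ((c + t * I) ^ 2) * cexp (-(c + t * I) * x)) =
        fun t : ℝ => cexp (-1 * (t:ℂ) ^ 2 + (2 * c * I - I * x) * t + (c ^ 2 - c * x)) := by
      funext t; rw [← Complex.exp_add]; congr 1
      linear_combination (t:ℂ) ^ 2 * I_sq
    rw [h4, h3]
    push_cast
    rw [neg_neg, div_one, Real.sqrt_eq_rpow, Complex.ofReal_cpow Real.pi_pos.le]
    push_cast
    congr 2
    linear_combination (4 * c ^ 2 - 4 * c * x + x ^ 2) / 4 * I_sq
  simp_rw [h2]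
  rw [integral_complex_ofReal, integral_const_mul, integral_gaussian_Ioi]
  rw [show Real.pi / (1/4) = 2 ^ 2 * Real.pi by ring, Real.sqrt_mul (by positivity),
    Real.sqrt_sq (by norm_num)]
  norm_cast
  have := Real.mul_self_sqrt Real.pi_pos.le
  linear_combination this

lemma lineIntegral_neg_of_odd {f : ℂ → ℂ} (hf : ∀ z, f (-z) = -f z) (c : ℝ) :
    lineIntegral f (-c) = - lineIntegral f c := by
  unfold lineIntegral
  rw [← integral_neg_eq_self, ← integral_neg]
  refine integral_congr_ae (ae_of_all _ fun t => ?_)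
  simp only []
  rw [← hf]; congr 1; push_cast; ring

/-- The function `e^{z²} z^{-r}` has a Gaussian bound on vertical strips away from `0`. -/
lemma exists_gauss_bound (a b : ℝ) : ∃ C : ℝ, 0 < C ∧ ∀ z : ℂ, a ≤ z.re → z.re ≤ b →
    ‖cexp (z ^ 2)‖ ≤ C / (1 + z.im ^ 2) := by
  obtain ⟨C, hC, h⟩ := exists_poly_mul_gauss_le 0 one_pos
  refine ⟨Real.exp (a ^ 2 + b ^ 2) * C, by positivity, fun z h1 h2 => ?_⟩
  rw [norm_cexp_sq, mul_div_assoc, show z.re ^ 2 - z.im ^ 2 = z.re ^ 2 + (-1 * z.im ^ 2) by ring,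
    Real.exp_add]
  have := h z.im
  rw [pow_zero, one_mul] at this
  gcongr
  rcases le_total 0 z.re with h0 | h0 <;> nlinarith

lemma ne_zero_of_line {c : ℝ} (hc : c ≠ 0) (t : ℝ) : (c + t * I : ℂ) ≠ 0 := fun h => hc (by
  simpa using congrArg re h)

lemma norm_inv_pow_le {c : ℝ} (hc : c ≠ 0) (t : ℝ) (r : ℕ) :
    ‖((c + t * I : ℂ) ^ r)⁻¹‖ ≤ (|c| ^ r)⁻¹ := by
  rw [norm_inv, norm_pow]
  have : |c| ≤ ‖(c + t * I : ℂ)‖ := by simpa using abs_re_le_norm (c + t * I : ℂ)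
  have h : 0 < |c| := abs_pos.2 hc
  gcongr

lemma integrable_line_div_pow {Y : ℂ → ℂ} {c C : ℝ} (hc : c ≠ 0)
    (hY : ∀ t : ℝ, ContinuousAt Y (c + t * I))
    (hC : ∀ t : ℝ, ‖Y (c + t * I)‖ ≤ C / (1 + t ^ 2)) (r : ℕ) :
    Integrable (fun t : ℝ => Y (c + t * I) / (c + t * I) ^ r) := by
  refine integrable_vertical (f := fun z => Y z / z ^ r) (C := (|c| ^ r)⁻¹ * C) (fun t => ?_)
    (fun t => ?_)
  · exact (hY t).div (by fun_prop) (pow_ne_zero _ (ne_zero_of_line hc t))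
  · rw [div_eq_mul_inv, norm_mul, mul_comm, mul_div_assoc]
    exact mul_le_mul (norm_inv_pow_le hc t r) (hC t) (norm_nonneg _) (by positivity)

lemma lineIntegral_gauss_rec {c : ℝ} (hc : c ≠ 0) (r : ℕ) :
    (r + 1) * lineIntegral (fun z => cexp (z ^ 2) / z ^ (r + 2)) c
      = 2 * lineIntegral (fun z => cexp (z ^ 2) / z ^ r) c := by
  obtain ⟨C, -, hC⟩ := exists_gauss_bound c c
  have hi := integrable_line_div_pow (Y := fun z => cexp (z ^ 2)) hc
    (fun t => by fun_prop) (fun t => by simpa using hC (c + t * I) (by simp) (by simp))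
  have hd : ∀ t : ℝ, HasDerivAt (fun t : ℝ => cexp ((c + t * I) ^ 2) / (c + t * I) ^ (r + 1))
      (I * (2 * (cexp ((c + t * I) ^ 2) / (c + t * I) ^ r)
        - (r + 1) * (cexp ((c + t * I) ^ 2) / (c + t * I) ^ (r + 2)))) t := by
    intro t
    have hz := ne_zero_of_line hc t
    have h0 : HasDerivAt (fun t : ℝ => (c + t * I : ℂ)) I t := by
      simpa using ((hasDerivAt_id t).ofReal_comp.mul_const I).const_add (c : ℂ)
    have h1 : HasDerivAt (fun z : ℂ => cexp (z ^ 2) / z ^ (r + 1)) _ (c + t * I : ℂ) :=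
      ((hasDerivAt_pow 2 (c + t * I : ℂ)).cexp).div (hasDerivAt_pow (r + 1) (c + t * I : ℂ))
        (pow_ne_zero _ hz)
    refine (h1.comp t h0).congr_deriv ?_
    field_simp
    push_cast
    ring
  have hlim : ∀ l : Filter ℝ, Tendsto (fun t : ℝ => t ^ 2) l atTop →
      Tendsto (fun t : ℝ => cexp ((c + t * I) ^ 2) / (c + t * I) ^ (r + 1)) l (𝓝 0) := by
    intro l hl
    have : Tendsto (fun t : ℝ => C / (1 + t ^ 2) * (|c| ^ (r + 1))⁻¹) l (𝓝 0) := by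
      simpa using ((tendsto_atTop_add_const_left _ (1:ℝ) hl).const_div_atTop C).mul_const
        ((|c| ^ (r + 1))⁻¹)
    refine squeeze_zero_norm (fun t => ?_) this
    rw [div_eq_mul_inv, norm_mul]
    refine mul_le_mul (by simpa using hC (c + t * I) (by simp) (by simp))
      (norm_inv_pow_le hc t _) (norm_nonneg _) ?_
    exact (norm_nonneg _).trans (by simpa using hC (c + t * I) (by simp) (by simp))
  have h2 : Tendsto (fun t : ℝ => t ^ 2) atBot atTop := by
    simpa [Function.comp_def] using
      (tendsto_pow_atTop (α := ℝ) two_ne_zero).comp tendsto_neg_atBot_atTop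
  have := integral_of_hasDerivAt_of_tendsto hd
    ((((hi r).const_mul 2).sub ((hi (r+2)).const_mul ((r:ℂ) + 1))).const_mul I)
    (hlim _ h2) (hlim _ (tendsto_pow_atTop two_ne_zero))
  rw [integral_const_mul, integral_sub ((hi r).const_mul 2) ((hi (r+2)).const_mul ((r:ℂ) + 1)),
    integral_const_mul, integral_const_mul, sub_zero] at this
  have := (mul_eq_zero.1 this).resolve_left I_ne_zero
  exact (sub_eq_zero.1 this).symm

lemma circleIntegral_gauss_rec {ρ : ℝ} (hρ : 0 < ρ) (r : ℕ) :
    (r + 1) * (∮ z in C(0, ρ), cexp (z ^ 2) / z ^ (r + 2))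
      = 2 * (∮ z in C(0, ρ), cexp (z ^ 2) / z ^ r) := by
  have hz : ∀ z ∈ Metric.sphere (0:ℂ) ρ, z ≠ 0 := by
    rintro z hz rfl
    simp at hz; exact hρ.ne hz
  have hci : ∀ r : ℕ, CircleIntegrable (fun z => cexp (z ^ 2) / z ^ r) 0 ρ := by
    intro r
    refine ContinuousOn.circleIntegrable hρ.le ?_
    exact ContinuousOn.div (by fun_prop) (by fun_prop) fun z h => pow_ne_zero _ (hz z h)
  have := circleIntegral.integral_eq_zero_of_hasDerivWithinAt' (c := 0) (R := ρ)
    (f := fun z : ℂ => cexp (z ^ 2) / z ^ (r + 1))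
    (f' := fun z => (2 * (cexp (z ^ 2) / z ^ r) - (r + 1) * (cexp (z ^ 2) / z ^ (r + 2))))
    (fun z h => by
      rw [abs_of_pos hρ] at h
      have hz := hz z h
      have h1 : HasDerivAt (fun z : ℂ => cexp (z ^ 2) / z ^ (r + 1)) _ z :=
        ((hasDerivAt_pow 2 z).cexp).div (hasDerivAt_pow (r + 1) z) (pow_ne_zero _ hz)
      refine (h1.congr_deriv ?_).hasDerivWithinAt
      field_simp
      push_cast
      ring)
  rw [circleIntegral.integral_sub] at this
  · rw [circleIntegral.integral_const_mul, circleIntegral.integral_const_mul] at this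
    exact (sub_eq_zero.1 this).symm
  · simpa [smul_eq_mul] using (hci r).const_fun_smul (a := (2:ℂ))
  · simpa [smul_eq_mul] using (hci (r + 2)).const_fun_smul (a := (r + 1 : ℂ))
end

section
lemma gauss_jump {a b ρ : ℝ} (ha : 0 < a) (hb : 0 < b) (hρ : 0 < ρ) (r : ℕ) :
    I * (lineIntegral (fun z => cexp (z ^ 2) / z ^ r) a
      - lineIntegral (fun z => cexp (z ^ 2) / z ^ r) (-b))
      = ∮ z in C(0, ρ), cexp (z ^ 2) / z ^ r := by
  induction r using Nat.twoStepInduction with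
  | zero =>
    obtain ⟨C, -, hC⟩ := exists_gauss_bound (-b) a
    rw [lineIntegral_shift (a := -b) (b := a) (C := C) (by linarith)
      (fun z _ _ => by simp) (fun z h1 h2 => by simpa using hC z h1 h2), sub_self, mul_zero]
    refine (circleIntegral_eq_zero_of_differentiable_on_off_countable hρ.le
      Set.countable_empty ?_ fun z _ => ?_).symm
    · simp; fun_prop
    · simp
  | one =>
    rw [lineIntegral_neg_of_odd (fun z => by simp [div_neg]), lineIntegral_gauss_div ha,
      lineIntegral_gauss_div hb]
    have := Complex.circleIntegral_sub_center_inv_smul_of_differentiable_on_off_countable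
      (c := 0) (f := fun z : ℂ => cexp (z ^ 2)) hρ Set.countable_empty
      (by fun_prop) (fun z _ => by fun_prop)
    simp only [sub_zero, smul_eq_mul, pow_one, div_eq_inv_mul] at this ⊢
    rw [this]
    simp; ring
  | more r h1 _ =>
    have e1 := lineIntegral_gauss_rec ha.ne' r
    have e2 := lineIntegral_gauss_rec (neg_ne_zero.2 hb.ne') r
    have e3 := circleIntegral_gauss_rec hρ r
    have h : (r + 1 : ℂ) ≠ 0 := by exact_mod_cast r.succ_ne_zero
    refine mul_left_cancel₀ h ?_
    rw [e3, ← h1]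
    linear_combination I * e1 - I * e2

/-- Shifting a line of integration across a pole at `0`. -/
theorem lineIntegral_jump {a b ρ : ℝ} (ha : 0 < a) (hb : 0 < b) (hρ : 0 < ρ) (hρa : ρ < a)
    (hρb : ρ < b) (r : ℕ) (Y : ℂ → ℂ)
    (hY : ∀ z : ℂ, -b ≤ z.re → z.re ≤ a → DifferentiableAt ℂ Y z)
    (hbd : ∃ C, ∀ z : ℂ, -b ≤ z.re → z.re ≤ a → ‖Y z‖ ≤ C / (1 + z.im ^ 2)) :
    I * (lineIntegral (fun z => Y z / z ^ r) a - lineIntegral (fun z => Y z / z ^ r) (-b))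
      = ∮ z in C(0, ρ), Y z / z ^ r := by
  have hsub : ∀ z ∈ Metric.closedBall (0:ℂ) ρ, -b ≤ z.re ∧ z.re ≤ a := by
    intro z hz
    have := (abs_re_le_norm z).trans (mem_closedBall_zero_iff.1 hz)
    constructor <;> linarith [(abs_le.1 this).1, (abs_le.1 this).2]
  induction r generalizing Y with
  | zero =>
    obtain ⟨C, hC⟩ := hbd
    rw [lineIntegral_shift (a := -b) (b := a) (C := C) (by linarith)
      (fun z h1 h2 => by simpa using hY z h1 h2) (fun z h1 h2 => by simpa using hC z h1 h2),
      sub_self, mul_zero]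
    refine (circleIntegral_eq_zero_of_differentiable_on_off_countable hρ.le
      Set.countable_empty ?_ fun z hz => ?_).symm
    · intro z hz
      simpa using (hY z (hsub z hz).1 (hsub z hz).2).continuousAt.continuousWithinAt
    · have := hsub z (Metric.ball_subset_closedBall hz.1)
      simpa using hY z this.1 this.2
  | succ r ih =>
    obtain ⟨C, hC⟩ := hbd
    obtain ⟨G, hG, hGb⟩ := exists_gauss_bound (-b) a
    have hC0 : 0 ≤ C := by
      simpa using (norm_nonneg _).trans (hC 0 (by simp [hb.le]) (by simp [ha.le]))
    set W : ℂ → ℂ := fun z => Y z - Y 0 * cexp (z ^ 2) with hW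
    set V : ℂ → ℂ := dslope W 0 with hV
    have hWd : ∀ z : ℂ, -b ≤ z.re → z.re ≤ a → DifferentiableAt ℂ W z := fun z h1 h2 =>
      (hY z h1 h2).sub (by fun_prop)
    have hVne : ∀ z : ℂ, z ≠ 0 → V z = W z / z := by
      intro z hz
      rw [hV, dslope_of_ne _ hz, slope_def_field]
      simp [hW]
    have hVd : ∀ z : ℂ, -b ≤ z.re → z.re ≤ a → DifferentiableAt ℂ V z := by
      intro z h1 h2
      by_cases hz : z = 0
      · subst hz
        have hball : Metric.ball (0:ℂ) ρ ∈ 𝓝 (0:ℂ) := Metric.ball_mem_nhds _ hρ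
        have : DifferentiableOn ℂ W (Metric.ball (0:ℂ) ρ) := fun z hz =>
          (hWd z (hsub z (Metric.ball_subset_closedBall hz)).1
            (hsub z (Metric.ball_subset_closedBall hz)).2).differentiableWithinAt
        exact ((differentiableOn_dslope hball).2 this).differentiableAt hball
      · exact (differentiableAt_dslope_of_ne hz).2 (hWd z h1 h2)
    have hVb : ∃ C, ∀ z : ℂ, -b ≤ z.re → z.re ≤ a → ‖V z‖ ≤ C / (1 + z.im ^ 2) := by
      obtain ⟨B, hB⟩ := (isCompact_closedBall (0:ℂ) ρ).exists_bound_of_continuousOn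
        (f := V) (fun z hz => (hVd z (hsub z hz).1 (hsub z hz).2).continuousAt.continuousWithinAt)
      have hB0 : 0 ≤ B := (norm_nonneg _).trans (hB 0 (by simp [hρ.le]))
      refine ⟨B * (1 + ρ ^ 2) + (C + ‖Y 0‖ * G) / ρ, fun z h1 h2 => ?_⟩
      have hpos : 0 < 1 + z.im ^ 2 := by positivity
      rw [le_div_iff₀ hpos]
      by_cases hz : ‖z‖ ≤ ρ
      · have h3 : z.im ^ 2 ≤ ρ ^ 2 := by
          have := abs_im_le_norm z
          rw [← sq_abs]; gcongr; linarith
        have h4 : 0 ≤ (C + ‖Y 0‖ * G) / ρ := by positivity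
        have := hB z (by simpa using hz)
        have : ‖V z‖ * (1 + z.im ^ 2) ≤ B * (1 + ρ ^ 2) := by gcongr
        linarith
      · push Not at hz
        have hz0 : z ≠ 0 := by rintro rfl; simp at hz; linarith
        have h3 : ‖W z‖ * (1 + z.im ^ 2) ≤ C + ‖Y 0‖ * G := by
          have e1 := hC z h1 h2
          have e2 := hGb z h1 h2
          rw [le_div_iff₀ hpos] at e1 e2
          calc ‖W z‖ * (1 + z.im ^ 2) ≤ (‖Y z‖ + ‖Y 0‖ * ‖cexp (z ^ 2)‖) * (1 + z.im ^ 2) := by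
                gcongr
                exact (norm_sub_le _ _).trans (by rw [norm_mul])
            _ = ‖Y z‖ * (1 + z.im ^ 2) + ‖Y 0‖ * (‖cexp (z ^ 2)‖ * (1 + z.im ^ 2)) := by ring
            _ ≤ _ := by gcongr
        have h5 : ‖V z‖ * (1 + z.im ^ 2) ≤ (C + ‖Y 0‖ * G) / ρ := by
          rw [hVne z hz0, norm_div, div_mul_eq_mul_div]
          gcongr
        have : 0 ≤ B * (1 + ρ ^ 2) := by positivity
        linarith
    have key := ih V hVd hVb
    have hg := gauss_jump ha hb hρ (r + 1)
    have hsplit : ∀ z : ℂ, z ≠ 0 →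
        Y z / z ^ (r + 1) = V z / z ^ r + Y 0 * (cexp (z ^ 2) / z ^ (r + 1)) := by
      intro z hz
      rw [hVne z hz, hW]; field_simp; ring
    have hline : ∀ c : ℝ, c ≠ 0 → -b ≤ c → c ≤ a →
        lineIntegral (fun z => Y z / z ^ (r + 1)) c = lineIntegral (fun z => V z / z ^ r) c
          + Y 0 * lineIntegral (fun z => cexp (z ^ 2) / z ^ (r + 1)) c := by
      intro c hc h1 h2
      obtain ⟨CV, hCV⟩ := hVb
      unfold lineIntegral
      rw [← integral_const_mul, ← integral_add]
      · exact integral_congr_ae (ae_of_all _ fun t => hsplit _ (ne_zero_of_line hc t))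
      · exact integrable_line_div_pow hc
          (fun t => (hVd _ (by simpa) (by simpa)).continuousAt)
          (fun t => by simpa using hCV (c + t * I) (by simpa) (by simpa)) r
      · exact (integrable_line_div_pow (Y := fun z => cexp (z ^ 2)) hc (fun t => by fun_prop)
          (fun t => by simpa using hGb (c + t * I) (by simpa) (by simpa)) (r + 1)).const_mul _
    rw [hline a ha.ne' (by linarith) le_rfl, hline (-b) (neg_ne_zero.2 hb.ne') le_rfl (by linarith)]
    have hz : ∀ z ∈ Metric.sphere (0:ℂ) ρ, z ≠ 0 := by
      rintro z hz rfl
      simp at hz; exact hρ.ne hz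
    have hcirc : (∮ z in C(0, ρ), Y z / z ^ (r + 1)) = (∮ z in C(0, ρ), V z / z ^ r)
        + Y 0 * ∮ z in C(0, ρ), cexp (z ^ 2) / z ^ (r + 1) := by
      rw [circleIntegral.integral_congr hρ.le (fun z h => hsplit z (hz z h)),
        circleIntegral.integral_add, circleIntegral.integral_const_mul]
      · refine ContinuousOn.circleIntegrable hρ.le (ContinuousOn.div (fun z h => ?_) (by fun_prop)
          fun z h => pow_ne_zero _ (hz z h))
        have := hsub z (Metric.sphere_subset_closedBall h)
        exact (hVd z this.1 this.2).continuousAt.continuousWithinAt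
      · refine ContinuousOn.circleIntegrable hρ.le (ContinuousOn.mul (by fun_prop)
          (ContinuousOn.div (by fun_prop) (by fun_prop) fun z h => pow_ne_zero _ (hz z h)))
    rw [hcirc, ← key, ← hg]
    ring
end

section
/-- A nonnegative kernel of total mass one with compactly supported Fourier transform `ψ`. -/
structure IsBandlimitedKernel (k : ℝ → ℝ) (ψ : ℝ → ℂ) : Prop where
  cont : Continuous k
  nonneg : ∀ v, 0 ≤ k v
  integrable : Integrable k
  integrable_abs_mul : Integrable fun v => |v| * k v
  integral_eq_one : ∫ v, k v = 1
  cont_ft : Continuous ψ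
  supp_ft : HasCompactSupport ψ
  ft : ∀ ω : ℝ, ∫ v : ℝ, (k v : ℂ) * cexp (-(I * ω * v)) = ψ ω

open scoped FourierTransform ContDiff Convolution in
lemma exists_nonneg_bandlimited : ∃ (k : ℝ → ℝ) (g : ℝ → ℂ), Continuous k ∧ (∀ v, 0 ≤ k v) ∧
    Integrable k ∧ (Integrable fun v => |v| * k v) ∧ Continuous g ∧ HasCompactSupport g ∧
    (∀ x : ℝ, ∫ v : ℝ, cexp (2 * Real.pi * v * x * I) * (k v : ℂ) = g x) ∧ g 0 ≠ 0 := by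
  obtain ⟨b⟩ : Nonempty (ContDiffBump (0:ℝ)) := ⟨⟨1, 2, one_pos, one_lt_two⟩⟩
  have hbs : ContDiff ℝ ∞ (fun x => (b x : ℂ)) := ofRealCLM.contDiff.comp b.contDiff
  have hbc : HasCompactSupport (fun x => (b x : ℂ)) :=
    HasCompactSupport.comp_left (g := fun x : ℝ => (x : ℂ)) b.hasCompactSupport (by simp)
  obtain ⟨f, hf⟩ : ∃ f : SchwartzMap ℝ ℂ, ∀ x, f x = (b x : ℂ) :=
    ⟨hbc.toSchwartzMap hbs, fun x => rfl⟩
  have hfc : HasCompactSupport (f : ℝ → ℂ) := by rwa [show (f : ℝ → ℂ) = _ from funext hf]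
  obtain ⟨φ, hφ⟩ : ∃ φ : SchwartzMap ℝ ℂ, ∀ ξ, φ ξ = 𝓕 (f : ℝ → ℂ) ξ := 
    ⟨𝓕 f, fun ξ => by rw [SchwartzMap.fourier_coe]⟩
  have hconj : ∀ ξ, (starRingEnd ℂ) (φ ξ) = φ ξ := by
    intro ξ
    rw [hφ, Real.fourier_real_eq_integral_exp_smul, ← integral_conj, ← integral_neg_eq_self]
    refine integral_congr_ae (ae_of_all _ fun x => ?_)
    have h2 : (starRingEnd ℂ) 2 = 2 := Complex.conj_ofReal 2
    simp [hf, ← Complex.exp_conj, b.neg, h2]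
  have hsq : ∀ ξ, ((‖φ ξ‖ ^ 2 : ℝ) : ℂ) = φ ξ * φ ξ := by
    intro ξ
    nth_rewrite 3 [← hconj ξ]
    rw [Complex.mul_conj, Complex.normSq_eq_norm_sq]
  obtain ⟨g, hgdef⟩ : ∃ g, g = (f : ℝ → ℂ) ⋆[ContinuousLinearMap.mul ℂ ℂ, volume] (f : ℝ → ℂ) :=
    ⟨_, rfl⟩
  have hgc : HasCompactSupport g := hgdef ▸ hfc.convolution _ hfc
  have hgcont : Continuous g := hgdef ▸
    hfc.continuous_convolution_left _ f.continuous f.integrable.locallyIntegrable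
  have hFg : 𝓕 g = fun ξ => ((‖φ ξ‖ ^ 2 : ℝ) : ℂ) := by
    funext ξ
    rw [hsq, hφ, hgdef, Real.fourier_mul_convolution_eq f.integrable f.integrable]
  obtain ⟨B, hB⟩ : ∃ B, ∀ ξ, ‖φ ξ‖ ≤ B := by
    obtain ⟨C, hC⟩ := φ.decay 0 0
    exact ⟨C, fun ξ => by simpa using hC.2 ξ⟩
  have hB0 : 0 ≤ B := (norm_nonneg _).trans (hB 0)
  have hcontφ : Continuous fun ξ => ‖φ ξ‖ ^ 2 := φ.continuous.norm.pow 2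
  have hi1 : Integrable fun ξ => ‖φ ξ‖ ^ 2 := by
    refine (φ.integrable.norm.const_mul B).mono' hcontφ.aestronglyMeasurable
      (ae_of_all _ fun ξ => ?_)
    rw [norm_pow, norm_norm, pow_two]
    exact mul_le_mul_of_nonneg_right (hB ξ) (norm_nonneg _)
  have hi2 : Integrable fun ξ => |ξ| * ‖φ ξ‖ ^ 2 := by
    refine ((φ.integrable_pow_mul volume 1).const_mul B).mono'
      (continuous_abs.mul hcontφ).aestronglyMeasurable (ae_of_all _ fun ξ => ?_)
    rw [Real.norm_of_nonneg (by positivity), pow_one, Real.norm_eq_abs, pow_two]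
    have := mul_le_mul_of_nonneg_right (hB ξ) (norm_nonneg (φ ξ))
    calc |ξ| * (‖φ ξ‖ * ‖φ ξ‖) ≤ |ξ| * (B * ‖φ ξ‖) := by gcongr
      _ = _ := by ring
  have hinv : ∀ x : ℝ, ∫ v : ℝ, cexp (2 * Real.pi * v * x * I) * ((‖φ v‖ ^ 2 : ℝ) : ℂ) = g x := by
    intro x
    have h := congrFun (hgcont.fourierInv_fourier_eq (hgcont.integrable_of_hasCompactSupport hgc)
      (by rw [hFg]; exact hi1.ofReal)) x
    rw [← h, hFg, Real.fourierInv_eq']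
    refine integral_congr_ae (ae_of_all _ fun v => ?_)
    simp only [smul_eq_mul]
    congr 2
    simp; ring
  have hg0 : g 0 ≠ 0 := by
    have h1 : g 0 = ((∫ x, b x ^ 2 : ℝ) : ℂ) := by
      rw [← integral_complex_ofReal, hgdef]
      refine integral_congr_ae (ae_of_all _ fun x => ?_)
      simp [hf, b.neg, pow_two]
    have h2 : 0 < ∫ x, b x ^ 2 := by
      have hsup : Function.support (fun x => b x ^ 2) = Metric.ball 0 b.rOut := by
        rw [← b.support_eq]; ext x; simp
      have hc : HasCompactSupport (fun x => b x ^ 2) :=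
        HasCompactSupport.comp_left (g := fun x : ℝ => x ^ 2) b.hasCompactSupport (by simp)
      have hb2 : Continuous (fun x => b x ^ 2) := b.continuous.pow 2
      rw [integral_pos_iff_support_of_nonneg (fun x => sq_nonneg _)
        (hb2.integrable_of_hasCompactSupport hc), hsup]
      simpa using b.rOut_pos
    rw [h1]
    exact_mod_cast h2.ne'
  exact ⟨fun v => ‖φ v‖ ^ 2, g, hcontφ, fun v => by positivity, hi1, hi2, hgcont, hgc, hinv, hg0⟩

lemma exists_isBandlimitedKernel : ∃ k ψ, IsBandlimitedKernel k ψ := by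
  obtain ⟨k, g, hk, hk0, hi1, hi2, hg, hgc, hinv, hg0⟩ := exists_nonneg_bandlimited
  obtain ⟨m, hm⟩ : ∃ m, m = ∫ v, k v := ⟨_, rfl⟩
  have hm0 : m ≠ 0 := by
    have := hinv 0
    simp only [ofReal_zero, mul_zero, zero_mul, Complex.exp_zero, one_mul] at this
    rw [integral_complex_ofReal, ← hm] at this
    intro h; rw [h] at this; exact hg0 (by simpa using this.symm)
  have hmpos : 0 < m := lt_of_le_of_ne (hm ▸ integral_nonneg hk0) hm0.symm
  refine ⟨fun v => k v / m, fun ω => g (-(ω / (2 * Real.pi))) / m,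
    by fun_prop, fun v => div_nonneg (hk0 v) hmpos.le, hi1.div_const _, ?_, ?_, by fun_prop, ?_,
    fun ω => ?_⟩
  · simpa [mul_div_assoc] using hi2.div_const m
  · rw [integral_div, ← hm, div_self hm0]
  · have h1 := hgc.comp_homeomorph ((Homeomorph.mulRight₀ (-(2 * Real.pi)⁻¹)
      (by simp [Real.pi_ne_zero])))
    have h2 := h1.comp_left (g := fun z : ℂ => z / m) (by simp)
    convert h2 using 2 with ω
    simp [div_eq_mul_inv]
  · rw [← hinv, ← integral_div]
    refine integral_congr_ae (ae_of_all _ fun v => ?_)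
    have hpi : (Real.pi : ℂ) ≠ 0 := by exact_mod_cast Real.pi_ne_zero
    simp only []
    rw [mul_comm, show -(I * ω * v) = 2 * Real.pi * v * ((-(ω / (2 * Real.pi)) : ℝ) : ℂ) * I by
      push_cast; field_simp]
    push_cast
    ring

/-- Dilation of a bandlimited kernel. -/
lemma IsBandlimitedKernel.dilate_ft {k : ℝ → ℝ} {ψ : ℝ → ℂ} (h : IsBandlimitedKernel k ψ)
    {T : ℝ} (hT : 0 < T) (ω : ℝ) :
    ∫ v : ℝ, ((T * k (T * v) : ℝ) : ℂ) * cexp (-(I * ω * v)) = ψ (ω / T) := by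
  rw [← h.ft]
  have := Measure.integral_comp_mul_left
    (fun v : ℝ => (k v : ℂ) * cexp (-(I * (ω / T : ℝ) * v))) T
  rw [abs_of_pos (inv_pos.2 hT), eq_inv_smul_iff₀ hT.ne', ← integral_smul] at this
  rw [← this]
  refine integral_congr_ae (ae_of_all _ fun v => ?_)
  have hT' : (T : ℂ) ≠ 0 := by exact_mod_cast hT.ne'
  simp only [real_smul]
  push_cast
  rw [mul_assoc]
  congr 3
  field_simp
end

section
/-- Simultaneous recurrence of finitely many characters of `ℝ`. -/
lemma exists_large_almost_period (Γ : Finset ℝ) {ε : ℝ} (hε : 0 < ε) (M : ℝ) :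
    ∃ y, M ≤ y ∧ ∀ γ ∈ Γ, ‖cexp (I * γ * y) - 1‖ ≤ ε := by
  let x : ℕ → (Γ → ℂ) := fun n γ => cexp (I * γ * n)
  have hx : ∀ n, x n ∈ Set.pi Set.univ fun _ : Γ => Metric.closedBall (0:ℂ) 1 := by
    intro n γ _
    simp [x, Complex.norm_exp]
  have hK : IsCompact (Set.pi Set.univ fun _ : Γ => Metric.closedBall (0:ℂ) 1) :=
    isCompact_univ_pi fun _ => isCompact_closedBall _ _
  obtain ⟨a, -, φ, hφ, ha⟩ := hK.tendsto_subseq hx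
  obtain ⟨N, hN⟩ := Metric.cauchySeq_iff.1 ha.cauchySeq ε hε
  obtain ⟨m, hm⟩ := exists_nat_ge (M + φ N)
  have hle : m ≤ φ (max m N) := (le_max_left _ _).trans hφ.le_apply
  refine ⟨(φ (max m N) : ℝ) - φ N, ?_, fun γ hγ => ?_⟩
  · have : (m : ℝ) ≤ φ (max m N) := by exact_mod_cast hle
    linarith
  · have h1 := (hN (max m N) (le_max_right _ _) N le_rfl).le
    have h2 := (dist_le_pi_dist _ _ (⟨γ, hγ⟩ : Γ)).trans h1
    rw [dist_eq_norm] at h2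
    simp only [x, Function.comp] at h2
    have h3 : cexp (I * γ * φ (max m N)) - cexp (I * γ * φ N)
        = cexp (I * γ * φ N) * (cexp (I * γ * ((φ (max m N) : ℝ) - φ N : ℝ)) - 1) := by
      rw [mul_sub, ← Complex.exp_add, mul_one]; congr 2; push_cast; ring
    rw [h3, norm_mul, Complex.norm_exp] at h2
    simpa using h2

/-- A function on `ℝ` that is asymptotically bounded by `1` at `+∞`. -/
def LimsupNormLeOne (S : ℝ → ℂ) : Prop := ∀ ε > 0, ∀ᶠ u in atTop, ‖S u‖ ≤ 1 + ε

lemma norm_trigPoly_le_one (Γ : Finset ℝ) (c : ℝ → ℂ)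
    (h : LimsupNormLeOne fun u : ℝ => ∑ γ ∈ Γ, c γ * cexp (I * γ * u)) (u : ℝ) :
    ‖∑ γ ∈ Γ, c γ * cexp (I * γ * u)‖ ≤ 1 := by
  set B := ∑ γ ∈ Γ, ‖c γ‖ with hB
  have hB0 : 0 ≤ B := Finset.sum_nonneg fun _ _ => norm_nonneg _
  refine le_of_forall_pos_le_add fun ε hε => ?_
  obtain ⟨U, hU⟩ := eventually_atTop.1 (h (ε / 2) (by positivity))
  obtain ⟨y, hy, hγ⟩ := exists_large_almost_period Γ (ε := ε / 2 / (B + 1)) (by positivity) (U - u)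
  have h1 := hU (u + y) (by linarith)
  have h2 : ‖∑ γ ∈ Γ, c γ * cexp (I * γ * u) - ∑ γ ∈ Γ, c γ * cexp (I * γ * (u + y : ℝ))‖
      ≤ B * (ε / 2 / (B + 1)) := by
    rw [← Finset.sum_sub_distrib, hB, Finset.sum_mul]
    refine norm_sum_le_of_le _ fun γ hg => ?_
    have : c γ * cexp (I * γ * u) - c γ * cexp (I * γ * (u + y : ℝ))
        = -(c γ * cexp (I * γ * u) * (cexp (I * γ * y) - 1)) := by
      push_cast; rw [mul_add, Complex.exp_add]; ring
    rw [this, norm_neg, norm_mul, norm_mul, Complex.norm_exp]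
    simpa using mul_le_mul_of_nonneg_left (hγ γ hg) (norm_nonneg _)
  have h3 : B * (ε / 2 / (B + 1)) ≤ ε / 2 := by
    rw [mul_div_assoc', div_le_iff₀ (by positivity)]; nlinarith
  have := norm_sub_norm_le (∑ γ ∈ Γ, c γ * cexp (I * γ * u))
    (∑ γ ∈ Γ, c γ * cexp (I * γ * (u + y : ℝ)))
  linarith

lemma IsBandlimitedKernel.dilate_integrable {k : ℝ → ℝ} {ψ : ℝ → ℂ} (h : IsBandlimitedKernel k ψ)
    {T : ℝ} (hT : 0 < T) : Integrable (fun v => T * k (T * v)) ∧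
    Integrable (fun v => |v| * (T * k (T * v))) ∧ ∫ v, T * k (T * v) = 1 := by
  refine ⟨(h.integrable.comp_mul_left' hT.ne').const_mul T, ?_, ?_⟩
  · refine ((h.integrable_abs_mul.comp_mul_left' hT.ne').const_mul 1).congr
      (ae_of_all _ fun v => ?_)
    simp only [abs_mul, abs_of_pos hT]; ring
  · rw [integral_const_mul, Measure.integral_comp_mul_left, abs_of_pos (inv_pos.2 hT),
      h.integral_eq_one]
    simp [hT.ne']

section Smoothing

variable {S : ℝ → ℂ} {C : ℝ} {k : ℝ → ℝ}

lemma integrable_conv_linear_growth (hS : Measurable S) (hC : ∀ u, ‖S u‖ ≤ C * (1 + |u|))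
    (hk : Continuous k) (hk0 : ∀ v, 0 ≤ k v) (h1 : Integrable k)
    (h2 : Integrable fun v => |v| * k v) (u : ℝ) :
    Integrable fun v => S (u - v) * (k v : ℂ) := by
  have hC0 : 0 ≤ C := by simpa using (norm_nonneg _).trans (hC 0)
  refine ((h1.const_mul (C * (1 + |u|))).add (h2.const_mul C)).mono'
    (Measurable.aestronglyMeasurable (by fun_prop)) (ae_of_all _ fun v => ?_)
  rw [norm_mul, norm_real, Real.norm_of_nonneg (hk0 v)]
  have h3 : ‖S (u - v)‖ ≤ C * (1 + (|u| + |v|)) := (hC _).trans (by gcongr; exact abs_sub _ _)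
  calc ‖S (u - v)‖ * k v ≤ C * (1 + (|u| + |v|)) * k v := by gcongr; exact hk0 v
    _ = _ := by simp only [Pi.add_apply]; ring

/-- Averaging against a probability kernel does not increase the asymptotic bound. -/
lemma limsupNormLeOne_conv (hS : Measurable S) (hC : ∀ u, ‖S u‖ ≤ C * (1 + |u|))
    (hlim : LimsupNormLeOne S) (hk : Continuous k) (hk0 : ∀ v, 0 ≤ k v) (h1 : Integrable k)
    (h2 : Integrable fun v => |v| * k v) (hk1 : ∫ v, k v = 1) :
    LimsupNormLeOne fun u => ∫ v, S (u - v) * (k v : ℂ) := by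
  intro ε hε
  have hC0 : 0 ≤ C := by simpa using (norm_nonneg _).trans (hC 0)
  obtain ⟨U, hU⟩ := eventually_atTop.1 (hlim (ε / 2) (by positivity))
  have hexc : Tendsto (fun u => ∫ v, max (‖S (u - v)‖ - (1 + ε / 2)) 0 * k v) atTop (𝓝 0) := by
    have := tendsto_integral_filter_of_dominated_convergence (μ := volume) (l := atTop)
      (F := fun u v => max (‖S (u - v)‖ - (1 + ε / 2)) 0 * k v) (f := fun _ => (0:ℝ))
      (fun v => C * (1 + |U|) * k v + 2 * C * (|v| * k v)) ?_ ?_ ?_ ?_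
    · simpa using this
    · exact .of_forall fun u => Measurable.aestronglyMeasurable (by fun_prop)
    · filter_upwards [eventually_ge_atTop 0] with u hu
      refine ae_of_all _ fun v => ?_
      rw [Real.norm_of_nonneg (mul_nonneg (le_max_right _ _) (hk0 v))]
      have hb : 0 ≤ C * (1 + |U|) * k v + 2 * C * (|v| * k v) := by
        have := hk0 v; positivity
      by_cases huv : U ≤ u - v
      · rw [max_eq_right (by linarith [hU _ huv]), zero_mul]; exact hb
      · push Not at huv
        have h3 : |u - v| ≤ |U| + 2 * |v| := by
          rw [abs_le]; constructor <;> linarith [neg_abs_le v, le_abs_self v, le_abs_self U,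
            abs_nonneg U, abs_nonneg v]
        have h4 : max (‖S (u - v)‖ - (1 + ε / 2)) 0 ≤ C * (1 + (|U| + 2 * |v|)) := by
          refine max_le ?_ (by positivity)
          have := (hC (u - v)).trans (mul_le_mul_of_nonneg_left (by linarith) hC0 :
            C * (1 + |u - v|) ≤ C * (1 + (|U| + 2 * |v|)))
          linarith
        calc _ ≤ C * (1 + (|U| + 2 * |v|)) * k v := by gcongr; exact hk0 v
          _ = _ := by ring
    · exact (h1.const_mul _).add (h2.const_mul _)
    · refine ae_of_all _ fun v => tendsto_const_nhds.congr' ?_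
      filter_upwards [eventually_ge_atTop (U + v)] with u hu
      rw [max_eq_right (by linarith [hU (u - v) (by linarith)]), zero_mul]
  filter_upwards [hexc.eventually (gt_mem_nhds (half_pos hε))] with u hu
  have hi := integrable_conv_linear_growth hS hC hk hk0 h1 h2 u
  have hi2 : Integrable fun v => max (‖S (u - v)‖ - (1 + ε / 2)) 0 * k v := by
    refine hi.norm.mono' (Measurable.aestronglyMeasurable (by fun_prop)) (ae_of_all _ fun v => ?_)
    rw [Real.norm_of_nonneg (mul_nonneg (le_max_right _ _) (hk0 v)), norm_mul, norm_real,
      Real.norm_of_nonneg (hk0 v)]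
    exact mul_le_mul_of_nonneg_right (max_le (by linarith) (norm_nonneg _)) (hk0 v)
  calc ‖∫ v, S (u - v) * (k v : ℂ)‖ ≤ ∫ v, ‖S (u - v) * (k v : ℂ)‖ :=
        norm_integral_le_integral_norm _
    _ ≤ ∫ v, ((1 + ε / 2) * k v + max (‖S (u - v)‖ - (1 + ε / 2)) 0 * k v) := by
        refine integral_mono hi.norm ((h1.const_mul _).add hi2) fun v => ?_
        simp only [norm_mul, norm_real, Real.norm_of_nonneg (hk0 v)]
        rw [← add_mul]
        exact mul_le_mul_of_nonneg_right (by linarith [le_max_left (‖S (u - v)‖ - (1 + ε / 2)) 0])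
          (hk0 v)
    _ = (1 + ε / 2) + ∫ v, max (‖S (u - v)‖ - (1 + ε / 2)) 0 * k v := by
        rw [integral_add (h1.const_mul _) hi2, integral_const_mul, hk1, mul_one]
    _ ≤ 1 + ε := by linarith

/-- Dilated kernels form an approximate identity. -/
lemma tendsto_conv_dilate (hS : Continuous S) (hC : ∀ u, ‖S u‖ ≤ C * (1 + |u|))
    (hk : Continuous k) (hk0 : ∀ v, 0 ≤ k v) (h1 : Integrable k)
    (h2 : Integrable fun v => |v| * k v) (hk1 : ∫ v, k v = 1) (u : ℝ) :
    Tendsto (fun T : ℝ => ∫ v, S (u - v) * ((T * k (T * v) : ℝ) : ℂ)) atTop (𝓝 (S u)) := by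
  have hC0 : 0 ≤ C := by simpa using (norm_nonneg _).trans (hC 0)
  have e1 : ∀ T : ℝ, 0 < T → ∫ v, S (u - v) * ((T * k (T * v) : ℝ) : ℂ)
      = ∫ v, S (u - v / T) * (k v : ℂ) := by
    intro T hT
    have := Measure.integral_comp_mul_left (fun v : ℝ => S (u - v / T) * (k v : ℂ)) T
    rw [abs_of_pos (inv_pos.2 hT), eq_inv_smul_iff₀ hT.ne', ← integral_smul] at this
    rw [← this]
    refine integral_congr_ae (ae_of_all _ fun v => ?_)
    simp only [real_smul]
    rw [mul_div_cancel_left₀ v hT.ne']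
    push_cast; ring
  have e2 : S u = ∫ v, S u * (k v : ℂ) := by
    rw [integral_const_mul, integral_complex_ofReal, hk1]; simp
  rw [e2]
  refine Tendsto.congr' (f₁ := fun T : ℝ => ∫ v, S (u - v / T) * (k v : ℂ)) ?_ ?_
  · filter_upwards [eventually_gt_atTop 0] with T hT using (e1 T hT).symm
  refine tendsto_integral_filter_of_dominated_convergence
    (fun v => C * (1 + |u|) * k v + C * (|v| * k v)) ?_ ?_ ?_ ?_
  · exact .of_forall fun T => Continuous.aestronglyMeasurable (by fun_prop)
  · filter_upwards [eventually_ge_atTop 1] with T hT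
    refine ae_of_all _ fun v => ?_
    rw [norm_mul, norm_real, Real.norm_of_nonneg (hk0 v)]
    have h3 : |u - v / T| ≤ |u| + |v| := by
      refine (abs_sub _ _).trans ?_
      rw [abs_div, abs_of_pos (by linarith : 0 < T)]
      gcongr
      exact div_le_self (abs_nonneg _) hT
    calc ‖S (u - v / T)‖ * k v ≤ C * (1 + (|u| + |v|)) * k v := by
          have := hk0 v
          gcongr
          exact (hC _).trans (by gcongr)
      _ = _ := by ring
  · exact (h1.const_mul _).add (h2.const_mul _)
  · refine ae_of_all _ fun v => ?_
    have : Tendsto (fun T : ℝ => u - v / T) atTop (𝓝 (u - 0)) :=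
      tendsto_const_nhds.sub (tendsto_const_nhds.div_atTop tendsto_id)
    rw [sub_zero] at this
    exact ((hS.tendsto u).comp this).mul_const _

end Smoothing

/-- If all band-limited averages of `S` are trigonometric polynomials, the bound at `+∞` is
global. -/
theorem norm_le_one_of_conv_trigPoly {S : ℝ → ℂ} {C : ℝ} (hS : Continuous S)
    (hC : ∀ u, ‖S u‖ ≤ C * (1 + |u|)) (hlim : LimsupNormLeOne S)
    {k : ℝ → ℝ} {ψ : ℝ → ℂ} (hk : IsBandlimitedKernel k ψ)
    (htrig : ∀ T : ℝ, 0 < T → ∃ (Γ : Finset ℝ) (c : ℝ → ℂ), ∀ u : ℝ,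
      ∫ v, S (u - v) * ((T * k (T * v) : ℝ) : ℂ) = ∑ γ ∈ Γ, c γ * cexp (I * γ * u)) (u : ℝ) :
    ‖S u‖ ≤ 1 := by
  refine le_of_tendsto (tendsto_conv_dilate hS hC hk.cont hk.nonneg hk.integrable
    hk.integrable_abs_mul hk.integral_eq_one u).norm ?_
  filter_upwards [eventually_gt_atTop 0] with T hT
  obtain ⟨Γ, c, h⟩ := htrig T hT
  obtain ⟨i1, i2, i3⟩ := hk.dilate_integrable hT
  have := limsupNormLeOne_conv hS.measurable hC hlim (k := fun v => T * k (T * v))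
    (continuous_const.mul (hk.cont.comp (continuous_const.mul continuous_id)))
    (fun v => mul_nonneg hT.le (hk.nonneg _)) i1 i2 i3
  simp only [h] at this ⊢
  exact norm_trigPoly_le_one Γ c this u
end

section
lemma tendsto_poisson {φ : ℝ → ℂ} (hφ : Continuous φ) (hc : HasCompactSupport φ) (γ : ℝ) :
    Tendsto (fun c : ℝ => ∫ t : ℝ, (1 / ((c + t * I : ℂ) - γ * I) - 1 / ((-c + t * I : ℂ) - γ * I))
        * φ t)
      (𝓝[>] 0) (𝓝 (2 * Real.pi * φ γ)) := by
  have e1 : ∀ c : ℝ, 0 < c →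
      ∫ t : ℝ, (1 / ((c + t * I : ℂ) - γ * I) - 1 / ((-c + t * I : ℂ) - γ * I)) * φ t
      = ∫ x : ℝ, (2 * (1 + x ^ 2)⁻¹ : ℝ) * φ (c * x + γ) := by
    intro c hc
    have := Measure.integral_comp_mul_left (fun x : ℝ =>
      (1 / ((c + x * I : ℂ)) - 1 / ((-c + x * I : ℂ))) * φ (x + γ)) c
    rw [abs_of_pos (inv_pos.2 hc), eq_inv_smul_iff₀ hc.ne', ← integral_smul] at this
    rw [← integral_add_right_eq_self (μ := volume) _ γ]
    have h2 : ∀ t : ℝ, (c + (t + γ : ℝ) * I : ℂ) - γ * I = c + t * I := fun t => by push_cast; ring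
    have h3 : ∀ t : ℝ, (-c + (t + γ : ℝ) * I : ℂ) - γ * I = -c + t * I := fun t => by
      push_cast; ring
    simp only [h2, h3]
    rw [← this]
    refine integral_congr_ae (ae_of_all _ fun x => ?_)
    simp only [real_smul]
    rw [← mul_assoc]
    congr 1
    have hx : (1 + x * I : ℂ) ≠ 0 := by simpa using ne_zero_of_line one_ne_zero x
    have hx' : (-1 + x * I : ℂ) ≠ 0 := by simpa using ne_zero_of_line (c := -1) (by norm_num) x
    have hc' : (c : ℂ) ≠ 0 := by exact_mod_cast hc.ne'
    have hx2 : (1 + x ^ 2 : ℂ) ≠ 0 := by exact_mod_cast (by positivity : (1 + x ^ 2 : ℝ) ≠ 0)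
    have e1 : (c + (c * x : ℝ) * I : ℂ) = c * (1 + x * I) := by push_cast; ring
    have e2 : (-c + (c * x : ℝ) * I : ℂ) = c * (-1 + x * I) := by push_cast; ring
    rw [e1, e2]
    push_cast
    field_simp
    linear_combination -(2 : ℂ) * (x:ℂ) ^ 2 * I_sq
  have e2 : (2 * Real.pi * φ γ : ℂ) = ∫ x : ℝ, (2 * (1 + x ^ 2)⁻¹ : ℝ) * φ γ := by
    rw [integral_mul_const, integral_complex_ofReal, integral_const_mul,
      integral_univ_inv_one_add_sq]
    push_cast; ring
  rw [e2]
  refine Tendsto.congr' (f₁ := fun c : ℝ => ∫ x : ℝ, (2 * (1 + x ^ 2)⁻¹ : ℝ) * φ (c * x + γ)) ?_ ?_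
  · filter_upwards [self_mem_nhdsWithin] with c hc using (e1 c hc).symm
  obtain ⟨B, hB⟩ := hc.exists_bound_of_continuous hφ
  have hinv : Continuous fun x : ℝ => (1 + x ^ 2)⁻¹ :=
    Continuous.inv₀ (by fun_prop) fun x => by positivity
  refine tendsto_integral_filter_of_dominated_convergence
    (fun x => 2 * B * (1 + x ^ 2)⁻¹) ?_ ?_ (integrable_inv_one_add_sq.const_mul _) ?_
  · exact .of_forall fun c => Continuous.aestronglyMeasurable (by fun_prop)
  · refine .of_forall fun c => ae_of_all _ fun x => ?_
    rw [norm_mul, norm_real, Real.norm_of_nonneg (by positivity)]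
    calc 2 * (1 + x ^ 2)⁻¹ * ‖φ (c * x + γ)‖ ≤ 2 * (1 + x ^ 2)⁻¹ * B := by gcongr; exact hB _
      _ = _ := by ring
  · refine ae_of_all _ fun x => ?_
    have : Tendsto (fun c : ℝ => c * x + γ) (𝓝[>] 0) (𝓝 (0 * x + γ)) :=
      (Continuous.tendsto (by fun_prop) 0).mono_left nhdsWithin_le_nhds
    rw [zero_mul, zero_add] at this
    exact ((hφ.tendsto γ).comp this).const_mul _

/-- A function with limits at all points of a segment of the imaginary axis has no jump. -/
lemma tendsto_no_jump {A : ℂ → ℂ} {φ : ℝ → ℂ} (hφ : Continuous φ) (hc : HasCompactSupport φ)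
    {c₀ : ℝ} (hc₀ : 0 < c₀)
    (hA : ∀ c : ℝ, c ≠ 0 → |c| < c₀ → Continuous fun t : ℝ => A (c + t * I))
    (hlim : ∀ t ∈ tsupport φ, ∃ l, Tendsto A (𝓝[≠] (t * I)) (𝓝 l)) :
    Tendsto (fun c : ℝ => ∫ t : ℝ, (A (c + t * I) - A (-c + t * I)) * φ t) (𝓝[>] 0) (𝓝 0) := by
  choose! l hl using hlim
  set K : Set ℂ := (fun t : ℝ => (t * I : ℂ)) '' tsupport φ
  have hK : IsCompact K := hc.isCompact.image (by fun_prop)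
  have hbd : ∃ ε > 0, ∃ M, ∀ c : ℝ, c ≠ 0 → |c| < ε → ∀ t ∈ tsupport φ,
      ‖A (c + t * I)‖ ≤ M := by
    have h1 : ∀ p ∈ K, {s : ℂ | s ≠ p → ‖A s‖ ≤ ‖l p.im‖ + 1} ∈ 𝓝 p := by
      rintro p ⟨t, ht, rfl⟩
      have := (hl t ht).norm.eventually (gt_mem_nhds (lt_add_one _))
      rw [eventually_nhdsWithin_iff] at this
      filter_upwards [this] with s hs hne
      simpa using (hs hne).le
    obtain ⟨P, hPK, hcov⟩ := hK.elim_nhds_subcover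
      (fun p : ℂ => interior {s : ℂ | s ≠ p → ‖A s‖ ≤ ‖l p.im‖ + 1})
      (fun p hp => interior_mem_nhds.2 (h1 p hp))
    obtain ⟨ε, hε, hsub⟩ := hK.exists_thickening_subset_open
      (isOpen_biUnion fun p _ => isOpen_interior) hcov
    refine ⟨ε, hε, ∑ p ∈ P, (‖l p.im‖ + 1), fun c hc hcε t ht => ?_⟩
    have hmem : (c + t * I : ℂ) ∈ Metric.thickening ε K := by
      refine Metric.mem_thickening_iff.2 ⟨t * I, ⟨t, ht, rfl⟩, ?_⟩
      rw [dist_eq_norm, add_sub_cancel_right, norm_real]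
      exact hcε
    obtain ⟨p, hp, hcp⟩ := Set.mem_iUnion₂.1 (hsub hmem)
    have hpe : (c + t * I : ℂ) ≠ p := by
      obtain ⟨x, -, rfl⟩ := hPK p hp
      intro h
      exact hc (by simpa using congrArg Complex.re h)
    exact (interior_subset hcp hpe).trans
      (Finset.single_le_sum (f := fun p : ℂ => ‖l p.im‖ + 1) (fun _ _ => by positivity) hp)
  obtain ⟨ε, hε, M, hM⟩ := hbd
  have h0 : (0 : ℂ) = ∫ t : ℝ, (0 : ℂ) * φ t := by simp
  rw [h0]
  refine tendsto_integral_filter_of_dominated_convergence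
    (fun t => 2 * M * ‖φ t‖) ?_ ?_ ((hφ.integrable_of_hasCompactSupport hc).norm.const_mul _) ?_
  · have : Set.Ioo 0 c₀ ∈ 𝓝[>] (0:ℝ) := Ioo_mem_nhdsGT hc₀
    filter_upwards [this] with c hc
    have h1 := hA c hc.1.ne' (by rw [abs_of_pos hc.1]; exact hc.2)
    have h2 := hA (-c) (by simpa using hc.1.ne') (by rw [abs_neg, abs_of_pos hc.1]; exact hc.2)
    push_cast at h2
    exact ((h1.sub h2).mul hφ).aestronglyMeasurable
  · filter_upwards [Ioo_mem_nhdsGT hε] with c hc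
    refine ae_of_all _ fun t => ?_
    rw [norm_mul]
    by_cases ht : φ t = 0
    · simp [ht]
    have ht' := subset_tsupport _ ht
    have h1 := hM c hc.1.ne' (by rw [abs_of_pos hc.1]; exact hc.2) t ht'
    have h2 := hM (-c) (by simpa using hc.1.ne') (by rw [abs_neg, abs_of_pos hc.1]; exact hc.2) t
        ht'
    push_cast at h2
    gcongr
    exact (norm_sub_le _ _).trans (by linarith)
  · refine ae_of_all _ fun t => ?_
    by_cases ht : φ t = 0
    · simp [ht]
    have ht' := hl t (subset_tsupport _ ht)
    have hne : ∀ c : ℝ, c ≠ 0 → (c + t * I : ℂ) ≠ t * I := fun c hc h => hc (by simpa using h)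
    have h1 : Tendsto (fun c : ℝ => (c + t * I : ℂ)) (𝓝[>] 0) (𝓝[≠] (t * I)) := by
      refine tendsto_nhdsWithin_iff.2 ⟨?_, ?_⟩
      · have : Tendsto (fun c : ℝ => (c + t * I : ℂ)) (𝓝 0) (𝓝 ((0:ℝ) + t * I)) :=
          Continuous.tendsto (by fun_prop) 0
        simpa using this.mono_left nhdsWithin_le_nhds
      · filter_upwards [self_mem_nhdsWithin] with c hc using hne c (ne_of_gt hc)
    have h2 : Tendsto (fun c : ℝ => (-c + t * I : ℂ)) (𝓝[>] 0) (𝓝[≠] (t * I)) := by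
      refine tendsto_nhdsWithin_iff.2 ⟨?_, ?_⟩
      · have : Tendsto (fun c : ℝ => (-c + t * I : ℂ)) (𝓝 0) (𝓝 (-(0:ℝ) + t * I)) :=
          Continuous.tendsto (by fun_prop) 0
        simpa using this.mono_left nhdsWithin_le_nhds
      · filter_upwards [self_mem_nhdsWithin] with c hc
        simpa using hne (-c) (by simpa using (ne_of_gt hc))
    simpa using ((ht'.comp h1).sub (ht'.comp h2)).mul_const (φ t)
end

section
lemma tendsto_inv_sub_pole {W : ℂ → ℂ} {p : ℂ} (hW : AnalyticAt ℂ W p) (h0 : W p = 0)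
    (h1 : deriv W p ≠ 0) :
    ∃ l, Tendsto (fun s => 1 / W s - (deriv W p)⁻¹ / (s - p)) (𝓝[≠] p) (𝓝 l) := by
  set g := dslope W p with hg
  have hga : AnalyticAt ℂ g p := by
    obtain ⟨q, hq⟩ := hW
    exact ⟨_, hq.has_fpower_series_dslope_fslope⟩
  have hgp : g p = deriv W p := dslope_same W p
  have hWg : ∀ s, W s = (s - p) * g s := by
    intro s
    have := sub_smul_dslope W p s
    rw [h0, sub_zero, smul_eq_mul] at this
    exact this.symm
  have hcont : ContinuousAt (dslope g p) p := continuousAt_dslope_same.2 hga.differentiableAt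
  refine ⟨-(dslope g p p) / (g p * g p), ?_⟩
  have hlim : Tendsto (fun s => -(dslope g p s) / (g s * g p)) (𝓝[≠] p)
      (𝓝 (-(dslope g p p) / (g p * g p))) :=
    Tendsto.mono_left ((hcont.neg.div₀ (hga.continuousAt.mul continuousAt_const)
      (by simpa [hg] using h1)).tendsto) nhdsWithin_le_nhds
  refine hlim.congr' ?_
  have hne : ∀ᶠ s in 𝓝[≠] p, g s ≠ 0 :=
    (hga.continuousAt.eventually_ne (by rwa [hgp])).filter_mono nhdsWithin_le_nhds
  filter_upwards [hne, self_mem_nhdsWithin] with s hs hsp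
  have hsp' : s - p ≠ 0 := sub_ne_zero.2 hsp
  have hgp0 : g p ≠ 0 := by rwa [hgp]
  have hd : (s - p) * dslope g p s = g s - g p := sub_smul_dslope g p s
  rw [hWg s, ← hgp]
  field_simp
  linear_combination -hd

lemma deriv_ne_zero_of_inv_le {W : ℂ → ℂ} {p : ℂ} (hW : DifferentiableAt ℂ W p) {C : ℝ}
    (hb : ∀ᶠ c : ℝ in 𝓝[>] 0, W (c + p) ≠ 0 ∧ ‖1 / W (c + p)‖ ≤ C / c) (h0 : W p = 0) :
    deriv W p ≠ 0 := by
  intro h1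
  have h := hW.hasDerivAt
  rw [h1, hasDerivAt_iff_tendsto_slope_zero] at h
  have h2 : Tendsto (fun c : ℝ => (c : ℂ)) (𝓝[>] 0) (𝓝[≠] 0) := by
    refine tendsto_nhdsWithin_iff.2 ⟨?_, ?_⟩
    · exact (continuous_ofReal.tendsto' 0 0 (by simp)).mono_left nhdsWithin_le_nhds
    · filter_upwards [self_mem_nhdsWithin] with c hc
      simpa using ne_of_gt hc
  have h3 := (h.comp h2).norm
  have hC : ‖(0 : ℂ)‖ < (|C| + 1)⁻¹ := by rw [norm_zero]; positivity
  have h4 := h3.eventually (gt_mem_nhds hC)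
  obtain ⟨c, ⟨hc1, hc2⟩, hc3, hc4⟩ := ((hb.and h4).and self_mem_nhdsWithin).exists.imp
    (fun c h => (⟨h.1.1, h.1.2, h.2⟩ : (_ ∧ _) ∧ _ ∧ _))
  have hc4 : 0 < c := hc4
  simp only [Function.comp, h0, sub_zero, norm_smul, norm_inv, norm_real,
    Real.norm_of_nonneg hc4.le] at hc3
  rw [add_comm] at hc3
  have hpos : 0 < ‖W (c + p)‖ := norm_pos_iff.2 hc1
  rw [norm_div, norm_one, div_le_div_iff₀ hpos hc4, one_mul] at hc2
  rw [inv_mul_lt_iff₀ hc4, ← div_eq_mul_inv, lt_div_iff₀ (by positivity)] at hc3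
  nlinarith [le_abs_self C]

/-- Jump of `1 / W` across the imaginary axis. -/
lemma exists_jump {W : ℂ → ℂ} {c₀ : ℝ} (hc₀ : 0 < c₀)
    (hW : ∀ s : ℂ, |s.re| < c₀ → AnalyticAt ℂ W s)
    (hW0 : ∀ s : ℂ, s.re ≠ 0 → |s.re| < c₀ → W s ≠ 0)
    (hb : ∀ t : ℝ, ∃ C, ∀ c : ℝ, 0 < c → c < c₀ → ‖1 / W (c + t * I)‖ ≤ C / c) (R : ℝ) :
    ∃ (Γ : Finset ℝ) (b : ℝ → ℂ), ∀ φ : ℝ → ℂ, Continuous φ → HasCompactSupport φ →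
      tsupport φ ⊆ Set.Icc (-R) R →
      Tendsto (fun c : ℝ => ∫ t : ℝ, (1 / W (c + t * I) - 1 / W (-c + t * I)) * φ t) (𝓝[>] 0)
        (𝓝 (∑ γ ∈ Γ, 2 * Real.pi * b γ * φ γ)) := by
  have han : ∀ t : ℝ, AnalyticAt ℂ W (t * I) := fun t => hW _ (by simpa using hc₀)
  have hsimple : ∀ t : ℝ, W (t * I) = 0 → deriv W (t * I) ≠ 0 := by
    intro t ht
    obtain ⟨C, hC⟩ := hb t
    refine deriv_ne_zero_of_inv_le (C := C) (han t).differentiableAt ?_ ht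
    filter_upwards [Ioo_mem_nhdsGT hc₀] with c hc
    exact ⟨hW0 _ (by simpa using hc.1.ne') (by simpa [abs_of_pos hc.1] using hc.2),
      hC c hc.1 hc.2⟩
  have hiso : ∀ t : ℝ, ∀ᶠ x : ℝ in 𝓝[≠] t, W (x * I) ≠ 0 := by
    intro t
    have h2 : Tendsto (fun x : ℝ => (x * I : ℂ)) (𝓝[≠] t) (𝓝[≠] (t * I)) := by
      refine tendsto_nhdsWithin_iff.2 ⟨?_, ?_⟩
      · exact (Continuous.tendsto (by fun_prop) t).mono_left nhdsWithin_le_nhds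
      · filter_upwards [self_mem_nhdsWithin] with x hx
        simpa using hx
    refine h2.eventually (p := fun s => W s ≠ 0) ?_
    by_cases h0 : W (t * I) = 0
    · exact (han t).differentiableAt.hasDerivAt.eventually_ne (hsimple t h0)
    · exact ((han t).continuousAt.eventually_ne h0).filter_mono nhdsWithin_le_nhds
  have hfin : {t : ℝ | t ∈ Set.Icc (-R) R ∧ W (t * I) = 0}.Finite := by
    by_contra hinf
    obtain ⟨t, -, ht⟩ := Set.Infinite.exists_accPt_of_subset_isCompact hinf
      (isCompact_Icc (a := -R) (b := R)) (fun x hx => hx.1)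
    rw [accPt_iff_frequently_nhdsNE] at ht
    exact ht ((hiso t).mono fun x hx h => hx h.2)
  set Γ := hfin.toFinset
  set b : ℝ → ℂ := fun γ => (deriv W (γ * I))⁻¹
  refine ⟨Γ, b, fun φ hφ hc hsupp => ?_⟩
  set A : ℂ → ℂ := fun s => 1 / W s - ∑ γ ∈ Γ, b γ / (s - γ * I)
  have hlineW : ∀ c : ℝ, c ≠ 0 → |c| < c₀ → Continuous fun t : ℝ => 1 / W (c + t * I) := by
    intro c hc hcc
    refine Continuous.div₀ continuous_const ?_ fun t => hW0 _ (by simpa) (by simpa)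
    rw [continuous_iff_continuousAt]
    intro t
    exact ContinuousAt.comp (f := fun t : ℝ => (c + t * I : ℂ)) (g := W)
      (hW _ (by simpa)).continuousAt (by fun_prop)
  have hlineP : ∀ γ c : ℝ, c ≠ 0 → Continuous fun t : ℝ => b γ / ((c + t * I : ℂ) - γ * I) := by
    intro γ c hc
    refine Continuous.div₀ continuous_const (by fun_prop) fun t h => hc ?_
    simpa using congrArg Complex.re h
  have hA := tendsto_no_jump (A := A) hφ hc hc₀ (fun c h1 h2 =>
      (hlineW c h1 h2).sub (continuous_finsetSum _ fun γ _ => hlineP γ c h1)) (by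
    intro t ht
    have hP : ∀ γ : ℝ, γ ≠ t → ∃ l, Tendsto (fun s : ℂ => b γ / (s - γ * I)) (𝓝[≠] (t * I)) (𝓝 l)
        := by
      intro γ hγ
      refine ⟨b γ / (t * I - γ * I), ?_⟩
      refine Tendsto.mono_left (ContinuousAt.tendsto ?_) nhdsWithin_le_nhds
      refine ContinuousAt.div₀ continuousAt_const (by fun_prop) ?_
      rw [← sub_mul]
      exact mul_ne_zero (by exact_mod_cast sub_ne_zero.2 hγ.symm) I_ne_zero
    choose! l hl using hP
    by_cases htΓ : t ∈ Γ
    · have h0 : W (t * I) = 0 := (hfin.mem_toFinset.1 htΓ).2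
      obtain ⟨l', hl'⟩ := tendsto_inv_sub_pole (han t) h0 (hsimple t h0)
      refine ⟨l' - ∑ γ ∈ Γ.erase t, l γ, ?_⟩
      refine (hl'.sub (tendsto_finsetSum _ fun γ hγ => hl γ (Finset.ne_of_mem_erase hγ))).congr ?_
      intro s
      simp only [A]
      rw [← Finset.add_sum_erase _ _ htΓ]
      simp only [b]
      ring
    · have h0 : W (t * I) ≠ 0 := fun h => htΓ (hfin.mem_toFinset.2 ⟨hsupp ht, h⟩)
      refine ⟨1 / W (t * I) - ∑ γ ∈ Γ, l γ, Tendsto.sub ?_ (tendsto_finsetSum _ fun γ hγ =>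
        hl γ (fun h => htΓ (h ▸ hγ)))⟩
      exact ((continuousAt_const.div₀ (han t).continuousAt h0).tendsto).mono_left
          nhdsWithin_le_nhds)
  have hsum := hA.add (tendsto_finsetSum Γ fun γ _ =>
    (tendsto_poisson hφ hc γ).const_mul (b γ))
  have e : (0 + ∑ γ ∈ Γ, b γ * (2 * Real.pi * φ γ) : ℂ) = ∑ γ ∈ Γ, 2 * Real.pi * b γ * φ γ := by
    rw [zero_add]
    exact Finset.sum_congr rfl fun γ _ => by ring
  rw [e] at hsum
  refine hsum.congr' ?_
  filter_upwards [Ioo_mem_nhdsGT hc₀] with c hcc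
  have hint : ∀ f : ℝ → ℂ, Continuous f → Integrable fun t => f t * φ t := fun f hf =>
    (hf.mul hφ).integrable_of_hasCompactSupport hc.mul_left
  have hcn : -c ≠ 0 := by simpa using hcc.1.ne'
  have hcm : |-c| < c₀ := by rw [abs_neg, abs_of_pos hcc.1]; exact hcc.2
  have hcp : |c| < c₀ := by rw [abs_of_pos hcc.1]; exact hcc.2
  have hP1 : ∀ γ : ℝ, Continuous fun t : ℝ => b γ * (1 / ((c + t * I : ℂ) - γ * I) -
      1 / ((-c + t * I : ℂ) - γ * I)) := by
    intro γ
    have h1 := hlineP γ c hcc.1.ne'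
    have h2 := hlineP γ (-c) hcn
    push_cast at h2
    refine (h1.sub h2).congr fun t => ?_
    simp only [Pi.sub_apply]
    ring
  have hA1 : Continuous fun t : ℝ => A (c + t * I) - A (-c + t * I) := by
    have h1 := (hlineW c hcc.1.ne' hcp).sub (continuous_finsetSum Γ fun γ _ => hlineP γ c hcc.1.ne')
    have h2 := (hlineW (-c) hcn hcm).sub (continuous_finsetSum Γ fun γ _ => hlineP γ (-c) hcn)
    push_cast at h2
    exact h1.sub h2
  have e3 : ∀ γ : ℝ, b γ * ∫ t : ℝ, (1 / ((c + t * I : ℂ) - γ * I) -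
      1 / ((-c + t * I : ℂ) - γ * I)) * φ t = ∫ t : ℝ, b γ * (1 / ((c + t * I : ℂ) - γ * I) -
      1 / ((-c + t * I : ℂ) - γ * I)) * φ t := by
    intro γ
    rw [← integral_const_mul]
    simp only [mul_assoc]
  simp only [e3]
  rw [← integral_finsetSum _ fun γ _ => hint _ (hP1 γ), ← integral_add (hint _ hA1)
    (integrable_finsetSum _ fun γ _ => hint _ (hP1 γ))]
  refine integral_congr_ae (ae_of_all _ fun t => ?_)
  simp only [A]
  rw [← Finset.sum_mul, ← add_mul]
  congr 1
  rw [show (∑ γ ∈ Γ, b γ * (1 / ((c + t * I : ℂ) - γ * I) - 1 / ((-c + t * I : ℂ) - γ * I)))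
    = ∑ γ ∈ Γ, b γ / ((c + t * I : ℂ) - γ * I) - ∑ γ ∈ Γ, b γ / ((-c + t * I : ℂ) - γ * I) from by
      rw [← Finset.sum_sub_distrib]; exact Finset.sum_congr rfl fun γ _ => by ring]
  ring
end

section
/-- The inverse Laplace-type integral of `Q` along the line of abscissa `c`. -/
def lineTransform (Q : ℂ → ℂ) (c u : ℝ) : ℂ := lineIntegral (fun s => Q s * cexp (s * u)) c

section LineTransform

variable {Q : ℂ → ℂ} {c C : ℝ}

lemma norm_cexp_line_mul (c t u : ℝ) : ‖cexp ((c + t * I) * u)‖ = Real.exp (c * u) := by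
  rw [Complex.norm_exp]; congr 1; simp

lemma lineTransform_eq (Q : ℂ → ℂ) (c u : ℝ) :
    lineTransform Q c u = cexp (c * u) * ∫ t : ℝ, Q (c + t * I) * cexp (I * t * u) := by
  rw [lineTransform, lineIntegral, ← integral_const_mul]
  refine integral_congr_ae (ae_of_all _ fun t => ?_)
  simp only
  rw [mul_left_comm, ← Complex.exp_add]
  congr 2; ring

lemma norm_cexp_I_mul (t u : ℝ) : ‖cexp (I * t * u)‖ = 1 := by
  rw [Complex.norm_exp]; simp

lemma norm_lineTransform_le (hb : ∀ t : ℝ, ‖Q (c + t * I)‖ ≤ C / (1 + t ^ 2)) (u : ℝ) :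
    ‖lineTransform Q c u‖ ≤ C * Real.pi * Real.exp (c * u) := by
  have := norm_lineIntegral_le (f := fun s => Q s * cexp (s * u)) (c := c)
    (C := C * Real.exp (c * u)) (fun t => by
      rw [norm_mul, norm_cexp_line_mul, mul_div_right_comm]
      gcongr
      exact hb t)
  exact this.trans_eq (by ring)

lemma continuous_lineTransform (hQ : Continuous fun t : ℝ => Q (c + t * I))
    (hb : ∀ t : ℝ, ‖Q (c + t * I)‖ ≤ C / (1 + t ^ 2)) : Continuous (lineTransform Q c) := by
  have : Continuous fun u : ℝ => ∫ t : ℝ, Q (c + t * I) * cexp (I * t * u) := by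
    refine continuous_of_dominated (bound := fun t => C / (1 + t ^ 2))
      (fun u => (hQ.mul (by fun_prop)).aestronglyMeasurable) (fun u => ae_of_all _ fun t => ?_)
      (integrable_inv_one_add_sq_mul C) (ae_of_all _ fun t => by fun_prop)
    rw [norm_mul, norm_cexp_I_mul, mul_one]
    exact hb t
  rw [show lineTransform Q c = _ from funext (lineTransform_eq Q c)]
  fun_prop

lemma integral_lineTransform_mul (hQ : Continuous fun t : ℝ => Q (c + t * I))
    (hb : ∀ t : ℝ, ‖Q (c + t * I)‖ ≤ C / (1 + t ^ 2)) {k : ℝ → ℝ} {ψ : ℝ → ℂ} (hk : Integrable k)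
    (hψ : ∀ ω : ℝ, ∫ v : ℝ, (k v : ℂ) * cexp (-(I * ω * v)) = ψ ω) (u : ℝ) :
    ∫ v : ℝ, lineTransform Q c (u - v) * cexp (-(c * (u - v))) * (k v : ℂ)
      = ∫ t : ℝ, Q (c + t * I) * (cexp (I * t * u) * ψ t) := by
  have hQi : Integrable fun t : ℝ => Q (c + t * I) :=
    (integrable_inv_one_add_sq_mul C).mono' hQ.aestronglyMeasurable (ae_of_all _ hb)
  have hprod : Integrable (fun p : ℝ × ℝ =>
      (k p.1 : ℂ) * Q (c + p.2 * I) * cexp (I * p.2 * (u - p.1 : ℝ))) (volume.prod volume) := by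
    refine ((hk.ofReal (𝕜 := ℂ)).mul_prod hQi).mul_bdd (c := 1)
      (Continuous.aestronglyMeasurable (by fun_prop)) (ae_of_all _ fun p => ?_)
    exact (norm_cexp_I_mul _ _).le
  calc _ = ∫ v : ℝ, ∫ t : ℝ, (k v : ℂ) * Q (c + t * I) * cexp (I * t * (u - v : ℝ)) := by
        refine integral_congr_ae (ae_of_all _ fun v => ?_)
        simp only
        rw [lineTransform_eq, ← integral_const_mul, ← integral_mul_const, ← integral_mul_const]
        refine integral_congr_ae (ae_of_all _ fun t => ?_)
        simp only
        have : cexp (c * (u - v : ℝ)) * cexp (-(c * (u - v))) = 1 := by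
          rw [← Complex.exp_add]; simp
        linear_combination (Q (c + t * I) * cexp (I * t * (u - v : ℝ)) * (k v : ℂ)) * this
    _ = ∫ t : ℝ, ∫ v : ℝ, (k v : ℂ) * Q (c + t * I) * cexp (I * t * (u - v : ℝ)) :=
        integral_integral_swap hprod
    _ = _ := by
        refine integral_congr_ae (ae_of_all _ fun t => ?_)
        simp only
        rw [← hψ t, ← integral_const_mul, ← integral_const_mul]
        refine integral_congr_ae (ae_of_all _ fun v => ?_)
        simp only
        have : cexp (I * t * (u - v : ℝ)) = cexp (I * t * u) * cexp (-(I * t * v)) := by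
          rw [← Complex.exp_add]; congr 1; push_cast; ring
        rw [this]; ring

end LineTransform

/-- The heat kernel at time `δ`. -/
def heatKernel (δ x : ℝ) : ℝ := (Real.sqrt (4 * Real.pi * δ))⁻¹ * Real.exp (-(x ^ 2 / (4 * δ)))

lemma lineIntegral_cexp_sq {δ : ℝ} (hδ : 0 < δ) (c x : ℝ) :
    lineIntegral (fun s => cexp (δ * s ^ 2 + s * x)) c = 2 * Real.pi * heatKernel δ x := by
  have h := integral_cexp_quadratic (b := -(δ : ℂ)) (by simpa using hδ) (I * (2 * δ * c + x))
    (δ * c ^ 2 + c * x)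
  have hδ' : (δ : ℂ) ≠ 0 := by exact_mod_cast hδ.ne'
  rw [lineIntegral]
  have e : ∀ t : ℝ, cexp (δ * (c + t * I) ^ 2 + (c + t * I) * x) =
      cexp (-(δ:ℂ) * t ^ 2 + I * (2 * δ * c + x) * t + (δ * c ^ 2 + c * x)) := by
    intro t
    congr 1
    linear_combination (δ * (t:ℂ) ^ 2) * I_sq
  simp only [e]
  rw [h, heatKernel]
  have e1 : (δ * c ^ 2 + c * x - (I * (2 * δ * c + x)) ^ 2 / (4 * -(δ:ℂ)))
      = ((-(x ^ 2 / (4 * δ)) : ℝ) : ℂ) := by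
    push_cast
    field_simp
    linear_combination (2 * δ * c + x : ℂ) ^ 2 * I_sq
  have e2 : (Real.pi / - -(δ : ℂ)) ^ (1 / 2 : ℂ) = ((Real.sqrt (Real.pi / δ) : ℝ) : ℂ) := by
    rw [neg_neg, Real.sqrt_eq_rpow, ofReal_cpow (by positivity)]
    push_cast; ring_nf
  rw [e1, e2, ← ofReal_exp]
  have e3 : Real.sqrt (Real.pi / δ) = 2 * Real.pi * (Real.sqrt (4 * Real.pi * δ))⁻¹ := by
    rw [Real.sqrt_eq_iff_mul_self_eq (by positivity) (by positivity)]
    have := Real.mul_self_sqrt (show 0 ≤ 4 * Real.pi * δ by positivity)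
    rw [mul_mul_mul_comm, ← mul_inv, this]
    field_simp
    ring
  rw [e3]; push_cast; ring

lemma heatKernel_props {δ : ℝ} (hδ : 0 < δ) : Continuous (heatKernel δ) ∧
    (∀ x, 0 ≤ heatKernel δ x) ∧
    Integrable (heatKernel δ) ∧ (Integrable fun x => |x| * heatKernel δ x) ∧
    ∫ x, heatKernel δ x = 1 := by
  have hb : 0 < (4 * δ)⁻¹ := by positivity
  have e : ∀ x, heatKernel δ x = (Real.sqrt (4 * Real.pi * δ))⁻¹ *
      Real.exp (-(4 * δ)⁻¹ * x ^ 2) := by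
    intro x; rw [heatKernel]; congr 2; field_simp
  have hcont : Continuous (heatKernel δ) := by unfold heatKernel; fun_prop
  refine ⟨hcont, fun x => by unfold heatKernel; positivity, ?_, ?_, ?_⟩
  · simp only [funext e]
    exact (integrable_exp_neg_mul_sq hb).const_mul _
  · have := ((integrable_mul_exp_neg_mul_sq hb).norm).const_mul (Real.sqrt (4 * Real.pi * δ))⁻¹
    refine this.congr (ae_of_all _ fun x => ?_)
    simp only [norm_mul, Real.norm_eq_abs, abs_of_pos (Real.exp_pos _)]
    rw [e]; ring
  · simp only [e]
    rw [integral_const_mul, integral_gaussian, div_inv_eq_mul, inv_mul_eq_one₀ (by positivity)]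
    congr 1; ring

lemma lineTransform_laplace {F : ℝ → ℂ} {N : ℂ → ℂ} {B c δ : ℝ} (hδ : 0 < δ) (hc : 0 < c)
    (hF : Measurable F) (hB : ∀ y, ‖F y‖ ≤ B) (hF0 : ∀ y < 0, F y = 0)
    (hN : ∀ t : ℝ, ∫ y, F y * cexp (-((c + t * I) * y)) = N (c + t * I)) (u : ℝ) :
    lineTransform (fun s => N s * cexp (δ * s ^ 2)) c u
      = 2 * Real.pi * ∫ v, F (u - v) * (heatKernel δ v : ℂ) := by
  have hFi : Integrable fun y => F y * cexp (-(c * y)) := by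
    have h1 : Integrable ((Set.Ioi (0:ℝ)).indicator fun y : ℝ => B * Real.exp (-c * y)) :=
      (integrable_indicator_iff measurableSet_Ioi).2
        ((exp_neg_integrableOn_Ioi 0 hc).const_mul B)
    refine h1.mono' (Measurable.aestronglyMeasurable (by fun_prop)) ?_
    have h0 : ∀ᵐ y : ℝ, y ≠ 0 := by
      simp [ae_iff]
    filter_upwards [h0] with y hy
    rcases lt_or_gt_of_ne hy with hy | hy
    · rw [hF0 y hy, zero_mul, norm_zero, Set.indicator_of_notMem (by simpa using hy.le)]
    · rw [Set.indicator_of_mem (by simpa using hy), norm_mul, Complex.norm_exp]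
      have : (-((c:ℂ) * y)).re = -c * y := by simp
      rw [this]; gcongr; exact hB y
  have hg : Integrable fun t : ℝ => cexp (δ * (c + t * I) ^ 2) := by
    have := integrable_cexp_quadratic' (b := -(δ:ℂ)) (by simpa using hδ) (I * (2 * δ * c))
      (δ * c ^ 2)
    refine this.congr (ae_of_all _ fun t => ?_)
    simp only
    congr 1
    linear_combination -(δ * (t:ℂ) ^ 2) * I_sq
  have hprod : Integrable (fun p : ℝ × ℝ =>
      cexp (δ * (c + p.1 * I) ^ 2) * (F p.2 * cexp (-(c * p.2))) *
        (cexp (c * u) * cexp (I * p.1 * (u - p.2 : ℝ)))) (volume.prod volume) := by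
    refine (hg.mul_prod hFi).mul_bdd (c := Real.exp (c * u))
      (Continuous.aestronglyMeasurable (by fun_prop)) (ae_of_all _ fun p => ?_)
    rw [norm_mul, norm_cexp_I_mul, Complex.norm_exp]
    simp
  have key : ∀ t y : ℝ, cexp (δ * (c + t * I) ^ 2) * (F y * cexp (-(c * y))) *
        (cexp (c * u) * cexp (I * t * (u - y : ℝ))) =
      F y * cexp (δ * (c + t * I) ^ 2 + (c + t * I) * (u - y : ℝ)) := by
    intro t y
    rw [show (δ * (c + t * I) ^ 2 + (c + t * I) * (u - y : ℝ) : ℂ) = δ * (c + t * I) ^ 2 +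
        -(c * y) +
      (c * u) + I * t * (u - y : ℝ) by push_cast; ring, Complex.exp_add, Complex.exp_add,
      Complex.exp_add]
    ring
  have hsw := integral_integral_swap (f := fun t y : ℝ =>
    cexp (δ * (c + t * I) ^ 2) * (F y * cexp (-(c * y))) *
      (cexp (c * u) * cexp (I * t * (u - y : ℝ)))) hprod
  simp only [key] at hsw
  calc _ = ∫ t : ℝ, ∫ y : ℝ, F y * cexp (δ * (c + t * I) ^ 2 + (c + t * I) * (u - y : ℝ)) := by
        rw [lineTransform, lineIntegral]
        refine integral_congr_ae (ae_of_all _ fun t => ?_)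
        simp only
        rw [← hN t, ← integral_mul_const, ← integral_mul_const]
        refine integral_congr_ae (ae_of_all _ fun y => ?_)
        simp only
        rw [mul_assoc, mul_assoc, ← Complex.exp_add, ← Complex.exp_add]
        congr 2; push_cast; ring
    _ = _ := hsw
    _ = ∫ y : ℝ, F y * (2 * Real.pi * heatKernel δ (u - y)) := by
        refine integral_congr_ae (ae_of_all _ fun y => ?_)
        simp only
        rw [integral_const_mul]
        congr 1
        exact lineIntegral_cexp_sq hδ c (u - y)
    _ = ∫ y : ℝ, F (u - y) * (2 * Real.pi * heatKernel δ (u - (u - y))) :=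
        (integral_sub_left_eq_self (fun y => F y * (2 * Real.pi * heatKernel δ (u - y) : ℂ)) volume
            u).symm
    _ = _ := by
        rw [← integral_const_mul]
        refine integral_congr_ae (ae_of_all _ fun y => ?_)
        simp only [sub_sub_cancel]
        ring
end

section
/-- A bounded function `F` on the half-line whose Laplace transform is `1 / W`, where `W` is
analytic across the imaginary axis and has all its zeros there. -/
structure InghamData (F : ℝ → ℂ) (W : ℂ → ℂ) (B C : ℝ) (m : ℕ) : Prop where
  meas : Measurable F
  bound : ∀ y, ‖F y‖ ≤ B
  zero : ∀ y < 0, F y = 0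
  limsup : LimsupNormLeOne F
  analytic : ∀ s : ℂ, |s.re| < 1 / 2 → AnalyticAt ℂ W s
  ne_zero : ∀ s : ℂ, s.re ≠ 0 → |s.re| < 1 / 2 → W s ≠ 0
  laplace : ∀ s : ℂ, 0 < s.re → s.re < 1 / 2 → ∫ y : ℝ, F y * cexp (-(s * y)) = 1 / W s
  left : ∀ s : ℂ, -(1 / 4) ≤ s.re → s.re < 0 → ‖1 / W s‖ ≤ C * (1 + |s.im|) ^ m / |s.re|

lemma norm_laplace_le {F : ℝ → ℂ} {B : ℝ} (hB : ∀ y, ‖F y‖ ≤ B)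
    (hF0 : ∀ y < 0, F y = 0) {s : ℂ} (hs : 0 < s.re) :
    ‖∫ y : ℝ, F y * cexp (-(s * y))‖ ≤ B / s.re := by
  have h1 : Integrable ((Set.Ioi (0:ℝ)).indicator fun y : ℝ => B * Real.exp (-s.re * y)) :=
    (integrable_indicator_iff measurableSet_Ioi).2 ((exp_neg_integrableOn_Ioi 0 hs).const_mul B)
  refine (norm_integral_le_of_norm_le h1 ?_).trans_eq ?_
  · have h0 : ∀ᵐ y : ℝ, y ≠ 0 := by simp [ae_iff]
    filter_upwards [h0] with y hy
    rcases lt_or_gt_of_ne hy with hy | hy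
    · rw [hF0 y hy, zero_mul, norm_zero, Set.indicator_of_notMem (by simpa using hy.le)]
    · rw [Set.indicator_of_mem (by simpa using hy), norm_mul, Complex.norm_exp]
      have : (-(s * y)).re = -s.re * y := by simp
      rw [this]; gcongr; exact hB y
  · rw [integral_indicator measurableSet_Ioi, integral_const_mul]
    have := integral_exp_mul_Ioi (a := -s.re) (by linarith) 0
    rw [this]
    simp [div_eq_mul_inv]

lemma linear_growth_of_exp_bounds {x C y : ℝ} (hC : 0 ≤ C) 
    (h : ∀ c, 0 < c → c ≤ 1 / 4 → x ≤ C / c * Real.exp (c * y)) {c : ℝ} (hc : 0 ≤ c)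
    (hc4 : c ≤ 1 / 4) : x * Real.exp (-(c * y)) ≤ 12 * C * (1 + |y|) := by
  rcases le_total y 0 with hy | hy
  · have h1 := h (1 / 4) (by norm_num) le_rfl
    calc x * Real.exp (-(c * y)) ≤ C / (1 / 4) * Real.exp (1 / 4 * y) * Real.exp (-(c * y)) := by
          gcongr
      _ = 4 * C * Real.exp ((1 / 4 - c) * y) := by
          rw [mul_assoc, ← Real.exp_add]; ring_nf
      _ ≤ 4 * C * 1 := by
          gcongr
          exact Real.exp_le_one_iff.2 (mul_nonpos_of_nonneg_of_nonpos (by linarith) hy)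
      _ ≤ 12 * C * (1 + |y|) := by nlinarith [abs_nonneg y, mul_nonneg hC (abs_nonneg y)]
  · have hpos : 0 < 4 + y := by linarith
    have h1 := h (1 / (4 + y)) (by positivity) (by
      rw [div_le_div_iff₀ hpos (by norm_num)]; linarith)
    have h2 : Real.exp (1 / (4 + y) * y) ≤ 3 := by
      refine (Real.exp_le_exp.2 (?_ : 1 / (4 + y) * y ≤ 1)).trans
        (Real.exp_one_lt_d9.le.trans (by norm_num))
      rw [one_div, inv_mul_le_iff₀ hpos]; linarith
    have h3 : Real.exp (-(c * y)) ≤ 1 := Real.exp_le_one_iff.2 (by nlinarith)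
    have hx : x ≤ C * (4 + y) * 3 := by
      refine h1.trans ?_
      rw [div_div_eq_mul_div, div_one]
      gcongr
    rw [abs_of_nonneg hy]
    calc x * Real.exp (-(c * y)) ≤ C * (4 + y) * 3 * Real.exp (-(c * y)) := by gcongr
      _ ≤ C * (4 + y) * 3 * 1 := by gcongr
      _ ≤ _ := by nlinarith [mul_nonneg hC hy]

namespace InghamData

variable {F : ℝ → ℂ} {W : ℂ → ℂ} {B C : ℝ} {m : ℕ}

/-- The Gaussian-regularized inverse of `W`. -/
def reg (W : ℂ → ℂ) (δ : ℝ) (s : ℂ) : ℂ := 1 / W s * cexp (δ * s ^ 2)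

/-- The contribution of the singularities to the left of the imaginary axis. -/
def leftPart (W : ℂ → ℂ) (δ u : ℝ) : ℂ :=
  (2 * Real.pi : ℂ)⁻¹ * lineTransform (reg W δ) (-(1 / 4)) u

/-- The contribution of the singularities on the imaginary axis. -/
def axisPart (F : ℝ → ℂ) (W : ℂ → ℂ) (δ u : ℝ) : ℂ :=
  (∫ v, F (u - v) * (heatKernel δ v : ℂ)) - leftPart W δ u

lemma bound_nonneg (h : InghamData F W B C m) : 0 ≤ B := (norm_nonneg _).trans (h.bound 0)

lemma left_nonneg (h : InghamData F W B C m) : 0 ≤ C := by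
  have h1 := (norm_nonneg _).trans (h.left (-(1 / 4)) (by norm_num) (by norm_num))
  by_contra hC
  push Not at hC
  have : ((-(1 / 4) : ℂ)).im = 0 := by norm_num
  rw [this] at h1
  simp at h1
  linarith

lemma exists_reg_bound (h : InghamData F W B C m) {δ : ℝ} (hδ : 0 < δ) :
    ∃ K, 0 ≤ K ∧ ∀ s : ℂ, s.re ≠ 0 → |s.re| ≤ 1 / 4 →
      ‖reg W δ s‖ ≤ K / |s.re| / (1 + s.im ^ 2) := by
  obtain ⟨K, hK, hb⟩ := exists_poly_mul_gauss_le m hδ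
  have hBn := h.bound_nonneg
  have hCn := h.left_nonneg
  refine ⟨(B + C) * Real.exp δ * K, by positivity, fun s h0 h4 => ?_⟩
  have h1 : ‖1 / W s‖ ≤ (B + C) * (1 + |s.im|) ^ m / |s.re| := by
    rcases lt_or_gt_of_ne h0 with hs | hs
    · refine (h.left s ?_ hs).trans ?_
      · rw [abs_of_neg hs] at h4; linarith
      · gcongr; linarith
    · rw [abs_of_pos hs] at h4 ⊢
      rw [← h.laplace s hs (by linarith)]
      refine (norm_laplace_le h.bound h.zero hs).trans ?_
      gcongr
      have : 1 ≤ (1 + |s.im|) ^ m := one_le_pow₀ (by linarith [abs_nonneg s.im])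
      nlinarith
  have h2 : ‖cexp (δ * s ^ 2)‖ ≤ Real.exp δ * Real.exp (-δ * s.im ^ 2) := by
    rw [Complex.norm_exp, ← Real.exp_add]
    have : (δ * s ^ 2 : ℂ).re = δ * (s.re ^ 2 - s.im ^ 2) := by
      rw [re_ofReal_mul]; simp [pow_two]
    rw [this]
    gcongr
    have : s.re ^ 2 ≤ 1 := by rw [← sq_abs]; nlinarith [abs_nonneg s.re]
    nlinarith
  rw [reg, norm_mul]
  have hre : 0 < |s.re| := abs_pos.2 h0
  calc ‖1 / W s‖ * ‖cexp (δ * s ^ 2)‖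
      ≤ (B + C) * (1 + |s.im|) ^ m / |s.re| * (Real.exp δ * Real.exp (-δ * s.im ^ 2)) := by gcongr
    _ = (B + C) * Real.exp δ / |s.re| * ((1 + |s.im|) ^ m * Real.exp (-δ * s.im ^ 2)) := by ring
    _ ≤ (B + C) * Real.exp δ / |s.re| * (K / (1 + s.im ^ 2)) := by gcongr; exact hb _
    _ = _ := by ring

lemma differentiableAt_reg (h : InghamData F W B C m) (δ : ℝ) {s : ℂ} (h0 : s.re ≠ 0)
    (h1 : |s.re| < 1 / 2) : DifferentiableAt ℂ (reg W δ) s :=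
  ((differentiableAt_const _).div (h.analytic s h1).differentiableAt (h.ne_zero s h0 h1)).mul
    (by fun_prop)

lemma continuous_reg (h : InghamData F W B C m) (δ : ℝ) {c : ℝ} (h0 : c ≠ 0) (h1 : |c| < 1 / 2) :
    Continuous fun t : ℝ => reg W δ (c + t * I) :=
  continuous_iff_continuousAt.2 fun t =>
    ContinuousAt.comp (f := fun t : ℝ => (c + t * I : ℂ)) (g := reg W δ)
      (h.differentiableAt_reg δ (by simpa) (by simpa using h1)).continuousAt (by fun_prop)

lemma lineTransform_right (h : InghamData F W B C m) {δ : ℝ} (hδ : 0 < δ) {c : ℝ} (hc : 0 < c)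
    (hc2 : c < 1 / 2) (u : ℝ) : lineTransform (reg W δ) c u =
      2 * Real.pi * ∫ v, F (u - v) * (heatKernel δ v : ℂ) :=
  lineTransform_laplace (N := fun s => 1 / W s) hδ hc h.meas h.bound h.zero
    (fun t => h.laplace _ (by simpa) (by simpa using hc2)) u

lemma lineTransform_left (h : InghamData F W B C m) {δ : ℝ} (hδ : 0 < δ) {c : ℝ} (hc : 0 < c)
    (hc4 : c ≤ 1 / 4) (u : ℝ) : lineTransform (reg W δ) (-c) u = 2 * Real.pi * leftPart W δ u := by
  rw [leftPart, mul_inv_cancel_left₀ (by exact_mod_cast (by positivity : 2 * Real.pi ≠ 0))]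
  obtain ⟨K, hK, hb⟩ := h.exists_reg_bound hδ
  symm
  have hneg : ∀ s : ℂ, -(1 / 4) ≤ s.re → s.re ≤ -c → s.re < 0 ∧ |s.re| ≤ 1 / 4 ∧ c ≤ |s.re| := by
    intro s h1 h2
    have h3 : s.re < 0 := by linarith
    rw [abs_of_neg h3]
    exact ⟨h3, by linarith, by linarith⟩
  refine lineIntegral_shift (C := K / c * Real.exp |u|) (by linarith) (fun s h1 h2 => ?_)
    (fun s h1 h2 => ?_)
  · obtain ⟨h3, h4, -⟩ := hneg s h1 h2
    exact (h.differentiableAt_reg δ h3.ne (by linarith)).mul (by fun_prop)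
  · obtain ⟨h3, h4, h5⟩ := hneg s h1 h2
    rw [norm_mul, mul_div_right_comm]
    have h6 : ‖cexp (s * u)‖ ≤ Real.exp |u| := by
      rw [Complex.norm_exp]
      gcongr
      simp only [mul_re, ofReal_re, ofReal_im, mul_zero, sub_zero]
      refine (le_abs_self _).trans ?_
      rw [abs_mul]
      nlinarith [abs_nonneg u]
    gcongr
    refine (hb s h3.ne h4).trans ?_
    gcongr

lemma norm_axisPart_le_one (h : InghamData F W B C m) {δ : ℝ} (hδ : 0 < δ) (u : ℝ) :
    ‖axisPart F W δ u‖ ≤ 1 := by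
  obtain ⟨K, hK, hb⟩ := h.exists_reg_bound hδ
  set A : ℝ → ℂ := fun u => ∫ v, F (u - v) * (heatKernel δ v : ℂ) with hA
  set L : ℝ → ℂ := leftPart W δ with hL
  have hpi : (0:ℝ) < 2 * Real.pi := by positivity
  have hpi' : (2 * Real.pi : ℂ) ≠ 0 := by exact_mod_cast hpi.ne'
  have hnpi : ‖(2 * Real.pi : ℂ)‖ = 2 * Real.pi := by
    rw [show (2 * Real.pi : ℂ) = ((2 * Real.pi : ℝ) : ℂ) by push_cast; rfl, norm_real,
      Real.norm_of_nonneg hpi.le]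
  have hline : ∀ c : ℝ, c ≠ 0 → |c| ≤ 1 / 4 → ∀ t : ℝ,
      ‖reg W δ (c + t * I)‖ ≤ K / |c| / (1 + t ^ 2) := fun c h1 h2 t => by
    simpa using hb (c + t * I) (by simpa) (by simpa using h2)
  have hAe : ∀ c, 0 < c → c ≤ 1 / 4 → ∀ u, ‖A u‖ ≤ K / c * Real.exp (c * u) := by
    intro c hc hc4 u
    have h1 := norm_lineTransform_le (hline c hc.ne' (by rwa [abs_of_pos hc])) u
    rw [h.lineTransform_right hδ hc (by linarith), norm_mul, hnpi, abs_of_pos hc] at h1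
    have : 0 ≤ K / c * Real.exp (c * u) := by positivity
    refine le_of_mul_le_mul_left (h1.trans ?_) hpi
    nlinarith [Real.pi_pos]
  have hLe : ∀ c, 0 < c → c ≤ 1 / 4 → ∀ u, ‖L u‖ ≤ K / c * Real.exp (c * -u) := by
    intro c hc hc4 u
    have h1 := norm_lineTransform_le (hline (-c) (neg_ne_zero.2 hc.ne')
      (by rwa [abs_neg, abs_of_pos hc])) u
    rw [h.lineTransform_left hδ hc hc4, norm_mul, hnpi, abs_neg, abs_of_pos hc,
      neg_mul_comm] at h1
    have : 0 ≤ K / c * Real.exp (c * -u) := by positivity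
    refine le_of_mul_le_mul_left (h1.trans ?_) hpi
    nlinarith [Real.pi_pos]
  have hAg : ∀ c, 0 ≤ c → c ≤ 1 / 4 → ∀ u, ‖A u‖ * Real.exp (-(c * u)) ≤ 12 * K * (1 + |u|) :=
    fun c h1 h2 u => linear_growth_of_exp_bounds hK (fun c h1 h2 => hAe c h1 h2 u) h1 h2
  have hLg : ∀ c, 0 ≤ c → c ≤ 1 / 4 → ∀ u, ‖L u‖ * Real.exp (c * u) ≤ 12 * K * (1 + |u|) := by
    intro c h1 h2 u
    have := linear_growth_of_exp_bounds hK (fun c h1 h2 => hLe c h1 h2 u) h1 h2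
    rwa [abs_neg, mul_neg, neg_neg] at this
  have hq : (1 / 4 : ℝ) ≠ 0 := by norm_num
  have hAc : Continuous A := by
    have h1 := continuous_lineTransform (h.continuous_reg δ hq (by rw [abs_of_pos] <;> norm_num))
      (hline (1 / 4) hq (by rw [abs_of_pos]; norm_num))
    have : A = fun u => (2 * Real.pi : ℂ)⁻¹ * lineTransform (reg W δ) (1 / 4 : ℝ) u := by
      funext u
      rw [h.lineTransform_right hδ (by norm_num) (by norm_num), inv_mul_cancel_left₀ hpi']
    rw [this]; exact continuous_const.mul h1
  have hLc : Continuous L := by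
    have h1 := continuous_lineTransform (c := -(1 / 4)) (h.continuous_reg δ (by norm_num)
      (by rw [abs_neg, abs_of_pos] <;> norm_num))
      (hline _ (by norm_num) (by rw [abs_neg, abs_of_pos]; norm_num))
    exact continuous_const.mul h1
  obtain ⟨hk1, hk2, hk3, hk4, hk5⟩ := heatKernel_props hδ
  have hFg : ∀ u, ‖F u‖ ≤ B * (1 + |u|) := fun u => (h.bound u).trans
    (by nlinarith [h.bound_nonneg, mul_nonneg h.bound_nonneg (abs_nonneg u)])
  have hAlim : LimsupNormLeOne A := limsupNormLeOne_conv h.meas hFg h.limsup hk1 hk2 hk3 hk4 hk5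
  have hLlim : Tendsto L atTop (𝓝 0) := by
    refine squeeze_zero_norm (fun u => hLe (1 / 4) (by norm_num) le_rfl u) ?_
    have : Tendsto (fun u : ℝ => Real.exp (1 / 4 * -u)) atTop (𝓝 0) :=
      Real.tendsto_exp_atBot.comp
        ((tendsto_const_mul_atBot_of_pos (by norm_num)).2 tendsto_neg_atTop_atBot)
    simpa using this.const_mul (K / (1 / 4))
  have hSlim : LimsupNormLeOne fun u => A u - L u := by
    intro ε hε
    have h1 := hLlim.norm.eventually
      (gt_mem_nhds (show ‖(0:ℂ)‖ < ε / 2 by rw [norm_zero]; linarith))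
    filter_upwards [hAlim (ε / 2) (by linarith), h1] with u h2 h3
    exact (norm_sub_le _ _).trans (by linarith)
  have hSg : ∀ u, ‖A u - L u‖ ≤ 24 * K * (1 + |u|) := by
    intro u
    have h1 := hAg 0 le_rfl (by norm_num) u
    have h2 := hLg 0 le_rfl (by norm_num) u
    simp only [zero_mul, neg_zero, Real.exp_zero, mul_one] at h1 h2
    exact (norm_sub_le _ _).trans (by linarith)
  obtain ⟨k, ψ, hk⟩ := exists_isBandlimitedKernel
  refine norm_le_one_of_conv_trigPoly (S := fun u => A u - L u) (hAc.sub hLc) hSg hSlim hk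
    (fun T hT => ?_) u
  obtain ⟨hi1, hi2, hi3⟩ := hk.dilate_integrable hT
  set ψT : ℝ → ℂ := fun t => ψ (t / T)
  set kT : ℝ → ℝ := fun v => T * k (T * v)
  have hkTc : Continuous kT := continuous_const.mul (hk.cont.comp (by fun_prop))
  have hkT0 : ∀ v, 0 ≤ kT v := fun v => mul_nonneg hT.le (hk.nonneg _)
  have hψc : Continuous ψT := hk.cont_ft.comp (by fun_prop)
  have hψs : HasCompactSupport ψT :=
    hk.supp_ft.comp_homeomorph (Homeomorph.mulRight₀ T⁻¹ (inv_ne_zero hT.ne'))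
  obtain ⟨R, hR⟩ := hψs.isCompact.isBounded.subset_closedBall 0
  rw [Real.closedBall_eq_Icc, zero_sub, zero_add] at hR
  have hW2an : ∀ s : ℂ, |s.re| < 1 / 2 →
      AnalyticAt ℂ (fun s => W s * cexp (-(δ * s ^ 2))) s := fun s hs =>
    (h.analytic s hs).mul (Differentiable.analyticAt (by fun_prop) s)
  have hreg : ∀ s, 1 / (W s * cexp (-(δ * s ^ 2))) = reg W δ s := by
    intro s; rw [reg, Complex.exp_neg, one_div, mul_inv, inv_inv, one_div]
  obtain ⟨Γ, b, hjump⟩ := exists_jump (W := fun s => W s * cexp (-(δ * s ^ 2))) (c₀ := 1 / 4)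
    (by norm_num) (fun s hs => hW2an s (hs.trans (by norm_num)))
    (fun s h0 hs => mul_ne_zero (h.ne_zero s h0 (hs.trans (by norm_num))) (exp_ne_zero _))
    (fun t => ⟨K, fun c hc hc4 => by
      rw [hreg]
      refine (hline c hc.ne' (by rw [abs_of_pos hc]; exact hc4.le) t).trans ?_
      rw [abs_of_pos hc]
      exact div_le_self (by positivity) (by nlinarith [sq_nonneg t])⟩) R
  simp only [hreg] at hjump
  refine ⟨Γ, fun γ => b γ * ψT γ, fun u => ?_⟩
  have hj := hjump (fun t => cexp (I * t * u) * ψT t) (by fun_prop) hψs.mul_left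
    ((tsupport_mul_subset_right).trans hR)
  have hk2' : Integrable fun v => |v| * kT v := hi2
  have hdom : Integrable fun v => 2 * (2 * Real.pi) * (12 * K * (1 + |u - v|) * kT v) := by
    have := (integrable_conv_linear_growth (S := fun x : ℝ => ((12 * K * (1 + |x|) : ℝ) : ℂ))
      (C := 12 * K) (by fun_prop) (fun x => by
        rw [norm_real, Real.norm_of_nonneg (by positivity)]) hkTc hkT0 hi1 hk2' u).norm
    refine (this.const_mul (2 * (2 * Real.pi))).congr (ae_of_all _ fun v => ?_)
    simp only
    rw [norm_mul, norm_real, norm_real, Real.norm_of_nonneg (hkT0 v),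
      Real.norm_of_nonneg (by positivity)]
  have hlim : Tendsto (fun c : ℝ => ∫ v, 2 * Real.pi *
      (A (u - v) * cexp (-(c * (u - v))) - L (u - v) * cexp (c * (u - v))) * (kT v : ℂ))
      (𝓝[>] 0) (𝓝 (∫ v, 2 * Real.pi * (A (u - v) - L (u - v)) * (kT v : ℂ))) := by
    refine tendsto_integral_filter_of_dominated_convergence _ ?_ ?_ hdom ?_
    · refine .of_forall fun c => Continuous.aestronglyMeasurable ?_
      fun_prop
    · filter_upwards [Ioo_mem_nhdsGT (show (0:ℝ) < 1 / 4 by norm_num)] with c hc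
      refine ae_of_all _ fun v => ?_
      rw [norm_mul, norm_mul, hnpi, norm_real, Real.norm_of_nonneg (hkT0 v)]
      have h1 : ‖A (u - v) * cexp (-(c * (u - v)))‖ ≤ 12 * K * (1 + |u - v|) := by
        rw [norm_mul, Complex.norm_exp]
        have := hAg c hc.1.le hc.2.le (u - v)
        rwa [show (-((c:ℂ) * (u - v))).re = -(c * (u - v)) by simp]
      have h2 : ‖L (u - v) * cexp (c * (u - v))‖ ≤ 12 * K * (1 + |u - v|) := by
        rw [norm_mul, Complex.norm_exp]
        have := hLg c hc.1.le hc.2.le (u - v)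
        rwa [show ((c:ℂ) * (u - v)).re = c * (u - v) by simp]
      calc 2 * Real.pi * ‖_‖ * kT v ≤ 2 * Real.pi *
          (12 * K * (1 + |u - v|) + 12 * K * (1 + |u - v|))
              * kT v := by
            gcongr
            · exact hkT0 v
            · exact (norm_sub_le _ _).trans (add_le_add h1 h2)
        _ = _ := by ring
    · refine ae_of_all _ fun v => ?_
      have : Continuous fun c : ℝ => 2 * Real.pi *
        (A (u - v) * cexp (-(c * (u - v))) - L (u - v) * cexp (c * (u - v))) * (kT v : ℂ) := by
        fun_prop
      refine ((this.tendsto' 0 _ ?_)).mono_left nhdsWithin_le_nhds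
      simp
  have heq : (fun c : ℝ => ∫ v, 2 * Real.pi *
      (A (u - v) * cexp (-(c * (u - v))) - L (u - v) * cexp (c * (u - v))) * (kT v : ℂ)) =ᶠ[𝓝[>] 0]
      fun c : ℝ => ∫ t : ℝ, (reg W δ (c + t * I) - reg W δ (-c + t * I)) *
        (cexp (I * t * u) * ψT t) := by
    filter_upwards [Ioo_mem_nhdsGT (show (0:ℝ) < 1 / 4 by norm_num)] with c hc
    have hcn : -c ≠ 0 := neg_ne_zero.2 hc.1.ne'
    have habs : |c| < 1 / 4 := by rw [abs_of_pos hc.1]; exact hc.2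
    have habs' : |(-c)| < 1 / 4 := by rw [abs_neg]; exact habs
    have c1 := h.continuous_reg δ hc.1.ne' (habs.trans (by norm_num))
    have c2 := h.continuous_reg δ hcn (habs'.trans (by norm_num))
    have i1 := integral_lineTransform_mul c1 (hline c hc.1.ne' habs.le) hi1 (hk.dilate_ft hT) u
    have i2 := integral_lineTransform_mul c2 (hline (-c) hcn habs'.le) hi1 (hk.dilate_ft hT) u
    have hcs : ∀ f : ℝ → ℂ, Continuous f → Integrable fun t => f t * (cexp (I * t * u) * ψT t) :=
      fun f hf => Continuous.integrable_of_hasCompactSupport (by fun_prop) hψs.mul_left.mul_left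
    have e1 : ∫ t : ℝ, (reg W δ (c + t * I) - reg W δ (-c + t * I)) * (cexp (I * t * u) * ψT t)
        = (∫ t : ℝ, reg W δ (c + t * I) * (cexp (I * t * u) * ψT t)) -
          ∫ t : ℝ, reg W δ ((-c : ℝ) + t * I) * (cexp (I * t * u) * ψT t) := by
      rw [← integral_sub (hcs _ c1) (hcs _ c2)]
      refine integral_congr_ae (ae_of_all _ fun t => ?_)
      push_cast; ring
    rw [e1, ← i1, ← i2]
    have hI : ∀ f : ℝ → ℂ, Continuous f → (∀ x, ‖f x‖ ≤ 2 * Real.pi * (12 * K) * (1 + |x|)) →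
        Integrable fun v => f (u - v) * (kT v : ℂ) := fun f hf hfg =>
      integrable_conv_linear_growth hf.measurable hfg hkTc hkT0 hi1 hk2' u
    have j1 : Integrable fun v : ℝ => lineTransform (reg W δ) c (u - v) *
        cexp (-(c * (u - v))) * (kT v : ℂ) := by
      have := hI (fun x => 2 * Real.pi * A x * cexp (-(c * x))) (by fun_prop) (fun x => by
        rw [norm_mul, norm_mul, hnpi, Complex.norm_exp, show (-((c:ℂ) * x)).re = -(c * x) by simp]
        have := hAg c hc.1.le hc.2.le x
        nlinarith)
      refine this.congr (ae_of_all _ fun v => ?_)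
      simp only
      rw [h.lineTransform_right hδ hc.1 (by linarith [hc.2])]
      push_cast; rfl
    have j2 : Integrable fun v : ℝ => lineTransform (reg W δ) (-c) (u - v) *
        cexp (-((-c : ℝ) * (u - v))) * (kT v : ℂ) := by
      have := hI (fun x => 2 * Real.pi * L x * cexp (c * x)) (by fun_prop) (fun x => by
        rw [norm_mul, norm_mul, hnpi, Complex.norm_exp, show ((c:ℂ) * x).re = (c * x) by simp]
        have := hLg c hc.1.le hc.2.le x
        nlinarith)
      refine this.congr (ae_of_all _ fun v => ?_)
      simp only
      rw [h.lineTransform_left hδ hc.1 hc.2.le]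
      push_cast; simp only [neg_mul, neg_neg]; rfl
    rw [← integral_sub j1 j2]
    refine integral_congr_ae (ae_of_all _ fun v => ?_)
    simp only
    rw [h.lineTransform_left hδ hc.1 hc.2.le, h.lineTransform_right hδ hc.1 (by linarith [hc.2])]
    push_cast
    simp only [neg_mul, neg_neg]
    ring
  have hfin := tendsto_nhds_unique (hlim.congr' heq) hj
  have e2 : ∫ v, 2 * Real.pi * (A (u - v) - L (u - v)) * (kT v : ℂ) =
      2 * Real.pi * ∫ v, (A (u - v) - L (u - v)) * (kT v : ℂ) := by
    rw [← integral_const_mul]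
    simp only [mul_assoc]
  rw [e2] at hfin
  refine mul_left_cancel₀ hpi' (hfin.trans ?_)
  rw [Finset.mul_sum]
  exact Finset.sum_congr rfl fun γ _ => by ring

end InghamData
end

section
lemma norm_Gamma_mul_le {x y : ℝ} (hx : 0 < x) (hxy : x ≤ y) (t : ℝ) :
    ‖Gamma (x + t * I)‖ * Real.Gamma y ≤ Real.Gamma x * ‖Gamma (y + t * I)‖ := by
  have hy : 0 < y := hx.trans_le hxy
  have hlim : ∀ a : ℝ, Tendsto (fun n => ‖GammaSeq (a + t * I) n‖) atTop (𝓝 ‖Gamma (a + t * I)‖) :=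
    fun a => (GammaSeq_tendsto_Gamma _).norm
  have hlim' : ∀ a : ℝ, 0 < a → Tendsto (fun n => ‖GammaSeq a n‖) atTop (𝓝 (Real.Gamma a)) := by
    intro a ha
    have := (GammaSeq_tendsto_Gamma (a : ℂ)).norm
    rwa [Gamma_ofReal, norm_real, Real.norm_of_nonneg (Real.Gamma_pos_of_pos ha).le] at this
  refine le_of_tendsto_of_tendsto ((hlim x).mul (hlim' y hy)) ((hlim' x hx).mul (hlim y)) ?_
  filter_upwards [eventually_gt_atTop 0] with n hn
  have hn' : (0:ℝ) < n := by exact_mod_cast hn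
  have hN : ∀ w : ℂ, ‖GammaSeq w n‖ = (n:ℝ) ^ w.re * n.factorial / ∏ j ∈ Finset.range (n + 1), ‖w +
      j‖ := by
    intro w
    rw [GammaSeq, norm_div, norm_mul, norm_prod, ← ofReal_natCast n,
      norm_cpow_eq_rpow_re_of_pos hn']
    simp
  simp only [hN]
  have hreal : ∀ a : ℝ, 0 < a → ∀ j : ℕ, ‖(a : ℂ) + j‖ = a + j := by
    intro a ha j
    rw [show (a : ℂ) + j = ((a + j : ℝ) : ℂ) by push_cast; rfl, norm_real,
      Real.norm_of_nonneg (by positivity)]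
  simp only [hreal x hx, hreal y hy]
  have hre : ∀ a : ℝ, ((a:ℂ) + t * I).re = a := fun a => by simp
  simp only [hre, ofReal_re]
  have hpos : ∀ a : ℝ, 0 < a → ∀ j : ℕ, 0 < ‖(a + t * I + j : ℂ)‖ := by
    intro a ha j
    refine norm_pos_iff.2 fun h => ?_
    have := congrArg Complex.re h
    simp at this
    have : 0 < a + j := by positivity
    linarith
  have hprod : ∏ j ∈ Finset.range (n + 1), (‖(y + t * I + j : ℂ)‖ * (x + j)) ≤
      ∏ j ∈ Finset.range (n + 1), (‖(x + t * I + j : ℂ)‖ * (y + j)) := by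
    refine Finset.prod_le_prod (fun j _ => by positivity) fun j _ => ?_
    have e : ∀ a : ℝ, ‖(a + t * I + j : ℂ)‖ = Real.sqrt ((a + j) ^ 2 + t ^ 2) := by
      intro a
      rw [Complex.norm_def, normSq_apply]
      simp [pow_two]
    rw [e, e]
    refine le_of_sq_le_sq ?_ (by positivity)
    rw [mul_pow, mul_pow, Real.sq_sqrt (by positivity), Real.sq_sqrt (by positivity)]
    have : (x + j) ^ 2 ≤ (y + j) ^ 2 := by gcongr
    nlinarith [mul_le_mul_of_nonneg_left this (sq_nonneg t)]
  rw [Finset.prod_mul_distrib, Finset.prod_mul_distrib] at hprod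
  have p1 : 0 < ∏ j ∈ Finset.range (n + 1), ‖(x + t * I + j : ℂ)‖ :=
    Finset.prod_pos fun j _ => hpos x hx j
  have p2 : 0 < ∏ j ∈ Finset.range (n + 1), ‖(y + t * I + j : ℂ)‖ :=
    Finset.prod_pos fun j _ => hpos y hy j
  have p3 : 0 < ∏ j ∈ Finset.range (n + 1), (x + j) := Finset.prod_pos fun j _ => by positivity
  have p4 : 0 < ∏ j ∈ Finset.range (n + 1), (y + j) := Finset.prod_pos fun j _ => by positivity
  rw [div_mul_div_comm, div_mul_div_comm, div_le_div_iff₀ (by positivity) (by positivity)]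
  have hc : 0 ≤ (n:ℝ) ^ x * n.factorial * ((n:ℝ) ^ y * n.factorial) := by positivity
  nlinarith [mul_le_mul_of_nonneg_left hprod hc]

/-- Comparison of the size of the Gamma function at points of a strip at the same height. -/
lemma exists_norm_Gamma_le : ∃ K : ℝ, 1 ≤ K ∧ ∀ w w' : ℂ, 1 / 8 ≤ w.re → w.re ≤ 4 →
    1 / 8 ≤ w'.re → w'.re ≤ 4 → w.re ≤ w'.re + 1 → |w.im| = |w'.im| →
    ‖Gamma w‖ ≤ K * (1 + |w.im|) * ‖Gamma w'‖ := by
  have hcont : ContinuousOn Real.Gamma (Set.Icc (1 / 8) 5) := fun x hx =>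
    (Real.differentiableAt_Gamma fun m h => by
      have := hx.1; have := m.cast_nonneg (α := ℝ); linarith).continuousAt.continuousWithinAt
  have hne : (Set.Icc (1 / 8 : ℝ) 5).Nonempty := ⟨1, by norm_num, by norm_num⟩
  obtain ⟨a, ha, hmax⟩ := isCompact_Icc.exists_isMaxOn hne hcont
  obtain ⟨b, hb, hmin⟩ := isCompact_Icc.exists_isMinOn hne hcont
  have hb0 : 0 < Real.Gamma b := Real.Gamma_pos_of_pos (by linarith [hb.1])
  have ha0 : 0 < Real.Gamma a := Real.Gamma_pos_of_pos (by linarith [ha.1])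
  have hba : Real.Gamma b ≤ Real.Gamma a := hmax hb
  refine ⟨Real.Gamma a / Real.Gamma b * 4, ?_, fun w w' h1 h2 h3 h4 h5 h6 => ?_⟩
  · have := (one_le_div hb0).2 hba
    linarith
  have key : ∀ w' : ℂ, 1 / 8 ≤ w'.re → w'.re ≤ 4 → w.re ≤ w'.re + 1 → w.im = w'.im →
    ‖Gamma w‖ ≤ Real.Gamma a / Real.Gamma b * 4 * (1 + |w.im|) * ‖Gamma w'‖ := by
    intro w' h3 h4 h5 h6
    have h := norm_Gamma_mul_le (x := w.re) (y := w'.re + 1) (by linarith) h5 w.im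
    have e1 : ((w'.re + 1 : ℝ) : ℂ) + w.im * I = w' + 1 := by
      apply Complex.ext <;> simp [h6]
    have hw' : w' ≠ 0 := fun h => by rw [h] at h3; norm_num at h3
    rw [re_add_im, e1, Gamma_add_one _ hw', norm_mul] at h
    have hB : Real.Gamma b ≤ Real.Gamma (w'.re + 1) := hmin ⟨by linarith, by linarith⟩
    have hA : Real.Gamma w.re ≤ Real.Gamma a := hmax ⟨h1, by linarith⟩
    have hn : ‖w'‖ ≤ 4 * (1 + |w.im|) := by
      refine (norm_le_abs_re_add_abs_im w').trans ?_
      rw [abs_of_pos (show 0 < w'.re by linarith), h6]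
      linarith [abs_nonneg w'.im]
    have h7 : ‖Gamma w‖ * Real.Gamma b ≤ Real.Gamma a * (4 * (1 + |w.im|) * ‖Gamma w'‖) :=
      calc _ ≤ ‖Gamma w‖ * Real.Gamma (w'.re + 1) := by gcongr
        _ ≤ _ := h
        _ ≤ _ := by gcongr
    rw [← le_div_iff₀ hb0] at h7
    exact h7.trans_eq (by ring)
  rcases abs_eq_abs.1 h6 with h | h
  · exact key w' h3 h4 h5 h
  · have := key ((starRingEnd ℂ) w') (by simpa using h3) (by simpa using h4) (by simpa using h5)
      (by simpa using h)
    rwa [Gamma_conj, RCLike.norm_conj] at this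

lemma norm_cpow_bounds {a : ℝ} (ha : 1 ≤ a) {w : ℂ} (h0 : 0 ≤ w.re) (h4 : w.re ≤ 4) :
    a ^ (-4 : ℝ) ≤ ‖(a : ℂ) ^ (-w)‖ ∧ ‖(a : ℂ) ^ (-w)‖ ≤ 1 := by
  rw [norm_cpow_eq_rpow_re_of_pos (by linarith), neg_re]
  exact ⟨Real.rpow_le_rpow_of_exponent_le ha (by linarith),
    Real.rpow_le_one_of_one_le_of_nonpos ha (by linarith)⟩

lemma exists_norm_Gammaℝ_le : ∃ K : ℝ, 1 ≤ K ∧ ∀ w w' : ℂ, 1 / 4 ≤ w.re → w.re ≤ 4 →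
    1 / 4 ≤ w'.re → w'.re ≤ 4 → w.re ≤ w'.re + 2 → |w.im| = |w'.im| →
    ‖Gammaℝ w‖ ≤ K * (1 + |w.im|) * ‖Gammaℝ w'‖ := by
  obtain ⟨K, hK, h⟩ := exists_norm_Gamma_le
  have hpi : 1 ≤ Real.pi := by linarith [Real.pi_gt_three]
  have hp : 0 < Real.pi ^ (-4 : ℝ) := by positivity
  refine ⟨K / Real.pi ^ (-4 : ℝ), ?_, fun w w' h1 h2 h3 h4 h5 h6 => ?_⟩
  · rw [le_div_iff₀ hp, one_mul]
    exact (Real.rpow_le_one_of_one_le_of_nonpos hpi (by norm_num)).trans hK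
  have hre : ∀ w : ℂ, (w / 2).re = w.re / 2 := fun w => by
    rw [show w / 2 = w / ((2:ℝ):ℂ) by norm_num, div_ofReal_re]
  have him : ∀ w : ℂ, (w / 2).im = w.im / 2 := fun w => by
    rw [show w / 2 = w / ((2:ℝ):ℂ) by norm_num, div_ofReal_im]
  have hG := h (w / 2) (w' / 2) (by rw [hre]; linarith) (by rw [hre]; linarith)
    (by rw [hre]; linarith) (by rw [hre]; linarith) (by rw [hre, hre]; linarith)
    (by rw [him, him, abs_div, abs_div, h6])
  have b1 := norm_cpow_bounds hpi (w := w / 2) (by rw [hre]; linarith) (by rw [hre]; linarith)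
  have b2 := norm_cpow_bounds hpi (w := w' / 2) (by rw [hre]; linarith) (by rw [hre]; linarith)
  rw [Gammaℝ_def, Gammaℝ_def, norm_mul, norm_mul, neg_div, neg_div]
  rw [him, abs_div, abs_two] at hG
  calc _ ≤ 1 * (K * (1 + |w.im| / 2) * ‖Gamma (w' / 2)‖) := by gcongr; exact b1.2
    _ ≤ 1 * (K * (1 + |w.im|) * ‖Gamma (w' / 2)‖) := by
        gcongr; linarith [abs_nonneg w.im]
    _ = K / Real.pi ^ (-4 : ℝ) * (1 + |w.im|) * (Real.pi ^ (-4 : ℝ) * ‖Gamma (w' / 2)‖) := by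
        field_simp
    _ ≤ _ := by gcongr; exact b2.1

lemma exists_norm_Gammaℂ_le : ∃ K : ℝ, 1 ≤ K ∧ ∀ w w' : ℂ, 1 / 4 ≤ w.re → w.re ≤ 4 →
    1 / 4 ≤ w'.re → w'.re ≤ 4 → w.re ≤ w'.re + 1 → |w.im| = |w'.im| →
    ‖Gammaℂ w‖ ≤ K * (1 + |w.im|) * ‖Gammaℂ w'‖ := by
  obtain ⟨K, hK, h⟩ := exists_norm_Gamma_le
  have hpi : 1 ≤ 2 * Real.pi := by linarith [Real.pi_gt_three]
  have hp : 0 < (2 * Real.pi) ^ (-4 : ℝ) := by positivity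
  refine ⟨K / (2 * Real.pi) ^ (-4 : ℝ), ?_, fun w w' h1 h2 h3 h4 h5 h6 => ?_⟩
  · rw [le_div_iff₀ hp, one_mul]
    exact (Real.rpow_le_one_of_one_le_of_nonpos hpi (by norm_num)).trans hK
  have hG := h w w' (by linarith) h2 (by linarith) h4 h5 h6
  have b1 := norm_cpow_bounds hpi (w := w) (by linarith) h2
  have b2 := norm_cpow_bounds hpi (w := w') (by linarith) h4
  push_cast at b1 b2
  rw [Gammaℂ_def, Gammaℂ_def, norm_mul, norm_mul, norm_mul, norm_mul]
  calc _ ≤ ‖(2:ℂ)‖ * 1 * (K * (1 + |w.im|) * ‖Gamma w'‖) := by gcongr; exact b1.2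
    _ = K / (2 * Real.pi) ^ (-4 : ℝ) * (1 + |w.im|) *
        (‖(2:ℂ)‖ * (2 * Real.pi) ^ (-4 : ℝ) * ‖Gamma w'‖) := by
        field_simp
    _ ≤ _ := by gcongr; exact b2.1

/-- The archimedean factor of a number field of signature `(r₁, r₂)`. -/
def gammaFac (r₁ r₂ : ℕ) (z : ℂ) : ℂ := Gammaℝ z ^ r₁ * Gammaℂ z ^ r₂

/-- The archimedean factor with its pole at the origin removed. -/
def gammaReg (r₁ r₂ : ℕ) (z : ℂ) : ℂ :=
  (2 * Real.pi) ^ (r₁ + r₂) * (Gammaℝ (z + 2) ^ r₁ * Gammaℂ (z + 1) ^ r₂)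

variable (r₁ r₂ : ℕ)

lemma Gammaℂ_ne_zero_of_re_pos {z : ℂ} (hz : 0 < z.re) : Gammaℂ z ≠ 0 := by
  rw [Gammaℂ_def]
  have hpi : (2 * Real.pi : ℂ) ≠ 0 := by exact_mod_cast (by positivity : 2 * Real.pi ≠ 0)
  exact mul_ne_zero (mul_ne_zero two_ne_zero (by simp [cpow_eq_zero_iff, hpi]))
    (Gamma_ne_zero_of_re_pos hz)

lemma gammaFac_ne_zero {z : ℂ} (hz : 0 < z.re) : gammaFac r₁ r₂ z ≠ 0 :=
  mul_ne_zero (pow_ne_zero _ (Gammaℝ_ne_zero_of_re_pos hz))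
    (pow_ne_zero _ (Gammaℂ_ne_zero_of_re_pos hz))

lemma differentiable_gammaFac_inv : Differentiable ℂ fun z => (gammaFac r₁ r₂ z)⁻¹ := by
  have : (fun z => (gammaFac r₁ r₂ z)⁻¹) = fun z => (Gammaℝ z)⁻¹ ^ r₁ * (Gammaℂ z)⁻¹ ^ r₂ := by
    funext z; rw [gammaFac, mul_inv, inv_pow, inv_pow]
  rw [this]
  exact (differentiable_Gammaℝ_inv.pow _).mul (differentiable_Gammaℂ_inv.pow _)

lemma differentiableAt_Gammaℝ_of_re_pos {z : ℂ} (hz : 0 < z.re) : DifferentiableAt ℂ Gammaℝ z := by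
  have h := (differentiable_Gammaℝ_inv z).inv (inv_ne_zero (Gammaℝ_ne_zero_of_re_pos hz))
  exact h.congr_of_eventuallyEq (.of_forall fun w => by simp)

lemma differentiableAt_Gammaℂ_of_re_pos {z : ℂ} (hz : 0 < z.re) : DifferentiableAt ℂ Gammaℂ z := by
  have h := (differentiable_Gammaℂ_inv z).inv (inv_ne_zero (Gammaℂ_ne_zero_of_re_pos hz))
  exact h.congr_of_eventuallyEq (.of_forall fun w => by simp)

lemma differentiableAt_gammaReg {z : ℂ} (hz : -1 < z.re) :
    DifferentiableAt ℂ (gammaReg r₁ r₂) z := by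
  have h1 : DifferentiableAt ℂ (fun z => Gammaℝ (z + 2)) z :=
    DifferentiableAt.comp (g := Gammaℝ) (f := fun z => z + 2) z
      (differentiableAt_Gammaℝ_of_re_pos (by simp; linarith)) (by fun_prop)
  have h2 : DifferentiableAt ℂ (fun z => Gammaℂ (z + 1)) z :=
    DifferentiableAt.comp (g := Gammaℂ) (f := fun z => z + 1) z
      (differentiableAt_Gammaℂ_of_re_pos (by simp; linarith)) (by fun_prop)
  exact ((h1.pow _).mul (h2.pow _)).const_mul _

lemma gammaReg_eq {z : ℂ} (hz : z ≠ 0) :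
    gammaReg r₁ r₂ z = z ^ (r₁ + r₂) * gammaFac r₁ r₂ z := by
  have hpi : (Real.pi : ℂ) ≠ 0 := by exact_mod_cast Real.pi_ne_zero
  rw [gammaReg, gammaFac, Gammaℝ_add_two hz, Gammaℂ_add_one hz]
  have e : ∀ g : ℂ, g * z / 2 / Real.pi = g * z * ((2:ℂ) * (Real.pi : ℂ))⁻¹ :=
      fun g => by field_simp
  simp only [e, mul_pow, pow_add, inv_pow]
  field_simp

lemma gammaReg_zero : gammaReg r₁ r₂ 0 = (2 * Real.pi) ^ (r₁ + r₂) *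
    (Real.pi : ℂ)⁻¹ ^ (r₁ + r₂) := by
  have h2 : Gammaℝ 2 = (Real.pi : ℂ)⁻¹ := by
    rw [Gammaℝ_def]
    norm_num [cpow_neg_one]
  rw [gammaReg, zero_add, zero_add, h2, Gammaℂ_one, one_div, pow_add (Real.pi : ℂ)⁻¹]

/-- Comparison of the size of the archimedean factor on both sides of the critical line. -/
lemma exists_norm_gammaFac_le : ∃ K : ℝ, 1 ≤ K ∧ ∀ z : ℂ, 1 / 4 ≤ z.re → z.re ≤ 1 / 2 →
    ‖gammaFac r₁ r₂ z‖ ≤ K * (1 + |z.im|) ^ (r₁ + r₂) * ‖gammaFac r₁ r₂ (1 - z)‖ := by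
  obtain ⟨K₁, hK₁, h₁⟩ := exists_norm_Gammaℝ_le
  obtain ⟨K₂, hK₂, h₂⟩ := exists_norm_Gammaℂ_le
  refine ⟨K₁ ^ r₁ * K₂ ^ r₂, one_le_mul_of_one_le_of_one_le (one_le_pow₀ hK₁) (one_le_pow₀ hK₂),
    fun z hz hz' => ?_⟩
  have a1 := h₁ z (1 - z) hz (by linarith) (by simp; linarith) (by simp; linarith)
    (by simp; linarith) (by simp)
  have a2 := h₂ z (1 - z) hz (by linarith) (by simp; linarith) (by simp; linarith)
    (by simp; linarith) (by simp)
  rw [gammaFac, gammaFac, norm_mul, norm_pow, norm_pow, norm_mul, norm_pow, norm_pow]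
  calc _ ≤ (K₁ * (1 + |z.im|) * ‖Gammaℝ (1 - z)‖) ^ r₁ *
      (K₂ * (1 + |z.im|) * ‖Gammaℂ (1 - z)‖) ^ r₂ := by
        gcongr
    _ = _ := by simp only [mul_pow, pow_add]; ring

lemma exists_norm_gammaReg_le : ∃ K : ℝ, 1 ≤ K ∧ ∀ z : ℂ, -(1 / 2) ≤ z.re → z.re ≤ 1 / 4 →
    ‖gammaReg r₁ r₂ z‖ ≤ K * (1 + |z.im|) ^ (r₁ + r₂) * ‖gammaFac r₁ r₂ (1 - z)‖ := by
  obtain ⟨K₁, hK₁, h₁⟩ := exists_norm_Gammaℝ_le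
  obtain ⟨K₂, hK₂, h₂⟩ := exists_norm_Gammaℂ_le
  have hpi : 1 ≤ 2 * Real.pi := by linarith [Real.pi_gt_three]
  refine ⟨(2 * Real.pi) ^ (r₁ + r₂) * (K₁ ^ r₁ * K₂ ^ r₂), one_le_mul_of_one_le_of_one_le
    (one_le_pow₀ hpi)
    (one_le_mul_of_one_le_of_one_le (one_le_pow₀ hK₁) (one_le_pow₀ hK₂)), fun z hz hz' => ?_⟩
  have a1 := h₁ (z + 2) (1 - z) (by simp; linarith) (by simp; linarith) (by simp; linarith)
    (by simp; linarith) (by simp; linarith) (by simp)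
  have a2 := h₂ (z + 1) (1 - z) (by simp; linarith) (by simp; linarith) (by simp; linarith)
    (by simp; linarith) (by simp; linarith) (by simp)
  have e1 : (z + 2).im = z.im := by simp
  have e2 : (z + 1).im = z.im := by simp
  rw [e1] at a1
  rw [e2] at a2
  have hn : ‖(2 * Real.pi : ℂ)‖ = 2 * Real.pi := by
    rw [show (2 * Real.pi : ℂ) = ((2 * Real.pi : ℝ) : ℂ) by push_cast; rfl, norm_real,
      Real.norm_of_nonneg (by linarith)]
  have e3 : ‖gammaReg r₁ r₂ z‖ = (2 * Real.pi) ^ (r₁ + r₂) *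
      (‖Gammaℝ (z + 2)‖ ^ r₁ * ‖Gammaℂ (z + 1)‖ ^ r₂) := by
    rw [gammaReg, norm_mul, norm_pow, hn, norm_mul, norm_pow, norm_pow]
  rw [e3, gammaFac, norm_mul, norm_pow, norm_pow]
  calc _ ≤ (2 * Real.pi) ^ (r₁ + r₂) * ((K₁ * (1 + |z.im|) * ‖Gammaℝ (1 - z)‖) ^ r₁ *
          (K₂ * (1 + |z.im|) * ‖Gammaℂ (1 - z)‖) ^ r₂) := by gcongr
    _ = _ := by simp only [mul_pow, pow_add]; ring

lemma norm_Gammaℝ_conj (z : ℂ) : ‖Gammaℝ ((starRingEnd ℂ) z)‖ = ‖Gammaℝ z‖ := by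
  rw [Gammaℝ_def, Gammaℝ_def, norm_mul, norm_mul, norm_cpow_eq_rpow_re_of_pos Real.pi_pos,
    norm_cpow_eq_rpow_re_of_pos Real.pi_pos]
  have e1 : (starRingEnd ℂ) z / 2 = (starRingEnd ℂ) (z / 2) := by rw [map_div₀, map_ofNat]
  have e2 : (-(starRingEnd ℂ) z / 2).re = (-z / 2).re := by
    rw [neg_div, neg_div, neg_re, neg_re, e1, conj_re]
  rw [e2, e1, Gamma_conj, RCLike.norm_conj]

lemma norm_Gammaℂ_conj (z : ℂ) : ‖Gammaℂ ((starRingEnd ℂ) z)‖ = ‖Gammaℂ z‖ := by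
  have h2 : 0 < 2 * Real.pi := by positivity
  rw [Gammaℂ_def, Gammaℂ_def, norm_mul, norm_mul, norm_mul, norm_mul,
    show (2 * Real.pi : ℂ) = ((2 * Real.pi : ℝ) : ℂ) by push_cast; rfl,
    norm_cpow_eq_rpow_re_of_pos h2, norm_cpow_eq_rpow_re_of_pos h2, Gamma_conj, RCLike.norm_conj]
  simp

variable {r₁ r₂} in
lemma norm_gammaFac_left {t : ℝ} (h : ¬(r₁ = 0 ∧ r₂ = 0)) :
    ‖gammaFac r₁ r₂ (-(1 / 2) + t * I)‖ ≤ (4 * (2 * Real.pi) ^ 2) ^ (r₁ + r₂) *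
      (1 / ‖(-(1 / 2) + t * I : ℂ)‖) * ‖gammaFac r₁ r₂ (1 - (-(1 / 2) + t * I))‖ := by
  set z : ℂ := -(1 / 2) + t * I with hz
  have hre : z.re = -(1 / 2) := by simp [hz]
  have hre1 : (z + 1).re = 1 / 2 := by rw [add_re, hre]; norm_num
  have hzn : 1 / 2 ≤ ‖z‖ := by
    have := abs_re_le_norm z
    rw [hre, abs_neg, abs_of_pos (by norm_num)] at this
    exact this
  have hzn1 : 1 / 2 ≤ ‖z + 1‖ := by
    have := abs_re_le_norm (z + 1)
    rwa [hre1, abs_of_pos (by norm_num)] at this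
  have hz0 : z ≠ 0 := norm_pos_iff.1 (by linarith)
  have hz1 : z + 1 ≠ 0 := norm_pos_iff.1 (by linarith)
  have hc : z + 2 = (starRingEnd ℂ) (1 - z) := by
    apply Complex.ext <;> simp [hz] <;> norm_num
  have hpi := Real.pi_gt_three
  have npi : ‖(Real.pi : ℂ)‖ = Real.pi := by rw [norm_real, Real.norm_of_nonneg (by linarith)]
  have n2 : ‖(2 : ℂ)‖ = 2 := by norm_num
  set M : ℝ := 2 * (2 * Real.pi) ^ 2 with hM
  have a1 : ‖Gammaℝ z‖ ≤ M * (1 / ‖z‖) * ‖Gammaℝ (1 - z)‖ := by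
    have h1 := congrArg norm (Gammaℝ_add_two hz0)
    rw [hc, norm_Gammaℝ_conj, norm_div, norm_div, norm_mul, npi, n2] at h1
    rw [h1]
    have : M * (1 / ‖z‖) * (‖Gammaℝ z‖ * ‖z‖ / 2 / Real.pi) = 4 * Real.pi * ‖Gammaℝ z‖ := by
      rw [hM]; field_simp; ring
    rw [this]
    nlinarith [norm_nonneg (Gammaℝ z)]
  have a2 : ‖Gammaℂ z‖ ≤ M * (1 / ‖z‖) * ‖Gammaℂ (1 - z)‖ := by
    have h1 := congrArg norm (Gammaℂ_add_one hz0)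
    have h2 := congrArg norm (Gammaℂ_add_one hz1)
    rw [show z + 1 + 1 = z + 2 by ring, hc, norm_Gammaℂ_conj, norm_div, norm_div, norm_mul, npi,
      n2, h1, norm_div, norm_div, norm_mul, npi, n2] at h2
    rw [h2]
    have : M * (1 / ‖z‖) * (‖Gammaℂ z‖ * ‖z‖ / 2 / Real.pi * ‖z + 1‖ / 2 / Real.pi) =
        2 * ‖z + 1‖ * ‖Gammaℂ z‖ := by
      rw [hM]; field_simp
    rw [this]
    nlinarith [norm_nonneg (Gammaℂ z)]
  have hq : 1 / ‖z‖ ≤ 2 := by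
    rw [div_le_iff₀ (by linarith)]; linarith
  obtain ⟨k, hk⟩ : ∃ k, r₁ + r₂ = k + 1 := Nat.exists_eq_succ_of_ne_zero (by omega)
  have hpow : (1 / ‖z‖) ^ (r₁ + r₂) ≤ 2 ^ (r₁ + r₂) * (1 / ‖z‖) := by
    rw [hk, pow_succ]
    gcongr
    calc (1 / ‖z‖) ^ k ≤ 2 ^ k := by gcongr
      _ ≤ 2 ^ (k + 1) := pow_le_pow_right₀ (by norm_num) (by omega)
  rw [gammaFac, gammaFac, norm_mul, norm_pow, norm_pow, norm_mul, norm_pow, norm_pow]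
  calc _ ≤ (M * (1 / ‖z‖) * ‖Gammaℝ (1 - z)‖) ^ r₁ * (M * (1 / ‖z‖) * ‖Gammaℂ (1 - z)‖) ^ r₂ := by
        gcongr
    _ = M ^ (r₁ + r₂) * (1 / ‖z‖) ^ (r₁ + r₂) * (‖Gammaℝ (1 - z)‖ ^ r₁ * ‖Gammaℂ (1 - z)‖ ^ r₂)
        := by
        simp only [mul_pow, pow_add]; ring
    _ ≤ M ^ (r₁ + r₂) * (2 ^ (r₁ + r₂) * (1 / ‖z‖)) *
        (‖Gammaℝ (1 - z)‖ ^ r₁ * ‖Gammaℂ (1 - z)‖ ^ r₂) := by gcongr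
    _ = _ := by
        rw [show 4 * (2 * Real.pi) ^ 2 = M * 2 by rw [hM]; ring, mul_pow M 2]; ring
end

section
/-- The analytic properties of the completed Dedekind zeta function `E z = z (z - 1) Λ z` of a
field of signature `(r₁, r₂)` and discriminant `D` used below; `Z` is the zeta function. -/
structure ZetaData (r₁ r₂ : ℕ) (D A C : ℝ) (E Z : ℂ → ℂ) : Prop where
  diff : Differentiable ℂ E
  symm : ∀ z, E (1 - z) = E z
  eq : ∀ z : ℂ, 1 < z.re → E z = z * (z - 1) * (D : ℂ) ^ (z / 2) * gammaFac r₁ r₂ z * Z z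
  bounds : ∀ z : ℂ, 3 / 2 ≤ z.re → 1 ≤ C * ‖Z z‖ ∧ ‖Z z‖ ≤ C
  crude : ∀ z : ℂ, ‖z - 2‖ ≤ 29 / 20 → ‖E z‖ ≤ C * D ^ A
  one_pos : ∃ e : ℝ, 0 < e ∧ E 1 = e

/-- The properties of the normalized Mertens function `F y = M (exp y) exp (-y / 2)`. -/
structure MertensData (Z : ℂ → ℂ) (F : ℝ → ℂ) (B : ℝ) : Prop where
  meas : Measurable F
  bound : ∀ y, ‖F y‖ ≤ B
  zero : ∀ y < 0, F y = 0
  limsup : LimsupNormLeOne F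
  init : ∀ y : ℝ, 0 < y → y < Real.log 2 → F y = Real.exp (-y / 2)
  laplace : ∀ z : ℂ, 3 / 2 ≤ z.re →
    ∫ y : ℝ, F y * cexp (-((z - 1 / 2) * y)) = 1 / (z * Z z)

/-- The Laplace transform of a bounded function on the half-line is holomorphic. -/
lemma differentiableAt_laplace {F : ℝ → ℂ} {B : ℝ} (hF : Measurable F) (hB : ∀ y, ‖F y‖ ≤ B)
    (hF0 : ∀ y < 0, F y = 0) {s : ℂ} (hs : 0 < s.re) :
    DifferentiableAt ℂ (fun s : ℂ => ∫ y : ℝ, F y * cexp (-(s * y))) s := by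
  have hB0 : 0 ≤ B := (norm_nonneg _).trans (hB 0)
  set c : ℝ := s.re / 2 with hc
  have hc0 : 0 < c := by positivity
  have hball : ∀ z ∈ Metric.ball s c, c < z.re := by
    intro z hz
    have h := (abs_re_le_norm (z - s)).trans_lt (mem_ball_iff_norm.1 hz)
    rw [sub_re] at h
    linarith [(abs_lt.1 h).1]
  have h0 : ∀ᵐ y : ℝ, y ≠ 0 := by simp [ae_iff]
  have hnorm : ∀ z ∈ Metric.ball s c, ∀ y : ℝ, 0 < y → ‖cexp (-(z * y))‖ ≤ Real.exp (-c * y) := by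
    intro z hz y hy
    rw [Complex.norm_exp]
    refine Real.exp_le_exp.2 ?_
    have : (-(z * y)).re = -(z.re * y) := by simp
    rw [this]
    nlinarith [hball z hz]
  have hmeas : ∀ z : ℂ, AEStronglyMeasurable (fun y : ℝ => F y * cexp (-(z * y))) volume :=
    fun z => (hF.mul (by fun_prop)).aestronglyMeasurable
  have hint : ∀ k : ℝ, 0 < k → ∀ M : ℝ,
      Integrable ((Set.Ioi (0:ℝ)).indicator fun y : ℝ => M * Real.exp (-k * y)) := fun k hk M =>
    (integrable_indicator_iff measurableSet_Ioi).2 ((exp_neg_integrableOn_Ioi 0 hk).const_mul M)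
  refine (hasDerivAt_integral_of_dominated_loc_of_deriv_le
    (F' := fun z y => F y * (cexp (-(z * y)) * (-y)))
    (bound := (Set.Ioi (0:ℝ)).indicator fun y : ℝ => (B * (2 / c)) * Real.exp (-(c / 2) * y))
    (Metric.ball_mem_nhds s hc0) (.of_forall hmeas) ?_ ?_ ?_ (hint _ (by positivity) _)
    ?_).2.differentiableAt
  · refine (hint c hc0 B).mono' (hmeas s) ?_
    filter_upwards [h0] with y hy
    rcases lt_or_gt_of_ne hy with hy | hy
    · rw [hF0 y hy, zero_mul, norm_zero, Set.indicator_of_notMem (by simpa using hy.le)]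
    · rw [Set.indicator_of_mem (by simpa using hy), norm_mul]
      exact mul_le_mul (hB y) (hnorm s (Metric.mem_ball_self hc0) y hy) (norm_nonneg _) hB0
  · exact (hF.mul (by fun_prop)).aestronglyMeasurable
  · filter_upwards [h0] with y hy z hz
    rcases lt_or_gt_of_ne hy with hy | hy
    · rw [hF0 y hy, zero_mul, norm_zero, Set.indicator_of_notMem (by simpa using hy.le)]
    · rw [Set.indicator_of_mem (by simpa using hy), norm_mul, norm_mul, norm_neg, norm_real,
        Real.norm_of_nonneg hy.le, mul_assoc]
      refine mul_le_mul (hB y) ?_ (by positivity) hB0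
      have e1 : Real.exp (-c * y) = Real.exp (-(c / 2) * y) * Real.exp (-(c / 2) * y) := by
        rw [← Real.exp_add]; ring_nf
      have e2 : y * Real.exp (-(c / 2) * y) ≤ 2 / c := by
        have h1 := Real.add_one_le_exp (c / 2 * y)
        rw [neg_mul, Real.exp_neg, ← div_eq_mul_inv, div_le_div_iff₀ (Real.exp_pos _) hc0]
        nlinarith
      calc ‖cexp (-(z * y))‖ * y ≤ Real.exp (-c * y) * y := by gcongr; exact hnorm z hz y hy
        _ = (y * Real.exp (-(c / 2) * y)) * Real.exp (-(c / 2) * y) := by rw [e1]; ring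
        _ ≤ _ := by gcongr
  · refine .of_forall fun y z _ => ?_
    have h1 : HasDerivAt (fun z : ℂ => -(z * y)) (-y : ℂ) z := by
      have := ((hasDerivAt_id z).mul_const (y : ℂ)).neg
      rwa [one_mul] at this
    exact h1.cexp.const_mul _

/-- The reciprocal of `z` times the Dedekind zeta function, in terms of its completion. -/
def invW (r₁ r₂ : ℕ) (D : ℝ) (E : ℂ → ℂ) (z : ℂ) : ℂ :=
  (z - 1) * (D : ℂ) ^ (z / 2) * gammaFac r₁ r₂ z / E z

section
variable {r₁ r₂ : ℕ} {D A C B : ℝ} {E Z : ℂ → ℂ} {F : ℝ → ℂ}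

lemma ZetaData.laplace_identity (hD : 1 ≤ D) (hZ : ZetaData r₁ r₂ D A C E Z)
    (hM : MertensData Z F B) {z : ℂ} (hz : 1 / 2 < z.re) :
    E z * (D : ℂ) ^ (-z / 2) * (gammaFac r₁ r₂ z)⁻¹ *
      (∫ y : ℝ, F y * cexp (-((z - 1 / 2) * y))) = z - 1 := by
  have hD0 : (D : ℂ) ≠ 0 := by exact_mod_cast (by linarith : D ≠ 0)
  have hopen : IsOpen {z : ℂ | 1 / 2 < z.re} := isOpen_lt continuous_const continuous_re
  have hU : IsPreconnected {z : ℂ | 1 / 2 < z.re} := (convex_halfSpace_re_gt _).isPreconnected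
  have hdiff : DifferentiableOn ℂ (fun z => E z * (D : ℂ) ^ (-z / 2) * (gammaFac r₁ r₂ z)⁻¹ *
      (∫ y : ℝ, F y * cexp (-((z - 1 / 2) * y)))) {z : ℂ | 1 / 2 < z.re} := by
    intro z hz
    refine DifferentiableAt.differentiableWithinAt ?_
    refine ((hZ.diff z).mul ?_ |>.mul (differentiable_gammaFac_inv r₁ r₂ z)).mul ?_
    · exact DifferentiableAt.const_cpow (by fun_prop) (.inl hD0)
    · exact DifferentiableAt.comp (g := fun s : ℂ => ∫ y : ℝ, F y * cexp (-(s * y)))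
        (f := fun z : ℂ => z - 1 / 2) z (differentiableAt_laplace hM.meas hM.bound hM.zero (by
          have : (z - 1 / 2).re = z.re - 1 / 2 := by simp
          rw [this]; linarith [Set.mem_ofPred.1 hz])) (by fun_prop)
  have h2 : (2 : ℂ) ∈ {z : ℂ | 1 / 2 < z.re} := by
    simp only [Set.mem_ofPred_eq, re_ofNat]; norm_num
  refine (hdiff.analyticOnNhd hopen).eqOn_of_preconnected_of_eventuallyEq
    (g := fun z => z - 1) (DifferentiableOn.analyticOnNhd (by fun_prop) hopen) hU h2 ?_ hz
  have hnhds : {z : ℂ | 3 / 2 < z.re} ∈ 𝓝 (2 : ℂ) :=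
    (isOpen_lt continuous_const continuous_re).mem_nhds (by
      simp only [Set.mem_ofPred_eq, re_ofNat]; norm_num)
  filter_upwards [hnhds] with z hz
  have hz : 3 / 2 < z.re := hz
  have hγ := gammaFac_ne_zero r₁ r₂ (z := z) (by linarith)
  have hZ0 : Z z ≠ 0 := fun h => by
    have := (hZ.bounds z hz.le).1
    rw [h, norm_zero, mul_zero] at this
    linarith
  have hz0 : z ≠ 0 := fun h => by rw [h, zero_re] at hz; linarith
  have hDz : (D : ℂ) ^ (z / 2) * (D : ℂ) ^ (-z / 2) = 1 := by
    rw [← cpow_add _ _ hD0, neg_div, add_neg_cancel, cpow_zero]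
  rw [hM.laplace z hz.le, hZ.eq z (by linarith)]
  calc _ = (z - 1) * ((D : ℂ) ^ (z / 2) * (D : ℂ) ^ (-z / 2)) *
        (gammaFac r₁ r₂ z * (gammaFac r₁ r₂ z)⁻¹) * (z * Z z * (1 / (z * Z z))) := by ring
    _ = z - 1 := by
        rw [hDz, mul_inv_cancel₀ hγ, mul_one_div_cancel (mul_ne_zero hz0 hZ0)]; ring

lemma ZetaData.ne_zero (hD : 1 ≤ D) (hZ : ZetaData r₁ r₂ D A C E Z) (hM : MertensData Z F B)
    {z : ℂ} (hz : z.re ≠ 1 / 2) : E z ≠ 0 := by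
  have key : ∀ z : ℂ, 1 / 2 < z.re → E z ≠ 0 := by
    intro z hz h
    have h1 := hZ.laplace_identity hD hM hz
    rw [h] at h1
    simp only [zero_mul] at h1
    obtain ⟨e, he, h2⟩ := hZ.one_pos
    rw [← sub_eq_zero.1 h1.symm, h] at h2
    exact he.ne (by exact_mod_cast h2)
  rcases lt_or_gt_of_ne hz with h | h
  · rw [← hZ.symm]
    exact key _ (by simp; linarith)
  · exact key z h

lemma ZetaData.laplace_eq (hD : 1 ≤ D) (hZ : ZetaData r₁ r₂ D A C E Z)
    (hM : MertensData Z F B) {z : ℂ} (hz : 1 / 2 < z.re) :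
    ∫ y : ℝ, F y * cexp (-((z - 1 / 2) * y)) = invW r₁ r₂ D E z := by
  have hD0 : (D : ℂ) ≠ 0 := by exact_mod_cast (by linarith : D ≠ 0)
  have h := hZ.laplace_identity hD hM hz
  have hE := hZ.ne_zero hD hM hz.ne'
  have hγ := gammaFac_ne_zero r₁ r₂ (z := z) (by linarith)
  have hDz : (D : ℂ) ^ (z / 2) * (D : ℂ) ^ (-z / 2) = 1 := by
    rw [← cpow_add _ _ hD0, neg_div, add_neg_cancel, cpow_zero]
  rw [invW, eq_div_iff hE, ← h]
  set J := ∫ y : ℝ, F y * cexp (-((z - 1 / 2) * y))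
  calc J * E z = J * E z * ((D : ℂ) ^ (z / 2) * (D : ℂ) ^ (-z / 2)) *
        (gammaFac r₁ r₂ z * (gammaFac r₁ r₂ z)⁻¹) := by rw [hDz, mul_inv_cancel₀ hγ]; ring
    _ = _ := by ring

lemma ZetaData.norm_invW_le (hD : 1 ≤ D) (hZ : ZetaData r₁ r₂ D A C E Z)
    (hM : MertensData Z F B) {z : ℂ} (hz : 1 / 2 < z.re) :
    ‖invW r₁ r₂ D E z‖ ≤ B / (z.re - 1 / 2) := by
  rw [← hZ.laplace_eq hD hM hz]
  have : (z - 1 / 2).re = z.re - 1 / 2 := by simp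
  rw [← this]
  exact norm_laplace_le hM.bound hM.zero (by rw [this]; linarith)

lemma ZetaData.norm_invW_reflect (hD : 1 ≤ D) (hZ : ZetaData r₁ r₂ D A C E Z) (z : ℂ) :
    ‖invW r₁ r₂ D E z‖ * (‖z‖ * ‖gammaFac r₁ r₂ (1 - z)‖) =
      D ^ (z.re - 1 / 2) * ‖1 - z‖ * ‖gammaFac r₁ r₂ z‖ * ‖invW r₁ r₂ D E (1 - z)‖ := by
  have hD0 : 0 < D := by linarith
  rw [invW, invW, hZ.symm]
  simp only [norm_div, norm_mul]
  rw [norm_cpow_eq_rpow_re_of_pos hD0, norm_cpow_eq_rpow_re_of_pos hD0]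
  have e1 : (z / 2).re = (z.re - 1 / 2) + ((1 - z) / 2).re := by
    rw [show z / 2 = z / ((2:ℝ):ℂ) by norm_num, show (1 - z) / 2 = (1 - z) / ((2:ℝ):ℂ) by norm_num,
      div_ofReal_re, div_ofReal_re, sub_re, one_re]
    ring
  rw [e1, Real.rpow_add hD0, norm_sub_rev z 1, show 1 - z - 1 = -z by ring, norm_neg]
  ring

/-- The reflected bound on the left of the critical line. -/
lemma ZetaData.exists_norm_invW_left_le (r₁ r₂ : ℕ) : ∃ K : ℝ, 1 ≤ K ∧
    ∀ {D A C B : ℝ} {E Z : ℂ → ℂ} {F : ℝ → ℂ}, 1 ≤ D → ZetaData r₁ r₂ D A C E Z →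
      MertensData Z F B → ∀ z : ℂ, 1 / 4 ≤ z.re → z.re < 1 / 2 →
      ‖invW r₁ r₂ D E z‖ ≤ K * B * (1 + |z.im|) ^ (r₁ + r₂) / |z.re - 1 / 2| := by
  obtain ⟨K, hK, h⟩ := exists_norm_gammaFac_le r₁ r₂
  refine ⟨5 * K, by linarith, fun {D A C B E Z F} hD hZ hM z hz hz' => ?_⟩
  have hB0 : 0 ≤ B := (norm_nonneg _).trans (hM.bound 0)
  have h1 := hZ.norm_invW_reflect hD z
  have hre : (1 - z).re = 1 - z.re := by simp
  have h2 := hZ.norm_invW_le hD hM (z := 1 - z) (by rw [hre]; linarith)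
  have hg : 0 < ‖gammaFac r₁ r₂ (1 - z)‖ :=
    norm_pos_iff.2 (gammaFac_ne_zero r₁ r₂ (by rw [hre]; linarith))
  have hzn : 1 / 4 ≤ ‖z‖ := hz.trans ((le_abs_self _).trans (abs_re_le_norm z))
  have hz1 : ‖1 - z‖ ≤ 5 * ‖z‖ := by
    have := norm_sub_le 1 z
    rw [norm_one] at this
    linarith
  have hab : (1 - z).re - 1 / 2 = |z.re - 1 / 2| := by
    rw [hre, abs_of_neg (by linarith)]; ring
  rw [hab] at h2
  have hpos : 0 < |z.re - 1 / 2| := abs_pos.2 (by linarith)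
  have hDle : D ^ (z.re - 1 / 2) ≤ 1 := Real.rpow_le_one_of_one_le_of_nonpos hD (by linarith)
  have h3 : ‖invW r₁ r₂ D E z‖ * (‖z‖ * ‖gammaFac r₁ r₂ (1 - z)‖) ≤
      (5 * K * B * (1 + |z.im|) ^ (r₁ + r₂) / |z.re - 1 / 2|) *
        (‖z‖ * ‖gammaFac r₁ r₂ (1 - z)‖) := by
    rw [h1]
    calc _ ≤ 1 * (5 * ‖z‖) * (K * (1 + |z.im|) ^ (r₁ + r₂) * ‖gammaFac r₁ r₂ (1 - z)‖) *
          (B / |z.re - 1 / 2|) := by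
          gcongr
          exact h z hz hz'.le
      _ = _ := by ring
  exact le_of_mul_le_mul_right h3 (by positivity)

/-- The zeta function in the coordinate `s = z - 1/2`, in the form used for Ingham's theorem. -/
def zetaW (r₁ r₂ : ℕ) (D : ℝ) (E : ℂ → ℂ) (s : ℂ) : ℂ :=
  E (s + 1 / 2) * (D : ℂ) ^ (-(s + 1 / 2) / 2) * (gammaFac r₁ r₂ (s + 1 / 2))⁻¹ / (s + 1 / 2 - 1)

lemma one_div_zetaW (hD : 1 ≤ D) (s : ℂ) :
    1 / zetaW r₁ r₂ D E s = invW r₁ r₂ D E (s + 1 / 2) := by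
  have hD0 : (D : ℂ) ≠ 0 := by exact_mod_cast (by linarith : D ≠ 0)
  rw [zetaW, invW, neg_div, cpow_neg, one_div, inv_div, div_eq_mul_inv, div_eq_mul_inv, mul_inv,
    mul_inv, inv_inv, inv_inv]
  ring

lemma inghamData (r₁ r₂ : ℕ) (hD : 1 ≤ D) (hZ : ZetaData r₁ r₂ D A C E Z)
    (hM : MertensData Z F B) : ∃ C', InghamData F (zetaW r₁ r₂ D E) B C' (r₁ + r₂) := by
  obtain ⟨K, hK, h⟩ := ZetaData.exists_norm_invW_left_le r₁ r₂
  have hD0 : (D : ℂ) ≠ 0 := by exact_mod_cast (by linarith : D ≠ 0)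
  have hre : ∀ s : ℂ, (s + 1 / 2).re = s.re + 1 / 2 := fun s => by simp
  have him : ∀ s : ℂ, (s + 1 / 2).im = s.im := fun s => by simp
  have hne1 : ∀ s : ℂ, |s.re| < 1 / 2 → s + 1 / 2 - 1 ≠ 0 := by
    intro s hs h
    have := congrArg Complex.re h
    rw [sub_re, hre, one_re, zero_re] at this
    have h2 := (abs_lt.1 hs).2
    linarith
  refine ⟨K * B, hM.meas, hM.bound, hM.zero, hM.limsup, ?_, ?_, ?_, ?_⟩
  · intro s hs
    have hopen : IsOpen {s : ℂ | |s.re| < 1 / 2} :=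
      isOpen_lt (continuous_abs.comp continuous_re) continuous_const
    refine DifferentiableOn.analyticAt (s := {s : ℂ | |s.re| < 1 / 2}) ?_ (hopen.mem_nhds hs)
    intro s hs
    refine DifferentiableAt.differentiableWithinAt ?_
    have hE : DifferentiableAt ℂ (fun s : ℂ => E (s + 1 / 2)) s :=
      (hZ.diff.comp (by fun_prop : Differentiable ℂ fun s : ℂ => s + 1 / 2)) s
    have hG : DifferentiableAt ℂ (fun s : ℂ => (gammaFac r₁ r₂ (s + 1 / 2))⁻¹) s :=
      ((differentiable_gammaFac_inv r₁ r₂).comp (by fun_prop : Differentiable ℂ fun s : ℂ => s +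
          1 / 2)) s
    exact ((hE.mul (DifferentiableAt.const_cpow (by fun_prop) (.inl hD0))).mul hG).div
      (by fun_prop) (hne1 s hs)
  · intro s hs hs'
    have hlt := abs_lt.1 hs'
    refine div_ne_zero (mul_ne_zero (mul_ne_zero ?_ ?_) (inv_ne_zero ?_)) (hne1 s hs')
    · exact hZ.ne_zero hD hM (by rw [hre]; intro h; exact hs (by linarith))
    · simp [cpow_eq_zero_iff, hD0]
    · exact gammaFac_ne_zero r₁ r₂ (by rw [hre]; linarith)
  · intro s hs hs'
    rw [one_div_zetaW hD, ← hZ.laplace_eq hD hM (by rw [hre]; linarith)]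
    simp
  · intro s hs hs'
    rw [one_div_zetaW hD]
    have := h hD hZ hM (s + 1 / 2) (by rw [hre]; linarith) (by rw [hre]; linarith)
    rwa [hre, him, add_sub_cancel_right] at this

end
end

section
/-- `invW` with its pole at the origin removed. -/
def regY (r₁ r₂ : ℕ) (D : ℝ) (E : ℂ → ℂ) (z : ℂ) : ℂ :=
  (z - 1) * (D : ℂ) ^ (z / 2) * gammaReg r₁ r₂ z / E z

lemma continuous_circleIntegral_gauss {g : ℂ → ℂ} {ρ : ℝ} (hρ : 0 ≤ ρ)
    (hg : ContinuousOn g (Metric.sphere 0 ρ)) :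
    Continuous fun p : ℝ × ℝ => ∮ z in C(0, ρ),
      g z * (cexp (p.1 * (z - 1 / 2) ^ 2) * cexp ((z - 1 / 2) * p.2)) := by
  unfold circleIntegral
  refine intervalIntegral.continuous_parametric_intervalIntegral_of_continuous' ?_ _ _
  have h1 : Continuous fun θ : ℝ => g (circleMap 0 ρ θ) :=
    hg.comp_continuous (continuous_circleMap 0 ρ) fun θ => circleMap_mem_sphere 0 hρ θ
  have h2 : Continuous fun θ : ℝ => deriv (circleMap 0 ρ) θ := by
    simp only [deriv_circleMap]
    exact (continuous_circleMap 0 ρ).mul continuous_const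
  have hc : Continuous fun p : (ℝ × ℝ) × ℝ => circleMap 0 ρ p.2 :=
    (continuous_circleMap 0 ρ).comp continuous_snd
  refine (h2.comp continuous_snd).smul ((h1.comp continuous_snd).mul ?_)
  have a1 : Continuous fun p : (ℝ × ℝ) × ℝ => (p.1.1 : ℂ) := by fun_prop
  have a2 : Continuous fun p : (ℝ × ℝ) × ℝ => (p.1.2 : ℂ) := by fun_prop
  exact (a1.mul ((hc.sub continuous_const).pow 2)).cexp.mul
    ((hc.sub continuous_const).mul a2).cexp

/-- Convolution with the heat kernel recovers a bounded function at points of continuity. -/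
lemma tendsto_heat_convolution {F : ℝ → ℂ} {B : ℝ} (hF : Measurable F) (hB : ∀ y, ‖F y‖ ≤ B)
    {u : ℝ} (hu : ContinuousAt F u) :
    Tendsto (fun ε : ℝ => ∫ v, F (u - v) * (heatKernel (ε ^ 2) v : ℂ)) (𝓝[>] 0) (𝓝 (F u)) := by
  obtain ⟨hc, h0, hi, -, h1⟩ := heatKernel_props one_pos
  have hB0 : 0 ≤ B := (norm_nonneg _).trans (hB 0)
  have hker : ∀ ε : ℝ, 0 < ε → ∀ w, ε * heatKernel (ε ^ 2) (ε * w) = heatKernel 1 w := by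
    intro ε hε w
    have e1 : Real.sqrt (4 * Real.pi * ε ^ 2) = Real.sqrt (4 * Real.pi * 1) * ε := by
      rw [mul_one, Real.sqrt_mul (by positivity), Real.sqrt_sq hε.le]
    have e2 : (ε * w) ^ 2 / (4 * ε ^ 2) = w ^ 2 / (4 * 1) := by field_simp
    rw [heatKernel, heatKernel, e1, e2, mul_inv]
    field_simp
  have hsub : ∀ ε : ℝ, 0 < ε → ∫ v, F (u - v) * (heatKernel (ε ^ 2) v : ℂ) =
      ∫ w, F (u - ε * w) * (heatKernel 1 w : ℂ) := by
    intro ε hε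
    have h := MeasureTheory.Measure.integral_comp_mul_left
      (fun v => F (u - v) * (heatKernel (ε ^ 2) v : ℂ)) ε
    have h' : ∫ v, F (u - v) * (heatKernel (ε ^ 2) v : ℂ) =
        ε • ∫ w, F (u - ε * w) * (heatKernel (ε ^ 2) (ε * w) : ℂ) := by
      rw [h, abs_of_pos (inv_pos.2 hε), smul_smul, mul_inv_cancel₀ hε.ne', one_smul]
    rw [h', ← integral_smul]
    refine integral_congr_ae (ae_of_all _ fun w => ?_)
    simp only [real_smul]
    rw [← hker ε hε w]
    push_cast
    ring
  have hlim : Tendsto (fun ε : ℝ => ∫ w, F (u - ε * w) * (heatKernel 1 w : ℂ)) (𝓝[>] 0)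
      (𝓝 (∫ w, F u * (heatKernel 1 w : ℂ))) := by
    refine MeasureTheory.tendsto_integral_filter_of_dominated_convergence
      (fun w => B * heatKernel 1 w) ?_ ?_ (hi.const_mul B) ?_
    · refine .of_forall fun ε => ?_
      exact ((hF.comp (by fun_prop)).mul
        (measurable_ofReal.comp hc.measurable)).aestronglyMeasurable
    · refine .of_forall fun ε => ae_of_all _ fun w => ?_
      rw [norm_mul, norm_real, Real.norm_of_nonneg (h0 w)]
      exact mul_le_mul_of_nonneg_right (hB _) (h0 w)
    · refine ae_of_all _ fun w => Tendsto.mul_const _ ?_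
      have : Tendsto (fun ε : ℝ => u - ε * w) (𝓝[>] 0) (𝓝 u) := by
        have : Tendsto (fun ε : ℝ => u - ε * w) (𝓝 0) (𝓝 (u - 0 * w)) :=
          Continuous.tendsto (by fun_prop) 0
        rw [zero_mul, sub_zero] at this
        exact this.mono_left nhdsWithin_le_nhds
      exact hu.tendsto.comp this
  have hval : ∫ w, F u * (heatKernel 1 w : ℂ) = F u := by
    rw [integral_const_mul, integral_complex_ofReal, h1]; simp
  rw [hval] at hlim
  refine hlim.congr' ?_
  filter_upwards [self_mem_nhdsWithin] with ε hε using (hsub ε hε).symm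

section
variable {r₁ r₂ : ℕ} {D A C B : ℝ} {E Z : ℂ → ℂ} {F : ℝ → ℂ}

lemma invW_eq_regY {z : ℂ} (hz : z ≠ 0) :
    invW r₁ r₂ D E z = regY r₁ r₂ D E z / z ^ (r₁ + r₂) := by
  rw [invW, regY, gammaReg_eq r₁ r₂ hz]
  field_simp

lemma ZetaData.differentiableAt_regY (hD : 1 ≤ D) (hZ : ZetaData r₁ r₂ D A C E Z)
    (hM : MertensData Z F B) {z : ℂ} (h1 : -1 < z.re) (h2 : z.re < 1 / 2) :
    DifferentiableAt ℂ (regY r₁ r₂ D E) z := by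
  have hD0 : (D : ℂ) ≠ 0 := by exact_mod_cast (by linarith : D ≠ 0)
  refine DifferentiableAt.div (((by fun_prop : DifferentiableAt ℂ (fun z : ℂ => z - 1) z).mul
      ?_).mul
    (differentiableAt_gammaReg r₁ r₂ h1)) (hZ.diff z) (hZ.ne_zero hD hM h2.ne)
  exact DifferentiableAt.const_cpow (by fun_prop) (.inl hD0)

lemma ZetaData.exists_norm_regY_le (hD : 1 ≤ D) (hZ : ZetaData r₁ r₂ D A C E Z)
    (hM : MertensData Z F B) : ∃ K : ℝ, 0 ≤ K ∧ ∀ z : ℂ, -(1 / 2) ≤ z.re → z.re ≤ 1 / 4 →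
      ‖regY r₁ r₂ D E z‖ ≤ K * (1 + |z.im|) ^ (r₁ + r₂) := by
  obtain ⟨K, hK, h⟩ := exists_norm_gammaReg_le r₁ r₂
  have hB0 : 0 ≤ B := (norm_nonneg _).trans (hM.bound 0)
  have hD0 : 0 < D := by linarith
  have hcpt : IsCompact (Set.Icc (-(1 / 2) : ℝ) (1 / 4) ×ℂ Set.Icc (-1 : ℝ) 1) :=
    isCompact_Icc.reProdIm isCompact_Icc
  obtain ⟨M, hM'⟩ := hcpt.exists_bound_of_continuousOn (f := regY r₁ r₂ D E) fun z hz =>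
    (hZ.differentiableAt_regY hD hM (by linarith [hz.1.1]) (by linarith [hz.1.2])
      ).continuousAt.continuousWithinAt
  refine ⟨max M (2 * K * (4 * B)), le_max_of_le_right (by positivity), fun z hz hz' => ?_⟩
  have hpow : 1 ≤ (1 + |z.im|) ^ (r₁ + r₂) := one_le_pow₀ (by linarith [abs_nonneg z.im])
  rcases le_total |z.im| 1 with him | him
  · calc _ ≤ M := hM' z ⟨⟨hz, hz'⟩, abs_le.1 him⟩
      _ ≤ max M (2 * K * (4 * B)) := le_max_left _ _
      _ ≤ _ := le_mul_of_one_le_right (le_max_of_le_right (by positivity)) hpow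
  have hre : (1 - z).re = 1 - z.re := by simp
  have h2 := hZ.norm_invW_le hD hM (z := 1 - z) (by rw [hre]; linarith)
  have hg : 0 < ‖gammaFac r₁ r₂ (1 - z)‖ :=
    norm_pos_iff.2 (gammaFac_ne_zero r₁ r₂ (by rw [hre]; linarith))
  have hzn : 1 ≤ ‖z‖ := him.trans (abs_im_le_norm z)
  have hE : 0 < ‖E z‖ := norm_pos_iff.2 (hZ.ne_zero hD hM (by linarith))
  have h2' : ‖invW r₁ r₂ D E (1 - z)‖ ≤ 4 * B := by
    refine h2.trans ?_
    rw [hre, div_le_iff₀ (by linarith)]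
    nlinarith
  have hz1 : ‖z - 1‖ ≤ 2 * ‖z‖ := by
    have := norm_sub_le z 1
    rw [norm_one] at this
    linarith
  rw [invW, hZ.symm, norm_div, norm_mul, norm_mul, show 1 - z - 1 = -z by ring, norm_neg,
    norm_cpow_eq_rpow_re_of_pos hD0, div_le_iff₀ hE] at h2'
  rw [regY, norm_div, norm_mul, norm_mul, norm_cpow_eq_rpow_re_of_pos hD0, div_le_iff₀ hE]
  have e1 : (z / 2).re = z.re / 2 := by
    rw [show z / 2 = z / ((2:ℝ):ℂ) by norm_num, div_ofReal_re]
  have e2 : ((1 - z) / 2).re = (1 - z.re) / 2 := by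
    rw [show (1 - z) / 2 = (1 - z) / ((2:ℝ):ℂ) by norm_num, div_ofReal_re, hre]
  rw [e2] at h2'
  rw [e1]
  have hDle : D ^ (z.re / 2) ≤ D ^ ((1 - z.re) / 2) :=
    Real.rpow_le_rpow_of_exponent_le hD (by linarith)
  calc ‖z - 1‖ * D ^ (z.re / 2) * ‖gammaReg r₁ r₂ z‖
      ≤ (2 * ‖z‖) * D ^ ((1 - z.re) / 2) *
          (K * (1 + |z.im|) ^ (r₁ + r₂) * ‖gammaFac r₁ r₂ (1 - z)‖) := by
        gcongr
        exact h z hz hz'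
    _ = 2 * K * (1 + |z.im|) ^ (r₁ + r₂) *
          (‖z‖ * D ^ ((1 - z.re) / 2) * ‖gammaFac r₁ r₂ (1 - z)‖) := by ring
    _ ≤ 2 * K * (1 + |z.im|) ^ (r₁ + r₂) * (4 * B * ‖E z‖) := by gcongr
    _ = 2 * K * (4 * B) * (1 + |z.im|) ^ (r₁ + r₂) * ‖E z‖ := by ring
    _ ≤ _ := by gcongr; exact le_max_right _ _

/-- The smoothed reciprocal on the far left line. -/
lemma ZetaData.norm_invW_left_le (h : ¬(r₁ = 0 ∧ r₂ = 0)) (hD : 1 ≤ D)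
    (hZ : ZetaData r₁ r₂ D A C E Z) (hM : MertensData Z F B) (t : ℝ) :
    ‖invW r₁ r₂ D E (-(1 / 2) + t * I)‖ ≤
      4 * (4 * (2 * Real.pi) ^ 2) ^ (r₁ + r₂) * C / D / (1 + t ^ 2) := by
  set z : ℂ := -(1 / 2) + t * I with hz
  have hre : z.re = -(1 / 2) := by simp [hz]
  have hre1 : (1 - z).re = 3 / 2 := by rw [sub_re, hre, one_re]; norm_num
  have hD0 : 0 < D := by linarith
  have h1 := hZ.norm_invW_reflect hD z
  have hg : 0 < ‖gammaFac r₁ r₂ (1 - z)‖ :=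
    norm_pos_iff.2 (gammaFac_ne_zero r₁ r₂ (by rw [hre1]; norm_num))
  have hb := (hZ.bounds (1 - z) hre1.ge).1
  have hZ0 : 0 < ‖Z (1 - z)‖ := by
    rcases (norm_nonneg (Z (1 - z))).eq_or_lt with h | h
    · rw [← h, mul_zero] at hb; linarith
    · exact h
  have hC0 : 0 < C := by
    by_contra hC
    push Not at hC
    nlinarith
  have hz1 : 0 < ‖1 - z‖ := by
    refine norm_pos_iff.2 fun h => ?_
    rw [h, zero_re] at hre1; norm_num at hre1
  have hzn : ‖z‖ ^ 2 = 1 / 4 + t ^ 2 := by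
    rw [← normSq_eq_norm_sq, normSq_apply]
    simp [hz]
    ring
  have hzp : 0 < ‖z‖ := by
    rcases (norm_nonneg z).eq_or_lt with h | h
    · rw [← h] at hzn; nlinarith [sq_nonneg t]
    · exact h
  have h2 : ‖1 - z‖ * ‖invW r₁ r₂ D E (1 - z)‖ ≤ C := by
    rw [← hZ.laplace_eq hD hM (by rw [hre1]; norm_num), hM.laplace _ hre1.ge, norm_div, norm_mul,
      norm_one, mul_one_div, div_le_iff₀ (by positivity)]
    nlinarith
  have hDD : D ^ (z.re - 1 / 2) = D⁻¹ := by
    rw [hre, show (-(1 / 2) - 1 / 2 : ℝ) = -1 by norm_num, Real.rpow_neg_one]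
  have hgl := norm_gammaFac_left (t := t) h
  rw [← hz] at hgl
  set M := (4 * (2 * Real.pi) ^ 2) ^ (r₁ + r₂) with hMdef
  have hM0 : 0 < M := by positivity
  have h3 : ‖invW r₁ r₂ D E z‖ * (‖z‖ * ‖gammaFac r₁ r₂ (1 - z)‖) ≤
      (M * C / D / ‖z‖ ^ 2) * (‖z‖ * ‖gammaFac r₁ r₂ (1 - z)‖) := by
    rw [h1, hDD]
    calc D⁻¹ * ‖1 - z‖ * ‖gammaFac r₁ r₂ z‖ * ‖invW r₁ r₂ D E (1 - z)‖
        = D⁻¹ * (‖1 - z‖ * ‖invW r₁ r₂ D E (1 - z)‖) * ‖gammaFac r₁ r₂ z‖ := by ring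
      _ ≤ D⁻¹ * C * (M * (1 / ‖z‖) * ‖gammaFac r₁ r₂ (1 - z)‖) := by gcongr
      _ = _ := by field_simp
  refine (le_of_mul_le_mul_right h3 (by positivity)).trans ?_
  rw [hzn, show 4 * M * C / D / (1 + t ^ 2) = M * C / D / ((1 + t ^ 2) / 4) by field_simp]
  gcongr
  linarith [sq_nonneg t]

/-- The effect of the pole of the archimedean factor at the origin. -/
lemma ZetaData.norm_smoothed_sub_residue_le (h : ¬(r₁ = 0 ∧ r₂ = 0)) (hD : 1 ≤ D)
    (hZ : ZetaData r₁ r₂ D A C E Z) (hM : MertensData Z F B) {ρ : ℝ} (hρ : 0 < ρ) (hρ' : ρ < 1 / 4)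
    {δ : ℝ} (hδ : 0 < δ) (hδ1 : δ ≤ 1) {u : ℝ} (hu : 0 ≤ u) :
    ‖(∫ v, F (u - v) * (heatKernel δ v : ℂ)) - (2 * Real.pi * I)⁻¹ * ∮ z in C(0, ρ),
      regY r₁ r₂ D E z / z ^ (r₁ + r₂) * (cexp (δ * (z - 1 / 2) ^ 2) * cexp ((z - 1 / 2) * u))‖ ≤
      1 + 6 * (4 * (2 * Real.pi) ^ 2) ^ (r₁ + r₂) * C / D := by
  obtain ⟨C', hI⟩ := inghamData r₁ r₂ hD hZ hM
  have hax := hI.norm_axisPart_le_one hδ u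
  obtain ⟨K, hK0, hK⟩ := hZ.exists_norm_regY_le hD hM
  obtain ⟨G, hG0, hG⟩ := exists_poly_mul_gauss_le (r₁ + r₂) hδ
  set g : ℂ → ℂ := fun z => cexp (δ * (z - 1 / 2) ^ 2) * cexp ((z - 1 / 2) * u) with hg
  have hgn : ∀ z : ℂ, ‖g z‖ = Real.exp (δ * ((z.re - 1 / 2) ^ 2 - z.im ^ 2)) *
      Real.exp ((z.re - 1 / 2) * u) := by
    intro z
    rw [hg, norm_mul, Complex.norm_exp, Complex.norm_exp]
    have e1 : (z - 1 / 2).re = z.re - 1 / 2 := by simp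
    have e2 : (z - 1 / 2).im = z.im := by simp
    rw [re_ofReal_mul, re_mul_ofReal, pow_two, mul_re, e1, e2]
    ring_nf
  set Y : ℂ → ℂ := fun z => regY r₁ r₂ D E z * g z with hY
  have hjump := lineIntegral_jump (a := 1 / 4) (b := 1 / 2) (by norm_num) (by norm_num) hρ hρ'
    (by linarith) (r₁ + r₂) Y (fun z h1 h2 => by
      refine (hZ.differentiableAt_regY hD hM (by linarith) (by linarith)).mul ?_
      rw [hg]; fun_prop) ?_
  swap
  · refine ⟨K * Real.exp 1 * G, fun z h1 h2 => ?_⟩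
    have h3 : ‖g z‖ ≤ Real.exp 1 * Real.exp (-δ * z.im ^ 2) := by
      rw [hgn]
      have : Real.exp ((z.re - 1 / 2) * u) ≤ 1 :=
        Real.exp_le_one_iff.2 (mul_nonpos_of_nonpos_of_nonneg (by linarith) hu)
      calc _ ≤ Real.exp (δ * ((z.re - 1 / 2) ^ 2 - z.im ^ 2)) * 1 := by gcongr
        _ = Real.exp (δ * (z.re - 1 / 2) ^ 2) * Real.exp (-δ * z.im ^ 2) := by
            rw [mul_one, ← Real.exp_add]; ring_nf
        _ ≤ _ := by
            gcongr
            nlinarith [mul_nonneg (show 0 ≤ z.re + 1 / 2 by linarith)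
                (show 0 ≤ 3 / 2 - z.re by linarith)]
    calc ‖Y z‖ = ‖regY r₁ r₂ D E z‖ * ‖g z‖ := norm_mul _ _
      _ ≤ (K * (1 + |z.im|) ^ (r₁ + r₂)) * (Real.exp 1 * Real.exp (-δ * z.im ^ 2)) := by
          gcongr; exact hK z h1 h2
      _ = K * Real.exp 1 * ((1 + |z.im|) ^ (r₁ + r₂) * Real.exp (-δ * z.im ^ 2)) := by ring
      _ ≤ K * Real.exp 1 * (G / (1 + z.im ^ 2)) := by gcongr; exact hG _
      _ = _ := by ring
  have hpi : (2 * Real.pi : ℂ) ≠ 0 := by exact_mod_cast (by positivity : 2 * Real.pi ≠ 0)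
  have hnpi : ‖(2 * Real.pi : ℂ)⁻¹‖ = (2 * Real.pi)⁻¹ := by
    rw [show (2 * Real.pi : ℂ) = ((2 * Real.pi : ℝ) : ℂ) by push_cast; rfl, ← ofReal_inv,
      norm_real, Real.norm_of_nonneg (by positivity)]
  have hleft : InghamData.leftPart (zetaW r₁ r₂ D E) δ u =
      (2 * Real.pi : ℂ)⁻¹ * lineIntegral (fun z => Y z / z ^ (r₁ + r₂)) (1 / 4) := by
    rw [InghamData.leftPart, lineTransform, lineIntegral, lineIntegral]
    congr 1
    refine integral_congr_ae (ae_of_all _ fun t => ?_)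
    have e : ((-(1 / 4) : ℝ) : ℂ) + t * I + 1 / 2 = ((1 / 4 : ℝ) : ℂ) + t * I := by
      push_cast; ring
    have e' : ((-(1 / 4) : ℝ) : ℂ) + t * I = ((1 / 4 : ℝ) : ℂ) + t * I - 1 / 2 := by
      push_cast; ring
    simp only [InghamData.reg]
    rw [one_div_zetaW hD, e, invW_eq_regY (ne_zero_of_line (by norm_num) t), e', hY, hg]
    ring
  have hfar : ‖lineIntegral (fun z => Y z / z ^ (r₁ + r₂)) (-(1 / 2))‖ ≤
      12 * (4 * (2 * Real.pi) ^ 2) ^ (r₁ + r₂) * C / D * Real.pi := by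
    refine norm_lineIntegral_le fun t => ?_
    have e : ((-(1 / 2) : ℝ) : ℂ) + t * I = -(1 / 2) + t * I := by push_cast; ring
    have h1 := hZ.norm_invW_left_le h hD hM t
    have hne : (-(1 / 2) + t * I : ℂ) ≠ 0 := by
      rw [← e]; exact ne_zero_of_line (by norm_num) t
    rw [e, hY]
    rw [show ∀ w : ℂ, regY r₁ r₂ D E w * g w / w ^ (r₁ + r₂) =
      regY r₁ r₂ D E w / w ^ (r₁ + r₂) * g w from fun w => by ring, ← invW_eq_regY hne, norm_mul]
    have h2 : ‖g (-(1 / 2) + t * I)‖ ≤ 3 := by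
      rw [hgn]
      have e1 : (-(1 / 2) + t * I : ℂ).re = -(1 / 2) := by simp
      rw [e1]
      have a1 : Real.exp ((-(1 / 2) - 1 / 2) * u) ≤ 1 :=
        Real.exp_le_one_iff.2 (by linarith)
      have a2 : Real.exp (δ * ((-(1 / 2) - 1 / 2) ^ 2 - (-(1 / 2) + t * I : ℂ).im ^ 2)) ≤ 3 := by
        refine (Real.exp_le_exp.2 (?_ : _ ≤ (1:ℝ))).trans
          (Real.exp_one_lt_d9.le.trans (by norm_num))
        nlinarith [mul_nonneg hδ.le (sq_nonneg (-(1 / 2) + t * I : ℂ).im)]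
      calc _ ≤ 3 * (1:ℝ) := by gcongr
        _ = 3 := mul_one _
    calc _ ≤ 4 * (4 * (2 * Real.pi) ^ 2) ^ (r₁ + r₂) * C / D / (1 + t ^ 2) * 3 :=
          mul_le_mul h1 h2 (norm_nonneg _) ((norm_nonneg _).trans h1)
      _ = _ := by ring
  set L₁ := lineIntegral (fun z => Y z / z ^ (r₁ + r₂)) (1 / 4)
  set L₂ := lineIntegral (fun z => Y z / z ^ (r₁ + r₂)) (-(1 / 2))
  have hcirc : (∮ z in C(0, ρ), regY r₁ r₂ D E z / z ^ (r₁ + r₂) * g z) = I * (L₁ - L₂) := by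
    rw [hjump]
    congr 1
    funext z
    rw [hY]; ring
  change ‖_ - (2 * Real.pi * I)⁻¹ * ∮ z in C(0, ρ), regY r₁ r₂ D E z / z ^ (r₁ + r₂) * g z‖ ≤ _
  rw [hcirc]
  have hsplit : (∫ v, F (u - v) * (heatKernel δ v : ℂ)) - (2 * Real.pi * I)⁻¹ * (I * (L₁ - L₂)) =
      InghamData.axisPart F (zetaW r₁ r₂ D E) δ u + (2 * Real.pi : ℂ)⁻¹ * L₂ := by
    rw [InghamData.axisPart, hleft, mul_inv (2 * Real.pi : ℂ) I, mul_assoc,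
        inv_mul_cancel_left₀ I_ne_zero]
    ring
  rw [hsplit]
  refine (norm_add_le _ _).trans (add_le_add hax ?_)
  rw [norm_mul, hnpi]
  calc _ ≤ (2 * Real.pi)⁻¹ * (12 * (4 * (2 * Real.pi) ^ 2) ^ (r₁ + r₂) * C / D * Real.pi) := by
        gcongr
    _ = _ := by field_simp; ring

/-- The inequality at the origin obtained by letting the smoothing and `u` tend to zero. -/
theorem ZetaData.norm_one_sub_residue_le (h : ¬(r₁ = 0 ∧ r₂ = 0)) (hD : 1 ≤ D)
    (hZ : ZetaData r₁ r₂ D A C E Z) (hM : MertensData Z F B) {ρ : ℝ} (hρ : 0 < ρ)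
    (hρ' : ρ < 1 / 4) :
    ‖1 - (2 * Real.pi * I)⁻¹ * ∮ z in C(0, ρ), regY r₁ r₂ D E z / z ^ (r₁ + r₂)‖ ≤
      1 + 6 * (4 * (2 * Real.pi) ^ 2) ^ (r₁ + r₂) * C / D := by
  have hcont : ContinuousOn (fun z => regY r₁ r₂ D E z / z ^ (r₁ + r₂)) (Metric.sphere 0 ρ) := by
    intro z hz
    have hzn : ‖z‖ = ρ := by simpa using hz
    have := abs_le.1 (abs_re_le_norm z)
    refine ContinuousAt.continuousWithinAt (ContinuousAt.div
      (hZ.differentiableAt_regY hD hM (by linarith) (by linarith)).continuousAt (by fun_prop) ?_)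
    exact pow_ne_zero _ (norm_pos_iff.1 (by linarith))
  have hJ := continuous_circleIntegral_gauss hρ.le hcont
  set J : ℝ × ℝ → ℂ := fun p => ∮ z in C(0, ρ), regY r₁ r₂ D E z / z ^ (r₁ + r₂) *
      (cexp (p.1 * (z - 1 / 2) ^ 2) * cexp ((z - 1 / 2) * p.2)) with hJdef
  set R : ℝ := 1 + 6 * (4 * (2 * Real.pi) ^ 2) ^ (r₁ + r₂) * C / D
  have step : ∀ u : ℝ, 0 < u → u < Real.log 2 →
      ‖(Real.exp (-u / 2) : ℂ) - (2 * Real.pi * I)⁻¹ * J (0, u)‖ ≤ R := by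
    intro u hu hu2
    have hFc : ContinuousAt F u := by
      have : F =ᶠ[𝓝 u] fun y => ((Real.exp (-y / 2) : ℝ) : ℂ) := by
        filter_upwards [isOpen_Ioo.mem_nhds ⟨hu, hu2⟩] with y hy using hM.init y hy.1 hy.2
      refine ContinuousAt.congr ?_ this.symm
      exact Continuous.continuousAt (by fun_prop)
    have l1 := tendsto_heat_convolution hM.meas hM.bound hFc
    rw [hM.init u hu hu2] at l1
    have l2 : Tendsto (fun ε : ℝ => J (ε ^ 2, u)) (𝓝[>] 0) (𝓝 (J (0, u))) := by
      have : Tendsto (fun ε : ℝ => J (ε ^ 2, u)) (𝓝 0) (𝓝 (J (0 ^ 2, u))) :=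
        (hJ.comp (by fun_prop : Continuous fun ε : ℝ => (ε ^ 2, u))).tendsto 0
      rw [zero_pow two_ne_zero] at this
      exact this.mono_left nhdsWithin_le_nhds
    refine le_of_tendsto (l1.sub (l2.const_mul _)).norm ?_
    filter_upwards [Ioo_mem_nhdsGT (show (0:ℝ) < 1 by norm_num)] with ε hε
    exact hZ.norm_smoothed_sub_residue_le h hD hM hρ hρ' (pow_pos hε.1 2)
      (pow_le_one₀ hε.1.le hε.2.le) hu.le
  have l3 : Tendsto (fun u : ℝ => ‖(Real.exp (-u / 2) : ℂ) - (2 * Real.pi * I)⁻¹ * J (0, u)‖)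
      (𝓝[>] 0) (𝓝 ‖(Real.exp (-0 / 2) : ℂ) - (2 * Real.pi * I)⁻¹ * J (0, 0)‖) := by
    refine Tendsto.mono_left (Continuous.tendsto ?_ 0) nhdsWithin_le_nhds
    have : Continuous fun u : ℝ => J (0, u) := hJ.comp (by fun_prop)
    fun_prop
  have hfin := le_of_tendsto l3 (by
    filter_upwards [Ioo_mem_nhdsGT (Real.log_pos one_lt_two)] with u hu using step u hu.1 hu.2)
  have e0 : J (0, 0) = ∮ z in C(0, ρ), regY r₁ r₂ D E z / z ^ (r₁ + r₂) := by
    rw [hJdef]; simp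
  rw [e0] at hfin
  simpa using hfin

end
end

section
/-- A nonvanishing holomorphic function on a disc has a holomorphic logarithm. -/
lemma exists_log_on_ball {Φ : ℂ → ℂ} {c : ℂ} {R : ℝ} (hR : 0 < R)
    (hΦ : DifferentiableOn ℂ Φ (Metric.ball c R)) (hne : ∀ w ∈ Metric.ball c R, Φ w ≠ 0) :
    ∃ V : ℂ → ℂ, DifferentiableOn ℂ V (Metric.ball c R) ∧ V c = 0 ∧
      ∀ w ∈ Metric.ball c R, Φ w = Φ c * cexp (V w) := by
  obtain ⟨g, hg⟩ := DifferentiableOn.isExactOn_ball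
    ((hΦ.deriv Metric.isOpen_ball).div hΦ hne)
  have hc := Metric.mem_ball_self (x := c) hR
  refine ⟨fun w => g w - g c, fun w hw => ((hg w hw).sub_const
      _).differentiableAt.differentiableWithinAt,
    sub_self _, fun w hw => ?_⟩
  have hq : ∀ w ∈ Metric.ball c R,
      HasDerivAt (fun w => Φ w * cexp (-(g w - g c))) 0 w := by
    intro w hw
    have h1 := (hΦ.differentiableAt (Metric.isOpen_ball.mem_nhds hw)).hasDerivAt
    have h2 : HasDerivAt (fun w => cexp (-(g w - g c)))
        (cexp (-(g w - g c)) * -(deriv Φ w / Φ w)) w :=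
      ((hg w hw).sub_const (g c)).neg.cexp
    have h3 := h1.mul h2
    have h4 : deriv Φ w * cexp (-(g w - g c)) +
        Φ w * (cexp (-(g w - g c)) * -(deriv Φ w / Φ w)) = 0 := by
      have := hne w hw
      field_simp
      ring
    rwa [h4] at h3
  have hconst := Metric.isOpen_ball.is_const_of_deriv_eq_zero
    (convex_ball c R).isPreconnected
    (fun w hw => (hq w hw).differentiableAt.differentiableWithinAt) (fun w hw => (hq w hw).deriv)
    hw hc
  simp only [sub_self, neg_zero, Complex.exp_zero, mul_one] at hconst
  rw [← hconst, mul_assoc, ← Complex.exp_add, neg_add_cancel, Complex.exp_zero, mul_one]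

/-- Interpolation between a good bound on a small disc and a weak bound on a large one. -/
lemma norm_le_of_two_discs {f : ℂ → ℂ} {M₁ M₂ : ℝ}
    (hf : DifferentiableOn ℂ f (Metric.ball 0 (29 / 20)))
    (h1 : ∀ z : ℂ, ‖z‖ ≤ 7 / 5 → ‖f z‖ ≤ M₁) (h2 : ∀ z : ℂ, ‖z‖ ≤ 2 / 5 → ‖f z‖ ≤ M₂) (N : ℕ)
    {z : ℂ} (hz : ‖z‖ < 6 / 5) :
    ‖f z‖ ≤ M₂ * ∑ k ∈ Finset.range N, 3 ^ k + M₁ * (7 * (6 / 7) ^ N) := by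
  have hM₁ : 0 ≤ M₁ := (norm_nonneg _).trans (h1 0 (by norm_num))
  have hM₂ : 0 ≤ M₂ := (norm_nonneg _).trans (h2 0 (by norm_num))
  have hs := hasSum_taylorSeries_on_ball hf (z := z) (by rw [mem_ball_zero_iff]; linarith)
  set a : ℕ → ℂ := fun n => ((n.factorial : ℂ))⁻¹ • (z - 0) ^ n • iteratedDeriv n f 0 with ha
  have hterm : ∀ R : ℝ, 0 < R → R < 29 / 20 → ∀ M : ℝ, (∀ z : ℂ, ‖z‖ ≤ R → ‖f z‖ ≤ M) → 0 ≤ M →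
      ∀ n, ‖a n‖ ≤ M * (6 / 5 / R) ^ n := by
    intro R hR hR' M hM hM0 n
    have hd : DiffContOnCl ℂ f (Metric.ball 0 R) :=
      DifferentiableOn.diffContOnCl_ball (U := Metric.ball 0 (29 / 20)) hf
        (Metric.closedBall_subset_ball hR')
    have h := norm_iteratedDeriv_le_of_forall_mem_sphere_norm_le n hR hd
      (fun w hw => hM w (mem_sphere_zero_iff_norm.1 hw).le)
    have hn : (0:ℝ) < n.factorial := by exact_mod_cast n.factorial_pos
    rw [ha]
    simp only [sub_zero, smul_eq_mul, norm_mul, norm_inv, norm_pow, norm_natCast]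
    calc (n.factorial : ℝ)⁻¹ * (‖z‖ ^ n * ‖iteratedDeriv n f 0‖)
        ≤ (n.factorial : ℝ)⁻¹ * ((6 / 5) ^ n * (n.factorial * M / R ^ n)) := by gcongr
      _ = _ := by rw [div_pow (6 / 5) R]; field_simp
  have b1 := hterm (7 / 5) (by norm_num) (by norm_num) M₁ h1 hM₁
  have b2 := hterm (2 / 5) (by norm_num) (by norm_num) M₂ h2 hM₂
  norm_num at b1 b2
  have htail : HasSum (fun k => a (k + N)) (f z - ∑ k ∈ Finset.range N, a k) :=
    (hasSum_nat_add_iff' N).2 hs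
  have hgeo : HasSum (fun k => M₁ * (6 / 7 : ℝ) ^ (k + N)) (M₁ * (7 * (6 / 7) ^ N)) := by
    have h := (hasSum_geometric_of_lt_one (show (0:ℝ) ≤ 6 / 7 by norm_num) (by norm_num)).mul_right
      ((6 / 7 : ℝ) ^ N)
    norm_num at h
    simpa only [pow_add] using h.mul_left M₁
  have h3 := htail.norm_le_of_bounded hgeo fun k => b1 _
  have h4 : ‖∑ k ∈ Finset.range N, a k‖ ≤ M₂ * ∑ k ∈ Finset.range N, 3 ^ k := by
    rw [Finset.mul_sum]
    exact (norm_sum_le _ _).trans (Finset.sum_le_sum fun k _ => b2 k)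
  calc ‖f z‖ = ‖(∑ k ∈ Finset.range N, a k) + (f z - ∑ k ∈ Finset.range N, a k)‖ := by
        rw [add_sub_cancel]
    _ ≤ _ := (norm_add_le _ _).trans (add_le_add h4 h3)

/-- The zeta function multiplied by `w - 1`, expressed through its completion. -/
def zetaReg (r₁ r₂ : ℕ) (D : ℝ) (E : ℂ → ℂ) (w : ℂ) : ℂ :=
  E w * (D : ℂ) ^ (-w / 2) * (gammaFac r₁ r₂ w)⁻¹ / w

section
variable {r₁ r₂ : ℕ} {D A C B : ℝ} {E Z : ℂ → ℂ} {F : ℝ → ℂ}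

lemma ZetaData.differentiableAt_zetaReg (hD : 1 ≤ D) (hZ : ZetaData r₁ r₂ D A C E Z) {w : ℂ}
    (hw : w ≠ 0) : DifferentiableAt ℂ (zetaReg r₁ r₂ D E) w := by
  have hD0 : (D : ℂ) ≠ 0 := by exact_mod_cast (by linarith : D ≠ 0)
  refine (((hZ.diff w).mul ?_).mul (differentiable_gammaFac_inv r₁ r₂ w)).div differentiableAt_id hw
  exact DifferentiableAt.const_cpow (by fun_prop) (.inl hD0)

lemma ZetaData.zetaReg_ne_zero (hD : 1 ≤ D) (hZ : ZetaData r₁ r₂ D A C E Z)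
    (hM : MertensData Z F B) {w : ℂ} (hw : 1 / 2 < w.re) : zetaReg r₁ r₂ D E w ≠ 0 := by
  have hD0 : (D : ℂ) ≠ 0 := by exact_mod_cast (by linarith : D ≠ 0)
  refine div_ne_zero (mul_ne_zero (mul_ne_zero (hZ.ne_zero hD hM hw.ne') ?_)
    (inv_ne_zero (gammaFac_ne_zero r₁ r₂ (by linarith)))) fun h => ?_
  · simp [cpow_eq_zero_iff, hD0]
  · rw [h, zero_re] at hw; linarith

lemma ZetaData.zetaReg_eq (hD : 1 ≤ D) (hZ : ZetaData r₁ r₂ D A C E Z) {w : ℂ} (hw : 1 < w.re) :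
    zetaReg r₁ r₂ D E w = (w - 1) * Z w := by
  have hD0 : (D : ℂ) ≠ 0 := by exact_mod_cast (by linarith : D ≠ 0)
  have hγ := gammaFac_ne_zero r₁ r₂ (z := w) (by linarith)
  have hw0 : w ≠ 0 := fun h => by rw [h, zero_re] at hw; linarith
  have hDz : (D : ℂ) ^ (w / 2) * (D : ℂ) ^ (-w / 2) = 1 := by
    rw [← cpow_add _ _ hD0, neg_div, add_neg_cancel, cpow_zero]
  rw [zetaReg, hZ.eq w hw, div_eq_iff hw0]
  calc _ = (w - 1) * Z w * w * ((D : ℂ) ^ (w / 2) * (D : ℂ) ^ (-w / 2)) *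
        (gammaFac r₁ r₂ w * (gammaFac r₁ r₂ w)⁻¹) := by ring
    _ = _ := by rw [hDz, mul_inv_cancel₀ hγ]; ring

/-- The logarithm of `zetaReg` is `o(log D)` near `1`, uniformly in the field. -/
theorem ZetaData.exists_log (r₁ r₂ : ℕ) (A C : ℝ) {ε : ℝ} (hε : 0 < ε) : ∃ K : ℝ, 0 ≤ K ∧
    ∀ {D B : ℝ} {E Z : ℂ → ℂ} {F : ℝ → ℂ}, 1 ≤ D → ZetaData r₁ r₂ D A C E Z →
      MertensData Z F B → ∃ V : ℂ → ℂ, DifferentiableOn ℂ V (Metric.ball 2 (3 / 2)) ∧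
        (∀ w ∈ Metric.ball (2:ℂ) (3 / 2),
          zetaReg r₁ r₂ D E w = zetaReg r₁ r₂ D E 2 * cexp (V w)) ∧
        ∀ w : ℂ, ‖w - 2‖ < 6 / 5 → ‖V w‖ ≤ ε * Real.log D + K := by
  obtain ⟨G, hG⟩ := (isCompact_closedBall (2:ℂ) (29 / 20)).exists_bound_of_continuousOn
    (differentiable_gammaFac_inv r₁ r₂).continuous.continuousOn
  set A' := max A 0 with hA'
  have hA'0 : 0 ≤ A' := le_max_right _ _
  obtain ⟨c, hc1, hc2, hc0⟩ : ∃ c : ℝ, C ^ 2 * G * 2 ≤ Real.exp c ∧ C ^ 2 * (3 / 2) ≤ Real.exp c ∧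
      0 < c := by
    refine ⟨max (max (C ^ 2 * G * 2) (C ^ 2 * (3 / 2))) 1, ?_, ?_, lt_max_of_lt_right zero_lt_one⟩
        <;>
    refine le_trans ?_ ((le_add_of_nonneg_right zero_le_one).trans (Real.add_one_le_exp _))
    · exact (le_max_left _ _).trans (le_max_left _ _)
    · exact (le_max_right _ _).trans (le_max_left _ _)
  obtain ⟨N, hN⟩ : ∃ N : ℕ, 56 * A' * (7 * (6 / 7 : ℝ) ^ N) ≤ ε := by
    have : Tendsto (fun N : ℕ => 56 * A' * (7 * (6 / 7 : ℝ) ^ N)) atTop (𝓝 (56 * A' * (7 * 0))) :=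
      ((tendsto_pow_atTop_nhds_zero_of_lt_one (by norm_num) (by norm_num)).const_mul 7).const_mul _
    rw [mul_zero, mul_zero] at this
    exact (this.eventually_le_const hε).exists
  refine ⟨8 * c * ∑ k ∈ Finset.range N, 3 ^ k + 56 * c * (7 * (6 / 7) ^ N), by positivity,
    fun {D B E Z F} hD hZ hM => ?_⟩
  have hD0 : 0 < D := by linarith
  have hL : 0 ≤ Real.log D := Real.log_nonneg hD
  have hball : ∀ w ∈ Metric.ball (2:ℂ) (3 / 2), 1 / 2 < w.re := by
    intro w hw
    have h := (abs_re_le_norm (w - 2)).trans_lt (mem_ball_iff_norm.1 hw)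
    rw [sub_re, re_ofNat] at h
    linarith [(abs_lt.1 h).1]
  obtain ⟨V, hVd, hV2, hV⟩ := exists_log_on_ball (Φ := zetaReg r₁ r₂ D E) (c := 2) (R := 3 / 2)
    (by norm_num) (fun w hw => (hZ.differentiableAt_zetaReg hD fun h => by
      have := hball w hw; rw [h, zero_re] at this; linarith).differentiableWithinAt)
    (fun w hw => hZ.zetaReg_ne_zero hD hM (hball w hw))
  refine ⟨V, hVd, hV, fun w hw => ?_⟩
  have hb2 := hZ.bounds 2 (by norm_num)
  have hC0 : 0 < C := by
    by_contra h
    push Not at h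
    nlinarith [norm_nonneg (Z 2)]
  have hΦ2 : zetaReg r₁ r₂ D E 2 = Z 2 := by
    rw [hZ.zetaReg_eq hD (by norm_num)]; ring
  have hre : ∀ w ∈ Metric.ball (2:ℂ) (3 / 2), ∀ Q q : ℝ, ‖zetaReg r₁ r₂ D E w‖ ≤ Q →
      C * Q ≤ Real.exp q → (V w).re ≤ q := by
    intro w hw Q q hQ hq
    rw [← Real.exp_le_exp]
    refine le_trans ?_ hq
    have h1 := congrArg norm (hV w hw)
    rw [norm_mul, Complex.norm_exp, hΦ2] at h1
    have hQ' : ‖Z 2‖ * Real.exp (V w).re ≤ Q := h1 ▸ hQ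
    calc Real.exp (V w).re = 1 * Real.exp (V w).re := (one_mul _).symm
      _ ≤ C * ‖Z 2‖ * Real.exp (V w).re := by gcongr; exact hb2.1
      _ = C * (‖Z 2‖ * Real.exp (V w).re) := by ring
      _ ≤ C * Q := by gcongr
  set f : ℂ → ℂ := fun ζ => V (2 + ζ) with hf
  have hmem : ∀ ζ : ℂ, ∀ R : ℝ, ζ ∈ Metric.ball (0:ℂ) R → 2 + ζ ∈ Metric.ball (2:ℂ) R := by
    intro ζ R hζ; simpa using hζ
  have hfd : DifferentiableOn ℂ f (Metric.ball 0 (3 / 2)) := by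
    refine hVd.comp (by fun_prop) fun ζ hζ => hmem ζ _ hζ
  have hf0 : f 0 = 0 := by rw [hf]; simp [hV2]
  have hbig : ∀ ζ ∈ Metric.ball (0:ℂ) (29 / 20), (f ζ).re ≤ c + A' * Real.log D := by
    intro ζ hζ
    have hζn : ‖ζ‖ < 29 / 20 := by simpa using hζ
    have hw : 2 + ζ ∈ Metric.ball (2:ℂ) (3 / 2) := hmem ζ _ (by simp; linarith)
    have hG0 : 0 ≤ G := (norm_nonneg _).trans (hG 2 (by simp; norm_num))
    refine hre _ hw (C * D ^ A * 1 * G * 2) _ ?_ ?_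
    · rw [zetaReg, norm_div, norm_mul, norm_mul, div_eq_mul_inv]
      have h1 := hZ.crude (2 + ζ) (by rw [add_sub_cancel_left]; exact hζn.le)
      have h2 : ‖(D : ℂ) ^ (-(2 + ζ) / 2)‖ ≤ 1 := by
        rw [norm_cpow_eq_rpow_re_of_pos hD0]
        refine Real.rpow_le_one_of_one_le_of_nonpos hD ?_
        have := hball _ hw
        rw [show -(2 + ζ) / 2 = -(2 + ζ) / ((2:ℝ):ℂ) by norm_num, div_ofReal_re, neg_re]
        linarith
      have h3 : ‖(gammaFac r₁ r₂ (2 + ζ))⁻¹‖ ≤ G := hG _ (by simpa using hζn.le)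
      have h4 : ‖(2 + ζ : ℂ)‖⁻¹ ≤ 2 := by
        have h5 := (hball _ hw).le.trans ((le_abs_self _).trans (abs_re_le_norm (2 + ζ)))
        rw [inv_le_comm₀ (by linarith) (by norm_num)]
        linarith
      gcongr
    · rw [Real.exp_add]
      have hDA : D ^ A ≤ Real.exp (A' * Real.log D) := by
        rw [Real.rpow_def_of_pos hD0, mul_comm]
        gcongr
        exact le_max_left _ _
      calc _ = C ^ 2 * G * 2 * D ^ A := by ring
        _ ≤ _ := by gcongr
  have hsmall : ∀ ζ ∈ Metric.ball (0:ℂ) (1 / 2), (f ζ).re ≤ c := by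
    intro ζ hζ
    have hζn : ‖ζ‖ < 1 / 2 := by simpa using hζ
    have hw : 2 + ζ ∈ Metric.ball (2:ℂ) (3 / 2) := hmem ζ _ (by simp; linarith)
    have hr : 3 / 2 ≤ (2 + ζ).re := by
      have := (abs_le.1 (abs_re_le_norm ζ)).1
      rw [add_re, re_ofNat]; linarith
    refine hre _ hw (3 / 2 * C) _ ?_ (by linarith)
    rw [hZ.zetaReg_eq hD (by linarith), norm_mul]
    have h1 : ‖2 + ζ - 1‖ ≤ 3 / 2 := by
      rw [show 2 + ζ - 1 = 1 + ζ by ring]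
      refine (norm_add_le _ _).trans ?_
      rw [norm_one]; linarith
    exact mul_le_mul h1 (hZ.bounds _ hr).2 (norm_nonneg _) (by norm_num)
  have hM1 : ∀ ζ : ℂ, ‖ζ‖ ≤ 7 / 5 → ‖f ζ‖ ≤ 56 * (c + A' * Real.log D) := by
    intro ζ hζ
    have hpos : 0 < c + A' * Real.log D := by positivity
    have := borelCaratheodory hpos (hfd.mono (Metric.ball_subset_ball (by norm_num)))
      (fun ζ hζ => hbig ζ hζ) (by norm_num : (0:ℝ) < 29 / 20) (z := ζ) (by simp; linarith)
    rw [hf0, norm_zero, zero_mul, zero_div, add_zero] at this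
    refine this.trans ?_
    rw [div_le_iff₀ (by linarith)]
    nlinarith
  have hM2 : ∀ ζ : ℂ, ‖ζ‖ ≤ 2 / 5 → ‖f ζ‖ ≤ 8 * c := by
    intro ζ hζ
    have := borelCaratheodory hc0 (hfd.mono (Metric.ball_subset_ball (by norm_num)))
      (fun ζ hζ => hsmall ζ hζ) (by norm_num : (0:ℝ) < 1 / 2) (z := ζ) (by simp; linarith)
    rw [hf0, norm_zero, zero_mul, zero_div, add_zero] at this
    refine this.trans ?_
    rw [div_le_iff₀ (by linarith)]
    nlinarith
  have hfin := norm_le_of_two_discs (hfd.mono (Metric.ball_subset_ball (by norm_num))) hM1 hM2 N hw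
  rw [show f (w - 2) = V w by rw [hf]; simp] at hfin
  refine hfin.trans ?_
  have : 56 * A' * (7 * (6 / 7 : ℝ) ^ N) * Real.log D ≤ ε * Real.log D := by gcongr
  linarith

end
end

section
/-- The residue of `exp (L z) g z / z ^ (n + 1)` at the origin when `g` is nearly constant. -/
lemma norm_circleIntegral_sub_le {g : ℂ → ℂ} {d η L : ℝ} (hL : 0 < L) (n : ℕ)
    (hg : ContinuousOn g (Metric.sphere 0 (1 / L)))
    (hη : ∀ z ∈ Metric.sphere (0:ℂ) (1 / L), ‖g z - d‖ ≤ η) :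
    ‖(2 * Real.pi * I)⁻¹ * (∮ z in C(0, 1 / L), cexp (L * z) * g z / z ^ (n + 1)) -
      d * L ^ n / n.factorial‖ ≤ Real.exp 1 * η * L ^ n := by
  have hρ : 0 < 1 / L := by positivity
  have hne : ∀ z ∈ Metric.sphere (0:ℂ) (1 / L), z ^ (n + 1) ≠ 0 := fun z hz => by
    have : ‖z‖ = 1 / L := by simpa using hz
    exact pow_ne_zero _ (norm_pos_iff.1 (this ▸ hρ))
  have hpi : (2 * Real.pi * I : ℂ) ≠ 0 := by simp [Real.pi_ne_zero]
  have h1 : (∮ z in C(0, 1 / L), (d : ℂ) * (cexp (L * z) / z ^ (n + 1))) =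
      2 * Real.pi * I * (d * L ^ n / n.factorial) := by
    have h := DifferentiableOn.circleIntegral_one_div_sub_center_pow_smul
        (f := fun z => cexp (L * z))
      (c := 0) hρ n (by fun_prop)
    rw [iteratedDeriv_cexp_const_mul] at h
    simp only [sub_zero, smul_eq_mul, mul_zero, Complex.exp_zero, mul_one] at h
    rw [circleIntegral.integral_const_mul, show (fun z : ℂ => cexp (L * z) / z ^ (n + 1)) =
      fun z => 1 / z ^ (n + 1) * cexp (L * z) by ext z; ring, h]
    ring
  have c1 : ContinuousOn (fun z : ℂ => cexp (L * z) * g z / z ^ (n + 1))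
      (Metric.sphere 0 (1 / L)) :=
    ((Continuous.continuousOn (by fun_prop)).mul hg).div (by fun_prop) hne
  have c2 : ContinuousOn (fun z : ℂ => (d : ℂ) * (cexp (L * z) / z ^ (n + 1)))
      (Metric.sphere 0 (1 / L)) :=
    continuousOn_const.mul ((Continuous.continuousOn (by fun_prop)).div (by fun_prop) hne)
  have h2 : (2 * Real.pi * I)⁻¹ * (∮ z in C(0, 1 / L), cexp (L * z) * g z / z ^ (n + 1)) -
      d * L ^ n / n.factorial = (2 * Real.pi * I)⁻¹ * ∮ z in C(0, 1 / L),
        (cexp (L * z) * g z / z ^ (n + 1) - (d : ℂ) * (cexp (L * z) / z ^ (n + 1))) := by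
    rw [circleIntegral.integral_sub (c1.circleIntegrable hρ.le) (c2.circleIntegrable hρ.le), h1,
      mul_sub, inv_mul_cancel_left₀ hpi]
  have hη0 : 0 ≤ η := (norm_nonneg _).trans (hη ((1 / L : ℝ) : ℂ) (by simp [hL.le]))
  have h3 : ‖∮ z in C(0, 1 / L), (cexp (L * z) * g z / z ^ (n + 1) -
      (d : ℂ) * (cexp (L * z) / z ^ (n + 1)))‖ ≤
      2 * Real.pi * (1 / L) * (Real.exp 1 * η * L ^ (n + 1)) := by
    refine circleIntegral.norm_integral_le_of_norm_le_const hρ.le fun z hz => ?_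
    have hz' : ‖z‖ = 1 / L := by simpa using hz
    rw [show cexp (L * z) * g z / z ^ (n + 1) - (d : ℂ) * (cexp (L * z) / z ^ (n + 1)) =
      cexp (L * z) * (g z - d) / z ^ (n + 1) by ring, norm_div, norm_mul, norm_pow, hz', one_div,
      inv_pow, div_inv_eq_mul]
    have h4 : ‖cexp (L * z)‖ ≤ Real.exp 1 := by
      rw [Complex.norm_exp]
      refine Real.exp_le_exp.2 ((le_abs_self _).trans ((abs_re_le_norm _).trans ?_))
      rw [norm_mul, hz', norm_real, Real.norm_of_nonneg hL.le]
      exact (mul_one_div_cancel hL.ne').le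
    gcongr
    exact hη z hz
  rw [h2, norm_mul, norm_inv]
  have h5 : ‖(2 * Real.pi * I : ℂ)‖ = 2 * Real.pi := by
    simp [abs_of_pos Real.pi_pos]
  rw [h5]
  calc _ ≤ (2 * Real.pi)⁻¹ * (2 * Real.pi * (1 / L) * (Real.exp 1 * η * L ^ (n + 1))) := by gcongr
    _ = _ := by field_simp; ring

/-- The ratio of gamma factors in the residue at the origin. -/
def gammaQuot (r₁ r₂ : ℕ) (z : ℂ) : ℂ := gammaReg r₁ r₂ z * (gammaFac r₁ r₂ (1 - z))⁻¹

lemma gammaFac_one (r₁ r₂ : ℕ) : gammaFac r₁ r₂ 1 = ((Real.pi⁻¹ ^ r₂ : ℝ) : ℂ) := by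
  rw [gammaFac, Gammaℝ_one, Gammaℂ_one]
  simp

lemma gammaQuot_zero (r₁ r₂ : ℕ) :
    gammaQuot r₁ r₂ 0 = (((2:ℝ) ^ (r₁ + r₂) * Real.pi ^ r₂ : ℝ) : ℂ) := by
  have : (Real.pi : ℂ) ≠ 0 := by simp [Real.pi_ne_zero]
  rw [gammaQuot, sub_zero, gammaFac_one, gammaReg_zero]
  push_cast
  rw [← mul_pow, mul_assoc, mul_inv_cancel₀ this, mul_one, inv_pow, inv_inv]

lemma differentiableAt_gammaQuot (r₁ r₂ : ℕ) {z : ℂ} (hz : -1 < z.re) :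
    DifferentiableAt ℂ (gammaQuot r₁ r₂) z :=
  (differentiableAt_gammaReg r₁ r₂ hz).mul
    (DifferentiableAt.comp (g := fun w => (gammaFac r₁ r₂ w)⁻¹) (f := fun z => 1 - z) z
      (differentiable_gammaFac_inv r₁ r₂ _) (by fun_prop))

section
variable {r₁ r₂ : ℕ} {D A C B : ℝ} {E Z : ℂ → ℂ} {F : ℝ → ℂ}

lemma ZetaData.exists_zetaReg_one (hD : 1 ≤ D) (hZ : ZetaData r₁ r₂ D A C E Z) :
    ∃ κ : ℝ, 0 < κ ∧ zetaReg r₁ r₂ D E 1 = κ := by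
  obtain ⟨e, he, hE⟩ := hZ.one_pos
  have hD0 : 0 < D := by linarith
  refine ⟨e * D ^ (-1 / 2 : ℝ) * (Real.pi⁻¹ ^ r₂)⁻¹, by positivity, ?_⟩
  rw [zetaReg, hE, gammaFac_one, div_one]
  push_cast [ofReal_cpow hD0.le]
  rfl

lemma ZetaData.regY_eq (hD : 1 ≤ D) (hZ : ZetaData r₁ r₂ D A C E Z) {z : ℂ} (hz : z.re < 1) :
    regY r₁ r₂ D E z = -(D : ℂ) ^ (z - 1 / 2) * gammaQuot r₁ r₂ z *
      (zetaReg r₁ r₂ D E (1 - z))⁻¹ := by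
  have hD0 : (D : ℂ) ≠ 0 := by exact_mod_cast (by linarith : D ≠ 0)
  have h1 : (1 - z) ≠ 0 := fun h => by
    rw [← sub_eq_zero.1 h, one_re] at hz; linarith
  have hγ := gammaFac_ne_zero r₁ r₂ (z := 1 - z) (by rw [sub_re, one_re]; linarith)
  have hDp : (D : ℂ) ^ (-(1 - z) / 2) ≠ 0 := by simp [cpow_eq_zero_iff, hD0]
  have hDz : (D : ℂ) ^ (z - 1 / 2) = (D : ℂ) ^ (z / 2) * (D : ℂ) ^ (-(1 - z) / 2) := by
    rw [← cpow_add _ _ hD0]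
    congr 1
    ring
  rw [zetaReg, hZ.symm, regY, gammaQuot, hDz]
  generalize (D : ℂ) ^ (-(1 - z) / 2) = P at *
  by_cases hE : E z = 0
  · simp [hE]
  field_simp
  ring

/-- The Mertens bound is incompatible with a large discriminant. -/
theorem ZetaData.false_of_mertensData (r₁ r₂ : ℕ) (h : ¬(r₁ = 0 ∧ r₂ = 0)) (A C : ℝ) :
    ∃ D₀ : ℝ, ∀ {D B : ℝ} {E Z : ℂ → ℂ} {F : ℝ → ℂ}, D₀ < D → ZetaData r₁ r₂ D A C E Z →
      MertensData Z F B → False := by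
  obtain ⟨n, hn⟩ : ∃ n, r₁ + r₂ = n + 1 := ⟨r₁ + r₂ - 1, by omega⟩
  set d : ℝ := 2 ^ (r₁ + r₂) * Real.pi ^ r₂ with hd
  have hd0 : 0 < d := by positivity
  set η : ℝ := d / (2 * Real.exp 1 * n.factorial) with hη
  have hη0 : 0 < η := by positivity
  obtain ⟨δ, hδ0, hδ⟩ := Metric.continuousAt_iff.1
    (differentiableAt_gammaQuot r₁ r₂ (z := 0) (by simp)).continuousAt (η / 2) (by positivity)
  simp only [gammaQuot_zero, dist_eq_norm, sub_zero, ← hd] at hδ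
  obtain ⟨ε, hε0, hε1, hε2, hε3⟩ : ∃ ε : ℝ, 0 < ε ∧ ε ≤ 1 / 4 ∧ 10 * ε ≤ 1 / 2 ∧
      (d + η) * (20 * ε) ≤ η / 4 := by
    refine ⟨min (1 / 20) (η / (80 * (d + η))), by positivity, ?_, ?_, ?_⟩
    · exact (min_le_left _ _).trans (by norm_num)
    · linarith [min_le_left (1 / 20 : ℝ) (η / (80 * (d + η)))]
    · calc _ ≤ (d + η) * (20 * (η / (80 * (d + η)))) := by gcongr; exact min_le_right _ _
        _ = _ := by field_simp; norm_num
  obtain ⟨K, hK0, hK⟩ := ZetaData.exists_log r₁ r₂ A C hε0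
  set C₁ : ℝ := 6 * (4 * (2 * Real.pi) ^ 2) ^ (r₁ + r₂) * C with hC₁
  set c₀ : ℝ := d / (2 * n.factorial) with hc₀
  have hc₀0 : 0 < c₀ := by positivity
  have hlog := Real.tendsto_log_atTop
  have hlog' : Tendsto (fun D : ℝ => 1 / Real.log D) atTop (𝓝 0) := by
    simp only [one_div]
    exact hlog.inv_tendsto_atTop
  have e1 : ∀ᶠ D : ℝ in atTop, 1 / Real.log D < min δ (1 / 5) :=
    hlog'.eventually_lt_const (by positivity)
  have e2 : ∀ᶠ D : ℝ in atTop, 10 * (K * (1 / Real.log D)) < 1 / 2 := by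
    refine ((hlog'.const_mul K).const_mul 10).eventually_lt_const (by norm_num)
  have e3 : ∀ᶠ D : ℝ in atTop, (d + η) * (20 * (K * (1 / Real.log D))) < η / 4 := by
    refine (((hlog'.const_mul K).const_mul 20).const_mul (d + η)).eventually_lt_const ?_
    simp only [mul_zero]
    positivity
  have e4 : ∀ᶠ D : ℝ in atTop, C₁ * (C * Real.exp K) < c₀ * D ^ (1 / 4 : ℝ) :=
    ((tendsto_rpow_atTop (by norm_num)).const_mul_atTop hc₀0).eventually_gt_atTop _
  obtain ⟨D₀, hD₀⟩ := (((((e1.and e2).and e3).and e4).and (hlog.eventually_ge_atTop 1)).and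
    (eventually_ge_atTop (1:ℝ))).exists_forall_of_atTop
  refine ⟨D₀, fun {D B E Z F} hDD hZ hM => ?_⟩
  obtain ⟨⟨⟨⟨⟨h1, h2⟩, h3⟩, h4⟩, hL⟩, hD⟩ := hD₀ D hDD.le
  obtain ⟨V, hVd, hV, hVb⟩ := hK hD hZ hM
  set L : ℝ := Real.log D with hLdef
  have hL0 : 0 < L := by linarith
  have hD0 : 0 < D := by linarith
  obtain ⟨κ, hκ0, hκ⟩ := hZ.exists_zetaReg_one hD
  have hb2 := hZ.bounds 2 (by norm_num)
  have hC0 : 0 < C := by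
    by_contra h
    push Not at h
    nlinarith [norm_nonneg (Z 2)]
  have hC₁0 : 0 < C₁ := by positivity
  have hΦ2 : zetaReg r₁ r₂ D E 2 = Z 2 := by
    rw [hZ.zetaReg_eq hD (by norm_num)]; ring
  have hκD : κ ≤ C * Real.exp K * D ^ (1 / 4 : ℝ) := by
    have hw := hV 1 (by rw [Metric.mem_ball, dist_eq_norm]; norm_num)
    have hn1 := congrArg norm hw
    rw [norm_mul, Complex.norm_exp, hΦ2, hκ, norm_real, Real.norm_of_nonneg hκ0.le] at hn1
    have h5 := (re_le_norm (V 1)).trans (hVb 1 (by norm_num))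
    calc κ = ‖Z 2‖ * Real.exp (V 1).re := hn1
      _ ≤ C * Real.exp (1 / 4 * L + K) := by
        gcongr
        · exact hb2.2
        · exact h5.trans (by gcongr)
      _ = _ := by
        rw [Real.exp_add, Real.rpow_def_of_pos hD0, mul_comm (1 / 4) L]; ring
  have hρ5 : 1 / L < 1 / 5 := h1.trans_le (min_le_right _ _)
  have hsph : ∀ z ∈ Metric.sphere (0:ℂ) (1 / L), ‖z‖ = 1 / L := fun z hz => by simpa using hz
  have hre : ∀ z ∈ Metric.sphere (0:ℂ) (1 / L), -(1 / 5) < z.re ∧ z.re < 1 / 5 := fun z hz => by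
    have := abs_le.1 (abs_re_le_norm z)
    rw [hsph z hz] at this
    constructor <;> linarith
  set g : ℂ → ℂ := fun z => gammaQuot r₁ r₂ z * (κ * (zetaReg r₁ r₂ D E (1 - z))⁻¹) with hg
  have hVdiff : ∀ z ∈ Metric.sphere (0:ℂ) (1 / L), ‖V 1 - V (1 - z)‖ ≤ 10 * (ε + K * (1 / L)) := by
    intro z hz
    have hb : ∀ w ∈ Metric.ball (1:ℂ) (1 / 5), ‖w - 2‖ < 6 / 5 := fun w hw => by
      have h5 : ‖w - 1‖ < 1 / 5 := by simpa [dist_eq_norm] using hw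
      have h6 := norm_sub_le (w - 1) 1
      rw [norm_one, show w - 1 - 1 = w - 2 by ring] at h6
      linarith
    have h5 := dist_le_div_mul_dist_of_mapsTo_ball (f := V) (c := 1) (z := 1 - z) (R₁ := 1 / 5)
      (R₂ := 2 * (ε * L + K)) (hVd.mono fun w hw => by
        rw [Metric.mem_ball, dist_eq_norm]; linarith [hb w hw]) (fun w hw => by
        rw [Metric.mem_closedBall, dist_eq_norm]
        refine (norm_sub_le _ _).trans ?_
        linarith [hVb w (hb w hw), hVb 1 (by norm_num)]) (by
        rw [Metric.mem_ball, dist_eq_norm, show 1 - z - 1 = -z by ring, norm_neg, hsph z hz]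
        exact hρ5)
    rw [dist_eq_norm, dist_eq_norm, show 1 - z - 1 = -z by ring, norm_neg, hsph z hz] at h5
    rw [norm_sub_rev]
    refine h5.trans (le_of_eq ?_)
    field_simp
    ring
  have hgd : ∀ z ∈ Metric.sphere (0:ℂ) (1 / L), ‖g z - d‖ ≤ η := by
    intro z hz
    have hv := hVdiff z hz
    have hquot : (κ : ℂ) * (zetaReg r₁ r₂ D E (1 - z))⁻¹ = cexp (V 1 - V (1 - z)) := by
      have hZ2 : Z 2 ≠ 0 := fun h0 => by rw [h0, norm_zero, mul_zero] at hb2; linarith [hb2.1]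
      have hw1 := hV 1 (by rw [Metric.mem_ball, dist_eq_norm]; norm_num)
      have hw2 := hV (1 - z) (by
        rw [Metric.mem_ball, dist_eq_norm, show 1 - z - 2 = -(1 + z) by ring, norm_neg]
        refine (norm_add_le _ _).trans_lt ?_
        rw [norm_one, hsph z hz]; linarith)
      rw [← hκ, hw1, hw2, hΦ2, Complex.exp_sub]
      field_simp
    have h5 : ‖gammaQuot r₁ r₂ z - d‖ ≤ η / 2 :=
      (hδ (by rw [hsph z hz]; exact h1.trans_le (min_le_left _ _))).le
    have h6 : ‖gammaQuot r₁ r₂ z‖ ≤ d + η := by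
      have := norm_add_le (gammaQuot r₁ r₂ z - d) (d : ℂ)
      rw [sub_add_cancel, norm_real, Real.norm_of_nonneg hd0.le] at this
      linarith
    have h7 : ‖cexp (V 1 - V (1 - z)) - 1‖ ≤ 20 * (ε + K * (1 / L)) :=
      (norm_exp_sub_one_le (by linarith)).trans (by linarith)
    rw [hg]
    simp only [hquot]
    calc ‖gammaQuot r₁ r₂ z * cexp (V 1 - V (1 - z)) - d‖
        = ‖gammaQuot r₁ r₂ z * (cexp (V 1 - V (1 - z)) - 1) + (gammaQuot r₁ r₂ z - d)‖ := by
          congr 1; ring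
      _ ≤ ‖gammaQuot r₁ r₂ z‖ * ‖cexp (V 1 - V (1 - z)) - 1‖ + ‖gammaQuot r₁ r₂ z - d‖ := by
          rw [← norm_mul]; exact norm_add_le _ _
      _ ≤ (d + η) * (20 * (ε + K * (1 / L))) + η / 2 := by gcongr
      _ ≤ η := by linarith
  have hgc : ContinuousOn g (Metric.sphere 0 (1 / L)) := by
    intro z hz
    obtain ⟨hz1, hz2⟩ := hre z hz
    have hw : 1 / 2 < (1 - z).re := by rw [sub_re, one_re]; linarith
    refine ContinuousAt.continuousWithinAt (ContinuousAt.mul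
      (differentiableAt_gammaQuot r₁ r₂ (by linarith)).continuousAt (continuousAt_const.mul
      (ContinuousAt.inv₀ (ContinuousAt.comp (g := zetaReg r₁ r₂ D E) (f := fun z => 1 - z) ?_
        (by fun_prop)) (hZ.zetaReg_ne_zero hD hM hw))))
    exact (hZ.differentiableAt_zetaReg hD fun h0 => by
      rw [h0, zero_re] at hw; linarith).continuousAt
  have hmain := norm_circleIntegral_sub_le hL0 n hgc hgd
  have hres := hZ.norm_one_sub_residue_le h hD hM (ρ := 1 / L) (by positivity) (by linarith)
  have hY : (∮ z in C(0, 1 / L), regY r₁ r₂ D E z / z ^ (r₁ + r₂)) =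
      -((D ^ (-1 / 2 : ℝ) / κ : ℝ) : ℂ) * ∮ z in C(0, 1 / L), cexp (L * z) * g z / z ^ (n + 1) := by
    rw [← circleIntegral.integral_const_mul]
    refine circleIntegral.integral_congr (by positivity) fun z hz => ?_
    rw [hZ.regY_eq hD (by linarith [(hre z hz).2]), hn, hg, sub_eq_add_neg,
      cpow_add _ _ (by exact_mod_cast hD0.ne'), cpow_def_of_ne_zero (by exact_mod_cast hD0.ne') z,
      ← ofReal_log hD0.le, ← hLdef, ofReal_div, ofReal_cpow hD0.le]
    have : (κ : ℂ) ≠ 0 := by exact_mod_cast hκ0.ne'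
    push_cast
    rw [neg_div 2 (1:ℂ)]
    field_simp
  set X : ℂ := (2 * Real.pi * I)⁻¹ * ∮ z in C(0, 1 / L), cexp (L * z) * g z / z ^ (n + 1) with hX
  have hXre : c₀ ≤ X.re := by
    have h5 : (d * L ^ n / n.factorial : ℝ) - X.re ≤ Real.exp 1 * η * L ^ n := by
      refine le_trans ?_ hmain
      rw [norm_sub_rev]
      refine le_trans (le_of_eq ?_) (re_le_norm _)
      rw [sub_re]
      norm_cast
    have h6 : Real.exp 1 * η * L ^ n = c₀ * L ^ n := by
      rw [hη, hc₀]; field_simp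
    have h7 : (d * L ^ n / n.factorial : ℝ) = 2 * c₀ * L ^ n := by
      rw [hc₀]; field_simp
    have h8 : c₀ ≤ c₀ * L ^ n := le_mul_of_one_le_right hc₀0.le (one_le_pow₀ hL)
    linarith
  have hfin : 1 + D ^ (-1 / 2 : ℝ) / κ * c₀ ≤ 1 + C₁ / D := by
    refine le_trans ?_ hres
    refine le_trans ?_ (re_le_norm _)
    rw [hY, show 1 - (2 * Real.pi * I : ℂ)⁻¹ * (-((D ^ (-1 / 2 : ℝ) / κ : ℝ) : ℂ) *
      ∮ z in C(0, 1 / L), cexp (L * z) * g z / z ^ (n + 1)) =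
      1 + ((D ^ (-1 / 2 : ℝ) / κ : ℝ) : ℂ) * X by rw [hX]; ring, add_re, re_ofReal_mul, one_re]
    gcongr
  have h9 : D ^ (-1 / 2 : ℝ) / κ * c₀ ≤ C₁ / D := by linarith
  have h10 : D * D ^ (-1 / 2 : ℝ) * c₀ ≤ C₁ * κ := by
    rw [div_mul_eq_mul_div, div_le_div_iff₀ hκ0 hD0] at h9
    linarith
  have h11 : D * D ^ (-1 / 2 : ℝ) = D ^ (1 / 4 : ℝ) * D ^ (1 / 4 : ℝ) := by
    rw [← Real.rpow_add hD0]
    nth_rw 1 [← Real.rpow_one D]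
    rw [← Real.rpow_add hD0]
    norm_num
  have h12 : 0 < D ^ (1 / 4 : ℝ) := by positivity
  have h13 : C₁ * κ ≤ C₁ * (C * Real.exp K * D ^ (1 / 4 : ℝ)) := by gcongr
  rw [h11] at h10
  nlinarith

end
end

section
open scoped ENNReal in
lemma ENNReal.tsum_pi_prod {ι α : Type*} [Fintype ι] (f : α → ℝ≥0∞) :
    ∑' k : ι → α, ∏ i, f (k i) = (∑' a, f a) ^ Fintype.card ι := by
  have key : ∀ n : ℕ, ∑' k : Fin n → α, ∏ i, f (k i) = (∑' a, f a) ^ n := by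
    intro n
    induction n with
    | zero => simp [tsum_fintype]
    | succ n ih =>
      calc _ = ∑' p : α × (Fin n → α), f p.1 * ∏ i, f (p.2 i) := by
            rw [← (Fin.consEquiv fun _ => α).tsum_eq]
            exact tsum_congr fun p => by simp [Fin.consEquiv, Fin.prod_univ_succ]
        _ = _ := by
            rw [ENNReal.tsum_prod (f := fun a (k : Fin n → α) => f a * ∏ i, f (k i)), pow_succ',
              ← ih, ← ENNReal.tsum_mul_right]
            exact tsum_congr fun a => ENNReal.tsum_mul_left
  rw [← key, ← (Equiv.arrowCongr (Fintype.equivFin ι) (Equiv.refl α)).tsum_eq]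
  refine tsum_congr fun k => ?_
  rw [← (Fintype.equivFin ι).symm.prod_comp]
  simp

lemma summable_exp_neg_mul_int_sq {c : ℝ} (hc : 0 < c) :
    Summable fun k : ℤ => Real.exp (-c * k ^ 2) := by
  have h : Summable fun n : ℕ => Real.exp (-c * (n : ℝ) ^ 2) := by
    refine (summable_geometric_of_lt_one (Real.exp_nonneg (-c)) (by simpa using hc)).of_nonneg_of_le
      (fun _ => Real.exp_nonneg _) fun n => ?_
    rw [← Real.exp_nat_mul]
    refine Real.exp_le_exp.2 ?_
    have : (n : ℝ) ≤ (n : ℝ) ^ 2 := by exact_mod_cast Nat.le_self_pow two_ne_zero n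
    nlinarith
  refine Summable.of_nat_of_neg (by simpa using h) (by simpa using h)

lemma summable_exp_neg_mul_sum_sq (ι : Type*) [Fintype ι] {c : ℝ} (hc : 0 < c) :
    Summable fun k : ι → ℤ => Real.exp (-c * ∑ i, (k i : ℝ) ^ 2) := by
  have h := ENNReal.tsum_pi_prod (ι := ι) fun k : ℤ => ENNReal.ofReal (Real.exp (-c * k ^ 2))
  have h1 := (summable_exp_neg_mul_int_sq hc).tsum_ofReal_ne_top
  have h2 := ENNReal.pow_ne_top (n := Fintype.card ι) h1
  rw [← h] at h2
  refine (ENNReal.summable_toReal h2).congr fun k => ?_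
  rw [ENNReal.toReal_prod, Finset.mul_sum, Real.exp_sum]
  exact Finset.prod_congr rfl fun i _ => by rw [ENNReal.toReal_ofReal (Real.exp_nonneg _)]

section
variable {ι : Type*} [Fintype ι]

/-- Half-open unit cubes with integral corners tile space. -/
lemma hasSum_setIntegral_cubes {f : (ι → ℝ) → ℂ} (hf : Integrable f) :
    HasSum (fun k : ι → ℤ => ∫ x in {x : ι → ℝ | ∀ i,
        x i ∈ Set.Ioc ((0 : ι → ℝ) i) ((0 : ι → ℝ) i + 1)},
      f (x + fun i => (k i : ℝ))) (∫ x, f x) := by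
  set S : (ι → ℤ) → Set (ι → ℝ) := fun k => {x | ∀ i, x i ∈ Set.Ioc (k i : ℝ) (k i + 1)} with hS
  have hmem : ∀ k x, x ∈ S k ↔ k = fun i => ⌈x i⌉ - 1 := by
    intro k x
    simp only [hS, Set.mem_ofPred_eq, Set.mem_Ioc, funext_iff]
    refine forall_congr' fun i => ?_
    have := Int.ceil_eq_iff (z := k i + 1) (a := x i)
    push_cast at this
    rw [add_sub_cancel_right] at this
    rw [← this]
    omega
  have hmeas : ∀ k, MeasurableSet (S k) := fun k =>
    MeasurableSet.univ_pi' fun i => measurableSet_Ioc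
  have hU : ⋃ k, S k = Set.univ := Set.eq_univ_of_forall fun x =>
    Set.mem_iUnion.2 ⟨_, (hmem _ _).2 rfl⟩
  have hd : Pairwise (Function.onFun Disjoint S) := fun k l hkl =>
    Set.disjoint_left.2 fun x hx hx' => hkl (((hmem _ _).1 hx).trans ((hmem _ _).1 hx').symm)
  have h := hasSum_integral_iUnion (f := f) hmeas hd hf.integrableOn
  rw [hU, setIntegral_univ] at h
  convert! h using 1
  funext k
  have hmp := measurePreserving_add_right (volume : Measure (ι → ℝ)) fun i => (k i : ℝ)
  have he := hmp.setIntegral_preimage_emb (MeasurableEquiv.addRight _).measurableEmbedding f (S k)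
  have hset : {x : ι → ℝ | ∀ i, x i ∈ Set.Ioc ((0 : ι → ℝ) i) ((0 : ι → ℝ) i + 1)} =
      (fun x => x + fun i => (k i : ℝ)) ⁻¹' S k := by
    ext x
    simp [hS, add_comm _ (1 : ℝ)]
  rw [hset]
  exact he

/-- **Poisson summation** over `ℤ^ι` for continuous functions with Gaussian decay. -/
theorem tsum_int_pi_eq_tsum_fourier {f : (ι → ℝ) → ℂ} (hf : Continuous f) {B c : ℝ} (hc : 0 < c)
    (hB : ∀ x, ‖f x‖ ≤ B * Real.exp (-c * ∑ i, x i ^ 2)) {φ : (ι → ℤ) → ℂ}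
    (hφ : ∀ m, φ m = ∫ x : ι → ℝ, cexp (-2 * Real.pi * I * ∑ i, m i * x i) * f x) (hs : Summable φ)
        :
    ∑' k : ι → ℤ, f (fun i => (k i : ℝ)) = ∑' m, φ m := by
  have hB0 : 0 ≤ B := nonneg_of_mul_nonneg_left ((norm_nonneg _).trans (hB 0)) (Real.exp_pos _)
  have hbound : ∀ R : ℝ, ∀ x : ι → ℝ, ∑ i, x i ^ 2 ≤ R → ∀ k : ι → ℤ,
      ‖f (x + fun i => (k i : ℝ))‖ ≤
        B * Real.exp (c * R) * Real.exp (-(c / 2) * ∑ i, (k i : ℝ) ^ 2) := by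
    intro R x hx k
    refine (hB _).trans ?_
    rw [mul_assoc, ← Real.exp_add]
    gcongr
    have : ∑ i, ((1 / 2) * (k i : ℝ) ^ 2 - x i ^ 2) ≤ ∑ i, (x + fun i => (k i : ℝ)) i ^ 2 :=
      Finset.sum_le_sum fun i _ => by
        rw [Pi.add_apply]
        nlinarith [sq_nonneg (2 * x i + k i)]
    rw [Finset.sum_sub_distrib, ← Finset.mul_sum] at this
    nlinarith
  have hsum : ∀ R : ℝ, Summable fun k : ι → ℤ =>
      B * Real.exp (c * R) * Real.exp (-(c / 2) * ∑ i, (k i : ℝ) ^ 2) := fun R =>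
    (summable_exp_neg_mul_sum_sq ι (half_pos hc)).mul_left _
  set P : (ι → ℝ) → ℂ := fun x => ∑' k : ι → ℤ, f (x + fun i => (k i : ℝ)) with hP
  have hPc : Continuous P := by
    refine continuous_iff_continuousAt.2 fun x => ?_
    set R := ∑ i, x i ^ 2 + 1
    have hU : IsOpen {y : ι → ℝ | ∑ i, y i ^ 2 < R} :=
      isOpen_lt (by fun_prop) continuous_const
    refine ContinuousOn.continuousAt (s := {y : ι → ℝ | ∑ i, y i ^ 2 < R}) ?_
      (hU.mem_nhds (by simp [R]))
    exact continuousOn_tsum (fun k => (by fun_prop)) (hsum R)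
      fun k y hy => hbound R y hy.le k
  have hPp : ∀ (x : ι → ℝ) (l : ι → ℤ), P (x + fun i => (l i : ℝ)) = P x := by
    intro x l
    rw [hP]
    simp only
    rw [← (Equiv.addLeft l).tsum_eq fun k : ι → ℤ => f (x + fun i => (k i : ℝ))]
    refine tsum_congr fun k => congrArg f ?_
    ext i
    simp [add_assoc]
  set q : C(ι → ℝ, UnitAddTorus ι) := ⟨fun x i => (x i : UnitAddCircle),
    continuous_pi fun i => (AddCircle.continuous_mk' 1).comp (continuous_apply i)⟩ with hq
  have hqm : IsQuotientMap q :=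
    (IsOpenQuotientMap.piMap fun _ => QuotientAddGroup.isOpenQuotientMap_mk).isQuotientMap
  have hfac : Function.FactorsThrough (⟨P, hPc⟩ : C(ι → ℝ, ℂ)) q := by
    intro x y hxy
    have : ∀ i, ∃ n : ℤ, y i - x i = n := fun i => by
      have h := QuotientAddGroup.eq.1 (show (x i : UnitAddCircle) = y i from congrFun hxy i)
      obtain ⟨n, hn⟩ := AddSubgroup.mem_zmultiples_iff.1 h
      exact ⟨n, by rw [zsmul_eq_mul, mul_one] at hn; rw [hn]; ring⟩
    choose l hl using this
    change P x = P y
    rw [← hPp x l]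
    congr 1
    ext i
    simp [← hl]
  set G : C(UnitAddTorus ι, ℂ) := hqm.lift ⟨P, hPc⟩ hfac with hG
  have hGq : ∀ x, G (q x) = P x := fun x => congrFun (congrArg DFunLike.coe
    (hqm.lift_comp ⟨P, hPc⟩ hfac)) x
  have hint : Integrable fun x : ι → ℝ => B * Real.exp (-c * ∑ i, x i ^ 2) := by
    refine (Integrable.congr (Integrable.fintype_prod (f := fun _ : ι => fun y : ℝ =>
      Real.exp (-c * y ^ 2)) fun _ => integrable_exp_neg_mul_sq hc)
          (.of_forall fun x => ?_)).const_mul B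
    simp only [Finset.mul_sum, Real.exp_sum]
  have hcoeff : ∀ m, UnitAddTorus.mFourierCoeff G m = φ m := by
    intro m
    set e : (ι → ℝ) → ℂ := fun x => cexp (-2 * Real.pi * I * ∑ i, m i * x i) with he
    have hec : Continuous e := by fun_prop
    have hen : ∀ x, ‖e x‖ = 1 := fun x => by
      rw [he]
      simp only
      rw [mul_right_comm, ← ofReal_ofNat, ← ofReal_neg, ← ofReal_mul, ← ofReal_mul,
        norm_exp_ofReal_mul_I]
    have hep : ∀ (x : ι → ℝ) (k : ι → ℤ), e (x + fun i => (k i : ℝ)) = e x := by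
      intro x k
      rw [he]
      simp only
      refine Complex.exp_eq_exp_iff_exists_int.2 ⟨-∑ i, m i * k i, ?_⟩
      push_cast
      simp only [Pi.add_apply, ofReal_add, mul_add, Finset.sum_add_distrib, ofReal_intCast]
      ring
    have hef : Integrable fun x => e x * f x := hint.mono' (hec.mul hf).aestronglyMeasurable
      (.of_forall fun x => by rw [norm_mul, hen, one_mul]; exact hB x)
    have h1 := hasSum_setIntegral_cubes hef
    rw [← hφ] at h1
    rw [UnitAddTorus.mFourierCoeff_eq_integral _ _ 0]
    set S := {x : ι → ℝ | ∀ i, x i ∈ Set.Ioc ((0 : ι → ℝ) i) ((0 : ι → ℝ) i + 1)} with hS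
    have hSm : MeasurableSet S := MeasurableSet.univ_pi' fun i => measurableSet_Ioc
    have hSf : volume S ≠ ⊤ := by
      refine ((measure_mono (t := Set.Icc 0 1) fun x hx => ?_).trans_lt
        isCompact_Icc.measure_lt_top).ne
      exact ⟨fun i => (hx i).1.le, fun i => by simpa using (hx i).2⟩
    have hfin : IsFiniteMeasure (volume.restrict S) := ⟨by simpa using hSf.lt_top⟩
    refine HasSum.unique ?_ h1
    refine hasSum_integral_of_dominated_convergence (fun (k : ι → ℤ) _ =>
      B * Real.exp (c * Fintype.card ι) * Real.exp (-(c / 2) * ∑ i, (k i : ℝ) ^ 2))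
      (fun k => (Continuous.aestronglyMeasurable (by fun_prop))) (fun k => ?_)
      (.of_forall fun _ => hsum _) (integrable_const _) ?_
    · filter_upwards [ae_restrict_mem hSm] with x hx
      rw [norm_mul, hen, one_mul]
      refine hbound _ x ?_ k
      rw [← nsmul_one, ← Finset.card_univ, ← Finset.sum_const]
      refine Finset.sum_le_sum fun i _ => ?_
      have h1 := (hx i).1
      have h2 := (hx i).2
      simp only [Pi.zero_apply, zero_add] at h1 h2
      nlinarith
    · filter_upwards [ae_restrict_mem hSm] with x hx
      have hmf : UnitAddTorus.mFourier (-m) (fun i => (x i : UnitAddCircle)) = e x := by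
        simp only [UnitAddTorus.mFourier, ContinuousMap.coe_mk, fourier_coe_apply, he]
        rw [← Complex.exp_sum, ofReal_sum, Finset.mul_sum]
        congr 1
        refine Finset.sum_congr rfl fun i _ => ?_
        simp only [Pi.neg_apply]
        push_cast
        ring
      rw [hmf, smul_eq_mul, show G (fun i => (x i : UnitAddCircle)) = P x from hGq x]
      simp only [hep]
      refine HasSum.mul_left _ (Summable.hasSum ?_)
      exact .of_norm_bounded (hsum _) (hbound _ x le_rfl)
  have hs' : Summable (UnitAddTorus.mFourierCoeff G) := hs.congr fun m => (hcoeff m).symm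
  have hfinal := (UnitAddTorus.hasSum_mFourier_series_apply_of_summable hs' (q 0)).tsum_eq
  rw [hGq] at hfinal
  have hP0 : P 0 = ∑' k : ι → ℤ, f (fun i => (k i : ℝ)) := by simp [hP]
  rw [← hP0, ← hfinal]
  refine tsum_congr fun m => ?_
  have : UnitAddTorus.mFourier m (q 0) = 1 := by
    simp [UnitAddTorus.mFourier, hq]
  rw [this, hcoeff, smul_eq_mul, mul_one]
end
end

section
variable {ι : Type*} [Fintype ι]
open Matrix

lemma Matrix.sum_sq_mulVec_le (A : Matrix ι ι ℝ) (y : ι → ℝ) :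
    ∑ i, (A *ᵥ y) i ^ 2 ≤ (∑ i, ∑ j, A i j ^ 2) * ∑ i, y i ^ 2 := by
  rw [Finset.sum_mul]
  exact Finset.sum_le_sum fun i _ => Finset.sum_mul_sq_le_sq_mul_sq _ _ _

/-- A positive definite real quadratic form is bounded below by a multiple of the norm. -/
lemma exists_le_sum_sq_mulVec {M : Matrix ι ι ℝ} (hM : M.det ≠ 0) :
    ∃ c : ℝ, 0 < c ∧ ∀ x : ι → ℝ, c * ∑ i, x i ^ 2 ≤ ∑ i, (M *ᵥ x) i ^ 2 := by
  set C := ∑ i, ∑ j, M⁻¹ i j ^ 2 with hC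
  have hC0 : 0 ≤ C := Finset.sum_nonneg fun i _ => Finset.sum_nonneg fun j _ => sq_nonneg _
  refine ⟨(C + 1)⁻¹, by positivity, fun x => ?_⟩
  have h := Matrix.sum_sq_mulVec_le M⁻¹ (M *ᵥ x)
  rw [mulVec_mulVec, nonsing_inv_mul _ (isUnit_iff_ne_zero.2 hM), one_mulVec, ← hC] at h
  rw [inv_mul_le_iff₀ (by positivity)]
  nlinarith [Finset.sum_nonneg fun i (_ : i ∈ Finset.univ) => sq_nonneg ((M *ᵥ x) i)]

lemma summable_exp_neg_sum_sq_mulVec {M : Matrix ι ι ℝ} (hM : M.det ≠ 0) :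
    Summable fun k : ι → ℤ => Real.exp (-Real.pi * ∑ i, (M *ᵥ fun j => (k j : ℝ)) i ^ 2) := by
  obtain ⟨c, hc, h⟩ := exists_le_sum_sq_mulVec hM
  refine (summable_exp_neg_mul_sum_sq ι (mul_pos Real.pi_pos hc)).of_nonneg_of_le
    (fun _ => Real.exp_nonneg _) fun k => Real.exp_le_exp.2 ?_
  have := mul_le_mul_of_nonneg_left (h fun j => (k j : ℝ)) Real.pi_pos.le
  linarith

lemma integral_comp_mulVec {M : Matrix ι ι ℝ} (hM : M.det ≠ 0) (f : (ι → ℝ) → ℂ) :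
    ∫ x, f (M *ᵥ x) = (|M.det|⁻¹ : ℝ) * ∫ x, f x := by
  have hM' : LinearMap.det (toLin' M) ≠ 0 := by rwa [LinearMap.det_toLin']
  set e := (LinearMap.equivOfDetNeZero (toLin' M) hM').toContinuousLinearEquiv
  have h1 : ∫ x, f (M *ᵥ x) = ∫ x, f x ∂(Measure.map (toLin' M) volume) :=
    (integral_map_equiv e.toHomeomorph.toMeasurableEquiv f).symm
  rw [h1, Real.map_matrix_volume_pi_eq_smul_volume_pi hM, integral_smul_measure,
    ENNReal.toReal_ofReal (abs_nonneg _), abs_inv, Complex.real_smul]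

lemma fourier_gaussian_mulVec {M : Matrix ι ι ℝ} (hM : M.det ≠ 0) (m : ι → ℝ) :
    ∫ x : ι → ℝ, cexp (-2 * Real.pi * I * ∑ i, m i * x i) *
        (Real.exp (-Real.pi * ∑ i, (M *ᵥ x) i ^ 2) : ℂ) =
      (|M.det|⁻¹ * Real.exp (-Real.pi * ∑ i, (M⁻¹ᵀ *ᵥ m) i ^ 2) : ℝ) := by
  have h1 : ∀ x : ι → ℝ, ∑ i, m i * x i = ∑ i, (M⁻¹ᵀ *ᵥ m) i * (M *ᵥ x) i := by
    intro x
    have : (M⁻¹ᵀ *ᵥ m) ⬝ᵥ (M *ᵥ x) = m ⬝ᵥ x := by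
      rw [mulVec_transpose, ← dotProduct_mulVec, mulVec_mulVec,
        nonsing_inv_mul _ (isUnit_iff_ne_zero.2 hM), one_mulVec]
    exact this.symm
  set w := M⁻¹ᵀ *ᵥ m with hw
  have h2 := integral_comp_mulVec hM fun y => cexp (-2 * Real.pi * I * ∑ i, w i * y i) *
        (Real.exp (-Real.pi * ∑ i, y i ^ 2) : ℂ)
  have h3 := GaussianFourier.integral_cexp_neg_mul_sum_add (b := Real.pi)
    (by simpa using Real.pi_pos) fun i => -2 * Real.pi * I * w i
  have hp : (Real.pi : ℂ) ≠ 0 := by exact_mod_cast Real.pi_ne_zero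
  calc _ = ∫ x : ι → ℝ, cexp (-2 * Real.pi * I * (∑ i, w i * (M *ᵥ x) i : ℝ)) *
        (Real.exp (-Real.pi * ∑ i, (M *ᵥ x) i ^ 2) : ℂ) := by
        refine integral_congr_ae (.of_forall fun x => ?_)
        simp only
        rw [← h1]
    _ = (|M.det|⁻¹ : ℝ) * ∫ v : ι → ℝ, cexp (-Real.pi * ∑ i, (v i : ℂ) ^ 2 +
          ∑ i, (-2 * Real.pi * I * w i) * v i) := by
        refine h2.trans ?_
        congr 1
        refine integral_congr_ae (.of_forall fun v => ?_)
        simp only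
        push_cast
        rw [← Complex.exp_add, add_comm, Finset.mul_sum (a := -2 * (Real.pi : ℂ) * I)]
        congr 2
        exact Finset.sum_congr rfl fun i _ => by ring
    _ = _ := by
        rw [h3, div_self hp, one_cpow, one_mul]
        push_cast
        congr 2
        rw [Finset.mul_sum, Finset.sum_div]
        refine Finset.sum_congr rfl fun i _ => ?_
        field_simp
        rw [I_sq]
        ring

/-- The inversion formula for multidimensional Gaussian theta series. -/
theorem tsum_exp_neg_sum_sq_mulVec {M : Matrix ι ι ℝ} (hM : M.det ≠ 0) :
    ∑' k : ι → ℤ, Real.exp (-Real.pi * ∑ i, (M *ᵥ fun j => (k j : ℝ)) i ^ 2) =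
      |M.det|⁻¹ * ∑' k : ι → ℤ,
        Real.exp (-Real.pi * ∑ i, (M⁻¹ᵀ *ᵥ fun j => (k j : ℝ)) i ^ 2) := by
  obtain ⟨c, hc, h⟩ := exists_le_sum_sq_mulVec hM
  have hM' : (M⁻¹ᵀ).det ≠ 0 := by
    rw [det_transpose]
    simpa [det_nonsing_inv] using hM
  have := tsum_int_pi_eq_tsum_fourier
    (f := fun x : ι → ℝ => (Real.exp (-Real.pi * ∑ i, (M *ᵥ x) i ^ 2) : ℂ)) (B := 1)
    (by simp only [mulVec, dotProduct]; fun_prop) (mul_pos Real.pi_pos hc)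
    (fun x => by
      rw [Complex.norm_real, Real.norm_of_nonneg (Real.exp_nonneg _), one_mul]
      refine Real.exp_le_exp.2 ?_
      have := mul_le_mul_of_nonneg_left (h x) Real.pi_pos.le
      linarith)
    (φ := fun k => (|M.det|⁻¹ * Real.exp (-Real.pi * ∑ i, (M⁻¹ᵀ *ᵥ fun j => (k j : ℝ)) i ^ 2) : ℝ))
    (fun m => (fourier_gaussian_mulVec hM fun j => (m j : ℝ)).symm)
    (Complex.summable_ofReal.2 ((summable_exp_neg_sum_sq_mulVec hM').mul_left _))
  rw [← tsum_mul_left]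
  exact_mod_cast this
end

section
variable {ι : Type*} [Fintype ι]
open Matrix

open scoped MatrixOrder in
lemma Matrix.PosDef.exists_eq_transpose_mul_self {G : Matrix ι ι ℝ} (hG : G.PosDef) :
    ∃ M : Matrix ι ι ℝ, M.det ≠ 0 ∧ G = Mᵀ * M := by
  obtain ⟨M, rfl⟩ := CStarAlgebra.nonneg_iff_eq_star_mul_self.mp hG.posSemidef.nonneg
  refine ⟨M, fun h => hG.det_pos.ne' ?_, by simp [star_eq_conjTranspose]⟩
  rw [det_mul, h, mul_zero]

lemma sum_sq_mulVec (M : Matrix ι ι ℝ) (x : ι → ℝ) :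
    ∑ i, (M *ᵥ x) i ^ 2 = x ⬝ᵥ (Mᵀ * M) *ᵥ x := by
  rw [← mulVec_mulVec, dotProduct_mulVec, vecMul_transpose]
  simp [dotProduct, sq]

lemma Matrix.PosDef.exists_le_dotProduct_mulVec {G : Matrix ι ι ℝ} (hG : G.PosDef) :
    ∃ c : ℝ, 0 < c ∧ ∀ x : ι → ℝ, c * ∑ i, x i ^ 2 ≤ x ⬝ᵥ G *ᵥ x := by
  obtain ⟨M, hM, rfl⟩ := hG.exists_eq_transpose_mul_self
  simpa only [sum_sq_mulVec] using exists_le_sum_sq_mulVec hM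

/-- The inversion formula for the theta series of a positive definite quadratic form. -/
theorem Matrix.PosDef.tsum_exp_neg {G : Matrix ι ι ℝ} (hG : G.PosDef) :
    ∑' k : ι → ℤ, Real.exp (-Real.pi * ((fun j => (k j : ℝ)) ⬝ᵥ G *ᵥ fun j => (k j : ℝ))) =
      (Real.sqrt G.det)⁻¹ * ∑' k : ι → ℤ,
        Real.exp (-Real.pi * ((fun j => (k j : ℝ)) ⬝ᵥ G⁻¹ *ᵥ fun j => (k j : ℝ))) := by
  obtain ⟨M, hM, rfl⟩ := hG.exists_eq_transpose_mul_self
  have h := tsum_exp_neg_sum_sq_mulVec hM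
  simp only [sum_sq_mulVec] at h
  rw [h, det_mul, det_transpose, Real.sqrt_mul_self_eq_abs, mul_inv_rev, transpose_transpose,
    transpose_nonsing_inv]

end

section
variable {K : Type} [Field K] [NumberField K]
open Matrix

/-- The twisted trace form `∑_v n_v e^{2 x_v} |a|_v²`. -/
def twistedForm (x : InfinitePlace K → ℝ) (a : K) : ℝ :=
  ∑ v, (v.mult : ℝ) * Real.exp (2 * x v) * v a ^ 2

lemma sum_algHom_place {M : Type*} [AddCommMonoid M] (f : InfinitePlace K → M) :
    ∑ φ : K →ₐ[ℚ] ℂ, f (InfinitePlace.mk φ.toRingHom) = ∑ v, v.mult • f v := by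
  rw [← Finset.sum_fiberwise (g := fun φ : K →ₐ[ℚ] ℂ => InfinitePlace.mk φ.toRingHom)]
  refine Finset.sum_congr rfl fun v _ => ?_
  rw [Finset.sum_congr rfl fun φ hφ => by rw [(Finset.mem_filter.1 hφ).2], Finset.sum_const,
    ← InfinitePlace.card_filter_mk_eq]
  congr 1
  exact Finset.card_bij' (fun φ _ => φ.toRingHom) (fun φ _ => RingHom.equivRatAlgHom K ℂ φ)
    (fun φ hφ => Finset.mem_filter.2 ⟨Finset.mem_univ _, (Finset.mem_filter.1 hφ).2⟩)
    (fun φ hφ => Finset.mem_filter.2 ⟨Finset.mem_univ _, (Finset.mem_filter.1 hφ).2⟩)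
    (fun φ _ => rfl) (fun φ _ => rfl)

variable {ι : Type*}

/-- The matrix of embeddings of a basis, rows indexed by the basis. -/
abbrev embMatrix (b : Module.Basis ι ℚ K) (e : ι ≃ (K →ₐ[ℚ] ℂ)) : Matrix ι ι ℂ :=
  Algebra.embeddingsMatrixReindex ℚ ℂ b e

lemma embMatrix_apply (b : Module.Basis ι ℚ K) (e : ι ≃ (K →ₐ[ℚ] ℂ)) (i j : ι) :
    embMatrix b e i j = e j (b i) := by
  simp [embMatrix, Algebra.embeddingsMatrixReindex]

variable [Fintype ι]

/-- The complex Gram matrix of the twisted trace form. -/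
def gramC (b : Module.Basis ι ℚ K) (e : ι ≃ (K →ₐ[ℚ] ℂ)) (x : InfinitePlace K → ℝ) : Matrix ι ι ℂ :=
  (embMatrix b e).map (starRingEnd ℂ) *
    diagonal (fun j => ((Real.exp (2 * x (InfinitePlace.mk (e j).toRingHom)) : ℝ) : ℂ)) *
    (embMatrix b e)ᵀ

lemma gramC_apply (b : Module.Basis ι ℚ K) (e : ι ≃ (K →ₐ[ℚ] ℂ)) (x : InfinitePlace K → ℝ)
    (i j : ι) : gramC b e x i j = ∑ φ : K →ₐ[ℚ] ℂ,
      starRingEnd ℂ (φ (b i)) * (Real.exp (2 * x (InfinitePlace.mk φ.toRingHom)) : ℝ) *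
          φ (b j) := by
  rw [gramC, mul_apply, ← e.sum_comp]
  refine Finset.sum_congr rfl fun k _ => ?_
  rw [mul_diagonal, transpose_apply, map_apply, embMatrix_apply, embMatrix_apply]

/-- Complex conjugation on the set of complex embeddings. -/
def conjAlgHom : (K →ₐ[ℚ] ℂ) ≃ (K →ₐ[ℚ] ℂ) :=
  Function.Involutive.toPerm
    (fun φ => RingHom.equivRatAlgHom K ℂ (ComplexEmbedding.conjugate φ.toRingHom))
    fun φ => by ext; simp [RingHom.equivRatAlgHom_apply]

lemma conjAlgHom_apply (φ : K →ₐ[ℚ] ℂ) (a : K) : conjAlgHom φ a = starRingEnd ℂ (φ a) := rfl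

lemma mk_conjAlgHom (φ : K →ₐ[ℚ] ℂ) :
    InfinitePlace.mk (conjAlgHom φ).toRingHom = InfinitePlace.mk φ.toRingHom :=
  InfinitePlace.mk_conjugate_eq _

lemma conj_gramC (b : Module.Basis ι ℚ K) (e : ι ≃ (K →ₐ[ℚ] ℂ)) (x : InfinitePlace K → ℝ) :
    (gramC b e x).map (starRingEnd ℂ) = gramC b e x := by
  ext i j
  rw [map_apply, gramC_apply, map_sum, ← conjAlgHom.sum_comp]
  refine Finset.sum_congr rfl fun φ _ => ?_
  rw [conjAlgHom_apply, conjAlgHom_apply, mk_conjAlgHom, map_mul, map_mul, conj_ofReal, conj_conj,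
    conj_conj]

/-- The Gram matrix of the twisted trace form. -/
def twistedGram (b : Module.Basis ι ℚ K) (e : ι ≃ (K →ₐ[ℚ] ℂ)) (x : InfinitePlace K → ℝ) :
    Matrix ι ι ℝ :=
  (gramC b e x).map re

lemma twistedGram_map_ofReal (b : Module.Basis ι ℚ K) (e : ι ≃ (K →ₐ[ℚ] ℂ))
    (x : InfinitePlace K → ℝ) :
    (twistedGram b e x).map Complex.ofRealHom = gramC b e x := by
  ext i j
  have h := congrFun (congrFun (conj_gramC b e x) i) j
  exact conj_eq_iff_re.1 h

lemma twistedGram_quadratic (b : Module.Basis ι ℚ K) (e : ι ≃ (K →ₐ[ℚ] ℂ)) (x : InfinitePlace K → ℝ)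
    (k : ι → ℝ) : ((k ⬝ᵥ twistedGram b e x *ᵥ k : ℝ) : ℂ) =
      ∑ φ : K →ₐ[ℚ] ℂ, (Real.exp (2 * x (InfinitePlace.mk φ.toRingHom)) : ℝ) *
        ((normSq (∑ i, k i * φ (b i)) : ℝ) : ℂ) := by
  have hg : ∀ i j, ((twistedGram b e x i j : ℝ) : ℂ) = gramC b e x i j := fun i j =>
    congrFun (congrFun (twistedGram_map_ofReal b e x) i) j
  simp only [dotProduct, mulVec]
  push_cast
  simp only [hg, gramC_apply, normSq_eq_conj_mul_self, map_sum, map_mul, conj_ofReal]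
  calc _ = ∑ i, ∑ j, ∑ φ : K →ₐ[ℚ] ℂ, (Real.exp (2 * x (InfinitePlace.mk φ.toRingHom)) : ℂ) *
        ((k i * starRingEnd ℂ (φ (b i))) * (k j * φ (b j))) := by
        refine Finset.sum_congr rfl fun i _ => ?_
        rw [Finset.mul_sum]
        refine Finset.sum_congr rfl fun j _ => ?_
        rw [Finset.sum_mul, Finset.mul_sum]
        exact Finset.sum_congr rfl fun φ _ => by ring
    _ = _ := by
        rw [Finset.sum_congr rfl fun i _ => Finset.sum_comm, Finset.sum_comm]
        refine Finset.sum_congr rfl fun φ _ => ?_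
        rw [Finset.sum_mul_sum, Finset.mul_sum]
        push_cast
        exact Finset.sum_congr rfl fun i _ => by rw [Finset.mul_sum]

lemma twistedGram_dotProduct_int (b : Module.Basis ι ℚ K) (e : ι ≃ (K →ₐ[ℚ] ℂ))
    (x : InfinitePlace K → ℝ)
    (k : ι → ℤ) : (fun i => (k i : ℝ)) ⬝ᵥ twistedGram b e x *ᵥ (fun i => (k i : ℝ)) =
      twistedForm x (∑ i, k i • b i) := by
  apply Complex.ofReal_injective
  rw [twistedGram_quadratic, twistedForm]
  have h := sum_algHom_place (K := K) fun v =>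
    (Real.exp (2 * x v) * v (∑ i, k i • b i) ^ 2 : ℝ)
  rw [show ∑ v : InfinitePlace K, (v.mult : ℝ) * Real.exp (2 * x v) * v (∑ i, k i • b i) ^ 2 =
    ∑ v : InfinitePlace K, v.mult • (Real.exp (2 * x v) * v (∑ i, k i • b i) ^ 2) from
    Finset.sum_congr rfl fun v _ => by rw [nsmul_eq_mul, mul_assoc], ← h]
  push_cast
  refine Finset.sum_congr rfl fun φ _ => ?_
  congr 1
  rw [InfinitePlace.apply, ← ofReal_pow, ← normSq_eq_norm_sq]
  congr 2
  simp

lemma det_twistedGram (b : Module.Basis ι ℚ K) (e : ι ≃ (K →ₐ[ℚ] ℂ)) (x : InfinitePlace K → ℝ) :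
    (twistedGram b e x).det = |((Algebra.discr ℚ b : ℚ) : ℝ)| *
      Real.exp (2 * ∑ v : InfinitePlace K, v.mult * x v) := by
  apply Complex.ofReal_injective
  have h := RingHom.map_det Complex.ofRealHom (twistedGram b e x)
  have h2 := Algebra.discr_eq_det_embeddingsMatrixReindex_pow_two ℚ ℂ b e
  have h3 : ‖((Algebra.discr ℚ b : ℚ) : ℂ)‖ = |((Algebra.discr ℚ b : ℚ) : ℝ)| := by
    rw [← Complex.ofReal_ratCast, Complex.norm_real, Real.norm_eq_abs]
  have h4 : (((embMatrix b e).map (starRingEnd ℂ)).det) = starRingEnd ℂ (embMatrix b e).det :=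
    (RingHom.map_det _ _).symm
  rw [show (Complex.ofRealHom.mapMatrix (twistedGram b e x)) =
      gramC b e x from twistedGram_map_ofReal b e x] at h
  refine h.trans ?_
  rw [gramC, det_mul, det_mul, det_transpose, h4, det_diagonal, mul_right_comm,
    ← normSq_eq_conj_mul_self, normSq_eq_norm_sq, ← norm_pow, ← h2, eq_ratCast, h3]
  push_cast
  congr 1
  rw [← Complex.exp_sum]
  congr 1
  rw [e.sum_comp fun φ : K →ₐ[ℚ] ℂ => 2 * (x (InfinitePlace.mk φ.toRingHom) : ℂ),
    sum_algHom_place fun v => 2 * (x v : ℂ), Finset.mul_sum]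
  exact Finset.sum_congr rfl fun v _ => by rw [nsmul_eq_mul]; ring

lemma posDef_twistedGram (b : Module.Basis ι ℚ K) (e : ι ≃ (K →ₐ[ℚ] ℂ)) (x : InfinitePlace K → ℝ) :
    (twistedGram b e x).PosDef := by
  have hs : (twistedGram b e x).PosSemidef := by
    refine .of_dotProduct_mulVec_nonneg ?_ fun k => ?_
    · ext i j
      have h := congrFun (congrFun (conj_gramC b e x) i) j
      rw [map_apply] at h
      change re (gramC b e x j i) = re (gramC b e x i j)
      rw [← h, gramC_apply, gramC_apply, map_sum]
      congr 1
      exact Finset.sum_congr rfl fun φ _ => by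
        rw [map_mul, map_mul, conj_ofReal, conj_conj]
        ring
    · rw [star_trivial]
      have h := twistedGram_quadratic b e x k
      rw [show (∑ φ : K →ₐ[ℚ] ℂ, ((Real.exp (2 * x (InfinitePlace.mk φ.toRingHom)) : ℝ) : ℂ) *
        ((normSq (∑ i, k i * φ (b i)) : ℝ) : ℂ)) = ((∑ φ : K →ₐ[ℚ] ℂ,
        (Real.exp (2 * x (InfinitePlace.mk φ.toRingHom))) *
        (normSq (∑ i, k i * φ (b i))) : ℝ) : ℂ) by push_cast; rfl] at h
      rw [Complex.ofReal_injective h]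
      exact Finset.sum_nonneg fun φ _ => mul_nonneg (Real.exp_nonneg _) (normSq_nonneg _)
  rw [hs.posDef_iff_det_ne_zero, det_twistedGram]
  have := Algebra.discr_not_zero_of_basis ℚ b
  have h2 : ((Algebra.discr ℚ b : ℚ) : ℝ) ≠ 0 := by exact_mod_cast this
  positivity

lemma embMatrix_mul_traceDual (b : Module.Basis ι ℚ K) (e : ι ≃ (K →ₐ[ℚ] ℂ)) :
    embMatrix b e * (embMatrix b.traceDual e)ᵀ = 1 := by
  ext i j
  rw [mul_apply, one_apply]
  have h := trace_eq_sum_embeddings (K := ℚ) (L := K) ℂ (x := b i * b.traceDual j)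
  rw [Module.Basis.trace_mul_traceDual, ← e.sum_comp] at h
  simp only [transpose_apply, embMatrix_apply]
  simp only [map_mul] at h
  rw [← h]
  split_ifs <;> simp

lemma twistedGram_inv (b : Module.Basis ι ℚ K) (e : ι ≃ (K →ₐ[ℚ] ℂ)) (x : InfinitePlace K → ℝ) :
    (twistedGram b e x)⁻¹ = twistedGram b.traceDual e (-x) := by
  refine inv_eq_right_inv ?_
  apply Matrix.map_injective Complex.ofReal_injective
  change Complex.ofRealHom.mapMatrix _ = Complex.ofRealHom.mapMatrix 1
  rw [map_mul, map_one, RingHom.mapMatrix_apply, RingHom.mapMatrix_apply, twistedGram_map_ofReal,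
    twistedGram_map_ofReal, ← conj_gramC b.traceDual]
  set V := embMatrix b e
  set W := embMatrix b.traceDual e
  have h1 : V * Wᵀ = 1 := embMatrix_mul_traceDual b e
  have h2 : Vᵀ * W = 1 := by
    have := congrArg transpose (mul_eq_one_comm.1 h1)
    simpa using this
  have h3 : V.map (starRingEnd ℂ) * (W.map (starRingEnd ℂ))ᵀ = 1 := by
    have := congrArg (starRingEnd ℂ).mapMatrix h1
    rw [map_mul, map_one] at this
    exact this
  have h4 : (gramC b.traceDual e (-x)).map (starRingEnd ℂ) = W *
      diagonal (fun j => ((Real.exp (-2 * x (InfinitePlace.mk (e j).toRingHom)) : ℝ) : ℂ)) *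
      (W.map (starRingEnd ℂ))ᵀ := by
    change (starRingEnd ℂ).mapMatrix _ = _
    rw [gramC, map_mul, map_mul]
    congr 1
    congr 1
    · ext i j
      simp [W]
    · ext i j
      by_cases hij : i = j
      · subst hij
        rw [RingHom.mapMatrix_apply, map_apply, diagonal_apply_eq, diagonal_apply_eq, conj_ofReal]
        simp
      · simp [hij]
  rw [h4, gramC]
  calc _ = V.map (starRingEnd ℂ) *
        (diagonal (fun j => ((Real.exp (2 * x (InfinitePlace.mk (e j).toRingHom)) : ℝ) : ℂ)) *
          (Vᵀ * W) *
          diagonal (fun j => ((Real.exp (-2 * x (InfinitePlace.mk (e j).toRingHom)) : ℝ) : ℂ))) *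
        (W.map (starRingEnd ℂ))ᵀ := by simp only [mul_assoc, V]
    _ = _ := by
      rw [h2, mul_one, diagonal_mul_diagonal]
      rw [show (fun i => ((Real.exp (2 * x (InfinitePlace.mk (e i).toRingHom)) : ℝ) : ℂ) *
        ((Real.exp (-2 * x (InfinitePlace.mk (e i).toRingHom)) : ℝ) : ℂ)) = fun _ => 1 by
          ext i
          rw [← ofReal_mul, ← Real.exp_add]
          simp]
      rw [diagonal_one, mul_one, h3]
end

section
variable {K : Type} [Field K] [NumberField K]
open Matrix
open scoped ENNReal nonZeroDivisors

/-- The lattice spanned by a `ℚ`-basis of `K`, as a set of integral combinations. -/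
def zspanEquiv {ι : Type*} [Fintype ι] (b : Module.Basis ι ℚ K) {S : Set K}
    (hS : ∀ a, a ∈ Submodule.span ℤ (Set.range b) ↔ a ∈ S) : (ι → ℤ) ≃ {a : K // a ∈ S} :=
  (b.restrictScalars ℤ).equivFun.symm.toEquiv.trans (Equiv.subtypeEquivRight hS)

lemma zspanEquiv_apply {ι : Type*} [Fintype ι] (b : Module.Basis ι ℚ K) {S : Set K}
    (hS : ∀ a, a ∈ Submodule.span ℤ (Set.range b) ↔ a ∈ S) (k : ι → ℤ) :
    (zspanEquiv b hS k : K) = ∑ i, k i • b i := by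
  simp [zspanEquiv, Module.Basis.equivFun_symm_apply, Module.Basis.restrictScalars_apply]

/-- The Hecke theta function of a lattice in `K`. -/
def heckeTheta (S : Set K) (x : InfinitePlace K → ℝ) : ℝ≥0∞ :=
  ∑' a : {a : K // a ∈ S}, ENNReal.ofReal (Real.exp (-Real.pi * twistedForm x a))

lemma summable_theta_aux {ι : Type*} [Fintype ι] (b : Module.Basis ι ℚ K)
    (e : ι ≃ (K →ₐ[ℚ] ℂ)) (x : InfinitePlace K → ℝ) :
    Summable fun k : ι → ℤ => Real.exp (-Real.pi *
      ((fun j => (k j : ℝ)) ⬝ᵥ twistedGram b e x *ᵥ fun j => (k j : ℝ))) := by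
  obtain ⟨c, hc, h⟩ := (posDef_twistedGram b e x).exists_le_dotProduct_mulVec
  refine (summable_exp_neg_mul_sum_sq ι (mul_pos Real.pi_pos hc)).of_nonneg_of_le
    (fun _ => Real.exp_nonneg _) fun k => Real.exp_le_exp.2 ?_
  have := mul_le_mul_of_nonneg_left (h fun j => (k j : ℝ)) Real.pi_pos.le
  linarith

lemma heckeTheta_eq_ofReal {ι : Type*} [Fintype ι] (b : Module.Basis ι ℚ K) {S : Set K}
    (hS : ∀ a, a ∈ Submodule.span ℤ (Set.range b) ↔ a ∈ S)
    (e : ι ≃ (K →ₐ[ℚ] ℂ)) (x : InfinitePlace K → ℝ) :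
    heckeTheta S x = ENNReal.ofReal (∑' k : ι → ℤ, Real.exp (-Real.pi *
      ((fun j => (k j : ℝ)) ⬝ᵥ twistedGram b e x *ᵥ fun j => (k j : ℝ)))) := by
  rw [heckeTheta, ← (zspanEquiv b hS).tsum_eq, ENNReal.ofReal_tsum_of_nonneg
    (fun _ => Real.exp_nonneg _) (summable_theta_aux b e x)]
  refine tsum_congr fun k => ?_
  rw [zspanEquiv_apply, twistedGram_dotProduct_int]

lemma exists_embedding_equiv {ι : Type*} [Fintype ι] (b : Module.Basis ι ℚ K) :
    Nonempty (ι ≃ (K →ₐ[ℚ] ℂ)) :=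
  Fintype.card_eq.1 (by rw [AlgHom.card, Module.finrank_eq_card_basis b])

/-- Theta inversion for a lattice and its trace dual. -/
lemma heckeTheta_inversion {ι : Type*} [Fintype ι] (b : Module.Basis ι ℚ K) {S T : Set K}
    (hS : ∀ a, a ∈ Submodule.span ℤ (Set.range b) ↔ a ∈ S)
    (hT : ∀ a, a ∈ Submodule.span ℤ (Set.range b.traceDual) ↔ a ∈ T) (x : InfinitePlace K → ℝ) :
    heckeTheta S x = ENNReal.ofReal (Real.exp (-∑ v : InfinitePlace K, v.mult * x v) /
      Real.sqrt |((Algebra.discr ℚ b : ℚ) : ℝ)|) * heckeTheta T (-x) := by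
  obtain ⟨e⟩ := exists_embedding_equiv b
  rw [heckeTheta_eq_ofReal b hS e, heckeTheta_eq_ofReal b.traceDual hT e,
    (posDef_twistedGram b e x).tsum_exp_neg, ENNReal.ofReal_mul (by positivity), twistedGram_inv,
    det_twistedGram, Real.sqrt_mul (abs_nonneg _), mul_inv, mul_comm (Real.sqrt _)⁻¹]
  congr 2
  rw [div_eq_mul_inv, Real.exp_neg]
  congr 2
  rw [two_mul, Real.exp_add, Real.sqrt_mul_self (Real.exp_nonneg _)]

lemma twistedForm_zero_apply (x : InfinitePlace K → ℝ) : twistedForm x (0 : K) = 0 := by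
  simp [twistedForm]

/-- The theta function with the zero term removed. -/
def heckeTheta₀ (S : Set K) (x : InfinitePlace K → ℝ) : ℝ≥0∞ :=
  ∑' a : {a : K // a ∈ S ∧ a ≠ 0}, ENNReal.ofReal (Real.exp (-Real.pi * twistedForm x a))

lemma heckeTheta_eq_one_add {S : Set K} (h0 : (0 : K) ∈ S) (x : InfinitePlace K → ℝ) :
    heckeTheta S x = 1 + heckeTheta₀ S x := by
  have h1 : heckeTheta S x = ∑' a : K, S.indicator
      (fun a => ENNReal.ofReal (Real.exp (-Real.pi * twistedForm x a))) a :=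
    tsum_subtype S fun a => ENNReal.ofReal (Real.exp (-Real.pi * twistedForm x a))
  have h2 : heckeTheta₀ S x = ∑' a : K, {a | a ∈ S ∧ a ≠ 0}.indicator
      (fun a => ENNReal.ofReal (Real.exp (-Real.pi * twistedForm x a))) a :=
    tsum_subtype {a | a ∈ S ∧ a ≠ 0} fun a => ENNReal.ofReal (Real.exp (-Real.pi * twistedForm x a))
  have h3 : (1 : ℝ≥0∞) = ∑' a : K, if a = 0 then 1 else 0 := by rw [tsum_ite_eq]
  rw [h1, h2, h3, ← ENNReal.tsum_add]
  refine tsum_congr fun a => ?_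
  by_cases ha : a = 0
  · subst ha
    simp [h0, twistedForm_zero_apply]
  · by_cases hs : a ∈ S <;> simp [ha, hs]

lemma twistedForm_ge {x : InfinitePlace K → ℝ} {A : ℝ} (hx : ∀ v, A ≤ Real.exp (2 * x v)) (a : K) :
    A * twistedForm 0 a ≤ twistedForm x a := by
  rw [twistedForm, twistedForm, Finset.mul_sum]
  refine Finset.sum_le_sum fun v _ => ?_
  have := mul_le_mul_of_nonneg_right (hx v) (show 0 ≤ (v.mult : ℝ) * v a ^ 2 by positivity)
  simp only [Pi.zero_apply, mul_zero, Real.exp_zero, mul_one]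
  nlinarith

/-- Uniform exponential decay of the theta function without its zero term. -/
lemma heckeTheta₀_le {ι : Type*} [Fintype ι] (b : Module.Basis ι ℚ K) {S : Set K}
    (hS : ∀ a, a ∈ Submodule.span ℤ (Set.range b) ↔ a ∈ S) :
    ∃ c : ℝ, 0 < c ∧ ∀ A₀ : ℝ, 0 < A₀ → ∃ C : ℝ, ∀ A, A₀ ≤ A → ∀ x : InfinitePlace K → ℝ,
      (∀ v, A ≤ Real.exp (2 * x v)) → heckeTheta₀ S x ≤ ENNReal.ofReal (C * Real.exp (-c * A)) := by
  obtain ⟨e⟩ := exists_embedding_equiv b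
  obtain ⟨c, hc, h⟩ := (posDef_twistedGram b e 0).exists_le_dotProduct_mulVec
  refine ⟨Real.pi * (c / 2), by positivity, fun A₀ hA₀ => ?_⟩
  have hsum := summable_exp_neg_mul_sum_sq ι
    (mul_pos Real.pi_pos (mul_pos (half_pos hc) hA₀))
  refine ⟨∑' k : ι → ℤ, Real.exp (-(Real.pi * (c / 2 * A₀)) * ∑ i, (k i : ℝ) ^ 2),
    fun A hA x hx => ?_⟩
  rw [mul_comm, ← tsum_mul_left, ENNReal.ofReal_tsum_of_nonneg (fun _ => by positivity)
    (hsum.mul_left _)]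
  set f : {a : K // a ∈ S ∧ a ≠ 0} → (ι → ℤ) := fun a => (zspanEquiv b hS).symm ⟨a.1, a.2.1⟩ with hf
  have hinj : Function.Injective f := fun a a' haa => by
    have := (zspanEquiv b hS).symm.injective haa
    exact Subtype.ext (Subtype.mk.inj this)
  refine le_trans (ENNReal.tsum_le_tsum fun a => ?_) (ENNReal.tsum_comp_le_tsum_of_injective hinj _)
  refine ENNReal.ofReal_le_ofReal ?_
  rw [← Real.exp_add]
  refine Real.exp_le_exp.2 ?_
  have ha : (a : K) = ∑ i, f a i • b i := by
    rw [← zspanEquiv_apply b hS, hf, Equiv.apply_symm_apply]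
  have hk : (1 : ℝ) ≤ ∑ i, (f a i : ℝ) ^ 2 := by
    have hne : f a ≠ 0 := fun h0 => a.2.2 (by rw [ha, h0]; simp)
    obtain ⟨i, hi⟩ := Function.ne_iff.1 hne
    have h1 : (1 : ℝ) ≤ (f a i : ℝ) ^ 2 := by
      have : 1 ≤ (f a i) ^ 2 := by
        have := sq_nonneg (f a i)
        have h2 : (f a i) ^ 2 ≠ 0 := pow_ne_zero _ hi
        omega
      exact_mod_cast this
    exact h1.trans (Finset.single_le_sum (f := fun i => (f a i : ℝ) ^ 2)
      (fun i _ => sq_nonneg _) (Finset.mem_univ i))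
  have h1 := h fun i => (f a i : ℝ)
  rw [twistedGram_dotProduct_int, ← ha] at h1
  have h2 := twistedForm_ge hx (a : K)
  set s := ∑ i, (f a i : ℝ) ^ 2
  have hA0 : 0 < A := hA₀.trans_le hA
  have h3 : A * (c * s) ≤ twistedForm x (a : K) :=
    (mul_le_mul_of_nonneg_left h1 hA0.le).trans h2
  have h4 : c / 2 * A + c / 2 * A₀ * s ≤ A * (c * s) := by
    have e1 : c / 2 * A ≤ c / 2 * A * s := le_mul_of_one_le_right (by positivity) hk
    have e2 : c / 2 * A₀ * s ≤ c / 2 * A * s := by gcongr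
    nlinarith
  have := mul_le_mul_of_nonneg_left (h4.trans h3) Real.pi_pos.le
  linarith

/-- The covolume of a fractional ideal, normalized by the trace form. -/
def covol (I : (FractionalIdeal (𝓞 K)⁰ K)ˣ) : ℝ :=
  (FractionalIdeal.absNorm I.1 : ℝ) * Real.sqrt ((discr K).natAbs : ℝ)

lemma discr_basisOfFractionalIdeal (I : (FractionalIdeal (𝓞 K)⁰ K)ˣ) :
    Real.sqrt |((Algebra.discr ℚ (basisOfFractionalIdeal K I) : ℚ) : ℝ)| = covol I := by
  have hcard : Fintype.card (Module.Free.ChooseBasisIndex ℤ (𝓞 K)) =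
      Fintype.card (Module.Free.ChooseBasisIndex ℤ I) := by
    rw [← Module.finrank_eq_card_basis (integralBasis K),
      ← Module.finrank_eq_card_basis (basisOfFractionalIdeal K I)]
  have e := (Fintype.card_eq.1 hcard).some
  set b' := (basisOfFractionalIdeal K I).reindex e.symm with hb'
  have h1 : Algebra.discr ℚ b' = Algebra.discr ℚ (basisOfFractionalIdeal K I) := by
    rw [hb', Module.Basis.coe_reindex, Equiv.symm_symm]
    exact Algebra.discr_reindex ℚ _ e.symm
  have h2 := Algebra.discr_of_matrix_vecMul (A := ℚ) (integralBasis K)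
      ((integralBasis K).toMatrix b')
  rw [Module.Basis.toMatrix_map_vecMul, h1, ← coe_discr, ← Module.Basis.det_apply] at h2
  have h3 := det_basisOfFractionalIdeal_eq_absNorm K I e
  rw [covol, h2, ← h3]
  push_cast
  rw [abs_mul, abs_pow, Real.sqrt_mul (by positivity), Real.sqrt_sq (abs_nonneg _), Nat.cast_natAbs]
  push_cast
  rfl

lemma covol_pos (I : (FractionalIdeal (𝓞 K)⁰ K)ˣ) : 0 < covol I := by
  have h1 : (FractionalIdeal.absNorm I.1) ≠ 0 := FractionalIdeal.absNorm_eq_zero_iff.not.2 I.ne_zero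
  have h2 := FractionalIdeal.absNorm_nonneg I.1
  have h3 : 0 < FractionalIdeal.absNorm I.1 := lt_of_le_of_ne h2 h1.symm
  have h4 : 0 < (discr K).natAbs := Int.natAbs_pos.2 (discr_ne_zero K)
  rw [covol]
  have : (0 : ℝ) < (FractionalIdeal.absNorm I.1 : ℝ) := by exact_mod_cast h3
  positivity

/-- The trace dual of a fractional ideal, as a unit of the group of fractional ideals. -/
def dualUnit (I : (FractionalIdeal (𝓞 K)⁰ K)ˣ) : (FractionalIdeal (𝓞 K)⁰ K)ˣ :=
  Units.mk0 (FractionalIdeal.dual ℤ ℚ (1 : FractionalIdeal (𝓞 K)⁰ K))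
    (FractionalIdeal.dual_ne_zero ℤ ℚ one_ne_zero) * I⁻¹

lemma coe_dualUnit (I : (FractionalIdeal (𝓞 K)⁰ K)ˣ) :
    (dualUnit I : FractionalIdeal (𝓞 K)⁰ K) = FractionalIdeal.dual ℤ ℚ I.1 := by
  rw [FractionalIdeal.dual_eq_mul_inv, dualUnit, Units.val_mul, Units.val_mk0,
    Units.val_inv_eq_inv_val]

lemma covol_dualUnit (I : (FractionalIdeal (𝓞 K)⁰ K)ˣ) : covol (dualUnit I) = (covol I)⁻¹ := by
  have h1 : FractionalIdeal.absNorm (FractionalIdeal.dual ℤ ℚ (1 : FractionalIdeal (𝓞 K)⁰ K)) *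
      ((discr K).natAbs : ℚ) = 1 := by
    rw [← absNorm_differentIdeal K (𝓞 K), ← FractionalIdeal.coeIdeal_absNorm (K := K),
      coeIdeal_differentIdeal ℤ ℚ K, ← map_mul, mul_inv_cancel₀
      (FractionalIdeal.dual_ne_zero ℤ ℚ (one_ne_zero (α := FractionalIdeal (𝓞 K)⁰ K))),
      FractionalIdeal.absNorm_one]
  have h2 : FractionalIdeal.absNorm I.1 * FractionalIdeal.absNorm (I⁻¹).1 = 1 := by
    rw [← map_mul, ← Units.val_mul, mul_inv_cancel, Units.val_one, FractionalIdeal.absNorm_one]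
  refine eq_inv_of_mul_eq_one_left ?_
  rw [covol, covol, dualUnit, Units.val_mul, map_mul,
    Units.val_mk0]
  have h1' : ((FractionalIdeal.absNorm (FractionalIdeal.dual ℤ ℚ
    (1 : FractionalIdeal (𝓞 K)⁰ K)) : ℚ) : ℝ) * ((discr K).natAbs : ℝ) = 1 := by exact_mod_cast h1
  have h2' : ((FractionalIdeal.absNorm I.1 : ℚ) : ℝ) *
    ((FractionalIdeal.absNorm (I⁻¹).1 : ℚ) : ℝ) = 1 := by exact_mod_cast h2
  rw [Rat.cast_mul]
  have hs := Real.mul_self_sqrt (show (0 : ℝ) ≤ ((discr K).natAbs : ℝ) by positivity)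
  calc _ = ((FractionalIdeal.absNorm (FractionalIdeal.dual ℤ ℚ
      (1 : FractionalIdeal (𝓞 K)⁰ K)) : ℚ) : ℝ) *
      (Real.sqrt ((discr K).natAbs : ℝ) * Real.sqrt ((discr K).natAbs : ℝ)) *
      (((FractionalIdeal.absNorm I.1 : ℚ) : ℝ) *
        ((FractionalIdeal.absNorm (I⁻¹).1 : ℚ) : ℝ)) := by ring
    _ = 1 := by rw [hs, h1', h2', one_mul]

lemma mem_span_traceDual_basisOfFractionalIdeal (I : (FractionalIdeal (𝓞 K)⁰ K)ˣ) (a : K) :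
    a ∈ Submodule.span ℤ (Set.range (basisOfFractionalIdeal K I).traceDual) ↔
      a ∈ (dualUnit I : Set K) := by
  change _ ↔ a ∈ (dualUnit I).1
  rw [coe_dualUnit, FractionalIdeal.mem_dual I.ne_zero, Module.Basis.traceDual_def,
    ← LinearMap.BilinForm.dualSubmodule_span_of_basis, LinearMap.BilinForm.mem_dualSubmodule]
  refine ⟨fun h y hy => ?_, fun h y hy => ?_⟩
  · exact Submodule.mem_one.1 (h y ((mem_span_basisOfFractionalIdeal K).2 hy))
  · exact Submodule.mem_one.2 (h y ((mem_span_basisOfFractionalIdeal K).1 hy))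

/-- Theta inversion for fractional ideals. -/
theorem heckeTheta_fractionalIdeal (I : (FractionalIdeal (𝓞 K)⁰ K)ˣ) (x : InfinitePlace K → ℝ) :
    heckeTheta (I : Set K) x = ENNReal.ofReal
      (Real.exp (-∑ v : InfinitePlace K, v.mult * x v) / covol I) *
      heckeTheta (dualUnit I : Set K) (-x) := by
  rw [heckeTheta_inversion (basisOfFractionalIdeal K I)
    (fun a => mem_span_basisOfFractionalIdeal K) (mem_span_traceDual_basisOfFractionalIdeal I),
    discr_basisOfFractionalIdeal]

end

section
variable {K : Type} [Field K] [NumberField K]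
open NumberField.Units NumberField.Units.dirichletUnitTheorem Module
open scoped ENNReal nonZeroDivisors

variable (K) in
lemma sum_mult_eq_add (x : InfinitePlace K → ℝ) :
    ∑ v : InfinitePlace K, (v.mult : ℝ) * x v = (w₀ : InfinitePlace K).mult * x w₀ +
      ∑ w : {w : InfinitePlace K // w ≠ w₀}, (w.1.mult : ℝ) * x w.1 :=
  Fintype.sum_eq_add_sum_subtype_ne _ w₀

lemma sum_mult_eq_finrank : ∑ v : InfinitePlace K, (v.mult : ℝ) = finrank ℚ K := by
  exact_mod_cast InfinitePlace.sum_mult_eq (K := K)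

omit [NumberField K] in
lemma mult_pos_real (v : InfinitePlace K) : (0 : ℝ) < v.mult := Nat.cast_pos.2 v.mult_pos

/-- Logarithmic coordinates: a height `τ` together with a point of the logarithmic space. -/
def logCoord (K : Type) [Field K] [NumberField K] :
    (ℝ × logSpace K) ≃ₗ[ℝ] (InfinitePlace K → ℝ) where
  toFun p v := (if h : v ≠ w₀ then p.2 ⟨v, h⟩ else -∑ w, p.2 w) / v.mult + p.1 / finrank ℚ K
  map_add' p q := by
    ext v
    by_cases h : v = w₀
    · simp only [h, ne_eq, not_true_eq_false, dite_false, Prod.snd_add, Pi.add_apply,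
        Finset.sum_add_distrib, Prod.fst_add]
      ring
    · simp only [h, ne_eq, not_false_eq_true, dite_true, Prod.snd_add, Pi.add_apply, Prod.fst_add]
      ring
  map_smul' c p := by
    ext v
    by_cases h : v = w₀
    · simp only [h, ne_eq, not_true_eq_false, dite_false, Prod.smul_snd, Pi.smul_apply,
        Prod.smul_fst, smul_eq_mul, RingHom.id_apply, ← Finset.mul_sum]
      ring
    · simp only [h, ne_eq, not_false_eq_true, dite_true, Prod.smul_snd, Pi.smul_apply,
        Prod.smul_fst, smul_eq_mul, RingHom.id_apply]
      ring
  invFun x := (∑ v : InfinitePlace K, (v.mult : ℝ) * x v,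
    fun w => w.1.mult * (x w.1 - (∑ v : InfinitePlace K, (v.mult : ℝ) * x v) / finrank ℚ K))
  left_inv p := by
    have hn : (0 : ℝ) < finrank ℚ K := Nat.cast_pos.2 finrank_pos
    have h0 := mult_pos_real (w₀ : InfinitePlace K)
    have hs : ∑ v : InfinitePlace K, (v.mult : ℝ) *
        ((if h : v ≠ w₀ then p.2 ⟨v, h⟩ else -∑ w, p.2 w) / v.mult + p.1 / finrank ℚ K) = p.1 := by
      have h1 : ∀ v : InfinitePlace K, (v.mult : ℝ) *
          ((if h : v ≠ w₀ then p.2 ⟨v, h⟩ else -∑ w, p.2 w) / v.mult + p.1 / finrank ℚ K) =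
          (v.mult : ℝ) * ((if h : v ≠ w₀ then p.2 ⟨v, h⟩ else -∑ w, p.2 w) / v.mult) +
          v.mult * (p.1 / finrank ℚ K) := fun v => mul_add _ _ _
      rw [Finset.sum_congr rfl fun v _ => h1 v, Finset.sum_add_distrib, ← Finset.sum_mul,
        sum_mult_eq_finrank, mul_div_cancel₀ _ hn.ne', sum_mult_eq_add]
      have h2 : ∀ w : {w : InfinitePlace K // w ≠ w₀}, (w.1.mult : ℝ) *
          ((if h : w.1 ≠ w₀ then p.2 ⟨w.1, h⟩ else -∑ w, p.2 w) / w.1.mult) = p.2 w := fun w => by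
        rw [dif_pos w.2, mul_div_cancel₀ _ (mult_pos_real w.1).ne']
      rw [Finset.sum_congr rfl fun w _ => h2 w, dif_neg (by simp), mul_div_cancel₀ _ h0.ne']
      ring
    refine Prod.ext hs ?_
    ext w
    change (w.1.mult : ℝ) * ((if h : w.1 ≠ w₀ then p.2 ⟨w.1, h⟩ else -∑ w, p.2 w) / w.1.mult +
      p.1 / finrank ℚ K - (∑ v : InfinitePlace K, (v.mult : ℝ) *
        ((if h : v ≠ w₀ then p.2 ⟨v, h⟩ else -∑ w, p.2 w) / v.mult + p.1 / finrank ℚ K)) /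
        finrank ℚ K) = p.2 w
    rw [hs, dif_pos w.2, add_sub_cancel_right, mul_div_cancel₀ _ (mult_pos_real w.1).ne']
  right_inv x := by
    have hn : (0 : ℝ) < finrank ℚ K := Nat.cast_pos.2 finrank_pos
    ext v
    by_cases h : v = w₀
    · have h0 := mult_pos_real (w₀ : InfinitePlace K)
      have e := sum_mult_eq_add K x
      have e1 : ∑ w : {w : InfinitePlace K // w ≠ w₀}, (w.1.mult : ℝ) =
          finrank ℚ K - (w₀ : InfinitePlace K).mult := by
        have := sum_mult_eq_add K fun _ => 1
        simp only [mul_one] at this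
        rw [sum_mult_eq_finrank] at this
        linarith
      subst h
      simp only [ne_eq, not_true_eq_false, dite_false, mul_sub, Finset.sum_sub_distrib,
        ← Finset.sum_mul, e1]
      field_simp
      rw [e]
      field_simp
      ring
    · have h0 := mult_pos_real v
      simp only [ne_eq, h, not_false_eq_true, dite_true]
      field_simp
      ring

lemma logCoord_apply (p : ℝ × logSpace K) (v : InfinitePlace K) : logCoord K p v =
    (if h : v ≠ w₀ then p.2 ⟨v, h⟩ else -∑ w, p.2 w) / v.mult + p.1 / finrank ℚ K := rfl

lemma sum_mult_logCoord (p : ℝ × logSpace K) :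
    ∑ v : InfinitePlace K, (v.mult : ℝ) * logCoord K p v = p.1 :=
  congrArg Prod.fst ((logCoord K).symm_apply_apply p)

lemma logCoord_add_log (τ : ℝ) (y : logSpace K) (u : (𝓞 K)ˣ) (v : InfinitePlace K) :
    logCoord K (τ, y + logEmbedding K (Additive.ofMul u)) v =
      logCoord K (τ, y) v + Real.log (v u) := by
  have hv := mult_pos_real v
  rw [logCoord_apply, logCoord_apply]
  by_cases h : v = w₀
  · subst h
    simp only [ne_eq, not_true_eq_false, dite_false, Pi.add_apply, Finset.sum_add_distrib,
      sum_logEmbedding_component]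
    field_simp
    ring
  · simp only [ne_eq, h, not_false_eq_true, dite_true, Pi.add_apply, logEmbedding_component]
    field_simp
    ring

lemma twistedForm_unit_mul (τ : ℝ) (y : logSpace K) (u : (𝓞 K)ˣ) (a : K) :
    twistedForm (logCoord K (τ, y)) ((u : K) * a) =
      twistedForm (logCoord K (τ, y + logEmbedding K (Additive.ofMul u))) a := by
  refine Finset.sum_congr rfl fun v _ => ?_
  rw [logCoord_add_log, map_mul, mul_add, Real.exp_add, ← Nat.cast_two (R := ℝ),
    Real.exp_nat_mul (Real.log _), Real.exp_log (Units.pos_at_place u v)]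
  ring

lemma continuous_twistedForm (a : K) : Continuous fun x => twistedForm x a := by
  unfold twistedForm
  fun_prop

lemma continuous_logCoord : Continuous (logCoord K) :=
  (logCoord K).toLinearMap.continuous_of_finiteDimensional

lemma continuous_twistedForm_logCoord (a : K) :
    Continuous fun p : ℝ × logSpace K => twistedForm (logCoord K p) a :=
  (continuous_twistedForm a).comp continuous_logCoord

variable (K) in
/-- Change of variables for logarithmic coordinates. -/
lemma exists_lintegral_logCoord : ∃ c : ℝ, 0 < c ∧ ∀ g : (InfinitePlace K → ℝ) → ℝ≥0∞,
    Measurable g → ∫⁻ τ : ℝ, ∫⁻ y : logSpace K, g (logCoord K (τ, y)) =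
      ENNReal.ofReal c * ∫⁻ x, g x := by
  set L := (logCoord K).toContinuousLinearEquiv
  set μ : Measure (InfinitePlace K → ℝ) :=
    Measure.map L (volume : Measure (ℝ × logSpace K)) with hμ
  have : (volume : Measure (ℝ × logSpace K)).IsAddHaarMeasure :=
    inferInstanceAs (((volume : Measure ℝ).prod (volume : Measure (logSpace K))).IsAddHaarMeasure)
  have : μ.IsAddHaarMeasure := L.isAddHaarMeasure_map volume
  obtain ⟨c, hc0, hc⟩ : ∃ c : NNReal, 0 < c ∧ μ = c • (volume : Measure (InfinitePlace K → ℝ)) :=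
    ⟨_, Measure.addHaarScalarFactor_pos_of_isAddHaarMeasure μ volume,
      Measure.isAddLeftInvariant_eq_smul μ volume⟩
  refine ⟨c, hc0, fun g hg => ?_⟩
  have h1 : ∫⁻ x, g x ∂μ = ∫⁻ p : ℝ × logSpace K, g (logCoord K p) :=
    lintegral_map hg L.continuous.measurable
  rw [Measure.volume_eq_prod, lintegral_prod (fun p => g (logCoord K p))
    (hg.comp continuous_logCoord.measurable).aemeasurable] at h1
  rw [← h1, hc, lintegral_smul_measure, ENNReal.ofReal_coe_nnreal]
  rfl

/-- Sums over units of functions of the logarithmic embedding. -/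
lemma tsum_units (f : logSpace K → ℝ≥0∞) :
    ∑' u : (𝓞 K)ˣ, f (logEmbedding K (Additive.ofMul u)) =
      (torsionOrder K : ℝ≥0∞) * ∑' l : unitLattice K, f l := by
  set s : (𝓞 K)ˣ ⧸ torsion K → (𝓞 K)ˣ := Quotient.out with hs
  have hs' : ∀ q, (QuotientGroup.mk (s q) : (𝓞 K)ˣ ⧸ torsion K) = q := Quotient.out_eq
  have hb : Function.Bijective fun p : ((𝓞 K)ˣ ⧸ torsion K) × torsion K => s p.1 * p.2 := by
    refine ⟨fun p q h => ?_, fun u => ?_⟩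
    · have h1 : p.1 = q.1 := by
        have := congrArg (QuotientGroup.mk (s := torsion K)) h
        simpa [QuotientGroup.mk_mul_of_mem, hs'] using this
      refine Prod.ext h1 (Subtype.ext ?_)
      have h2 : s p.1 * p.2 = s q.1 * q.2 := h
      rw [h1] at h2
      exact mul_left_cancel h2
    · refine ⟨(QuotientGroup.mk u, ⟨(s (QuotientGroup.mk u))⁻¹ * u,
        QuotientGroup.eq.1 (hs' _)⟩), ?_⟩
      simp
  rw [← (Equiv.ofBijective _ hb).tsum_eq, ENNReal.tsum_prod']
  have h3 : ∀ (q : (𝓞 K)ˣ ⧸ torsion K) (ζ : torsion K),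
      logEmbedding K (Additive.ofMul (Equiv.ofBijective _ hb (q, ζ))) =
        (logEmbeddingEquiv K (Additive.ofMul q) : logSpace K) := fun q ζ => by
    have h4 : logEmbedding K (Additive.ofMul (ζ : (𝓞 K)ˣ)) = 0 := logEmbedding_eq_zero_iff.2 ζ.2
    conv_rhs => rw [← hs' q]
    rw [logEmbeddingEquiv_apply]
    change logEmbedding K (Additive.ofMul (s q * ζ)) = _
    rw [ofMul_mul, map_add, h4, add_zero]
  simp_rw [h3]
  have h5 : ∀ c : ℝ≥0∞, ∑' _ : torsion K, c = torsionOrder K * c := fun c => by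
    have := Fintype.ofFinite (torsion K)
    rw [tsum_fintype, Finset.sum_const, nsmul_eq_mul, torsionOrder, Finset.card_univ,
      Nat.card_eq_fintype_card]
  simp_rw [h5]
  rw [ENNReal.tsum_mul_left]
  congr 1
  exact ((Additive.ofMul.trans (logEmbeddingEquiv K).toEquiv).tsum_eq fun l => f l)

/-- Unfolding an integral over a fundamental domain of the unit lattice. -/
lemma tsum_units_setLIntegral {F : Set (logSpace K)}
    (hF : IsAddFundamentalDomain (unitLattice K) F volume) (g : logSpace K → ℝ≥0∞) :
    ∑' u : (𝓞 K)ˣ, ∫⁻ y in F, g (y + logEmbedding K (Additive.ofMul u)) =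
      (torsionOrder K : ℝ≥0∞) * ∫⁻ y, g y := by
  have : VAddInvariantMeasure (unitLattice K) (logSpace K) volume :=
    inferInstanceAs (VAddInvariantMeasure (unitLattice K).toAddSubgroup (logSpace K) volume)
  rw [tsum_units fun l => ∫⁻ y in F, g (y + l), hF.lintegral_eq_tsum'']
  congr 1
  refine tsum_congr fun l => lintegral_congr fun y => ?_
  rw [add_comm]
  rfl

end

section
variable {K : Type} [Field K] [NumberField K]
open Module FractionalIdeal
open scoped ENNReal nonZeroDivisors

/-- A choice, for each nonzero integral ideal `J`, of a representative `c J` of the inverse class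
and of a generator of `J * I (c J)`. -/
lemma exists_ideal_generators {ι : Type} {I : ι → (FractionalIdeal (𝓞 K)⁰ K)ˣ}
    (hI : Function.Bijective fun i => ClassGroup.mk K (I i)) :
    ∃ (c : {J : Ideal (𝓞 K) // J ≠ ⊥} → ι) (α : {J : Ideal (𝓞 K) // J ≠ ⊥} → K),
      ∀ J, α J ≠ 0 ∧ spanSingleton (𝓞 K)⁰ (α J) = (J.1 : FractionalIdeal (𝓞 K)⁰ K) *
          (I (c J)).1 := by
  have h : ∀ J : {J : Ideal (𝓞 K) // J ≠ ⊥}, ∃ (i : ι) (a : K), a ≠ 0 ∧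
      spanSingleton (𝓞 K)⁰ a = (J.1 : FractionalIdeal (𝓞 K)⁰ K) * (I i).1 := fun J => by
    set U : (FractionalIdeal (𝓞 K)⁰ K)ˣ := Units.mk0 (J.1 : FractionalIdeal (𝓞 K)⁰ K)
      (coeIdeal_ne_zero.2 J.2)
    obtain ⟨i, hi⟩ := hI.2 (ClassGroup.mk K U)⁻¹
    have h1 : ClassGroup.mk K (U * I i) = 1 := by
      rw [map_mul]
      exact mul_eq_one_iff_eq_inv'.2 hi
    obtain ⟨a, ha⟩ := (isPrincipal_iff _).1 (ClassGroup.mk_eq_one_iff.1 h1)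
    refine ⟨i, a, fun h0 => (U * I i).ne_zero ?_, ha.symm⟩
    rw [ha, h0, spanSingleton_zero]
  choose c α hα using h
  exact ⟨c, α, hα⟩

lemma exists_unit_of_spanSingleton_eq {a b : K} (hb : b ≠ 0)
    (h : spanSingleton (𝓞 K)⁰ a = spanSingleton (𝓞 K)⁰ b) : ∃ u : (𝓞 K)ˣ, (u : K) * a = b := by
  obtain ⟨x, hx⟩ := (mem_spanSingleton (𝓞 K)⁰).1 (h ▸ mem_spanSingleton_self (𝓞 K)⁰ a)
  obtain ⟨y, hy⟩ := (mem_spanSingleton (𝓞 K)⁰).1 (h.symm ▸ mem_spanSingleton_self (𝓞 K)⁰ b)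
  rw [Algebra.smul_def] at hx hy
  have h1 : (algebraMap (𝓞 K) K) (y * x) = algebraMap (𝓞 K) K 1 := by
    rw [map_mul, map_one]
    refine mul_right_cancel₀ hb ?_
    rw [mul_assoc, hx, hy, one_mul]
  have h2 : y * x = 1 := FaithfulSMul.algebraMap_injective (𝓞 K) K h1
  exact ⟨⟨y, x, h2, by rw [mul_comm, h2]⟩, hy⟩

lemma spanSingleton_unit_mul (u : (𝓞 K)ˣ) (a : K) :
    spanSingleton (𝓞 K)⁰ ((u : K) * a) = spanSingleton (𝓞 K)⁰ a := by
  refine le_antisymm (spanSingleton_le_iff_mem.2 ?_) (spanSingleton_le_iff_mem.2 ?_)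
  · exact (mem_spanSingleton _).2 ⟨u, by rw [Algebra.smul_def]⟩
  · refine (mem_spanSingleton _).2 ⟨(u⁻¹ : (𝓞 K)ˣ), ?_⟩
    rw [Algebra.smul_def, ← mul_assoc, ← map_mul, ← Units.val_mul, inv_mul_cancel, Units.val_one,
      map_one, one_mul]

/-- Regrouping nonzero elements of ideals representing the classes by the ideals they generate. -/
lemma sum_tsum_eq_tsum_ideals {ι : Type} [Fintype ι] {I : ι → (FractionalIdeal (𝓞 K)⁰ K)ˣ}
    (hI : Function.Bijective fun i => ClassGroup.mk K (I i))
    {c : {J : Ideal (𝓞 K) // J ≠ ⊥} → ι} {α : {J : Ideal (𝓞 K) // J ≠ ⊥} → K}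
    (hα : ∀ J, α J ≠ 0 ∧
      spanSingleton (𝓞 K)⁰ (α J) = (J.1 : FractionalIdeal (𝓞 K)⁰ K) * (I (c J)).1)
    (h : ι → K → ℝ≥0∞) :
    ∑ i, ∑' a : {a : K // a ∈ (I i : Set K) ∧ a ≠ 0}, h i a =
      ∑' J, ∑' u : (𝓞 K)ˣ, h (c J) (u * α J) := by
  have hmem : ∀ J (u : (𝓞 K)ˣ), (u : K) * α J ∈ (I (c J) : Set K) ∧ (u : K) * α J ≠ 0 :=
      fun J u => by
    have hu : ((u : 𝓞 K) : K) ≠ 0 := NumberField.Units.coe_ne_zero u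
    refine ⟨?_, mul_ne_zero hu (hα J).1⟩
    change _ ∈ (I (c J)).1
    rw [← spanSingleton_le_iff_mem, spanSingleton_unit_mul, (hα J).2]
    exact mul_le_of_le_one_left' coeIdeal_le_one
  set φ : {J : Ideal (𝓞 K) // J ≠ ⊥} × (𝓞 K)ˣ → Σ i, {a : K // a ∈ (I i : Set K) ∧ a ≠ 0} :=
    fun p => ⟨c p.1, (p.2 : K) * α p.1, hmem p.1 p.2⟩ with hφ
  have hinj : Function.Injective φ := fun p q hpq => by
    have h1 : c p.1 = c q.1 := congrArg Sigma.fst hpq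
    have h2 : (p.2 : K) * α p.1 = (q.2 : K) * α q.1 :=
      congrArg (fun s : Σ i, {a : K // a ∈ (I i : Set K) ∧ a ≠ 0} => (s.2 : K)) hpq
    have h3 := congrArg (spanSingleton (𝓞 K)⁰) h2
    rw [spanSingleton_unit_mul, spanSingleton_unit_mul, (hα _).2, (hα _).2, h1] at h3
    have h4 : p.1 = q.1 := Subtype.ext (coeIdeal_injective
        (mul_right_cancel₀ (I (c q.1)).ne_zero h3))
    refine Prod.ext h4 (Units.ext ?_)
    rw [h4] at h2
    exact FaithfulSMul.algebraMap_injective (𝓞 K) K (mul_right_cancel₀ (hα _).1 h2)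
  have hsurj : Function.Surjective φ := by
    rintro ⟨i, a, ha, ha0⟩
    have h1 : spanSingleton (𝓞 K)⁰ a * (I i)⁻¹.1 ≤ 1 := by
      refine le_trans (mul_le_mul_left (spanSingleton_le_iff_mem.2 ha) _) ?_
      rw [← Units.val_mul, mul_inv_cancel, Units.val_one]
    obtain ⟨J, hJ⟩ := le_one_iff_exists_coeIdeal.1 h1
    have h2 : spanSingleton (𝓞 K)⁰ a = (J : FractionalIdeal (𝓞 K)⁰ K) * (I i).1 := by
      rw [hJ, mul_assoc, ← Units.val_mul, inv_mul_cancel, Units.val_one, mul_one]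
    have hJ0 : J ≠ ⊥ := fun h0 => ha0 (by
      rw [← spanSingleton_eq_zero_iff (R := 𝓞 K) (S := (𝓞 K)⁰), h2, h0, coeIdeal_bot, zero_mul])
    have h3 : c ⟨J, hJ0⟩ = i := by
      refine hI.1 ?_
      set U : (FractionalIdeal (𝓞 K)⁰ K)ˣ := Units.mk0 (J : FractionalIdeal (𝓞 K)⁰ K)
        (coeIdeal_ne_zero.2 hJ0)
      have e1 : ClassGroup.mk K (U * I i) = 1 :=
        ClassGroup.mk_eq_one_iff.2 ((isPrincipal_iff _).2 ⟨a, h2.symm⟩)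
      have e2 : ClassGroup.mk K (U * I (c ⟨J, hJ0⟩)) = 1 :=
        ClassGroup.mk_eq_one_iff.2 ((isPrincipal_iff _).2 ⟨_, (hα ⟨J, hJ0⟩).2.symm⟩)
      rw [map_mul] at e1 e2
      exact mul_left_cancel (e2.trans e1.symm)
    have h4 : spanSingleton (𝓞 K)⁰ (α ⟨J, hJ0⟩) = spanSingleton (𝓞 K)⁰ a := by
      rw [(hα _).2, h3, h2]
    obtain ⟨u, hu⟩ := exists_unit_of_spanSingleton_eq ha0 h4
    refine ⟨(⟨J, hJ0⟩, u), ?_⟩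
    subst h3
    rw [hφ]
    simp only [hu]
  rw [← tsum_fintype (L := .unconditional ι), ← ENNReal.tsum_sigma
    (f := fun i (a : {a : K // a ∈ (I i : Set K) ∧ a ≠ 0}) => h i a),
    ← (Equiv.ofBijective φ ⟨hinj, hsurj⟩).tsum_eq, ENNReal.tsum_prod']
  rfl

lemma covol_rpow_mul_norm {I : (FractionalIdeal (𝓞 K)⁰ K)ˣ} {J : Ideal (𝓞 K)} (hJ : J ≠ ⊥) {a : K}
    (h : spanSingleton (𝓞 K)⁰ a = (J : FractionalIdeal (𝓞 K)⁰ K) * I.1) (σ : ℝ) :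
    covol I ^ σ * (|Algebra.norm ℚ a| : ℚ) ^ (-σ) =
      ((discr K).natAbs : ℝ) ^ (σ / 2) * (Ideal.absNorm J : ℝ) ^ (-σ) := by
  have h1 : |Algebra.norm ℚ a| = (Ideal.absNorm J : ℚ) * FractionalIdeal.absNorm I.1 := by
    rw [← FractionalIdeal.absNorm_span_singleton (R := 𝓞 K), h, map_mul, coeIdeal_absNorm]
  have h2 : 0 < FractionalIdeal.absNorm I.1 := lt_of_le_of_ne (absNorm_nonneg I.1)
    (Ne.symm (absNorm_eq_zero_iff.not.2 I.ne_zero))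
  have h2' : (0 : ℝ) < (FractionalIdeal.absNorm I.1 : ℝ) := by exact_mod_cast h2
  have h3 : (0 : ℝ) < Ideal.absNorm J :=
    Nat.cast_pos.2 (Nat.pos_of_ne_zero (Ideal.absNorm_eq_zero_iff.not.2 hJ))
  rw [h1, covol, Rat.cast_mul, Rat.cast_natCast, Real.mul_rpow h2'.le (Real.sqrt_nonneg _),
    Real.mul_rpow h3.le h2'.le, Real.rpow_neg h2'.le, Real.sqrt_eq_rpow, ← Real.rpow_mul
    (Nat.cast_nonneg _), one_div_mul_eq_div]
  have := (Real.rpow_pos_of_pos h2' σ).ne'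
  field_simp

end

section
open Module
open scoped ENNReal nonZeroDivisors

/-- Logarithmic substitution on the positive half-line. -/
lemma lintegral_Ioi_comp_exp {c : ℝ} (hc : 0 < c) (g : ℝ → ℝ≥0∞) :
    ∫⁻ t in Set.Ioi (0 : ℝ), g t =
      ∫⁻ x : ℝ, ENNReal.ofReal (c * Real.exp x) * g (c * Real.exp x) := by
  have himg : (fun x => c * Real.exp x) '' Set.univ = Set.Ioi (0 : ℝ) := by
    ext t
    simp only [Set.image_univ, Set.mem_range, Set.mem_Ioi]
    refine ⟨?_, fun ht => ⟨Real.log (t / c), ?_⟩⟩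
    · rintro ⟨x, rfl⟩
      positivity
    · rw [Real.exp_log (div_pos ht hc)]
      field_simp
  rw [← himg, lintegral_image_eq_lintegral_abs_deriv_mul (f' := fun x => c * Real.exp x)
    MeasurableSet.univ, setLIntegral_univ]
  · refine lintegral_congr fun x => ?_
    rw [abs_of_pos (by positivity)]
  · exact fun x _ => ((Real.hasDerivAt_exp x).const_mul c).hasDerivWithinAt
  · exact fun x _ y _ h => Real.exp_injective (mul_left_cancel₀ hc.ne' h)

lemma lintegral_exp_mul_exp {s a : ℝ} (hs : 0 < s) (ha : 0 < a) :
    ∫⁻ x : ℝ, ENNReal.ofReal (Real.exp (s * x) * Real.exp (-a * Real.exp (2 * x))) =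
      ENNReal.ofReal (a ^ (-s / 2) * (1 / 2) * Real.Gamma (s / 2)) := by
  have h1 := integral_rpow_mul_exp_neg_mul_rpow (p := 2) (q := s - 1) (b := a) two_pos
    (by linarith) ha
  have h2 : IntegrableOn (fun x : ℝ => x ^ (s - 1) * Real.exp (-a * x ^ (2 : ℝ))) (Set.Ioi 0) :=
    integrableOn_rpow_mul_exp_neg_mul_rpow (by linarith) two_pos ha
  rw [sub_add_cancel] at h1
  rw [← h1, ofReal_integral_eq_lintegral_ofReal h2 ((ae_restrict_mem measurableSet_Ioi).mono
    fun x hx => by have : (0 : ℝ) < x := hx; positivity), lintegral_Ioi_comp_exp zero_lt_one]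
  refine lintegral_congr fun x => ?_
  rw [one_mul, ← ENNReal.ofReal_mul (Real.exp_nonneg _), ← mul_assoc, ← Real.exp_mul,
    ← Real.exp_mul, mul_comm x 2, ← Real.exp_add x]
  ring_nf

/-- The local factor at an infinite place. -/
def localGamma {K : Type} [Field K] (v : InfinitePlace K) (σ : ℝ) : ℝ :=
  (Real.pi * v.mult) ^ (-(σ * v.mult) / 2) * (1 / 2) * Real.Gamma (σ * v.mult / 2)

variable {K : Type} [Field K] [NumberField K]

omit [NumberField K] in
lemma lintegral_local (v : InfinitePlace K) {σ : ℝ} (hσ : 0 < σ) {a : K} (ha : a ≠ 0) :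
    ∫⁻ x : ℝ, ENNReal.ofReal (Real.exp (σ * v.mult * x) *
      Real.exp (-Real.pi * (v.mult * Real.exp (2 * x) * v a ^ 2))) =
      ENNReal.ofReal ((v a ^ v.mult) ^ (-σ) * localGamma v σ) := by
  have hm : (0 : ℝ) < v.mult := mult_pos_real v
  have hva : 0 < v a := v.pos_iff.2 ha
  have h := lintegral_exp_mul_exp (s := σ * v.mult) (a := Real.pi * v.mult * v a ^ 2)
    (by positivity) (by positivity)
  convert! h using 2
  · ext x
    congr 3
    ring
  · rw [localGamma, Real.mul_rpow (x := Real.pi * v.mult) (by positivity) (by positivity),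
      ← Real.rpow_natCast (v a) 2,
      ← Real.rpow_natCast (v a) v.mult, ← Real.rpow_mul hva.le, ← Real.rpow_mul hva.le]
    have : ((2 : ℕ) : ℝ) * (-(σ * v.mult) / 2) = v.mult * -σ := by push_cast; ring
    rw [this]
    ring

lemma lintegral_fintype_prod {ι : Type*} [Fintype ι] {f : ι → ℝ → ℝ} (hf : ∀ i x, 0 ≤ f i x)
    (hm : ∀ i, Measurable (f i)) (h : ∀ i, ∫⁻ x, ENNReal.ofReal (f i x) ≠ ⊤) :
    ∫⁻ x : ι → ℝ, ENNReal.ofReal (∏ i, f i (x i)) = ∏ i, ∫⁻ x, ENNReal.ofReal (f i x) := by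
  have hint : ∀ i, Integrable (f i) := fun i => ⟨(hm i).aestronglyMeasurable, by
    rw [HasFiniteIntegral]
    convert! lt_top_iff_ne_top.2 (h i) using 1
    refine lintegral_congr fun x => ?_
    rw [Real.enorm_eq_ofReal (hf i x)]⟩
  have h1 : Integrable fun x : ι → ℝ => ∏ i, f i (x i) := Integrable.fintype_prod hint
  rw [← ofReal_integral_eq_lintegral_ofReal h1 (ae_of_all _ fun x =>
    Finset.prod_nonneg fun i _ => hf i _), integral_fintype_prod_volume_eq_prod,
    ENNReal.ofReal_prod_of_nonneg fun i _ => integral_nonneg (hf i)]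
  exact Finset.prod_congr rfl fun i _ => ofReal_integral_eq_lintegral_ofReal (hint i)
    (ae_of_all _ (hf i))

/-- The full archimedean integral. -/
lemma lintegral_archimedean {σ : ℝ} (hσ : 0 < σ) {a : K} (ha : a ≠ 0) :
    ∫⁻ x : InfinitePlace K → ℝ, ENNReal.ofReal (Real.exp (σ * ∑ v, v.mult * x v) *
      Real.exp (-Real.pi * twistedForm x a)) =
      ENNReal.ofReal ((|Algebra.norm ℚ a| : ℚ) ^ (-σ) * ∏ v : InfinitePlace K, localGamma v σ) := by
  have h1 : ∀ x : InfinitePlace K → ℝ, Real.exp (σ * ∑ v, v.mult * x v) *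
      Real.exp (-Real.pi * twistedForm x a) = ∏ v : InfinitePlace K, (Real.exp (σ * v.mult * x v) *
      Real.exp (-Real.pi * (v.mult * Real.exp (2 * x v) * v a ^ 2))) := fun x => by
    rw [Finset.prod_mul_distrib, ← Real.exp_sum, ← Real.exp_sum, twistedForm, Finset.mul_sum,
      Finset.mul_sum]
    simp only [mul_assoc]
  simp_rw [h1]
  rw [lintegral_fintype_prod (f := fun (v : InfinitePlace K) x => Real.exp (σ * v.mult * x) *
    Real.exp (-Real.pi * (v.mult * Real.exp (2 * x) * v a ^ 2))) (fun _ _ => by positivity)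
        (fun v => by fun_prop)
    (fun v => by rw [lintegral_local v hσ ha]; exact ENNReal.ofReal_ne_top)]
  simp_rw [lintegral_local _ hσ ha]
  have hg : ∀ v : InfinitePlace K, 0 ≤ localGamma v σ := fun v => by
    have := mult_pos_real v
    have := Real.Gamma_pos_of_pos (show 0 < σ * v.mult / 2 by positivity)
    rw [localGamma]
    positivity
  rw [← ENNReal.ofReal_prod_of_nonneg fun v _ => mul_nonneg (by positivity) (hg v),
    Finset.prod_mul_distrib, Real.finsetProd_rpow _ _ fun v _ => by positivity,
    InfinitePlace.prod_eq_abs_norm, Rat.cast_abs]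

/-- The archimedean gamma factor at a positive real argument. -/
def realGammaFac (r₁ r₂ : ℕ) (σ : ℝ) : ℝ :=
  (Real.pi ^ (-σ / 2) * Real.Gamma (σ / 2)) ^ r₁ *
    (2 * (2 * Real.pi) ^ (-σ) * Real.Gamma σ) ^ r₂

lemma realGammaFac_pos (r₁ r₂ : ℕ) {σ : ℝ} (hσ : 0 < σ) : 0 < realGammaFac r₁ r₂ σ := by
  have := Real.Gamma_pos_of_pos hσ
  have := Real.Gamma_pos_of_pos (half_pos hσ)
  rw [realGammaFac]
  positivity

lemma ofReal_realGammaFac (r₁ r₂ : ℕ) (σ : ℝ) :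
    (realGammaFac r₁ r₂ σ : ℂ) = gammaFac r₁ r₂ σ := by
  rw [realGammaFac, gammaFac, Gammaℝ, Gammaℂ]
  push_cast
  rw [ofReal_cpow Real.pi_pos.le, ofReal_cpow (by positivity), ← Gamma_ofReal, ← Gamma_ofReal]
  push_cast
  rfl

lemma prod_localGamma (σ : ℝ) : ∏ v : InfinitePlace K, localGamma v σ =
    (1 / 2) ^ InfinitePlace.nrRealPlaces K * (1 / 4) ^ InfinitePlace.nrComplexPlaces K *
      realGammaFac (InfinitePlace.nrRealPlaces K) (InfinitePlace.nrComplexPlaces K) σ := by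
  have h1 : ∀ v : InfinitePlace K, localGamma v σ = if v.IsReal then
      1 / 2 * (Real.pi ^ (-σ / 2) * Real.Gamma (σ / 2)) else
      1 / 4 * (2 * (2 * Real.pi) ^ (-σ) * Real.Gamma σ) := fun v => by
    rw [localGamma, InfinitePlace.mult]
    split_ifs
    · push_cast
      rw [mul_one, mul_one]
      ring
    · push_cast
      rw [show -(σ * 2) / 2 = -σ by ring, show σ * 2 / 2 = σ by ring, mul_comm Real.pi]
      ring
  simp_rw [h1]
  rw [Finset.prod_ite, Finset.prod_const, Finset.prod_const, realGammaFac, mul_pow (1 / 2 : ℝ),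
    mul_pow (1 / 4 : ℝ)]
  have h2 : (Finset.univ.filter fun v : InfinitePlace K => v.IsReal).card =
      InfinitePlace.nrRealPlaces K := by
    rw [InfinitePlace.nrRealPlaces, Fintype.card_subtype]
  have h3 : (Finset.univ.filter fun v : InfinitePlace K => ¬ v.IsReal).card =
      InfinitePlace.nrComplexPlaces K := by
    rw [InfinitePlace.nrComplexPlaces, Fintype.card_subtype]
    simp only [InfinitePlace.not_isReal_iff_isComplex]
  rw [h2, h3]
  ring

end

section
variable {K : Type} [Field K] [NumberField K]
open NumberField.Units NumberField.Units.dirichletUnitTheorem Module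
open scoped ENNReal nonZeroDivisors

lemma countable_numberField (K : Type) [Field K] [NumberField K] : Countable K :=
  (Module.finBasis ℚ K).equivFun.injective.countable

lemma countable_units (K : Type) [Field K] [NumberField K] : Countable (𝓞 K)ˣ :=
  have := countable_numberField K
  (Units.coe_injective K).countable

lemma measurable_expForm (a : K) : Measurable fun p : ℝ × logSpace K =>
    ENNReal.ofReal (Real.exp (-Real.pi * twistedForm (logCoord K p) a)) := by
  have := (continuous_twistedForm_logCoord a).measurable
  exact (this.const_mul _).exp.ennreal_ofReal

lemma measurable_heckeTheta₀ (S : Set K) : Measurable fun p : ℝ × logSpace K =>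
    heckeTheta₀ S (logCoord K p) := by
  have := countable_numberField K
  exact Measurable.tsum fun a => measurable_expForm _

variable {ι : Type} [Fintype ι]

/-- The theta function integrated over a domain of the logarithmic space and summed over a family
of lattices of normalised covolume. -/
def thetaFun (F : Set (logSpace K)) (I : ι → (FractionalIdeal (𝓞 K)⁰ K)ˣ) (t : ℝ) : ℝ≥0∞ :=
  ∑ i, ∫⁻ y in F, heckeTheta (I i : Set K) (logCoord K (Real.log (t / covol (I i)), y))

/-- The theta function with its constant term removed. -/
def thetaFun₀ (F : Set (logSpace K)) (I : ι → (FractionalIdeal (𝓞 K)⁰ K)ˣ) (t : ℝ) : ℝ≥0∞ :=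
  ∑ i, ∫⁻ y in F, heckeTheta₀ (I i : Set K) (logCoord K (Real.log (t / covol (I i)), y))

lemma thetaFun_eq_add (F : Set (logSpace K)) (I : ι → (FractionalIdeal (𝓞 K)⁰ K)ˣ) (t : ℝ) :
    thetaFun F I t = Fintype.card ι * volume F + thetaFun₀ F I t := by
  have h0 : ∀ i, (0 : K) ∈ (I i : Set K) := fun i => (I i).1.zero_mem
  simp_rw [thetaFun, thetaFun₀, heckeTheta_eq_one_add (h0 _)]
  simp_rw [lintegral_add_left (f := fun _ : logSpace K => (1 : ℝ≥0∞)) measurable_const]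
  simp [Finset.sum_add_distrib]

lemma measurable_setLIntegral_expForm (F : Set (logSpace K)) (a : K) : Measurable fun τ : ℝ =>
    ∫⁻ y in F, ENNReal.ofReal (Real.exp (-Real.pi * twistedForm (logCoord K (τ, y)) a)) :=
  Measurable.lintegral_prod_right' (measurable_expForm a)

lemma measurable_setLIntegral_heckeTheta₀ (F : Set (logSpace K)) (S : Set K) :
    Measurable fun τ : ℝ => ∫⁻ y in F, heckeTheta₀ S (logCoord K (τ, y)) :=
  Measurable.lintegral_prod_right' (measurable_heckeTheta₀ S)

lemma measurable_thetaFun₀ (F : Set (logSpace K)) (I : ι → (FractionalIdeal (𝓞 K)⁰ K)ˣ) :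
    Measurable (thetaFun₀ F I) := by
  refine Finset.measurable_sum _ fun i _ => ?_
  exact (measurable_setLIntegral_heckeTheta₀ F (I i : Set K)).comp
    (Real.measurable_log.comp (measurable_id.div_const _))

/-- The contribution of a single lattice vector to the Mellin transform of the theta function. -/
def thetaWeight (F : Set (logSpace K)) (V σ : ℝ) (a : K) : ℝ≥0∞ :=
  ∫⁻ τ : ℝ, ENNReal.ofReal (V ^ σ * Real.exp (σ * τ)) *
    ∫⁻ y in F, ENNReal.ofReal (Real.exp (-Real.pi * twistedForm (logCoord K (τ, y)) a))

lemma measurable_thetaWeight (F : Set (logSpace K)) (V σ : ℝ) (a : K) : Measurable fun τ : ℝ =>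
    ENNReal.ofReal (V ^ σ * Real.exp (σ * τ)) *
      ∫⁻ y in F, ENNReal.ofReal (Real.exp (-Real.pi * twistedForm (logCoord K (τ, y)) a)) :=
  Measurable.mul (by fun_prop) (measurable_setLIntegral_expForm F a)

lemma measurable_expForm_right (τ : ℝ) (a : K) : Measurable fun y : logSpace K =>
    ENNReal.ofReal (Real.exp (-Real.pi * twistedForm (logCoord K (τ, y)) a)) :=
  (measurable_expForm a).comp measurable_prodMk_left

lemma lintegral_heckeTheta₀_mellin (F : Set (logSpace K)) (S : Set K) {V : ℝ} (hV : 0 < V) (σ : ℝ) :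
    ∫⁻ t in Set.Ioi (0 : ℝ), ENNReal.ofReal (t ^ (σ - 1)) *
      ∫⁻ y in F, heckeTheta₀ S (logCoord K (Real.log (t / V), y)) =
      ∑' a : {a : K // a ∈ S ∧ a ≠ 0}, thetaWeight F V σ a := by
  have := countable_numberField K
  rw [lintegral_Ioi_comp_exp hV]
  simp_rw [thetaWeight]
  rw [← lintegral_tsum fun a : {a : K // a ∈ S ∧ a ≠ 0} =>
    (measurable_thetaWeight F V σ a.1).aemeasurable]
  refine lintegral_congr fun τ => ?_
  rw [ENNReal.tsum_mul_left, ← lintegral_tsum fun a : {a : K // a ∈ S ∧ a ≠ 0} =>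
    (measurable_expForm_right τ a.1).aemeasurable, ← mul_assoc,
    ← ENNReal.ofReal_mul (by positivity)]
  congr 2
  · rw [Real.rpow_sub_one (by positivity), mul_div_cancel₀ _ (by positivity),
      Real.mul_rpow hV.le (Real.exp_nonneg _), ← Real.exp_mul, mul_comm τ]
  · simp_rw [mul_div_cancel_left₀ _ hV.ne', Real.log_exp]
    rfl

lemma tsum_units_thetaWeight {F : Set (logSpace K)}
    (hF : IsAddFundamentalDomain (unitLattice K) F volume) (V σ : ℝ) (a : K) :
    ∑' u : (𝓞 K)ˣ, thetaWeight F V σ (u * a) =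
      torsionOrder K * thetaWeight Set.univ V σ a := by
  have := countable_units K
  simp_rw [thetaWeight]
  rw [← lintegral_tsum fun u : (𝓞 K)ˣ => (measurable_thetaWeight F V σ (u * a)).aemeasurable,
    ← lintegral_const_mul _ (measurable_thetaWeight _ V σ a)]
  refine lintegral_congr fun τ => ?_
  rw [ENNReal.tsum_mul_left]
  simp_rw [twistedForm_unit_mul]
  rw [tsum_units_setLIntegral hF fun y =>
    ENNReal.ofReal (Real.exp (-Real.pi * twistedForm (logCoord K (τ, y)) a)), Measure.restrict_univ]
  ring

lemma thetaWeight_univ {c : ℝ} (hc : ∀ g : (InfinitePlace K → ℝ) → ℝ≥0∞,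
    Measurable g → ∫⁻ τ : ℝ, ∫⁻ y : logSpace K, g (logCoord K (τ, y)) =
      ENNReal.ofReal c * ∫⁻ x, g x) (hc0 : 0 < c) {V σ : ℝ} (hV : 0 < V) (hσ : 0 < σ)
      {a : K} (ha : a ≠ 0) :
    thetaWeight Set.univ V σ a = ENNReal.ofReal (c * (V ^ σ *
      ((|Algebra.norm ℚ a| : ℚ) ^ (-σ) * ∏ v : InfinitePlace K, localGamma v σ))) := by
  have h1 : thetaWeight Set.univ V σ a = ENNReal.ofReal (V ^ σ) * ∫⁻ τ : ℝ, ∫⁻ y : logSpace K,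
      (fun x : InfinitePlace K → ℝ => ENNReal.ofReal (Real.exp (σ * ∑ v, v.mult * x v) *
      Real.exp (-Real.pi * twistedForm x a))) (logCoord K (τ, y)) := by
    have hm : Measurable fun p : ℝ × logSpace K => ENNReal.ofReal (Real.exp (σ * p.1) *
        Real.exp (-Real.pi * twistedForm (logCoord K p) a)) := by
      have := (continuous_twistedForm_logCoord a).measurable
      exact (Measurable.mul (by fun_prop) (this.const_mul _).exp).ennreal_ofReal
    simp_rw [sum_mult_logCoord]
    rw [thetaWeight, ← lintegral_const_mul _ hm.lintegral_prod_right', Measure.restrict_univ]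
    refine lintegral_congr fun τ => ?_
    simp_rw [ENNReal.ofReal_mul (Real.exp_nonneg (σ * τ))]
    rw [ENNReal.ofReal_mul (by positivity), mul_assoc, lintegral_const_mul _
      (measurable_expForm_right τ a)]
  have hm : Measurable fun x : InfinitePlace K → ℝ => ENNReal.ofReal
      (Real.exp (σ * ∑ v, v.mult * x v) * Real.exp (-Real.pi * twistedForm x a)) := by
    have := (continuous_twistedForm a).measurable
    exact (Measurable.mul (by fun_prop) (this.const_mul _).exp).ennreal_ofReal
  rw [h1, hc _ hm, lintegral_archimedean hσ ha,
    ← ENNReal.ofReal_mul hc0.le, ← ENNReal.ofReal_mul (by positivity)]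
  congr 1
  ring

variable (K) in
/-- The Mellin transform of the theta function is the completed Dirichlet series. -/
theorem exists_mellin_thetaFun₀ : ∃ κ : ℝ, 0 < κ ∧
    ∀ {ι : Type} [Fintype ι] {I : ι → (FractionalIdeal (𝓞 K)⁰ K)ˣ} {F : Set (logSpace K)},
      (Function.Bijective fun i => ClassGroup.mk K (I i)) →
      IsAddFundamentalDomain (unitLattice K) F volume → ∀ σ : ℝ, 0 < σ →
      ∫⁻ t in Set.Ioi (0 : ℝ), ENNReal.ofReal (t ^ (σ - 1)) * thetaFun₀ F I t =
        ENNReal.ofReal (κ * ((discr K).natAbs : ℝ) ^ (σ / 2) * realGammaFac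
          (InfinitePlace.nrRealPlaces K) (InfinitePlace.nrComplexPlaces K) σ) *
        ∑' J : {J : Ideal (𝓞 K) // J ≠ ⊥},
          ENNReal.ofReal ((Ideal.absNorm J.1 : ℝ) ^ (-σ)) := by
  obtain ⟨c, hc0, hc⟩ := exists_lintegral_logCoord K
  refine ⟨torsionOrder K * (c * ((1 / 2) ^ InfinitePlace.nrRealPlaces K *
    (1 / 4) ^ InfinitePlace.nrComplexPlaces K)), ?_, ?_⟩
  · have : (0 : ℝ) < torsionOrder K := Nat.cast_pos.2 (torsionOrder_pos K)
    positivity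
  intro ι _ I F hI hF σ hσ
  obtain ⟨k, α, hα⟩ := exists_ideal_generators hI
  simp_rw [thetaFun₀, Finset.mul_sum]
  have hm : ∀ i, Measurable fun t : ℝ => ENNReal.ofReal (t ^ (σ - 1)) *
      ∫⁻ y in F, heckeTheta₀ (I i : Set K) (logCoord K (Real.log (t / covol (I i)), y)) := fun i =>
    Measurable.mul (by fun_prop) ((measurable_setLIntegral_heckeTheta₀ F (I i : Set K)).comp
      (Real.measurable_log.comp (measurable_id.div_const _)))
  rw [lintegral_finsetSum _ fun i _ => hm i]
  simp_rw [lintegral_heckeTheta₀_mellin F _ (covol_pos _) σ]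
  rw [sum_tsum_eq_tsum_ideals hI hα fun i a => thetaWeight F (covol (I i)) σ a,
    ← ENNReal.tsum_mul_left]
  refine tsum_congr fun J => ?_
  have hD : (0 : ℝ) ≤ (discr K).natAbs := Nat.cast_nonneg _
  have hg := realGammaFac_pos (InfinitePlace.nrRealPlaces K) (InfinitePlace.nrComplexPlaces K) hσ
  rw [tsum_units_thetaWeight hF, thetaWeight_univ hc hc0 (covol_pos _) hσ (hα J).1,
    ← mul_assoc (covol _ ^ σ), covol_rpow_mul_norm J.2 (hα J).2, prod_localGamma,
    ← ENNReal.ofReal_natCast, ← ENNReal.ofReal_mul (Nat.cast_nonneg _),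
    ← ENNReal.ofReal_mul (by positivity)]
  congr 1
  ring

/-- The functional equation of the theta function. -/
theorem thetaFun_one_div (F : Set (logSpace K)) (I : ι → (FractionalIdeal (𝓞 K)⁰ K)ˣ) {t : ℝ}
    (ht : 0 < t) : thetaFun F I (1 / t) =
      ENNReal.ofReal t * thetaFun (-F) (fun i => dualUnit (I i)) t := by
  rw [thetaFun, thetaFun, Finset.mul_sum]
  refine Finset.sum_congr rfl fun i _ => ?_
  have hV := covol_pos (I i)
  have h1 : Real.log (1 / t / covol (I i)) = -Real.log (t / covol (dualUnit (I i))) := by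
    rw [covol_dualUnit, ← Real.log_inv]
    congr 1
    field_simp
  have h2 : ∀ y : logSpace K, logCoord K (-Real.log (t / covol (dualUnit (I i))), y) =
      -logCoord K (Real.log (t / covol (dualUnit (I i))), -y) := fun y => by
    rw [← map_neg, Prod.neg_mk, neg_neg]
  simp_rw [h1, heckeTheta_fractionalIdeal (I i), sum_mult_logCoord, h2, neg_neg]
  have h3 : Real.exp (Real.log (t / covol (dualUnit (I i)))) / covol (I i) = t := by
    rw [covol_dualUnit, Real.exp_log (by positivity)]
    field_simp
  rw [h3, lintegral_const_mul' _ _ ENNReal.ofReal_ne_top]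
  congr 1
  have h4 : MeasurePreserving (Neg.neg : logSpace K → logSpace K) volume volume :=
    Measure.measurePreserving_neg volume
  have h5 := h4.setLIntegral_comp_preimage_emb (MeasurableEquiv.neg
      (logSpace K)).measurableEmbedding
    (fun y => heckeTheta (dualUnit (I i) : Set K)
      (logCoord K (Real.log (t / covol (dualUnit (I i))), y))) (-F)
  rw [← h5]
  congr 2
  ext y
  simp

lemma isAddFundamentalDomain_neg {F : Set (logSpace K)}
    (hF : IsAddFundamentalDomain (unitLattice K) F volume) :
    IsAddFundamentalDomain (unitLattice K) (-F) volume := by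
  refine hF.preimage_of_equiv (f := Neg.neg) (e := Neg.neg)
    (Measure.measurePreserving_neg volume).quasiMeasurePreserving neg_involutive.bijective
    fun g y => ?_
  change -((-g : unitLattice K) + y : logSpace K) = g + -y
  rw [Submodule.coe_neg, neg_add, neg_neg]

end

section
open Asymptotics

/-- Two holomorphic functions on a half-plane agreeing on the real axis are equal. -/
lemma eqOn_halfPlane_of_eq_real {f g : ℂ → ℂ} (hf : DifferentiableOn ℂ f {z | 1 < z.re})
    (hg : DifferentiableOn ℂ g {z | 1 < z.re}) (h : ∀ σ : ℝ, 1 < σ → f σ = g σ) :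
    Set.EqOn f g {z | 1 < z.re} := by
  have ho : IsOpen {z : ℂ | 1 < z.re} := isOpen_lt continuous_const continuous_re
  refine (hf.analyticOnNhd ho).eqOn_of_preconnected_of_frequently_eq (hg.analyticOnNhd ho)
    (convex_halfSpace_re_gt 1).isPreconnected (z₀ := ((2 : ℝ) : ℂ))
    (by simp) ?_
  have h1 : Tendsto (fun x : ℝ => (x : ℂ)) (𝓝[>] 2) (𝓝[≠] ((2 : ℝ) : ℂ)) := by
    refine tendsto_nhdsWithin_iff.2 ⟨?_, ?_⟩
    · exact (continuous_ofReal.tendsto 2).mono_left nhdsWithin_le_nhds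
    · filter_upwards [self_mem_nhdsWithin] with x hx
      exact fun h0 => (ne_of_gt hx : x ≠ 2) (ofReal_injective h0)
  refine h1.frequently (Eventually.frequently ?_)
  filter_upwards [self_mem_nhdsWithin] with x hx
  exact h x (lt_trans one_lt_two hx)

lemma differentiableOn_gammaFac (r₁ r₂ : ℕ) :
    DifferentiableOn ℂ (gammaFac r₁ r₂) {z | 1 < z.re} := by
  have h : (gammaFac r₁ r₂) = fun z => ((gammaFac r₁ r₂ z)⁻¹)⁻¹ := by
    funext z
    rw [inv_inv]
  rw [h]
  exact (differentiable_gammaFac_inv r₁ r₂).differentiableOn.inv fun z hz =>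
    inv_ne_zero (gammaFac_ne_zero r₁ r₂ (lt_trans zero_lt_one hz))

/-- A pair of positive decreasing functions of rapid decay related by a theta functional equation
with constant term `M`. -/
structure ThetaPair (M : ℝ) (θ₁ θ₂ : ℝ → ℝ) : Prop where
  nonneg₁ : ∀ t, 0 ≤ θ₁ t
  nonneg₂ : ∀ t, 0 ≤ θ₂ t
  anti₁ : AntitoneOn θ₁ (Set.Ioi 0)
  anti₂ : AntitoneOn θ₂ (Set.Ioi 0)
  decay₁ : ∀ r : ℝ, θ₁ =O[atTop] (fun t => t ^ r)
  decay₂ : ∀ r : ℝ, θ₂ =O[atTop] (fun t => t ^ r)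
  feq : ∀ t : ℝ, 0 < t → M + θ₁ (1 / t) = t * (M + θ₂ t)

variable {M : ℝ} {θ₁ θ₂ : ℝ → ℝ}

lemma locallyIntegrableOn_add_of_antitoneOn {θ : ℝ → ℝ} (M : ℝ) (h : AntitoneOn θ (Set.Ioi 0)) :
    LocallyIntegrableOn (fun t => ((M + θ t : ℝ) : ℂ)) (Set.Ioi 0) := by
  refine (locallyIntegrableOn_iff isOpen_Ioi.isLocallyClosed).2 fun k hk hc => ?_
  have h1 : AntitoneOn (fun t => M + θ t) k := fun x hx y hy hxy =>
    add_le_add_right (h (hk hx) (hk hy) hxy) M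
  exact (h1.integrableOn_isCompact hc).ofReal

/-- The functional-equation pair attached to a theta pair. -/
def ThetaPair.fePair (h : ThetaPair M θ₁ θ₂) : WeakFEPair ℂ where
  f t := ((M + θ₁ t : ℝ) : ℂ)
  g t := ((M + θ₂ t : ℝ) : ℂ)
  k := 1
  ε := 1
  f₀ := M
  g₀ := M
  hf_int := locallyIntegrableOn_add_of_antitoneOn M h.anti₁
  hg_int := locallyIntegrableOn_add_of_antitoneOn M h.anti₂
  hk := zero_lt_one
  hε := one_ne_zero
  h_feq t ht := by
    rw [h.feq t ht]
    simp
  hf_top r := by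
    refine IsBigO.trans (IsBigO.of_norm_le fun t => ?_) (h.decay₁ r)
    rw [← ofReal_sub, norm_real, add_sub_cancel_left, Real.norm_of_nonneg (h.nonneg₁ t)]
  hg_top r := by
    refine IsBigO.trans (IsBigO.of_norm_le fun t => ?_) (h.decay₂ r)
    rw [← ofReal_sub, norm_real, add_sub_cancel_left, Real.norm_of_nonneg (h.nonneg₂ t)]

lemma ThetaPair.symm (h : ThetaPair M θ₁ θ₂) : ThetaPair M θ₂ θ₁ where
  nonneg₁ := h.nonneg₂
  nonneg₂ := h.nonneg₁
  anti₁ := h.anti₂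
  anti₂ := h.anti₁
  decay₁ := h.decay₂
  decay₂ := h.decay₁
  feq t ht := by
    have := h.feq (1 / t) (by positivity)
    rw [one_div_one_div] at this
    rw [this, ← mul_assoc, mul_one_div_cancel ht.ne', one_mul]

lemma ThetaPair.fePair_symm_Λ₀ (h : ThetaPair M θ₁ θ₂) :
    h.fePair.symm.Λ₀ = h.symm.fePair.Λ₀ := by
  have : h.fePair.symm.f_modif = h.symm.fePair.f_modif := by
    funext t
    simp [WeakFEPair.f_modif, ThetaPair.fePair, WeakFEPair.symm]
  rw [WeakFEPair.Λ₀, WeakFEPair.Λ₀, this]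

lemma cpow_sub_one_eq (σ : ℝ) {t : ℝ} (ht : 0 < t) :
    (t : ℂ) ^ ((σ : ℂ) - 1) = ((t ^ (σ - 1) : ℝ) : ℂ) := by
  rw [ofReal_cpow ht.le]
  push_cast
  rfl

lemma ThetaPair.Λ_ofReal (h : ThetaPair M θ₁ θ₂) {σ : ℝ} (hσ : 1 < σ) :
    h.fePair.Λ σ = ((∫ t in Set.Ioi (0 : ℝ), t ^ (σ - 1) * θ₁ t : ℝ) : ℂ) := by
  have h1 : (h.fePair.k : ℝ) < (σ : ℂ).re := by
    rw [ofReal_re]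
    exact hσ
  rw [← (h.fePair.hasMellin h1).2, mellin, ← integral_complex_ofReal]
  refine setIntegral_congr_fun measurableSet_Ioi fun t ht => ?_
  change (t : ℂ) ^ ((σ : ℂ) - 1) * (((M + θ₁ t : ℝ) : ℂ) - (M : ℂ)) = _
  rw [cpow_sub_one_eq σ ht, ← ofReal_sub, add_sub_cancel_left, ofReal_mul]

/-- The real form of the truncated theta function. -/
def ThetaPair.modif (_h : ThetaPair M θ₁ θ₂) (t : ℝ) : ℝ :=
  if 1 < t then θ₁ t else if 0 < t ∧ t < 1 then 1 / t * θ₂ (1 / t) else 0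

lemma ThetaPair.modif_nonneg (h : ThetaPair M θ₁ θ₂) (t : ℝ) : 0 ≤ h.modif t := by
  rw [ThetaPair.modif]
  split_ifs with h1 h2
  · exact h.nonneg₁ t
  · exact mul_nonneg (one_div_pos.2 h2.1).le (h.nonneg₂ _)
  · exact le_rfl

lemma ThetaPair.fePair_f_modif (h : ThetaPair M θ₁ θ₂) (t : ℝ) :
    h.fePair.f_modif t = (h.modif t : ℂ) := by
  rw [WeakFEPair.f_modif, ThetaPair.modif, Pi.add_apply, Set.indicator_apply, Set.indicator_apply]
  by_cases h1 : 1 < t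
  · rw [if_pos h1, if_pos (Set.mem_Ioi.2 h1), if_neg fun h2 : t ∈ Set.Ioo (0 : ℝ) 1 => by
      linarith [h2.2], add_zero]
    change ((M + θ₁ t : ℝ) : ℂ) - (M : ℂ) = _
    rw [← ofReal_sub, add_sub_cancel_left]
  · rw [if_neg h1, if_neg fun h2 => h1 (Set.mem_Ioi.1 h2), zero_add]
    by_cases h2 : 0 < t ∧ t < 1
    · rw [if_pos h2, if_pos (Set.mem_Ioo.2 h2)]
      change ((M + θ₁ t : ℝ) : ℂ) - (1 * ((t ^ (-1 : ℝ) : ℝ) : ℂ)) * (M : ℂ) = _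
      have h3 := h.feq (1 / t) (one_div_pos.2 h2.1)
      rw [one_div_one_div] at h3
      rw [h3, Real.rpow_neg_one, one_mul, ← ofReal_mul, ← ofReal_sub]
      congr 1
      ring
    · rw [if_neg h2, if_neg fun h3 => h2 (Set.mem_Ioo.1 h3), ofReal_zero]

lemma ThetaPair.integrableOn_modif (h : ThetaPair M θ₁ θ₂) (σ : ℝ) :
    IntegrableOn (fun t : ℝ => t ^ (σ - 1) * h.modif t) (Set.Ioi 0) := by
  have h1 : MellinConvergent h.fePair.f_modif σ :=
    (h.fePair.isStrongFEPair_toStrongFEPair.hasMellin (σ : ℂ)).1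
  refine IntegrableOn.congr_fun (show IntegrableOn _ _ _ from Integrable.re h1) (fun t ht => ?_)
    measurableSet_Ioi
  change ((t : ℂ) ^ ((σ : ℂ) - 1) * h.fePair.f_modif t).re = _
  rw [cpow_sub_one_eq σ ht, h.fePair_f_modif, ← ofReal_mul, ofReal_re]

/-- The regularized Mellin transform at real arguments. -/
def ThetaPair.realΛ₀ (h : ThetaPair M θ₁ θ₂) (σ : ℝ) : ℝ :=
  ∫ t in Set.Ioi (0 : ℝ), t ^ (σ - 1) * h.modif t

lemma ThetaPair.Λ₀_ofReal (h : ThetaPair M θ₁ θ₂) (σ : ℝ) :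
    h.fePair.Λ₀ σ = (h.realΛ₀ σ : ℂ) := by
  rw [WeakFEPair.Λ₀, mellin, ThetaPair.realΛ₀, ← integral_complex_ofReal]
  refine setIntegral_congr_fun measurableSet_Ioi fun t ht => ?_
  change (t : ℂ) ^ ((σ : ℂ) - 1) * h.fePair.f_modif t = _
  rw [cpow_sub_one_eq σ ht, h.fePair_f_modif, ofReal_mul]

lemma ThetaPair.realΛ₀_nonneg (h : ThetaPair M θ₁ θ₂) (σ : ℝ) : 0 ≤ h.realΛ₀ σ :=
  setIntegral_nonneg measurableSet_Ioi fun t ht =>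
    mul_nonneg (Real.rpow_nonneg (le_of_lt ht) _) (h.modif_nonneg t)

lemma rpow_le_rpow_add_rpow {t a b c : ℝ} (ht : 0 < t) (hab : a ≤ b) (hbc : b ≤ c) :
    t ^ b ≤ t ^ a + t ^ c := by
  rcases le_total 1 t with h1 | h1
  · have := Real.rpow_le_rpow_of_exponent_le h1 hbc
    have := Real.rpow_pos_of_pos ht a
    linarith
  · have := Real.rpow_le_rpow_of_exponent_ge ht h1 hab
    have := Real.rpow_pos_of_pos ht c
    linarith

lemma ThetaPair.norm_Λ₀_le (h : ThetaPair M θ₁ θ₂) {a b : ℝ} {z : ℂ} (ha : a ≤ z.re)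
    (hb : z.re ≤ b) : ‖h.fePair.Λ₀ z‖ ≤ h.realΛ₀ a + h.realΛ₀ b := by
  rw [WeakFEPair.Λ₀, mellin, ThetaPair.realΛ₀, ThetaPair.realΛ₀,
    ← integral_add (h.integrableOn_modif a) (h.integrableOn_modif b)]
  refine norm_integral_le_of_norm_le ((h.integrableOn_modif a).add (h.integrableOn_modif b)) ?_
  filter_upwards [ae_restrict_mem measurableSet_Ioi] with t ht
  have ht' : (0 : ℝ) < t := ht
  rw [norm_smul, norm_cpow_eq_rpow_re_of_pos ht', h.fePair_f_modif, norm_real,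
    Real.norm_of_nonneg (h.modif_nonneg t), ← add_mul, sub_re, one_re]
  exact mul_le_mul_of_nonneg_right (rpow_le_rpow_add_rpow ht' (by linarith) (by linarith))
    (h.modif_nonneg t)

/-- The Mellin transform of a theta pair yields the analytic data of its Dirichlet series. -/
theorem ThetaPair.zetaData (h : ThetaPair M θ₁ θ₂) (hM : 0 < M) {r₁ r₂ : ℕ} {κ D C₀ : ℝ}
    (hκ : 0 < κ) (hD : 1 ≤ D) {Z : ℂ → ℂ} {S : ℝ → ℝ} (hZ : DifferentiableOn ℂ Z {z | 1 < z.re})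
    (hS : ∀ σ : ℝ, 1 < σ → Z σ = S σ)
    (h₁ : ∀ σ : ℝ, 1 < σ → ∫ t in Set.Ioi (0 : ℝ), t ^ (σ - 1) * θ₁ t =
      κ * D ^ (σ / 2) * realGammaFac r₁ r₂ σ * S σ)
    (h₂ : ∀ σ : ℝ, 1 < σ → ∫ t in Set.Ioi (0 : ℝ), t ^ (σ - 1) * θ₂ t =
      κ * D ^ (σ / 2) * realGammaFac r₁ r₂ σ * S σ)
    (hC₀ : ∀ z : ℂ, 3 / 2 ≤ z.re → 1 ≤ C₀ * ‖Z z‖ ∧ ‖Z z‖ ≤ C₀) :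
    ∃ E : ℂ → ℂ, ZetaData r₁ r₂ D 2
      (C₀ * (1 + 18 * realGammaFac r₁ r₂ 4 + 2 * realGammaFac r₁ r₂ 2)) E Z := by
  have hκ' : (κ : ℂ) ≠ 0 := ofReal_ne_zero.2 hκ.ne'
  have hD0 : (D : ℂ) ≠ 0 := ofReal_ne_zero.2 (by linarith)
  have hΛ : ∀ z, h.fePair.Λ z = h.fePair.Λ₀ z - 1 / z * M - 1 / (1 - z) * M := fun z => by
    rw [WeakFEPair.Λ]
    simp [ThetaPair.fePair]
  have hΛ' : ∀ z, h.symm.fePair.Λ z = h.symm.fePair.Λ₀ z - 1 / z * M - 1 / (1 - z) * M :=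
      fun z => by
    rw [WeakFEPair.Λ]
    simp [ThetaPair.fePair]
  have hΛ₀ : h.symm.fePair.Λ₀ = h.fePair.Λ₀ := by
    have h1 : Set.EqOn h.symm.fePair.Λ₀ h.fePair.Λ₀ {z | 1 < z.re} :=
      eqOn_halfPlane_of_eq_real h.symm.fePair.differentiable_Λ₀.differentiableOn
        h.fePair.differentiable_Λ₀.differentiableOn fun σ hσ => by
      have e1 := h.symm.Λ_ofReal hσ
      have e2 := h.Λ_ofReal hσ
      rw [h₂ σ hσ, ← h₁ σ hσ, ← e2, hΛ, hΛ'] at e1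
      linear_combination e1
    refine AnalyticOnNhd.eq_of_eventuallyEq
      (h.symm.fePair.differentiable_Λ₀.differentiableOn.analyticOnNhd isOpen_univ)
      (h.fePair.differentiable_Λ₀.differentiableOn.analyticOnNhd isOpen_univ) (z₀ := 2) ?_
    exact h1.eventuallyEq_of_mem ((isOpen_lt continuous_const continuous_re).mem_nhds (by simp))
  have hsymm : ∀ z, h.fePair.Λ₀ (1 - z) = h.fePair.Λ₀ z := fun z => by
    have := h.fePair.functional_equation₀ z
    rw [h.fePair_symm_Λ₀, hΛ₀] at this
    simpa [ThetaPair.fePair] using this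
  have hE : ∀ σ : ℝ, 1 < σ → h.realΛ₀ σ + M / (σ * (σ - 1)) =
      κ * D ^ (σ / 2) * realGammaFac r₁ r₂ σ * S σ := fun σ hσ => by
    have e1 := hΛ σ
    have hs : (σ : ℂ) ≠ 0 := ofReal_ne_zero.2 (by linarith)
    have hs1 : (1 - σ : ℂ) ≠ 0 := by
      rw [← ofReal_one, ← ofReal_sub]
      exact ofReal_ne_zero.2 (by linarith)
    have hs2 : (σ - 1 : ℂ) ≠ 0 := by
      rw [← neg_sub]
      exact neg_ne_zero.2 hs1
    rw [h.Λ_ofReal hσ, h₁ σ hσ, h.Λ₀_ofReal] at e1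
    have e2 : (h.realΛ₀ σ : ℂ) - 1 / σ * M - 1 / (1 - σ) * M =
        ((h.realΛ₀ σ + M / (σ * (σ - 1)) : ℝ) : ℂ) := by
      push_cast
      have e3 : (1 : ℂ) / (1 - σ) = -(1 / (σ - 1)) := by
        rw [← neg_sub, div_neg]
      rw [e3]
      field_simp
      ring
    rw [e2] at e1
    exact (ofReal_injective e1).symm
  have hS' : ∀ σ : ℝ, 3 / 2 ≤ σ → S σ ≤ C₀ := fun σ hσ => by
    have e1 := (hC₀ σ (by simpa using hσ)).2
    rw [hS σ (by linarith), norm_real] at e1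
    exact (le_abs_self _).trans e1
  have hC₀' : 0 ≤ C₀ := (norm_nonneg _).trans (hC₀ 2 (by norm_num)).2
  have hg2 := realGammaFac_pos r₁ r₂ (σ := 2) (by norm_num)
  have hg4 := realGammaFac_pos r₁ r₂ (σ := 4) (by norm_num)
  have hCle : C₀ ≤ C₀ * (1 + 18 * realGammaFac r₁ r₂ 4 + 2 * realGammaFac r₁ r₂ 2) :=
    le_mul_of_one_le_right hC₀' (by linarith)
  refine ⟨fun z => (z * (z - 1) * h.fePair.Λ₀ z + M) / κ, ?_, fun z => ?_, fun z hz => ?_,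
    fun z hz => ⟨?_, ?_⟩, fun z hz => ?_, M / κ, by positivity, by simp⟩
  · have := h.fePair.differentiable_Λ₀
    fun_prop
  · simp only [hsymm]
    ring
  · have hcpow : DifferentiableOn ℂ (fun z : ℂ => (D : ℂ) ^ (z / 2)) {z | 1 < z.re} := fun z _ =>
      ((differentiableAt_id.div_const 2).const_cpow (Or.inl hD0)).differentiableWithinAt
    have hg := differentiableOn_gammaFac r₁ r₂
    have hl := h.fePair.differentiable_Λ₀.differentiableOn (s := {z : ℂ | 1 < z.re})
    refine eqOn_halfPlane_of_eq_real (f := fun z => (z * (z - 1) * h.fePair.Λ₀ z + M) / κ)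
      (g := fun z => z * (z - 1) * (D : ℂ) ^ (z / 2) * gammaFac r₁ r₂ z * Z z)
      (by fun_prop) (by fun_prop) (fun σ hσ => ?_) hz
    have hs : (σ : ℂ) * (σ - 1) = ((σ * (σ - 1) : ℝ) : ℂ) := by push_cast; rfl
    have hd : (D : ℂ) ^ ((σ : ℂ) / 2) = ((D ^ (σ / 2) : ℝ) : ℂ) := by
      rw [ofReal_cpow (by linarith)]
      push_cast
      rfl
    rw [h.Λ₀_ofReal, hS σ hσ, ← ofReal_realGammaFac, hs, hd]
    have e1 := hE σ hσ
    have e2 : σ * (σ - 1) * h.realΛ₀ σ + M =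
        κ * (σ * (σ - 1) * D ^ (σ / 2) * realGammaFac r₁ r₂ σ * S σ) := by
      have : σ * (σ - 1) ≠ 0 := (mul_pos (by linarith) (by linarith)).ne'
      rw [show κ * (σ * (σ - 1) * D ^ (σ / 2) * realGammaFac r₁ r₂ σ * S σ) =
        σ * (σ - 1) * (κ * D ^ (σ / 2) * realGammaFac r₁ r₂ σ * S σ) by ring, ← e1, mul_add,
        mul_div_cancel₀ _ this]
    rw [div_eq_iff hκ']
    exact_mod_cast e2.trans (mul_comm _ _)
  · exact (hC₀ z hz).1.trans (mul_le_mul_of_nonneg_right hCle (norm_nonneg _))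
  · exact (hC₀ z hz).2.trans hCle
  · have hre : |z.re - 2| ≤ 29 / 20 := by
      have := abs_re_le_norm (z - 2)
      simp only [sub_re, re_ofNat] at this
      linarith
    have hre' := abs_le.1 hre
    have e1 := h.norm_Λ₀_le (z := z) (a := -3) (b := 4) (by linarith) (by linarith)
    have e2 : h.realΛ₀ (-3) = h.realΛ₀ 4 := by
      have := hsymm 4
      rw [show (1 - 4 : ℂ) = ((-3 : ℝ) : ℂ) by norm_num, show (4 : ℂ) = ((4 : ℝ) : ℂ) by norm_num,
        h.Λ₀_ofReal, h.Λ₀_ofReal] at this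
      exact ofReal_injective this
    have e4 := hE 4 (by norm_num)
    have e3 := hE 2 (by norm_num)
    have p2 := h.realΛ₀_nonneg 2
    have b4 : h.realΛ₀ 4 ≤ κ * D ^ (2 : ℝ) * realGammaFac r₁ r₂ 4 * C₀ := by
      have : 0 < M / (4 * (4 - 1)) := by positivity
      refine le_trans (by linarith : h.realΛ₀ 4 ≤ _) (e4.le.trans ?_)
      rw [show (4 : ℝ) / 2 = 2 by norm_num]
      exact mul_le_mul_of_nonneg_left (hS' 4 (by norm_num)) (by positivity)
    have b2 : M ≤ 2 * (κ * D ^ (2 : ℝ) * realGammaFac r₁ r₂ 2 * C₀) := by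
      have q1 : M / 2 ≤ κ * D ^ ((2 : ℝ) / 2) * realGammaFac r₁ r₂ 2 * S 2 := by
        norm_num at e3 ⊢
        linarith
      have q2 : κ * D ^ ((2 : ℝ) / 2) * realGammaFac r₁ r₂ 2 * S 2 ≤
          κ * D ^ (2 : ℝ) * realGammaFac r₁ r₂ 2 * C₀ := by
        refine (mul_le_mul_of_nonneg_left (hS' 2 (by norm_num)) (by positivity)).trans ?_
        have : D ^ ((2 : ℝ) / 2) ≤ D ^ (2 : ℝ) :=
          Real.rpow_le_rpow_of_exponent_le hD (by norm_num)
        gcongr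
      linarith
    have n1 : ‖z‖ ≤ 69 / 20 := by
      have := norm_add_le (z - 2) 2
      rw [sub_add_cancel] at this
      norm_num at this
      linarith
    have n2 : ‖z - 1‖ ≤ 49 / 20 := by
      have := norm_add_le (z - 2) 1
      rw [show z - 2 + 1 = z - 1 by ring] at this
      norm_num at this
      linarith
    have n3 : ‖z * (z - 1)‖ ≤ 9 := by
      rw [norm_mul]
      refine (mul_le_mul n1 n2 (norm_nonneg _) (by norm_num)).trans (by norm_num)
    rw [norm_div, norm_real, Real.norm_of_nonneg hκ.le, div_le_iff₀ hκ]
    have p4 := h.realΛ₀_nonneg 4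
    have n4 : ‖z * (z - 1) * h.fePair.Λ₀ z‖ ≤ 9 * (2 * h.realΛ₀ 4) := by
      rw [norm_mul]
      exact mul_le_mul n3 (by linarith) (norm_nonneg _) (by norm_num)
    have n5 : ‖(M : ℂ)‖ = M := by rw [norm_real, Real.norm_of_nonneg hM.le]
    have n6 := norm_add_le (z * (z - 1) * h.fePair.Λ₀ z) M
    have n7 : 0 ≤ C₀ * D ^ (2 : ℝ) * κ := by positivity
    linear_combination n6 + n4 + n5 + 18 * b4 + b2 + n7

end

section
variable {K : Type} [Field K] [NumberField K]
open NumberField.Units NumberField.Units.dirichletUnitTheorem Module Asymptotics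
open scoped ENNReal nonZeroDivisors

lemma twistedForm_mono {x x' : InfinitePlace K → ℝ} (h : ∀ v, x v ≤ x' v) (a : K) :
    twistedForm x a ≤ twistedForm x' a := by
  refine Finset.sum_le_sum fun v _ => ?_
  have := h v
  gcongr

lemma heckeTheta₀_anti (S : Set K) {x x' : InfinitePlace K → ℝ} (h : ∀ v, x v ≤ x' v) :
    heckeTheta₀ S x' ≤ heckeTheta₀ S x := by
  refine ENNReal.tsum_le_tsum fun a => ENNReal.ofReal_le_ofReal (Real.exp_le_exp.2 ?_)
  exact mul_le_mul_of_nonpos_left (twistedForm_mono h _) (neg_nonpos.2 Real.pi_pos.le)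

lemma logCoord_eq_add (τ : ℝ) (y : logSpace K) (v : InfinitePlace K) :
    logCoord K (τ, y) v = logCoord K (0, y) v + τ / finrank ℚ K := by
  rw [logCoord_apply, logCoord_apply, zero_div, add_zero]

lemma thetaFun₀_anti {ι : Type} [Fintype ι] (F : Set (logSpace K))
    (I : ι → (FractionalIdeal (𝓞 K)⁰ K)ˣ) : AntitoneOn (thetaFun₀ F I) (Set.Ioi 0) := by
  intro s hs t _ hst
  have hs' : (0 : ℝ) < s := hs
  refine Finset.sum_le_sum fun i _ => lintegral_mono fun y => heckeTheta₀_anti _ fun v => ?_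
  rw [logCoord_eq_add, logCoord_eq_add (Real.log (t / _))]
  have hV := covol_pos (I i)
  gcongr

lemma exists_logCoord_ge {F : Set (logSpace K)} (hF : Bornology.IsBounded F) :
    ∃ B : ℝ, ∀ y ∈ F, ∀ v, -B ≤ logCoord K (0, y) v := by
  obtain ⟨R, hR⟩ := hF.exists_norm_le
  set L : (ℝ × logSpace K) →L[ℝ] (InfinitePlace K → ℝ) :=
    ⟨(logCoord K).toLinearMap, continuous_logCoord⟩
  refine ⟨‖L‖ * R, fun y hy v => ?_⟩
  have h1 : ‖L (0, y) v‖ ≤ ‖L‖ * R := by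
    refine (norm_le_pi_norm _ v).trans ((L.le_opNorm _).trans ?_)
    refine mul_le_mul_of_nonneg_left ?_ (norm_nonneg _)
    rw [Prod.norm_mk, norm_zero, max_eq_right (norm_nonneg _)]
    exact hR y hy
  exact (abs_le.1 h1).1

/-- Decay of the theta function of a single lattice. -/
lemma exists_setLIntegral_heckeTheta₀_le {F : Set (logSpace K)} (hF : Bornology.IsBounded F)
    (hFm : MeasurableSet F) (I : (FractionalIdeal (𝓞 K)⁰ K)ˣ) :
    ∃ c : ℝ, 0 < c ∧ ∀ ε : ℝ, 0 < ε → ∃ C : ℝ, ∀ t, ε ≤ t →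
      ∫⁻ y in F, heckeTheta₀ (I : Set K) (logCoord K (Real.log (t / covol I), y)) ≤
        ENNReal.ofReal (C * Real.exp (-c * t ^ (2 / finrank ℚ K : ℝ))) * volume F := by
  obtain ⟨B, hB⟩ := exists_logCoord_ge hF
  obtain ⟨c, hc, h⟩ := heckeTheta₀_le (basisOfFractionalIdeal K I) (S := (I : Set K))
    fun a => mem_span_basisOfFractionalIdeal K
  have hV := covol_pos I
  have hn : (0 : ℝ) < finrank ℚ K := Nat.cast_pos.2 finrank_pos
  set p : ℝ := 2 / finrank ℚ K with hp
  have hp0 : 0 < p := by positivity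
  set a : ℝ := Real.exp (-(2 * B)) / covol I ^ p with ha
  have ha0 : 0 < a := by positivity
  refine ⟨c * a, by positivity, fun ε hε => ?_⟩
  obtain ⟨C, hC⟩ := h (a * ε ^ p) (by positivity)
  refine ⟨C, fun t ht => ?_⟩
  have ht0 : 0 < t := hε.trans_le ht
  have h1 : ∀ y ∈ F, heckeTheta₀ (I : Set K) (logCoord K (Real.log (t / covol I), y)) ≤
      ENNReal.ofReal (C * Real.exp (-(c * a) * t ^ p)) := fun y hy => by
    have h2 := hC (a * t ^ p) (by gcongr) (logCoord K (Real.log (t / covol I), y)) fun v => by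
      have h3 : a * t ^ p = Real.exp (2 * (-B + Real.log (t / covol I) / finrank ℚ K)) := by
        rw [ha, div_mul_eq_mul_div, mul_div_assoc, ← Real.div_rpow ht0.le hV.le,
          Real.rpow_def_of_pos (by positivity : 0 < t / covol I), ← Real.exp_add, hp]
        congr 1
        ring
      rw [h3, logCoord_eq_add]
      have := hB y hy v
      gcongr
    rwa [← mul_assoc, neg_mul c a] at h2
  refine (setLIntegral_mono' hFm h1).trans ?_
  rw [setLIntegral_const]

lemma thetaFun₀_ne_top {ι : Type} [Fintype ι] {F : Set (logSpace K)} (hF : Bornology.IsBounded F)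
    (hFm : MeasurableSet F) (I : ι → (FractionalIdeal (𝓞 K)⁰ K)ˣ) {t : ℝ} (ht : 0 < t) :
    thetaFun₀ F I t ≠ ∞ := by
  refine ENNReal.sum_ne_top.2 fun i _ => ?_
  obtain ⟨c, -, h⟩ := exists_setLIntegral_heckeTheta₀_le hF hFm (I i)
  obtain ⟨C, hC⟩ := h t ht
  exact ((hC t le_rfl).trans_lt (ENNReal.mul_lt_top ENNReal.ofReal_lt_top hF.measure_lt_top)).ne

lemma thetaFun₀_isBigO {ι : Type} [Fintype ι] {F : Set (logSpace K)} (hF : Bornology.IsBounded F)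
    (hFm : MeasurableSet F) (I : ι → (FractionalIdeal (𝓞 K)⁰ K)ˣ) (r : ℝ) :
    (fun t => (thetaFun₀ F I t).toReal) =O[atTop] fun t : ℝ => t ^ r := by
  have hn : (0 : ℝ) < finrank ℚ K := Nat.cast_pos.2 finrank_pos
  have hv : volume F ≠ ∞ := hF.measure_lt_top.ne
  have h1 : ∀ i, (fun t => (∫⁻ y in F, heckeTheta₀ (I i : Set K)
      (logCoord K (Real.log (t / covol (I i)), y))).toReal) =O[atTop] fun t : ℝ => t ^ r :=
          fun i => by
    obtain ⟨c, hc, h⟩ := exists_setLIntegral_heckeTheta₀_le hF hFm (I i)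
    obtain ⟨C, hC⟩ := h 1 zero_lt_one
    set p : ℝ := 2 / finrank ℚ K with hp
    have hp0 : 0 < p := by positivity
    have h2 : (fun t : ℝ => Real.exp (-c * t ^ p)) =O[atTop] fun t : ℝ => t ^ r := by
      have h3 := ((isLittleO_exp_neg_mul_rpow_atTop hc (r / p)).comp_tendsto
        (tendsto_rpow_atTop hp0)).isBigO
      refine h3.congr' .rfl ?_
      filter_upwards [eventually_gt_atTop 0] with t ht
      simp only [Function.comp_apply]
      rw [← Real.rpow_mul ht.le, mul_div_cancel₀ _ hp0.ne']
    refine IsBigO.trans (IsBigO.of_bound (|C| * (volume F).toReal) ?_) h2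
    filter_upwards [eventually_ge_atTop 1] with t ht
    rw [Real.norm_of_nonneg ENNReal.toReal_nonneg, Real.norm_of_nonneg (Real.exp_nonneg _)]
    refine (ENNReal.toReal_mono (ENNReal.mul_ne_top ENNReal.ofReal_ne_top hv) (hC t ht)).trans ?_
    rw [ENNReal.toReal_mul, mul_right_comm]
    refine mul_le_mul_of_nonneg_right ?_ ENNReal.toReal_nonneg
    have h4 : C * Real.exp (-c * t ^ p) ≤ |C| * Real.exp (-c * t ^ p) := by
      gcongr
      exact le_abs_self C
    exact (ENNReal.toReal_mono ENNReal.ofReal_ne_top (ENNReal.ofReal_le_ofReal h4)).trans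
      (ENNReal.toReal_ofReal (by positivity)).le
  have h5 : (fun t => ∑ i, (∫⁻ y in F, heckeTheta₀ (I i : Set K)
      (logCoord K (Real.log (t / covol (I i)), y))).toReal) =O[atTop] fun t : ℝ => t ^ r := by
    have := IsBigO.sum (s := Finset.univ) fun i _ => h1 i
    refine this.congr_left fun t => ?_
    rw [Finset.sum_apply]
  refine h5.congr' ?_ .rfl
  filter_upwards [eventually_gt_atTop 0] with t ht
  rw [thetaFun₀, ENNReal.toReal_sum (ENNReal.sum_ne_top.1 (thetaFun₀_ne_top hF hFm I ht))]

/-- The theta functions of a family of ideals and of the dual family form a theta pair. -/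
lemma thetaPair_thetaFun₀ {ι : Type} [Fintype ι] {F : Set (logSpace K)}
    (hF : Bornology.IsBounded F) (hFm : MeasurableSet F) (I : ι → (FractionalIdeal (𝓞 K)⁰ K)ˣ) :
    ThetaPair (Fintype.card ι * (volume F).toReal) (fun t => (thetaFun₀ F I t).toReal)
      (fun t => (thetaFun₀ (-F) (fun i => dualUnit (I i)) t).toReal) := by
  have hF' : Bornology.IsBounded (-F) := hF.neg
  have hFm' : MeasurableSet (-F) := hFm.neg
  have hv : volume F ≠ ∞ := hF.measure_lt_top.ne
  have hanti : ∀ {G : Set (logSpace K)} (J : ι → (FractionalIdeal (𝓞 K)⁰ K)ˣ),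
      Bornology.IsBounded G → MeasurableSet G →
      AntitoneOn (fun t => (thetaFun₀ G J t).toReal) (Set.Ioi 0) := fun J hG hGm s hs t ht hst =>
    ENNReal.toReal_mono (thetaFun₀_ne_top hG hGm J hs) (thetaFun₀_anti _ J hs ht hst)
  refine ⟨fun _ => ENNReal.toReal_nonneg, fun _ => ENNReal.toReal_nonneg, hanti _ hF hFm,
    hanti _ hF' hFm', thetaFun₀_isBigO hF hFm I, thetaFun₀_isBigO hF' hFm' _, fun t ht => ?_⟩
  have h1 := thetaFun_one_div F I ht
  rw [thetaFun_eq_add, thetaFun_eq_add, Measure.measure_neg] at h1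
  have h2 := congrArg ENNReal.toReal h1
  have hc : (Fintype.card ι : ℝ≥0∞) * volume F ≠ ∞ :=
    ENNReal.mul_ne_top (ENNReal.natCast_ne_top _) hv
  rwa [ENNReal.toReal_add hc (thetaFun₀_ne_top hF hFm I (by positivity)), ENNReal.toReal_mul,
    ENNReal.toReal_mul, ENNReal.toReal_add hc (thetaFun₀_ne_top hF' hFm' _ ht),
    ENNReal.toReal_mul, ENNReal.toReal_ofReal ht.le, ENNReal.toReal_natCast] at h2

variable (K) in
lemma exists_bijective_classGroup : ∃ I : ClassGroup (𝓞 K) → (FractionalIdeal (𝓞 K)⁰ K)ˣ,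
    (Function.Bijective fun c => ClassGroup.mk K (I c)) ∧
    Function.Bijective fun c => ClassGroup.mk K (dualUnit (I c)) := by
  have hs : Function.Surjective (ClassGroup.mk (R := 𝓞 K) K) := fun c =>
    ClassGroup.induction K (P := fun c => ∃ x, ClassGroup.mk K x = c) (fun x => ⟨x, rfl⟩) c
  have h1 : ∀ c, ClassGroup.mk K (Function.surjInv hs c) = c := Function.surjInv_eq hs
  refine ⟨Function.surjInv hs, ?_, ?_⟩
  · simp_rw [h1]
    exact Function.bijective_id
  · simp_rw [dualUnit, map_mul, map_inv, h1]
    exact (Group.mulLeft_bijective _).comp (Equiv.inv _).bijective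

variable (K) in
lemma exists_fundamentalDomain : ∃ F : Set (logSpace K), Bornology.IsBounded F ∧ MeasurableSet F ∧
    volume F ≠ 0 ∧ IsAddFundamentalDomain (unitLattice K) F volume := by
  set b := (basisUnitLattice K).ofZLatticeBasis ℝ
  exact ⟨ZSpan.fundamentalDomain b, ZSpan.fundamentalDomain_isBounded b,
    ZSpan.fundamentalDomain_measurableSet b, ZSpan.measure_fundamentalDomain_ne_zero b,
    ZLattice.isAddFundamentalDomain _ _⟩

/-- The Dedekind zeta function as a Dirichlet series. -/
def zetaSeries (K : Type) [Field K] [NumberField K] (z : ℂ) : ℂ :=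
  ∑' J : {J : Ideal (𝓞 K) // J ≠ ⊥}, (Ideal.absNorm J.1 : ℂ) ^ (-z)

variable (K) in
/-- Analytic continuation and bounds for the completed Dedekind zeta function. -/
theorem exists_zetaData {C₀ : ℝ} (hZ : DifferentiableOn ℂ (zetaSeries K) {z | 1 < z.re})
    (hsum : ∀ σ : ℝ, 1 < σ → Summable fun J : {J : Ideal (𝓞 K) // J ≠ ⊥} =>
      (Ideal.absNorm J.1 : ℝ) ^ (-σ))
    (hC₀ : ∀ z : ℂ, 3 / 2 ≤ z.re → 1 ≤ C₀ * ‖zetaSeries K z‖ ∧ ‖zetaSeries K z‖ ≤ C₀) :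
    ∃ E : ℂ → ℂ, ZetaData (InfinitePlace.nrRealPlaces K) (InfinitePlace.nrComplexPlaces K)
      ((discr K).natAbs : ℝ) 2 (C₀ * (1 + 18 * realGammaFac (InfinitePlace.nrRealPlaces K)
        (InfinitePlace.nrComplexPlaces K) 4 + 2 * realGammaFac (InfinitePlace.nrRealPlaces K)
        (InfinitePlace.nrComplexPlaces K) 2)) E (zetaSeries K) := by
  obtain ⟨I, hI, hI'⟩ := exists_bijective_classGroup K
  obtain ⟨F, hF, hFm, hv, hfd⟩ := exists_fundamentalDomain K
  obtain ⟨κ, hκ, hmellin⟩ := exists_mellin_thetaFun₀ K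
  have hD : (1 : ℝ) ≤ (discr K).natAbs := by
    exact_mod_cast Int.natAbs_pos.2 (discr_ne_zero K)
  have hM : 0 < Fintype.card (ClassGroup (𝓞 K)) * (volume F).toReal :=
    mul_pos (Nat.cast_pos.2 Fintype.card_pos) (ENNReal.toReal_pos hv hF.measure_lt_top.ne)
  set S : ℝ → ℝ := fun σ => ∑' J : {J : Ideal (𝓞 K) // J ≠ ⊥}, (Ideal.absNorm J.1 : ℝ) ^ (-σ)
  have key : ∀ {G : Set (logSpace K)} {J : ClassGroup (𝓞 K) → (FractionalIdeal (𝓞 K)⁰ K)ˣ},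
      Bornology.IsBounded G → MeasurableSet G → (Function.Bijective fun i => ClassGroup.mk K (J i))
          →
      IsAddFundamentalDomain (unitLattice K) G volume → ∀ σ : ℝ, 1 < σ →
      ∫ t in Set.Ioi (0 : ℝ), t ^ (σ - 1) * (thetaFun₀ G J t).toReal =
        κ * ((discr K).natAbs : ℝ) ^ (σ / 2) * realGammaFac (InfinitePlace.nrRealPlaces K)
        (InfinitePlace.nrComplexPlaces K) σ * S σ := fun {G J} hG hGm hJ hGf σ hσ => by
    have hg := realGammaFac_pos (InfinitePlace.nrRealPlaces K) (InfinitePlace.nrComplexPlaces K)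
      (lt_trans zero_lt_one hσ)
    rw [integral_eq_lintegral_of_nonneg_ae]
    · have h1 : ∫⁻ t in Set.Ioi (0 : ℝ), ENNReal.ofReal (t ^ (σ - 1) * (thetaFun₀ G J t).toReal) =
          ∫⁻ t in Set.Ioi (0 : ℝ), ENNReal.ofReal (t ^ (σ - 1)) * thetaFun₀ G J t := by
        refine setLIntegral_congr_fun measurableSet_Ioi fun t ht => ?_
        rw [ENNReal.ofReal_mul (Real.rpow_nonneg (le_of_lt ht) _),
          ENNReal.ofReal_toReal (thetaFun₀_ne_top hG hGm J ht)]
      rw [h1, hmellin hJ hGf σ (lt_trans zero_lt_one hσ), ENNReal.toReal_mul,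
        ENNReal.toReal_ofReal (by positivity), ← ENNReal.ofReal_tsum_of_nonneg
        (fun J => by positivity) (hsum σ hσ), ENNReal.toReal_ofReal
        (tsum_nonneg fun J => by positivity)]
    · filter_upwards [ae_restrict_mem measurableSet_Ioi] with t ht
      exact mul_nonneg (Real.rpow_nonneg (le_of_lt ht) _) ENNReal.toReal_nonneg
    · exact (Measurable.mul (by fun_prop) (measurable_thetaFun₀ G
        J).ennreal_toReal).aestronglyMeasurable
  refine (thetaPair_thetaFun₀ hF hFm I).zetaData hM hκ hD hZ (S := S) (fun σ hσ => ?_)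
    (key hF hFm hI hfd) (key hF.neg hFm.neg hI' (isAddFundamentalDomain_neg hfd)) hC₀
  rw [zetaSeries, ofReal_tsum]
  refine tsum_congr fun J => ?_
  rw [ofReal_cpow (Nat.cast_nonneg _)]
  push_cast
  rfl

end

section
variable {K : Type} [Field K] [NumberField K]
open Module UniqueFactorizationMonoid

lemma exists_absNorm_eq_minFac_pow {P : Ideal (𝓞 K)} (hP : Prime P) :
    (Ideal.absNorm P).minFac.Prime ∧ ((Ideal.absNorm P).minFac : 𝓞 K) ∈ P ∧
      ∃ f : ℕ, f ≠ 0 ∧ Ideal.absNorm P = (Ideal.absNorm P).minFac ^ f := by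
  have hP' : P.IsPrime := Ideal.isPrime_of_prime hP
  have : P.IsMaximal := hP'.isMaximal hP.ne_zero
  obtain ⟨p, f, hf, hpP, hp, h⟩ := Ideal.exists_prime_and_absNorm_eq_pow P
  have : (Ideal.absNorm P).minFac = p := by rw [h, Nat.Prime.pow_minFac hp hf.ne']
  rw [this]
  exact ⟨hp, hpP, f, hf.ne', h⟩

lemma card_normalizedFactors_le (p : ℕ) (hp : p.Prime) :
    (normalizedFactors (Ideal.span {(p : 𝓞 K)})).toFinset.card ≤ finrank ℚ K := by
  set T := (normalizedFactors (Ideal.span {(p : 𝓞 K)})).toFinset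
  have hT : ∀ P ∈ T, Prime P := fun P hP => prime_of_normalized_factor P
      (Multiset.mem_toFinset.1 hP)
  have h1 : ∏ P ∈ T, P ∣ Ideal.span {(p : 𝓞 K)} :=
    Finset.prod_primes_dvd _ hT fun P hP =>
      dvd_of_mem_normalizedFactors (Multiset.mem_toFinset.1 hP)
  have h2 : ∏ P ∈ T, Ideal.absNorm P ∣ p ^ finrank ℚ K := by
    have := map_dvd Ideal.absNorm h1
    rwa [map_prod, Ideal.absNorm_span_natCast, RingOfIntegers.rank] at this
  have h3 : p ^ T.card ∣ ∏ P ∈ T, Ideal.absNorm P := by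
    rw [← Finset.prod_const]
    refine Finset.prod_dvd_prod_of_dvd _ _ fun P hP => ?_
    have hPp : P ∣ Ideal.span {(p : 𝓞 K)} :=
      dvd_of_mem_normalizedFactors (Multiset.mem_toFinset.1 hP)
    have hd := map_dvd Ideal.absNorm hPp
    rw [Ideal.absNorm_span_natCast] at hd
    obtain ⟨-, -, f, hf, h⟩ := exists_absNorm_eq_minFac_pow (hT P hP)
    obtain ⟨k, -, hk⟩ := (Nat.dvd_prime_pow hp).1 hd
    rw [hk]
    refine dvd_pow_self _ ?_
    rintro rfl
    rw [pow_zero, Ideal.absNorm_eq_one_iff] at hk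
    exact (hT P hP).not_isUnit (by rw [hk, ← Ideal.one_eq_top]; exact isUnit_one)
  exact (Nat.pow_dvd_pow_iff_le_right hp.one_lt).1 (h3.trans h2)

/-- An indexing of the nonzero primes by `Fin n`, injective above each rational prime. -/
lemma exists_primeIndex (K : Type) [Field K] [NumberField K] :
    ∃ idx : Ideal (𝓞 K) → Fin (finrank ℚ K), ∀ P Q, Prime P → Prime Q →
      (Ideal.absNorm P).minFac = (Ideal.absNorm Q).minFac → idx P = idx Q → P = Q := by
  have hn : 0 < finrank ℚ K := finrank_pos
  have key : ∀ p : ℕ, ∃ f : Ideal (𝓞 K) → Fin (finrank ℚ K), p.Prime →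
      Set.InjOn f ((normalizedFactors (Ideal.span {(p : 𝓞 K)})).toFinset : Set (Ideal (𝓞 K))) := by
    intro p
    by_cases hp : p.Prime
    · have hc := card_normalizedFactors_le (K := K) p hp
      obtain ⟨e⟩ := Function.Embedding.nonempty_of_card_le
        (α := (normalizedFactors (Ideal.span {(p : 𝓞 K)})).toFinset) (β := Fin (finrank ℚ K))
        (by simpa using hc)
      refine ⟨fun P => if h : P ∈ (normalizedFactors (Ideal.span {(p : 𝓞 K)})).toFinset
        then e ⟨P, h⟩ else ⟨0, hn⟩, fun _ P hP Q hQ h => ?_⟩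
      simp only [dif_pos (Finset.mem_coe.1 hP), dif_pos (Finset.mem_coe.1 hQ)] at h
      exact congrArg Subtype.val (e.injective h)
    · exact ⟨fun _ => ⟨0, hn⟩, fun h => absurd h hp⟩
  choose f hf using key
  refine ⟨fun P => f (Ideal.absNorm P).minFac P, fun P Q hP hQ hpq h => ?_⟩
  obtain ⟨hp, hpP, -⟩ := exists_absNorm_eq_minFac_pow hP
  obtain ⟨-, hpQ, -⟩ := exists_absNorm_eq_minFac_pow hQ
  dsimp only at h
  rw [← hpq] at h hpQ
  have hne : Ideal.span {((Ideal.absNorm P).minFac : 𝓞 K)} ≠ 0 := by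
    rw [Ne, Ideal.zero_eq_bot, Ideal.span_singleton_eq_bot]
    exact_mod_cast hp.ne_zero
  have hmem : ∀ R : Ideal (𝓞 K), Prime R → ((Ideal.absNorm P).minFac : 𝓞 K) ∈ R →
      R ∈ ((normalizedFactors (Ideal.span {((Ideal.absNorm P).minFac : 𝓞 K)})).toFinset :
        Set (Ideal (𝓞 K))) := by
    intro R hR h
    rw [Finset.mem_coe, Multiset.mem_toFinset, mem_normalizedFactors_iff hne]
    exact ⟨hR, Ideal.dvd_span_singleton.2 h⟩
  exact hf _ hp (hmem P hP hpP) (hmem Q hQ hpQ) h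

/-- The part of the norm of `J` coming from the primes of index `i`. -/
def normPart {n : ℕ} (idx : Ideal (𝓞 K) → Fin n) (s : Multiset (Ideal (𝓞 K))) (i : Fin n) : ℕ :=
  (s.map fun P => if idx P = i then Ideal.absNorm P else 1).prod

lemma prod_normPart {n : ℕ} (idx : Ideal (𝓞 K) → Fin n) (s : Multiset (Ideal (𝓞 K))) :
    ∏ i, normPart idx s i = Ideal.absNorm s.prod := by
  induction s using Multiset.induction_on with
  | empty => simp [normPart]
  | cons P s ih =>
    simp only [normPart, Multiset.map_cons, Multiset.prod_cons, map_mul,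
      Finset.prod_mul_distrib] at ih ⊢
    rw [ih, Finset.prod_ite_eq]
    simp

lemma factorization_normPart {n : ℕ} {idx : Ideal (𝓞 K) → Fin n}
    (hidx : ∀ P Q, Prime P → Prime Q →
      (Ideal.absNorm P).minFac = (Ideal.absNorm Q).minFac → idx P = idx Q → P = Q)
    {P : Ideal (𝓞 K)} (hP : Prime P) (s : Multiset (Ideal (𝓞 K))) (hs : ∀ Q ∈ s, Prime Q) :
    (normPart idx s (idx P)).factorization (Ideal.absNorm P).minFac =
      s.count P * (Ideal.absNorm P).factorization (Ideal.absNorm P).minFac := by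
  induction s using Multiset.induction_on with
  | empty => simp [normPart]
  | cons Q s ih =>
    have hQ := hs Q (Multiset.mem_cons_self _ _)
    have hs' : ∀ R ∈ s, Prime R := fun R hR => hs R (Multiset.mem_cons_of_mem hR)
    have hne : ∀ R : Ideal (𝓞 K), Prime R →
        (if idx R = idx P then Ideal.absNorm R else 1) ≠ 0 := by
      intro R hR
      split_ifs
      · rw [Ne, Ideal.absNorm_eq_zero_iff]
        exact hR.ne_zero
      · exact one_ne_zero
    have hne' : normPart idx s (idx P) ≠ 0 := by
      rw [normPart, Ne, Multiset.prod_eq_zero_iff, Multiset.mem_map]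
      rintro ⟨R, hR, h⟩
      exact hne R (hs' R hR) h
    have hsplit : normPart idx (Q ::ₘ s) (idx P) =
        (if idx Q = idx P then Ideal.absNorm Q else 1) * normPart idx s (idx P) := by
      simp [normPart]
    rw [hsplit, Nat.factorization_mul (hne Q hQ) hne', Finsupp.add_apply, ih hs',
      Multiset.count_cons]
    by_cases hPQ : P = Q
    · subst hPQ
      simp
      ring
    · rw [if_neg hPQ, add_zero, Nat.add_eq_right]
      split_ifs with hi
      · obtain ⟨hp, -, f, hf, h⟩ := exists_absNorm_eq_minFac_pow hQ
        obtain ⟨hp', -⟩ := exists_absNorm_eq_minFac_pow hP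
        rw [h, hp.factorization_pow, Finsupp.single_apply, if_neg]
        intro hqp
        exact hPQ (hidx _ _ hQ hP hqp hi).symm
      · simp

lemma normPart_injective {n : ℕ} {idx : Ideal (𝓞 K) → Fin n}
    (hidx : ∀ P Q, Prime P → Prime Q →
      (Ideal.absNorm P).minFac = (Ideal.absNorm Q).minFac → idx P = idx Q → P = Q) :
    Function.Injective fun (J : {J : Ideal (𝓞 K) // J ≠ ⊥}) =>
        normPart idx (normalizedFactors J.1) := by
  intro I J hIJ
  dsimp only at hIJ
  have hcount : normalizedFactors I.1 = normalizedFactors J.1 := by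
    ext P
    by_cases hP : Prime P
    · have h1 := factorization_normPart hidx hP _
        (fun Q hQ => prime_of_normalized_factor (a := I.1) Q hQ)
      have h2 := factorization_normPart hidx hP _
        (fun Q hQ => prime_of_normalized_factor (a := J.1) Q hQ)
      rw [hIJ, h2] at h1
      obtain ⟨hp, -, f, hf, h⟩ := exists_absNorm_eq_minFac_pow hP
      refine (Nat.eq_of_mul_eq_mul_right ?_ h1).symm
      have : (Ideal.absNorm P).factorization (Ideal.absNorm P).minFac = f := by
        conv_lhs => rw [h]
        rw [hp.factorization_pow]
        conv_lhs => rw [← h]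
        simp
      omega
    · rw [Multiset.count_eq_zero_of_notMem, Multiset.count_eq_zero_of_notMem]
      · exact fun h => hP (prime_of_normalized_factor P h)
      · exact fun h => hP (prime_of_normalized_factor P h)
  refine Subtype.ext ?_
  rw [← Ideal.prod_normalizedFactors_eq_self I.2,
    ← Ideal.prod_normalizedFactors_eq_self J.2, hcount]

lemma tsum_absNorm_rpow_le (K : Type) [Field K] [NumberField K] (σ : ℝ) :
    ∑' J : {J : Ideal (𝓞 K) // J ≠ ⊥}, ENNReal.ofReal ((Ideal.absNorm J.1 : ℝ) ^ (-σ)) ≤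
      (∑' k : ℕ, ENNReal.ofReal ((k : ℝ) ^ (-σ))) ^ finrank ℚ K := by
  obtain ⟨idx, hidx⟩ := exists_primeIndex K
  have h := ENNReal.tsum_pi_prod (ι := Fin (finrank ℚ K))
    (fun k : ℕ => ENNReal.ofReal ((k : ℝ) ^ (-σ)))
  rw [Fintype.card_fin] at h
  rw [← h]
  refine le_trans (le_of_eq ?_) (ENNReal.tsum_comp_le_tsum_of_injective (normPart_injective hidx)
    (fun k : Fin (finrank ℚ K) → ℕ => ∏ i, ENNReal.ofReal ((k i : ℝ) ^ (-σ))))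
  refine tsum_congr fun J => ?_
  rw [← ENNReal.ofReal_prod_of_nonneg (fun i _ => by positivity),
    Real.finsetProd_rpow _ _ (fun i _ => by positivity), ← Nat.cast_prod, prod_normPart,
    Ideal.prod_normalizedFactors_eq_self J.2]

/-- The bound `ζ(3/2)^n` for the Dedekind zeta function of a field of degree `n`. -/
def zetaBound (n : ℕ) : ℝ := (∑' k : ℕ, (k : ℝ) ^ (-(3 / 2 : ℝ))) ^ n

lemma tsum_ofReal_rpow {σ : ℝ} (hσ : 1 < σ) :
    ∑' k : ℕ, ENNReal.ofReal ((k : ℝ) ^ (-σ)) = ENNReal.ofReal (∑' k : ℕ, (k : ℝ) ^ (-σ)) :=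
  (ENNReal.ofReal_tsum_of_nonneg (fun k => by positivity)
    (Real.summable_nat_rpow.2 (by linarith))).symm

lemma summable_absNorm_rpow (K : Type) [Field K] [NumberField K] {σ : ℝ} (hσ : 1 < σ) :
    Summable fun J : {J : Ideal (𝓞 K) // J ≠ ⊥} => (Ideal.absNorm J.1 : ℝ) ^ (-σ) := by
  have h := tsum_absNorm_rpow_le K σ
  rw [tsum_ofReal_rpow hσ] at h
  have h' := ENNReal.summable_toReal
    (h.trans_lt (ENNReal.pow_lt_top ENNReal.ofReal_lt_top)).ne
  refine h'.congr fun J => ENNReal.toReal_ofReal (by positivity)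

lemma tsum_absNorm_rpow_le_zetaBound (K : Type) [Field K] [NumberField K] :
    ∑' J : {J : Ideal (𝓞 K) // J ≠ ⊥}, (Ideal.absNorm J.1 : ℝ) ^ (-(3 / 2 : ℝ)) ≤
      zetaBound (finrank ℚ K) := by
  have h := tsum_absNorm_rpow_le K (3 / 2)
  have h0 : 0 ≤ ∑' k : ℕ, (k : ℝ) ^ (-(3 / 2 : ℝ)) := tsum_nonneg fun k => by positivity
  rw [tsum_ofReal_rpow (by norm_num), ← ENNReal.ofReal_pow h0,
    ← ENNReal.ofReal_tsum_of_nonneg (fun k => by positivity)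
      (summable_absNorm_rpow K (by norm_num))] at h
  exact (ENNReal.ofReal_le_ofReal_iff (pow_nonneg h0 _)).1 h
end

section
variable {K : Type} [Field K] [NumberField K]
open Module UniqueFactorizationMonoid

lemma moebiusK_abs_le (I : Ideal (𝓞 K)) : |(moebiusK K I : ℝ)| ≤ 1 := by
  rw [moebiusK]
  split_ifs <;> simp

lemma moebiusK_norm_le (I : Ideal (𝓞 K)) : ‖(moebiusK K I : ℂ)‖ ≤ 1 := by
  have := moebiusK_abs_le I
  rwa [← Real.norm_eq_abs, ← Complex.norm_real, Complex.ofReal_intCast] at this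

lemma moebiusK_top : moebiusK K ⊤ = 1 := by
  rw [moebiusK, ← Ideal.one_eq_top, if_pos squarefree_one, factors_one]
  simp

lemma normalizedFactors_prod_primes {S : Finset (Ideal (𝓞 K))} (hS : ∀ P ∈ S, Prime P) :
    normalizedFactors (∏ P ∈ S, P) = S.val := by
  have := normalizedFactors_prod_of_prime (m := S.val) fun P hP => hS P hP
  rw [← this, Finset.prod, Multiset.map_id']

lemma moebiusK_prod_primes {S : Finset (Ideal (𝓞 K))} (hS : ∀ P ∈ S, Prime P) :
    moebiusK K (∏ P ∈ S, P) = (-1) ^ S.card := by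
  have hne : ∏ P ∈ S, P ≠ 0 := Finset.prod_ne_zero_iff.2 fun P hP => (hS P hP).ne_zero
  have h : Squarefree (∏ P ∈ S, P) := by
    rw [squarefree_iff_nodup_normalizedFactors hne, normalizedFactors_prod_primes hS]
    exact S.nodup
  rw [moebiusK, if_pos h, factors_eq_normalizedFactors, normalizedFactors_prod_primes hS]
  rfl

/-- The squarefree divisors of a nonzero ideal. -/
def squarefreeDivisors (L : Ideal (𝓞 K)) : Finset (Ideal (𝓞 K)) :=
  (normalizedFactors L).toFinset.powerset.image fun S => ∏ P ∈ S, P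

lemma prime_of_mem_powerset {L P : Ideal (𝓞 K)} {S : Finset (Ideal (𝓞 K))}
    (hS : S ∈ (normalizedFactors L).toFinset.powerset) (hP : P ∈ S) : Prime P :=
  prime_of_normalized_factor P (Multiset.mem_toFinset.1 (Finset.mem_powerset.1 hS hP))

lemma sum_moebiusK_squarefreeDivisors {L : Ideal (𝓞 K)} (hL : L ≠ ⊥) :
    ∑ I ∈ squarefreeDivisors L, moebiusK K I = if L = ⊤ then 1 else 0 := by
  rw [squarefreeDivisors, Finset.sum_image]
  · rw [Finset.sum_congr rfl fun S hS => moebiusK_prod_primes fun P => prime_of_mem_powerset hS,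
      Finset.sum_powerset_neg_one_pow_card]
    refine if_congr ?_ rfl rfl
    rw [Multiset.toFinset_eq_empty, normalizedFactors_eq_zero_iff (by exact hL),
      Ideal.isUnit_iff]
  · intro S hS T hT h
    have h' := congrArg normalizedFactors h
    dsimp only at h'
    rw [normalizedFactors_prod_primes fun P => prime_of_mem_powerset hS,
      normalizedFactors_prod_primes fun P => prime_of_mem_powerset hT] at h'
    exact Finset.val_injective h'

lemma dvd_of_mem_squarefreeDivisors {L I : Ideal (𝓞 K)}
    (hI : I ∈ squarefreeDivisors L) : I ∣ L := by
  obtain ⟨S, hS, rfl⟩ := Finset.mem_image.1 hI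
  exact Finset.prod_primes_dvd _ (fun P => prime_of_mem_powerset hS) fun P hP =>
    dvd_of_mem_normalizedFactors (Multiset.mem_toFinset.1 (Finset.mem_powerset.1 hS hP))

lemma mem_squarefreeDivisors {L I : Ideal (𝓞 K)} (hL : L ≠ ⊥) (hI : I ∣ L)
    (hμ : moebiusK K I ≠ 0) : I ∈ squarefreeDivisors L := by
  have hI0 : I ≠ 0 := by
    rintro rfl
    exact hL (zero_dvd_iff.1 hI)
  have hsq : Squarefree I := by
    by_contra h
    exact hμ (if_neg h)
  rw [squarefree_iff_nodup_normalizedFactors hI0] at hsq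
  refine Finset.mem_image.2 ⟨⟨normalizedFactors I, hsq⟩, ?_, ?_⟩
  · rw [Finset.mem_powerset]
    intro P hP
    have hle := (dvd_iff_normalizedFactors_le_normalizedFactors hI0 (by exact hL)).1 hI
    exact Multiset.mem_toFinset.2 (Multiset.mem_of_le hle hP)
  · rw [Finset.prod, Multiset.map_id']
    exact Ideal.prod_normalizedFactors_eq_self hI0

lemma hasSum_moebiusK_dvd {L : Ideal (𝓞 K)} (hL : L ≠ ⊥) :
    HasSum (fun I : {J : Ideal (𝓞 K) // J ≠ ⊥} => if I.1 ∣ L then (moebiusK K I.1 : ℂ) else 0)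
      (if L = ⊤ then 1 else 0) := by
  have h : HasSum (fun I : Ideal (𝓞 K) => if I ∣ L then (moebiusK K I : ℂ) else 0)
      (if L = ⊤ then 1 else 0) := by
    have h1 := hasSum_sum_of_ne_finset_zero (L := SummationFilter.unconditional _)
      (s := squarefreeDivisors L)
      (f := fun I : Ideal (𝓞 K) => if I ∣ L then (moebiusK K I : ℂ) else 0) fun I hI => by
        split_ifs with hd
        · by_contra hμ
          exact hI (mem_squarefreeDivisors hL hd fun h => hμ (by rw [h, Int.cast_zero]))
        · rfl
    rw [Finset.sum_congr rfl fun I hI => if_pos (dvd_of_mem_squarefreeDivisors hI),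
      ← Int.cast_sum, sum_moebiusK_squarefreeDivisors hL] at h1
    convert h1 using 1
    split_ifs <;> simp
  refine (hasSum_subtype_iff_of_support_subset (s := {J : Ideal (𝓞 K) | J ≠ ⊥}) ?_).2 h
  rintro I hI rfl
  refine hI ?_
  exact if_neg fun h => hL (zero_dvd_iff.1 h)

lemma absNorm_ne_zero (J : {J : Ideal (𝓞 K) // J ≠ ⊥}) : Ideal.absNorm J.1 ≠ 0 :=
  fun h => J.2 (Ideal.absNorm_eq_zero_iff.1 h)

lemma norm_absNorm_cpow (J : {J : Ideal (𝓞 K) // J ≠ ⊥}) (z : ℂ) :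
    ‖(Ideal.absNorm J.1 : ℂ) ^ (-z)‖ = (Ideal.absNorm J.1 : ℝ) ^ (-z.re) := by
  have : 0 < Ideal.absNorm J.1 := Nat.pos_of_ne_zero (absNorm_ne_zero J)
  rw [Complex.norm_natCast_cpow_of_pos this, Complex.neg_re]

lemma summable_norm_absNorm_cpow {z : ℂ} (hz : 1 < z.re) :
    Summable fun J : {J : Ideal (𝓞 K) // J ≠ ⊥} => ‖(Ideal.absNorm J.1 : ℂ) ^ (-z)‖ :=
  (summable_absNorm_rpow K hz).congr fun J => (norm_absNorm_cpow J z).symm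

lemma norm_moebiusK_mul_le (J : {J : Ideal (𝓞 K) // J ≠ ⊥}) (z : ℂ) :
    ‖(moebiusK K J.1 : ℂ) * (Ideal.absNorm J.1 : ℂ) ^ (-z)‖ ≤
      ‖(Ideal.absNorm J.1 : ℂ) ^ (-z)‖ := by
  rw [norm_mul]
  exact mul_le_of_le_one_left (norm_nonneg _) (moebiusK_norm_le _)

lemma summable_norm_moebiusK_mul {z : ℂ} (hz : 1 < z.re) :
    Summable fun J : {J : Ideal (𝓞 K) // J ≠ ⊥} =>
      ‖(moebiusK K J.1 : ℂ) * (Ideal.absNorm J.1 : ℂ) ^ (-z)‖ :=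
  (summable_norm_absNorm_cpow hz).of_nonneg_of_le (fun _ => norm_nonneg _)
    fun J => norm_moebiusK_mul_le J z

/-- The Dirichlet series of the Möbius function inverts the Dedekind zeta function. -/
lemma tsum_moebiusK_mul_zetaSeries {z : ℂ} (hz : 1 < z.re) :
    (∑' J : {J : Ideal (𝓞 K) // J ≠ ⊥},
      (moebiusK K J.1 : ℂ) * (Ideal.absNorm J.1 : ℂ) ^ (-z)) * zetaSeries K z = 1 := by
  set X := {J : Ideal (𝓞 K) // J ≠ ⊥}
  have hs1 := summable_norm_moebiusK_mul (K := K) hz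
  have hs2 := summable_norm_absNorm_cpow (K := K) hz
  have hprod := (summable_mul_of_summable_norm hs1 hs2).hasSum
  rw [← tsum_mul_tsum_of_summable_norm hs1 hs2] at hprod
  let g : X × X → X × X := fun p => (⟨p.1.1 * p.2.1, mul_ne_zero p.1.2 p.2.2⟩, p.1)
  have hg : Function.Injective g := by
    rintro ⟨I, J⟩ ⟨I', J'⟩ h
    simp only [g, Prod.mk.injEq] at h
    obtain ⟨h1, rfl⟩ := h
    exact Prod.ext rfl (Subtype.ext (mul_left_cancel₀ (by exact I.2) (congrArg Subtype.val h1)))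
  let f : X × X → ℂ := fun p =>
    (if p.2.1 ∣ p.1.1 then (moebiusK K p.2.1 : ℂ) else 0) * (Ideal.absNorm p.1.1 : ℂ) ^ (-z)
  have hfg : HasSum f (((∑' J : X, (moebiusK K J.1 : ℂ) * (Ideal.absNorm J.1 : ℂ) ^ (-z))) *
      zetaSeries K z) := by
    refine (hg.hasSum_iff ?_).1 ?_
    · rintro ⟨L, I⟩ hLI
      have : ¬ I.1 ∣ L.1 := by
        rintro ⟨J, hJ⟩
        refine hLI ⟨(I, ⟨J, ?_⟩), ?_⟩
        · rintro rfl
          exact L.2 (by rw [hJ]; exact mul_zero _)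
        · exact Prod.ext (Subtype.ext hJ.symm) rfl
      simp [f, this]
    · refine hprod.congr_fun ?_
      rintro ⟨I, J⟩
      simp only [f, g, Function.comp_apply, dvd_mul_right, if_true, map_mul, Nat.cast_mul]
      rw [Complex.natCast_mul_natCast_cpow, mul_assoc]
  have h1 := hfg.prod_fiberwise fun L => (hasSum_moebiusK_dvd L.2).mul_right
    ((Ideal.absNorm L.1 : ℂ) ^ (-z))
  have h2 := hasSum_single (f := fun L : X =>
    (if L.1 = ⊤ then (1 : ℂ) else 0) * (Ideal.absNorm L.1 : ℂ) ^ (-z)) ⟨⊤, top_ne_bot⟩ (by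
      intro L hL
      rw [if_neg fun h => hL (Subtype.ext h), zero_mul])
  rw [h1.unique h2]
  simp

lemma zetaSeries_norm_le {z : ℂ} (hz : 3 / 2 ≤ z.re) :
    ‖zetaSeries K z‖ ≤ zetaBound (finrank ℚ K) ∧
    ‖∑' J : {J : Ideal (𝓞 K) // J ≠ ⊥}, (moebiusK K J.1 : ℂ) * (Ideal.absNorm J.1 : ℂ) ^ (-z)‖ ≤
      zetaBound (finrank ℚ K) := by
  have hz1 : 1 < z.re := by linarith
  have key : ∑' J : {J : Ideal (𝓞 K) // J ≠ ⊥}, ‖(Ideal.absNorm J.1 : ℂ) ^ (-z)‖ ≤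
      zetaBound (finrank ℚ K) := by
    refine le_trans ?_ (tsum_absNorm_rpow_le_zetaBound K)
    refine (summable_norm_absNorm_cpow hz1).tsum_le_tsum (fun J => ?_)
      (summable_absNorm_rpow K (by norm_num))
    rw [norm_absNorm_cpow]
    have : 1 ≤ Ideal.absNorm J.1 := Nat.one_le_iff_ne_zero.2 (absNorm_ne_zero J)
    exact Real.rpow_le_rpow_of_exponent_le (by exact_mod_cast this) (by linarith)
  refine ⟨(norm_tsum_le_tsum_norm (summable_norm_absNorm_cpow hz1)).trans key,
    (norm_tsum_le_tsum_norm (summable_norm_moebiusK_mul hz1)).trans (le_trans ?_ key)⟩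
  exact (summable_norm_moebiusK_mul hz1).tsum_le_tsum (fun J => norm_moebiusK_mul_le J z)
    (summable_norm_absNorm_cpow hz1)

lemma zetaSeries_bounds {z : ℂ} (hz : 3 / 2 ≤ z.re) :
    1 ≤ zetaBound (finrank ℚ K) * ‖zetaSeries K z‖ ∧
      ‖zetaSeries K z‖ ≤ zetaBound (finrank ℚ K) := by
  refine ⟨?_, (zetaSeries_norm_le hz).1⟩
  have h := congrArg norm (tsum_moebiusK_mul_zetaSeries (K := K) (z := z) (by linarith))
  rw [norm_mul, norm_one] at h
  rw [← h]
  exact mul_le_mul_of_nonneg_right (zetaSeries_norm_le hz).2 (norm_nonneg _)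

lemma differentiableOn_zetaSeries (K : Type) [Field K] [NumberField K] :
    DifferentiableOn ℂ (zetaSeries K) {z | 1 < z.re} := by
  intro z hz
  obtain ⟨σ, hσ, hσz⟩ := exists_between (show 1 < z.re from hz)
  have ho : IsOpen {w : ℂ | σ < w.re} := isOpen_lt continuous_const Complex.continuous_re
  have h : DifferentiableOn ℂ (zetaSeries K) {w : ℂ | σ < w.re} := by
    refine differentiableOn_tsum_of_summable_norm (summable_absNorm_rpow K hσ) (fun J => ?_) ho
      fun J w hw => ?_
    · have : (Ideal.absNorm J.1 : ℂ) ≠ 0 := Nat.cast_ne_zero.2 (absNorm_ne_zero J)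
      exact fun w _ => ((differentiableAt_id.neg.const_cpow
        (Or.inl this))).differentiableWithinAt
    · rw [norm_absNorm_cpow]
      have : 1 ≤ Ideal.absNorm J.1 := Nat.one_le_iff_ne_zero.2 (absNorm_ne_zero J)
      have hw' : σ < w.re := hw
      exact Real.rpow_le_rpow_of_exponent_le (by exact_mod_cast this) (by linarith)
  exact ((h z hσz).differentiableAt (ho.mem_nhds hσz)).differentiableWithinAt
end

section
variable {K : Type} [Field K] [NumberField K]
open Module

lemma countable_ideals (K : Type) [Field K] [NumberField K] :
    Countable {J : Ideal (𝓞 K) // J ≠ ⊥} := by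
  have h := (summable_absNorm_rpow K (one_lt_two)).countable_support
  refine Set.countable_univ_iff.1 (h.mono fun J _ => ?_)
  have : 0 < Ideal.absNorm J.1 := Nat.pos_of_ne_zero (absNorm_ne_zero J)
  exact (show (0 : ℝ) < (Ideal.absNorm J.1 : ℝ) ^ (-2 : ℝ) by positivity).ne'

/-- The contribution of the ideal `J` to `M_K(e^y)`. -/
def mertensTerm (J : {J : Ideal (𝓞 K) // J ≠ ⊥}) (y : ℝ) : ℝ :=
  if (Ideal.absNorm J.1 : ℝ) < Real.exp y then (moebiusK K J.1 : ℝ)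
  else if (Ideal.absNorm J.1 : ℝ) = Real.exp y then (moebiusK K J.1 : ℝ) / 2 else 0

lemma mertensK_exp (y : ℝ) : mertensK K (Real.exp y) = ∑' J, mertensTerm (K := K) J y := by
  rw [mertensK, ← tsum_subtype_eq_of_support_subset (s := {J : Ideal (𝓞 K) | J ≠ ⊥})]
  · refine tsum_congr fun J => ?_
    have hJ : J.1 ≠ ⊥ := J.2
    simp only [mertensTerm, hJ, ne_eq, not_false_eq_true, true_and]
  · rintro J hJ rfl
    exact hJ (by simp)

lemma abs_mertensTerm_le (J : {J : Ideal (𝓞 K) // J ≠ ⊥}) (y : ℝ) : |mertensTerm J y| ≤ 1 := by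
  have := moebiusK_abs_le J.1
  rw [mertensTerm]
  split_ifs
  · exact this
  · rw [abs_div, abs_two]
    linarith [abs_nonneg (moebiusK K J.1 : ℝ)]
  · simp

lemma mertensTerm_eq_zero {J : {J : Ideal (𝓞 K) // J ≠ ⊥}} {y : ℝ}
    (h : Real.exp y < Ideal.absNorm J.1) : mertensTerm J y = 0 := by
  rw [mertensTerm, if_neg h.not_gt, if_neg h.ne']

lemma one_le_absNorm (J : {J : Ideal (𝓞 K) // J ≠ ⊥}) : (1 : ℝ) ≤ Ideal.absNorm J.1 := by
  exact_mod_cast Nat.one_le_iff_ne_zero.2 (absNorm_ne_zero J)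

lemma measurable_mertensTerm (J : {J : Ideal (𝓞 K) // J ≠ ⊥}) : Measurable (mertensTerm J) := by
  refine Measurable.ite (measurableSet_lt measurable_const Real.measurable_exp) measurable_const ?_
  exact Measurable.ite (measurableSet_eq_fun measurable_const Real.measurable_exp)
    measurable_const measurable_const

lemma mertensK_exp_of_neg {y : ℝ} (hy : y < 0) : mertensK K (Real.exp y) = 0 := by
  rw [mertensK_exp]
  refine (tsum_congr fun J => mertensTerm_eq_zero ?_).trans tsum_zero
  exact (Real.exp_lt_one_iff.2 hy).trans_le (one_le_absNorm J)

lemma mertensK_exp_of_lt_log_two {y : ℝ} (hy : 0 < y) (hy2 : y < Real.log 2) :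
    mertensK K (Real.exp y) = 1 := by
  have h2 : Real.exp y < 2 := by rwa [← Real.lt_log_iff_exp_lt two_pos]
  rw [mertensK_exp, tsum_eq_single ⟨⊤, top_ne_bot⟩]
  · have : ((Ideal.absNorm (⊤ : Ideal (𝓞 K)) : ℕ) : ℝ) < Real.exp y := by
      simpa using hy
    rw [mertensTerm, if_pos this, moebiusK_top, Int.cast_one]
  · intro J hJ
    refine mertensTerm_eq_zero (h2.trans_le ?_)
    have h1 := absNorm_ne_zero J
    have h1' : Ideal.absNorm J.1 ≠ 1 := fun h =>
      hJ (Subtype.ext (Ideal.absNorm_eq_one_iff.1 h))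
    exact_mod_cast (show 2 ≤ Ideal.absNorm J.1 by omega)

lemma exists_mertensK_exp_bound (K : Type) [Field K] [NumberField K] (Y : ℝ) :
    ∃ B : ℝ, ∀ y ≤ Y, |mertensK K (Real.exp y)| ≤ B := by
  have hfin : {J : {J : Ideal (𝓞 K) // J ≠ ⊥} | Ideal.absNorm J.1 ≤ ⌊Real.exp Y⌋₊}.Finite :=
    (Ideal.finite_setOfPred_absNorm_le _).preimage Subtype.val_injective.injOn
  refine ⟨hfin.toFinset.card, fun y hy => ?_⟩
  rw [mertensK_exp, tsum_eq_sum (s := hfin.toFinset)]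
  · refine (Finset.abs_sum_le_sum_abs _ _).trans ?_
    refine (Finset.sum_le_sum fun J _ => abs_mertensTerm_le J y).trans ?_
    simp
  · intro J hJ
    refine mertensTerm_eq_zero ((Real.exp_le_exp.2 hy).trans_lt ?_)
    rw [Set.Finite.mem_toFinset, Set.mem_ofPred_eq, not_le] at hJ
    exact (Nat.floor_lt (Real.exp_pos Y).le).1 hJ

lemma tsum_ofReal_mertensTerm (y : ℝ) :
    ((mertensK K (Real.exp y) : ℝ) : ℂ) = ∑' J, (mertensTerm (K := K) J y : ℂ) := by
  rw [mertensK_exp, Complex.ofReal_tsum]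

lemma mertensTerm_ae_eq (J : {J : Ideal (𝓞 K) // J ≠ ⊥}) (z : ℂ) :
    (fun y : ℝ => (mertensTerm J y : ℂ) * cexp (-z * y)) =ᵐ[volume]
      (Set.Ioi (Real.log (Ideal.absNorm J.1))).indicator
        fun y : ℝ => (moebiusK K J.1 : ℂ) * cexp (-z * y) := by
  have hN : (0 : ℝ) < Ideal.absNorm J.1 := zero_lt_one.trans_le (one_le_absNorm J)
  have hae : ∀ᵐ y : ℝ, y ≠ Real.log (Ideal.absNorm J.1) := by
    simp [ae_iff]
  filter_upwards [hae] with y hy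
  have hne : (Ideal.absNorm J.1 : ℝ) ≠ Real.exp y := by
    intro h
    exact hy (by rw [h, Real.log_exp])
  by_cases hlt : (Ideal.absNorm J.1 : ℝ) < Real.exp y
  · rw [mertensTerm, if_pos hlt, Set.indicator_of_mem, Complex.ofReal_intCast]
    exact (Real.log_lt_iff_lt_exp hN).2 hlt
  · rw [mertensTerm, if_neg hlt, if_neg hne, Set.indicator_of_notMem]
    · simp
    · exact fun h => hlt ((Real.log_lt_iff_lt_exp hN).1 h)

lemma integrable_mertensTerm (J : {J : Ideal (𝓞 K) // J ≠ ⊥}) {z : ℂ} (hz : 0 < z.re) :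
    Integrable fun y : ℝ => (mertensTerm J y : ℂ) * cexp (-z * y) := by
  refine Integrable.congr ?_ (mertensTerm_ae_eq J z).symm
  rw [integrable_indicator_iff measurableSet_Ioi]
  exact (integrableOn_exp_mul_complex_Ioi (by simpa using hz) _).const_mul _

lemma exp_log_absNorm (J : {J : Ideal (𝓞 K) // J ≠ ⊥}) (z : ℂ) :
    cexp (-z * Real.log (Ideal.absNorm J.1)) = (Ideal.absNorm J.1 : ℂ) ^ (-z) := by
  rw [Complex.cpow_def_of_ne_zero (Nat.cast_ne_zero.2 (absNorm_ne_zero J)),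
    ← Complex.natCast_log, mul_comm]

lemma integral_mertensTerm (J : {J : Ideal (𝓞 K) // J ≠ ⊥}) {z : ℂ} (hz : 0 < z.re) :
    ∫ y : ℝ, (mertensTerm J y : ℂ) * cexp (-z * y) =
      (moebiusK K J.1 : ℂ) * (Ideal.absNorm J.1 : ℂ) ^ (-z) / z := by
  rw [integral_congr_ae (mertensTerm_ae_eq J z), integral_indicator measurableSet_Ioi,
    integral_const_mul, integral_exp_mul_complex_Ioi (by simpa using hz), exp_log_absNorm]
  rw [neg_div_neg_eq, mul_div_assoc]

lemma integral_norm_mertensTerm_le (J : {J : Ideal (𝓞 K) // J ≠ ⊥}) {z : ℂ} (hz : 0 < z.re) :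
    ∫ y : ℝ, ‖(mertensTerm J y : ℂ) * cexp (-z * y)‖ ≤
      (Ideal.absNorm J.1 : ℝ) ^ (-z.re) / z.re := by
  have hN : (0 : ℝ) < Ideal.absNorm J.1 := zero_lt_one.trans_le (one_le_absNorm J)
  have h1 : (fun y : ℝ => ‖(mertensTerm J y : ℂ) * cexp (-z * y)‖) =ᵐ[volume]
      (Set.Ioi (Real.log (Ideal.absNorm J.1))).indicator
        fun y : ℝ => ‖(moebiusK K J.1 : ℂ)‖ * Real.exp (-z.re * y) := by
    filter_upwards [mertensTerm_ae_eq J z] with y hy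
    rw [hy, norm_indicator_eq_indicator_norm]
    refine congrFun (congrArg _ (funext fun t => ?_)) y
    rw [norm_mul, Complex.norm_exp]
    simp
  rw [integral_congr_ae h1, integral_indicator measurableSet_Ioi, integral_const_mul,
    integral_exp_mul_Ioi (by simpa using hz), neg_div_neg_eq,
    Real.rpow_def_of_pos hN, mul_comm (Real.log _)]
  exact mul_le_of_le_one_left (by positivity) (moebiusK_norm_le _)

/-- `∫ M_K(e^y) e^{-zy} dy = 1 / (z ζ_K(z))`. -/
lemma integral_mertensK_exp {z : ℂ} (hz : 1 < z.re) :
    ∫ y : ℝ, ((mertensK K (Real.exp y) : ℝ) : ℂ) * cexp (-z * y) = 1 / (z * zetaSeries K z) := by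
  have hz0 : 0 < z.re := by linarith
  have := countable_ideals K
  have h := (hasSum_integral_of_summable_integral_norm
    (F := fun (J : {J : Ideal (𝓞 K) // J ≠ ⊥}) (y : ℝ) => (mertensTerm J y : ℂ) * cexp (-z * y))
    (fun J => integrable_mertensTerm J hz0)
    (((summable_absNorm_rpow K hz).div_const z.re).of_nonneg_of_le
      (fun J => integral_nonneg fun y => norm_nonneg _)
      fun J => integral_norm_mertensTerm_le J hz0)).tsum_eq
  simp only [integral_mertensTerm _ hz0, tsum_div_const, tsum_mul_right] at h
  simp only [tsum_ofReal_mertensTerm]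
  rw [← h]
  have hinv := tsum_moebiusK_mul_zetaSeries (K := K) hz
  have hne : zetaSeries K z ≠ 0 := by
    intro h0
    rw [h0, mul_zero] at hinv
    exact zero_ne_one hinv
  have hzne : z ≠ 0 := by
    rintro rfl
    simp at hz0
  rw [eq_div_of_mul_eq hne hinv, div_div, mul_comm z]

/-- The normalized Mertens function `M_K(e^y) e^{-y/2}`. -/
def mertensFun (K : Type) [Field K] [NumberField K] (y : ℝ) : ℂ :=
  ((mertensK K (Real.exp y) * Real.exp (-y / 2) : ℝ) : ℂ)

lemma norm_mertensFun (y : ℝ) :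
    ‖mertensFun K y‖ = |mertensK K (Real.exp y) / Real.sqrt (Real.exp y)| := by
  rw [mertensFun, Complex.norm_real, Real.norm_eq_abs, ← Real.exp_half, neg_div, Real.exp_neg,
    ← div_eq_mul_inv]

lemma limsup_mertensFun (h : NaiveMertensConj K) : LimsupNormLeOne (mertensFun K) := by
  obtain ⟨h1, -, h2⟩ := h
  intro ε hε
  have hlo : ∀ᶠ x : ℝ in atTop, ((-(1 + ε) : ℝ) : EReal) <
      ((mertensK K x / Real.sqrt x : ℝ) : EReal) := by
    refine eventually_lt_of_lt_liminf (lt_of_lt_of_le ?_ h1)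
    exact EReal.coe_lt_coe_iff.2 (show -(1 + ε) < (-1 : ℝ) by linarith)
  have hhi : ∀ᶠ x : ℝ in atTop, ((mertensK K x / Real.sqrt x : ℝ) : EReal) < ((1 + ε : ℝ) : EReal)
      := by
    refine eventually_lt_of_limsup_lt (lt_of_le_of_lt h2 ?_)
    exact_mod_cast (show (1 : ℝ) < 1 + ε by linarith)
  filter_upwards [Real.tendsto_exp_atTop.eventually hlo,
    Real.tendsto_exp_atTop.eventually hhi] with y hy1 hy2
  rw [norm_mertensFun, abs_le]
  exact ⟨(EReal.coe_lt_coe_iff.1 hy1).le, (EReal.coe_lt_coe_iff.1 hy2).le⟩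

lemma exists_mertensData (h : NaiveMertensConj K) :
    ∃ B : ℝ, MertensData (zetaSeries K) (mertensFun K) B := by
  have hlim := limsup_mertensFun h
  have hzero : ∀ y < 0, mertensFun K y = 0 := fun y hy => by
    rw [mertensFun, mertensK_exp_of_neg hy, zero_mul, Complex.ofReal_zero]
  obtain ⟨Y, hY⟩ := eventually_atTop.1 (hlim 1 one_pos)
  obtain ⟨B, hB⟩ := exists_mertensK_exp_bound K Y
  refine ⟨max B 2, ?_, fun y => ?_, hzero, hlim, fun y hy hy2 => ?_, fun z hz => ?_⟩
  · have := countable_ideals K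
    have hm : Measurable fun y : ℝ => mertensK K (Real.exp y) := by
      simp only [mertensK_exp]
      exact Measurable.tsum measurable_mertensTerm
    exact Complex.measurable_ofReal.comp (hm.mul (by fun_prop))
  · rcases le_or_gt Y y with hy | hy
    · exact (hY y hy).trans (by rw [one_add_one_eq_two]; exact le_max_right _ _)
    rcases lt_or_ge y 0 with h0 | h0
    · rw [hzero y h0, norm_zero]
      exact le_trans zero_le_two (le_max_right _ _)
    · refine le_trans ?_ (le_max_left _ _)
      rw [mertensFun, Complex.norm_real, norm_mul, Real.norm_eq_abs, Real.norm_eq_abs,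
        Real.abs_exp]
      have he : Real.exp (-y / 2) ≤ 1 := Real.exp_le_one_iff.2 (by linarith)
      exact (mul_le_of_le_one_right (abs_nonneg _) he).trans (hB y hy.le)
  · rw [mertensFun, mertensK_exp_of_lt_log_two hy hy2, one_mul]
  · rw [← integral_mertensK_exp (by linarith : 1 < z.re)]
    refine integral_congr_ae (Eventually.of_forall fun y => ?_)
    dsimp only
    rw [mertensFun, Complex.ofReal_mul, Complex.ofReal_exp, mul_assoc, ← Complex.exp_add]
    congr 2
    push_cast
    ring
end

/-- For any fixed signature `(r₁, r₂)` (not both zero) there is a bound `𝒟 > 0` such that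
the naïve Mertens-type conjecture is false for every number field of that signature whose
absolute discriminant exceeds `𝒟`. -/
theorem naive_mertens_false_large_discriminant
    (r₁ r₂ : ℕ) (hsig : ¬(r₁ = 0 ∧ r₂ = 0)) :
    ∃ 𝒟 : ℝ, 0 < 𝒟 ∧
      ∀ (K : Type) [Field K] [NumberField K],
        NumberField.InfinitePlace.nrRealPlaces K = r₁ →
        NumberField.InfinitePlace.nrComplexPlaces K = r₂ →
        𝒟 < ((NumberField.discr K).natAbs : ℝ) →
        ¬ NaiveMertensConj K := by
  set c : ℝ := zetaBound (r₁ + 2 * r₂) with hc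
  obtain ⟨D₀, hD₀⟩ := ZetaData.false_of_mertensData r₁ r₂ hsig 2
    (c * (1 + 18 * realGammaFac r₁ r₂ 4 + 2 * realGammaFac r₁ r₂ 2))
  refine ⟨max D₀ 1, lt_max_of_lt_right zero_lt_one, fun K _ _ h₁ h₂ hD hconj => ?_⟩
  have hn : Module.finrank ℚ K = r₁ + 2 * r₂ := by
    rw [← h₁, ← h₂, InfinitePlace.card_add_two_mul_card_eq_rank]
  obtain ⟨E, hE⟩ := exists_zetaData K (C₀ := c) (differentiableOn_zetaSeries K)
    (fun σ hσ => summable_absNorm_rpow K hσ) (fun z hz => by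
      rw [hc, ← hn]
      exact zetaSeries_bounds hz)
  obtain ⟨B, hB⟩ := exists_mertensData hconj
  rw [h₁, h₂] at hE
  exact hD₀ ((le_max_left _ _).trans_lt hD) hE hB
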